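/- Let α ∈ (0,1), N ≥ 2, 1 ≤ M ≤ N, and let ℒ be the lattice generated by linearly independent vectors a_1, …, a_M ∈ ℝ^N. Then there exist r₀ > 0 and, for every r > r₀, a continuous function φ_r : S → ℝ such that: (i) sup_S |φ_r| < 1 and sup_S |φ_r| → 0 as r → +∞; (ii) φ_r is even, i.e. φ_r(−θ) = φ_r(θ) for all θ ∈ S; (iii) setting E_r = ⋃_{p ∈ ℒ} (B_{φ_r} + r p), for every boundary point x of E_r the principal value lim_{ε→0} ∫_{{y : |y−x| > ε}} (1_{E_r^c}(y) − 1_{E_r}(y)) |y−x|^{−N−α} dy exists, is independent of the boundary point x, and equals the corresponding principal value lim_{ε→0} ∫_{{y : |y−e| > ε}} (1_{B^c}(y) − 1_B(y)) |y−e|^{−N−α} dy for the open unit ball B at any point e of the unit sphere. In other words, each set E_r has constant nonlocal mean curvature of order α, equal to that of the unit sphere. -/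

import Mathlib

open MeasureTheory Filter

/-- The truncated integral whose limit (as `ε → 0⁺`) is, up to the constant `d_{N,α}`, the
nonlocal mean curvature of order `α` of the set `E` at the point `x`. Here `E^c = ℝ^N \ closure E`. -/
noncomputable def pvInt (N : ℕ) (α : ℝ) (E : Set (EuclideanSpace ℝ (Fin N)))
    (x : EuclideanSpace ℝ (Fin N)) (ε : ℝ) : ℝ :=
  ∫ y in {y : EuclideanSpace ℝ (Fin N) | ε < ‖y - x‖},
    (Set.indicator (closure E)ᶜ (fun _ => (1 : ℝ)) y - Set.indicator E (fun _ => (1 : ℝ)) y) *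
      ‖y - x‖ ^ (-((N : ℝ) + α))

/-- The open star-shaped body `B_φ` enclosed by the deformed sphere `S_φ`. -/
def starBody {N : ℕ} (φ : EuclideanSpace ℝ (Fin N) → ℝ) : Set (EuclideanSpace ℝ (Fin N)) :=
  {x | ∃ σ ∈ Metric.sphere (0 : EuclideanSpace ℝ (Fin N)) 1,
        ∃ t ∈ Set.Ico (0 : ℝ) 1, x = t • ((1 + φ σ) • σ)}

/-- The `M`-dimensional lattice in `ℝ^N` generated by the vectors `a 0, …, a (M-1)`. -/
def latticeSet {N M : ℕ} (a : Fin M → EuclideanSpace ℝ (Fin N)) :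
    Set (EuclideanSpace ℝ (Fin N)) :=
  {p | ∃ k : Fin M → ℤ, p = ∑ i, (k i : ℝ) • a i}

/-- The periodic set `E_r = ⋃_{p ∈ ℒ} (B_φ + r p)`. -/
def translatedBodies {N M : ℕ} (a : Fin M → EuclideanSpace ℝ (Fin N)) (r : ℝ)
    (φ : EuclideanSpace ℝ (Fin N) → ℝ) : Set (EuclideanSpace ℝ (Fin N)) :=
  ⋃ p ∈ latticeSet a, (fun y => y + r • p) '' starBody φ

namespace NearSphere

/-! ### Integrals of powers of the distance -/

section DistPow

variable {X : Type*} [PseudoMetricSpace X] [MeasurableSpace X] [OpensMeasurableSpace X]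

lemma lintegral_le_geometric {μ : Measure X} {x₀ : X} {C n q A B ρ : ℝ} (hC : 0 ≤ C)
    (hμ : ∀ t : ℝ, 0 < t → μ (Metric.ball x₀ t) ≤ ENNReal.ofReal (C * t ^ n))
    (hA : 0 < A) (hB : 0 ≤ B) (hρ : 0 < ρ) (hρ1 : ρ ^ (n + q) < 1)
    {f : X → ENNReal}
    (hf : ∀ y, f y ≤ ∑' k : ℕ, (Metric.ball x₀ (A * ρ ^ k)).indicator
      (fun _ => ENNReal.ofReal (B * (ρ ^ k) ^ q)) y) :
    ∫⁻ y, f y ∂μ ≤ ENNReal.ofReal (C * A ^ n * B * (1 - ρ ^ (n + q))⁻¹) := by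
  calc ∫⁻ y, f y ∂μ ≤ ∫⁻ y, (∑' k : ℕ, (Metric.ball x₀ (A * ρ ^ k)).indicator
      (fun _ => ENNReal.ofReal (B * (ρ ^ k) ^ q)) y) ∂μ := lintegral_mono hf
    _ = ∑' k : ℕ, ENNReal.ofReal (B * (ρ ^ k) ^ q) * μ (Metric.ball x₀ (A * ρ ^ k)) := by
      rw [lintegral_tsum]
      · congr 1; ext k
        rw [lintegral_indicator Metric.isOpen_ball.measurableSet]
        simp
      · intro k
        exact (measurable_const.indicator Metric.isOpen_ball.measurableSet).aemeasurable
    _ ≤ ∑' k : ℕ, ENNReal.ofReal (C * A ^ n * B * (ρ ^ (n + q)) ^ k) := by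
      refine ENNReal.tsum_le_tsum fun k => ?_
      have hk : 0 < ρ ^ k := pow_pos hρ k
      calc _ ≤ ENNReal.ofReal (B * (ρ ^ k) ^ q) * ENNReal.ofReal (C * (A * ρ ^ k) ^ n) := by
            gcongr; exact hμ _ (by positivity)
        _ = _ := by
            rw [← ENNReal.ofReal_mul (by positivity)]
            congr 1
            rw [Real.mul_rpow hA.le hk.le, ← Real.rpow_natCast (ρ ^ (n + q)) k,
              ← Real.rpow_mul hρ.le, mul_comm (n + q), Real.rpow_mul hρ.le, Real.rpow_natCast,
              Real.rpow_add hk]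
            ring
    _ = ENNReal.ofReal (C * A ^ n * B * (1 - ρ ^ (n + q))⁻¹) := by
      have h0 : 0 ≤ ρ ^ (n + q) := by positivity
      rw [← ENNReal.ofReal_tsum_of_nonneg]
      · rw [tsum_mul_left, tsum_geometric_of_lt_one h0 hρ1]
      · intro k; positivity
      · exact (summable_geometric_of_lt_one h0 hρ1).mul_left _

lemma rpow_le_rpow_abs_mul {c d x : ℝ} (q : ℝ) (hc : 0 < c) (hd : 0 < d) (hx : 0 < x)
    (h1 : x ≤ c * d) (h2 : d ≤ c * x) : d ^ q ≤ c ^ |q| * x ^ q := by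
  rcases le_total 0 q with h | h
  · rw [abs_of_nonneg h, ← Real.mul_rpow hc.le hx.le]
    exact Real.rpow_le_rpow hd.le h2 h
  · rw [abs_of_nonpos h]
    have : d ^ q ≤ (c⁻¹ * x) ^ q :=
      Real.rpow_le_rpow_of_nonpos (by positivity) (by rwa [inv_mul_le_iff₀ hc]) h
    rwa [Real.mul_rpow (by positivity) hx.le, Real.inv_rpow hc.le, ← Real.rpow_neg hc.le] at this

/-- Powers of the distance are integrable near a point when the exponent exceeds minus the
growth exponent of the measure. -/
lemma exists_inner_bound (C n q : ℝ) (hC : 0 ≤ C) (hq : q ≠ 0) (hnq : 0 < n + q) :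
    ∃ K : ℝ, 0 ≤ K ∧ ∀ (μ : Measure X) (x₀ : X),
      (∀ t : ℝ, 0 < t → μ (Metric.ball x₀ t) ≤ ENNReal.ofReal (C * t ^ n)) → ∀ t : ℝ, 0 < t →
      IntegrableOn (fun y => dist y x₀ ^ q) (Metric.ball x₀ t) μ ∧
      ∫ y in Metric.ball x₀ t, dist y x₀ ^ q ∂μ ≤ K * t ^ (n + q) := by
  have h2 : ((2:ℝ)⁻¹) ^ (n + q) < 1 := Real.rpow_lt_one (by norm_num) (by norm_num) hnq
  have h3 : 0 ≤ (1 - ((2:ℝ)⁻¹) ^ (n + q))⁻¹ := by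
    have : 0 < 1 - ((2:ℝ)⁻¹) ^ (n + q) := by linarith
    positivity
  refine ⟨C * 2 ^ n * 2 ^ |q| * (1 - ((2:ℝ)⁻¹) ^ (n + q))⁻¹, by positivity, fun μ x₀ hμ t ht => ?_⟩
  have key : ∫⁻ y in Metric.ball x₀ t, ENNReal.ofReal (dist y x₀ ^ q) ∂μ ≤
      ENNReal.ofReal (C * 2 ^ n * 2 ^ |q| * (1 - ((2:ℝ)⁻¹) ^ (n + q))⁻¹ * t ^ (n + q)) := by
    rw [← lintegral_indicator Metric.isOpen_ball.measurableSet]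
    refine (lintegral_le_geometric (A := 2 * t) (q := q) (B := 2 ^ |q| * t ^ q) (ρ := 2⁻¹) hC hμ
      (by positivity) (by positivity) (by norm_num) h2 (fun y => ?_)).trans (le_of_eq ?_)
    · by_cases hy : y ∈ Metric.ball x₀ t
      swap
      · simp [hy]
      rw [Set.indicator_of_mem hy]
      rcases (dist_nonneg (x := y) (y := x₀)).eq_or_lt' with h0 | h0
      · simp [h0, Real.zero_rpow hq]
      obtain ⟨k, hk1, hk2⟩ := exists_nat_pow_near_of_lt_one (x := dist y x₀ / t) (y := (2:ℝ)⁻¹)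
        (by positivity) (by rw [div_le_one ht]; exact (Metric.mem_ball.1 hy).le)
        (by norm_num) (by norm_num)
      rw [lt_div_iff₀ ht] at hk1
      rw [div_le_iff₀ ht] at hk2
      have hp : (0:ℝ) < (2⁻¹) ^ k := by positivity
      rw [pow_succ] at hk1
      refine le_trans ?_ (ENNReal.le_tsum k)
      rw [Set.indicator_of_mem (by rw [Metric.mem_ball]; nlinarith)]
      apply ENNReal.ofReal_le_ofReal
      rw [mul_assoc, ← Real.mul_rpow ht.le hp.le]
      exact rpow_le_rpow_abs_mul q two_pos h0 (by positivity) (by nlinarith) (by nlinarith)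
    · congr 1
      rw [Real.rpow_add ht, Real.mul_rpow (by norm_num) ht.le]; ring
  have hm : AEStronglyMeasurable (fun y => dist y x₀ ^ q) (μ.restrict (Metric.ball x₀ t)) := by
    have : Measurable (fun y => dist y x₀ ^ q) :=
      (measurable_id.pow_const q).comp (continuous_id.dist continuous_const).measurable
    exact this.aestronglyMeasurable
  have hnn : 0 ≤ᵐ[μ.restrict (Metric.ball x₀ t)] (fun y => dist y x₀ ^ q) :=
    Eventually.of_forall fun y => by positivity
  refine ⟨⟨hm, ?_⟩, ?_⟩
  · rw [hasFiniteIntegral_iff_ofReal hnn]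
    exact key.trans_lt ENNReal.ofReal_lt_top
  · rw [integral_eq_lintegral_of_nonneg_ae hnn hm]
    exact ENNReal.toReal_le_of_le_ofReal (by positivity) key

/-- Powers of the distance are integrable at infinity when the exponent is below minus the
growth exponent of the measure. -/
lemma exists_outer_bound (C n q : ℝ) (hC : 0 ≤ C) (hnq : n + q < 0) :
    ∃ K : ℝ, 0 ≤ K ∧ ∀ (μ : Measure X) (x₀ : X),
      (∀ t : ℝ, 0 < t → μ (Metric.ball x₀ t) ≤ ENNReal.ofReal (C * t ^ n)) → ∀ t : ℝ, 0 < t →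
      IntegrableOn (fun y => dist y x₀ ^ q) (Metric.ball x₀ t)ᶜ μ ∧
      ∫ y in (Metric.ball x₀ t)ᶜ, dist y x₀ ^ q ∂μ ≤ K * t ^ (n + q) := by
  have h2 : (2:ℝ) ^ (n + q) < 1 := Real.rpow_lt_one_of_one_lt_of_neg (by norm_num) hnq
  have h3 : 0 ≤ (1 - (2:ℝ) ^ (n + q))⁻¹ := by
    have : 0 < 1 - (2:ℝ) ^ (n + q) := by linarith
    positivity
  refine ⟨C * 2 ^ n * 2 ^ |q| * (1 - (2:ℝ) ^ (n + q))⁻¹, by positivity, fun μ x₀ hμ t ht => ?_⟩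
  have key : ∫⁻ y in (Metric.ball x₀ t)ᶜ, ENNReal.ofReal (dist y x₀ ^ q) ∂μ ≤
      ENNReal.ofReal (C * 2 ^ n * 2 ^ |q| * (1 - (2:ℝ) ^ (n + q))⁻¹ * t ^ (n + q)) := by
    rw [← lintegral_indicator Metric.isOpen_ball.measurableSet.compl]
    refine (lintegral_le_geometric (A := 2 * t) (q := q) (B := 2 ^ |q| * t ^ q) (ρ := 2) hC hμ
      (by positivity) (by positivity) (by norm_num) h2 (fun y => ?_)).trans (le_of_eq ?_)
    · by_cases hy : y ∈ (Metric.ball x₀ t)ᶜ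
      swap
      · simp [hy]
      rw [Set.indicator_of_mem hy]
      rw [Set.mem_compl_iff, Metric.mem_ball, not_lt] at hy
      have h0 : 0 < dist y x₀ := ht.trans_le hy
      obtain ⟨k, hk1, hk2⟩ := exists_nat_pow_near (x := dist y x₀ / t) (y := (2:ℝ))
        ((one_le_div ht).2 hy) (by norm_num)
      rw [le_div_iff₀ ht] at hk1
      rw [div_lt_iff₀ ht] at hk2
      have hp : (0:ℝ) < 2 ^ k := by positivity
      rw [pow_succ] at hk2
      refine le_trans ?_ (ENNReal.le_tsum k)
      rw [Set.indicator_of_mem (by rw [Metric.mem_ball]; nlinarith)]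
      apply ENNReal.ofReal_le_ofReal
      rw [mul_assoc, ← Real.mul_rpow ht.le hp.le]
      exact rpow_le_rpow_abs_mul q two_pos h0 (by positivity) (by nlinarith) (by nlinarith)
    · congr 1
      rw [Real.rpow_add ht, Real.mul_rpow (by norm_num) ht.le]; ring
  have hm : AEStronglyMeasurable (fun y => dist y x₀ ^ q) (μ.restrict (Metric.ball x₀ t)ᶜ) := by
    have : Measurable (fun y => dist y x₀ ^ q) :=
      (measurable_id.pow_const q).comp (continuous_id.dist continuous_const).measurable
    exact this.aestronglyMeasurable
  have hnn : 0 ≤ᵐ[μ.restrict (Metric.ball x₀ t)ᶜ] (fun y => dist y x₀ ^ q) :=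
    Eventually.of_forall fun y => by positivity
  refine ⟨⟨hm, ?_⟩, ?_⟩
  · rw [hasFiniteIntegral_iff_ofReal hnn]
    exact key.trans_lt ENNReal.ofReal_lt_top
  · rw [integral_eq_lintegral_of_nonneg_ae hnn hm]
    exact ENNReal.toReal_le_of_le_ofReal (by positivity) key

end DistPow
/-! ### The unit sphere and its surface measure -/

/-- Euclidean space. -/
abbrev EE (N : ℕ) := EuclideanSpace ℝ (Fin N)

/-- The unit sphere as a type. -/
abbrev Sph (N : ℕ) := Metric.sphere (0 : EE N) 1

/-- The surface measure of the unit sphere. -/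
noncomputable def sm (N : ℕ) : Measure (Sph N) := (volume : Measure (EE N)).toSphere

/-- The action of a linear isometry on the sphere. -/
noncomputable def rot {N : ℕ} (R : EE N ≃ₗᵢ[ℝ] EE N) (σ : Sph N) : Sph N := ⟨R σ, by simp⟩

@[simp] lemma coe_rot {N : ℕ} (R : EE N ≃ₗᵢ[ℝ] EE N) (σ : Sph N) : (rot R σ : EE N) = R σ := rfl

variable {N : ℕ}

instance : IsFiniteMeasure (sm N) := by unfold sm; infer_instance

@[simp] lemma norm_coe (σ : Sph N) : ‖(σ : EE N)‖ = 1 := by simp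

lemma dist_coe (σ τ : Sph N) : dist σ τ = ‖(σ : EE N) - τ‖ := by
  rw [Subtype.dist_eq, dist_eq_norm]

lemma dist_le_two (σ τ : Sph N) : dist σ τ ≤ 2 := by
  rw [dist_coe]
  refine (norm_sub_le _ _).trans ?_
  simp; norm_num

lemma dist_sq (σ τ : Sph N) : dist σ τ ^ 2 = 2 - 2 * inner ℝ (σ : EE N) (τ : EE N) := by
  rw [dist_coe, norm_sub_sq_real]; simp; ring

@[simp] lemma dist_rot (R : EE N ≃ₗᵢ[ℝ] EE N) (σ τ : Sph N) : dist (rot R σ) (rot R τ) = dist σ τ := by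
  simp [dist_coe, ← map_sub]

lemma continuous_rot (R : EE N ≃ₗᵢ[ℝ] EE N) : Continuous (rot R) :=
  (R.continuous.comp continuous_subtype_val).subtype_mk _

/-- The action of a linear isometry on the sphere, as a homeomorphism. -/
noncomputable def rotHomeo (R : EE N ≃ₗᵢ[ℝ] EE N) : Sph N ≃ₜ Sph N where
  toFun := rot R
  invFun := rot R.symm
  left_inv σ := by ext1; simp
  right_inv σ := by ext1; simp
  continuous_toFun := continuous_rot R
  continuous_invFun := continuous_rot R.symm

open scoped Pointwise in
lemma measurePreserving_rot (R : EE N ≃ₗᵢ[ℝ] EE N) : MeasurePreserving (rot R) (sm N) (sm N) := by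
  refine ⟨(continuous_rot R).measurable, ?_⟩
  ext s hs
  rw [Measure.map_apply (continuous_rot R).measurable hs, sm,
    Measure.toSphere_apply' _ ((continuous_rot R).measurable hs), Measure.toSphere_apply' _ hs]
  congr 1
  rw [← R.measurePreserving.measure_preimage_emb R.toHomeomorph.measurableEmbedding
    (Set.Ioo (0 : ℝ) 1 • ((fun σ : Sph N => (σ : EE N)) '' s))]
  congr 1
  ext x
  simp only [Set.mem_smul, Set.mem_image, Set.mem_preimage]
  constructor
  · rintro ⟨t, ht, _, ⟨y, hy, rfl⟩, rfl⟩
    exact ⟨t, ht, _, ⟨rot R y, hy, rfl⟩, by simp⟩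
  · rintro ⟨t, ht, _, ⟨y, hy, rfl⟩, hx⟩
    refine ⟨t, ht, _, ⟨rot R.symm y, ?_, rfl⟩, ?_⟩
    · have : rot R (rot R.symm y) = y := by ext1; simp
      change rot R (rot R.symm y) ∈ s
      rwa [this]
    · apply R.injective
      simp [← hx]

lemma integral_rot (R : EE N ≃ₗᵢ[ℝ] EE N) (f : Sph N → ℝ) :
    ∫ σ, f (rot R σ) ∂(sm N) = ∫ σ, f σ ∂(sm N) :=
  (measurePreserving_rot R).integral_comp (rotHomeo R).measurableEmbedding f

lemma integrable_rot (R : EE N ≃ₗᵢ[ℝ] EE N) {f : Sph N → ℝ} :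
    Integrable (fun σ => f (rot R σ)) (sm N) ↔ Integrable f (sm N) :=
  (measurePreserving_rot R).integrable_comp_emb (rotHomeo R).measurableEmbedding

lemma lintegral_logPolar (hN : 2 ≤ N) {F : EE N → ENNReal} (hF : Measurable F) :
    ∫⁻ x, F x = ∫⁻ σ : Sph N, ∫⁻ s : ℝ, ENNReal.ofReal (Real.exp (N * s)) *
      F (Real.exp s • (σ : EE N)) ∂volume ∂(sm N) := by
  have : Nontrivial (EE N) := Module.nontrivial_of_finrank_pos (R := ℝ) (by simp; omega)
  have mp := (volume : Measure (EE N)).measurePreserving_homeomorphUnitSphereProd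
  have e1 : ∫⁻ x, F x = ∫⁻ x : ({(0 : EE N)}ᶜ : Set (EE N)), F x
      ∂((volume : Measure (EE N)).comap (↑)) := by
    rw [lintegral_subtype_comap (measurableSet_singleton _).compl (fun x => F x),
      restrict_compl_singleton]
  have e2 := mp.lintegral_comp_emb (homeomorphUnitSphereProd (EE N)).measurableEmbedding
    (fun p => F (p.2.1 • (p.1 : EE N)))
  have e3 : ∀ x : ({(0 : EE N)}ᶜ : Set (EE N)), F ((homeomorphUnitSphereProd (EE N) x).2.1 •
      ((homeomorphUnitSphereProd (EE N) x).1 : EE N)) = F x := by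
    intro x
    have : (x : EE N) ≠ 0 := x.2
    congr 1
    simp [smul_smul, this]
  simp only [e3] at e2
  rw [e1, e2, lintegral_prod]
  swap
  · apply Measurable.aemeasurable
    apply hF.comp
    fun_prop
  rw [sm]
  refine lintegral_congr fun σ => ?_
  have hexp : Real.exp '' Set.univ = Set.Ioi 0 := by simp
  rw [Measure.volumeIoiPow, lintegral_withDensity_eq_lintegral_mul]
  · simp only [Pi.mul_apply]
    rw [lintegral_subtype_comap measurableSet_Ioi (fun r : ℝ =>
      ENNReal.ofReal (r ^ (Module.finrank ℝ (EE N) - 1)) * F (r • (σ : EE N))), ← hexp,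
      lintegral_image_eq_lintegral_abs_deriv_mul MeasurableSet.univ
      (fun x _ => (Real.hasDerivAt_exp x).hasDerivWithinAt) Real.exp_injective.injOn,
      setLIntegral_univ]
    refine lintegral_congr fun s => ?_
    rw [← mul_assoc, ← ENNReal.ofReal_mul (by positivity), abs_of_pos (Real.exp_pos _),
      ← pow_succ', Nat.sub_add_cancel (by simp; omega), ← Real.exp_nat_mul]
    simp
  · fun_prop
  · apply hF.comp
    fun_prop

/-- The weight of logarithmic polar coordinates. -/
noncomputable def lw (N : ℕ) : Measure ℝ :=
  volume.withDensity fun s => ENNReal.ofReal (Real.exp (N * s))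

instance : SFinite (lw N) := by unfold lw; infer_instance

lemma measurable_logPolar : Measurable fun p : Sph N × ℝ => Real.exp p.2 • (p.1 : EE N) := by
  fun_prop

lemma measurePreserving_logPolar (hN : 2 ≤ N) :
    MeasurePreserving (fun p : Sph N × ℝ => Real.exp p.2 • (p.1 : EE N))
      ((sm N).prod (lw N)) volume := by
  refine ⟨measurable_logPolar, ?_⟩
  ext s hs
  rw [Measure.map_apply measurable_logPolar hs, ← lintegral_indicator_one hs,
    lintegral_logPolar hN (measurable_one.indicator hs),
    Measure.prod_apply (measurable_logPolar hs)]
  refine lintegral_congr fun σ => ?_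
  have : Measurable fun s : ℝ => Real.exp s • (σ : EE N) := by fun_prop
  rw [lw, withDensity_apply _ (measurable_prodMk_left (measurable_logPolar hs)),
    ← lintegral_indicator (measurable_prodMk_left (measurable_logPolar hs))]
  refine lintegral_congr fun t => ?_
  simp only [Set.indicator, Pi.one_apply, mul_ite, mul_one, mul_zero]
  rfl

lemma measurableEmbedding_logPolar :
    MeasurableEmbedding (fun p : Sph N × ℝ => Real.exp p.2 • (p.1 : EE N)) := by
  refine Measurable.measurableEmbedding measurable_logPolar ?_
  rintro ⟨σ, s⟩ ⟨τ, t⟩ h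
  simp only at h
  have h1 : Real.exp s = Real.exp t := by
    have := congrArg norm h
    simpa [norm_smul] using this
  rw [h1] at h
  have h2 := smul_right_injective (EE N) (Real.exp_pos t).ne' h
  exact Prod.ext (Subtype.ext h2) (Real.exp_injective h1)


/-- Spherical caps have measure at most `C t ^ (N - 1)`. -/
lemma exists_cap_bound (hN : 2 ≤ N) : ∃ C : ℝ, 0 < C ∧ ∀ (θ : Sph N) (t : ℝ), 0 < t →
    sm N (Metric.ball θ t) ≤ ENNReal.ofReal (C * t ^ ((N : ℝ) - 1)) := by
  have : Nontrivial (EE N) := Module.nontrivial_of_finrank_pos (R := ℝ) (by simp; omega)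
  set V := (volume : Measure (EE N)).real (Metric.ball 0 1) with hV
  have hVpos : 0 ≤ V := measureReal_nonneg
  refine ⟨V * 4 ^ N * Real.exp N + 1 + (sm N).real Set.univ, by positivity, fun θ t ht => ?_⟩
  rcases lt_or_ge t 1 with h1 | h1
  swap
  · have hone : 1 ≤ t ^ ((N : ℝ) - 1) := Real.one_le_rpow h1
      (by have : (2:ℝ) ≤ N := by exact_mod_cast hN
          linarith)
    calc sm N (Metric.ball θ t) ≤ sm N Set.univ := measure_mono (Set.subset_univ _)
      _ = ENNReal.ofReal ((sm N).real Set.univ) := by simp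
      _ ≤ _ := ENNReal.ofReal_le_ofReal (by
          nlinarith [show 0 ≤ V * 4 ^ N * Real.exp N + 1 by positivity,
            show 0 ≤ (sm N).real Set.univ from measureReal_nonneg])
  have key : ENNReal.ofReal t * (ENNReal.ofReal (Real.exp (-N)) * sm N (Metric.ball θ t)) ≤
      ENNReal.ofReal (V * (4 * t) ^ N) := by
    calc ENNReal.ofReal t * (ENNReal.ofReal (Real.exp (-N)) * sm N (Metric.ball θ t))
        = ENNReal.ofReal (Real.exp (-N)) * ((sm N).prod volume)
            (Metric.ball θ t ×ˢ Set.Ioo (-t) 0) := by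
          rw [Measure.prod_prod, Real.volume_Ioo]
          simp; ring
      _ ≤ ((sm N).prod (lw N)) (Metric.ball θ t ×ˢ Set.Ioo (-t) 0) := by
          rw [Measure.prod_prod, Measure.prod_prod, mul_left_comm]
          gcongr
          rw [lw, withDensity_apply _ measurableSet_Ioo, ← setLIntegral_const]
          refine setLIntegral_mono' measurableSet_Ioo fun s hs => ENNReal.ofReal_le_ofReal ?_
          apply Real.exp_le_exp.2
          have : (0:ℝ) ≤ N := by positivity
          nlinarith [hs.1, hs.2]
      _ ≤ volume (Metric.ball (θ : EE N) (4 * t)) := by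
          rw [← (measurePreserving_logPolar hN).measure_preimage
            Metric.isOpen_ball.measurableSet.nullMeasurableSet]
          apply measure_mono
          rintro ⟨σ, s⟩ ⟨hσ, hs⟩
          simp only [Set.mem_preimage, Metric.mem_ball, dist_eq_norm] at hσ ⊢
          rw [dist_coe] at hσ
          have e : Real.exp s • (σ : EE N) - θ = (σ - θ) + (Real.exp s - 1) • (σ : EE N) := by
            module
          rw [e]
          refine (norm_add_le _ _).trans_lt ?_
          rw [norm_smul, norm_coe, mul_one, Real.norm_eq_abs, abs_sub_comm]
          have h2 : Real.exp s ≤ 1 := Real.exp_le_one_iff.2 hs.2.le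
          have h3 := Real.add_one_le_exp s
          rw [abs_of_nonneg (by linarith)]
          linarith [hs.1]
      _ = ENNReal.ofReal (V * (4 * t) ^ N) := by
          rw [Measure.addHaar_ball _ _ (by positivity), mul_comm, ENNReal.ofReal_mul hVpos, hV,
            ofReal_measureReal measure_ball_lt_top.ne]
          simp
  have hfin : sm N (Metric.ball θ t) ≠ ⊤ := measure_ne_top _ _
  rw [← ENNReal.ofReal_toReal hfin, ← ENNReal.ofReal_mul (by positivity),
    ← ENNReal.ofReal_mul (by positivity), ENNReal.ofReal_le_ofReal_iff (by positivity)] at key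
  rw [← ENNReal.ofReal_toReal hfin]
  apply ENNReal.ofReal_le_ofReal
  set m := (sm N (Metric.ball θ t)).toReal
  have hp : t ^ N = t * t ^ ((N : ℝ) - 1) := by
    rw [Real.rpow_sub_one ht.ne', Real.rpow_natCast]; field_simp
  rw [mul_pow, hp] at key
  have hk2 : Real.exp (-N) * m ≤ V * (4 ^ N * t ^ ((N : ℝ) - 1)) := by
    apply le_of_mul_le_mul_left _ ht
    linarith
  have hk3 : m ≤ Real.exp N * (V * (4 ^ N * t ^ ((N : ℝ) - 1))) := by
    calc m = Real.exp N * (Real.exp (-N) * m) := by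
          rw [← mul_assoc, ← Real.exp_add]; simp
      _ ≤ _ := by gcongr
  have : 0 ≤ (1 + (sm N).real Set.univ) * t ^ ((N : ℝ) - 1) := by positivity
  linarith

/-- The reflection fixing the line spanned by `v`. -/
noncomputable abbrev refl (v : EE N) : EE N ≃ₗᵢ[ℝ] EE N := (ℝ ∙ v).reflection

lemma refl_apply (u v : EE N) : refl u v = (2 * (inner ℝ u v / ‖u‖ ^ 2)) • u - v := by
  rw [refl, Submodule.reflection_singleton_apply, two_smul, ← add_smul]
  congr 2
  simp; ring

/-- The reflection of `σ` about the axis through `θ`. -/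
noncomputable def opp (θ σ : Sph N) : Sph N := rot (refl (θ : EE N)) σ

lemma coe_opp (θ σ : Sph N) : (opp θ σ : EE N) = (2 * inner ℝ (θ : EE N) σ) • (θ : EE N) - σ := by
  rw [opp, coe_rot, refl_apply]; simp

@[simp] lemma opp_self (θ : Sph N) : opp θ θ = θ := by
  ext1; rw [coe_opp]; simp; module

@[simp] lemma dist_opp (θ σ : Sph N) : dist (opp θ σ) θ = dist σ θ := by
  conv_lhs => rw [← opp_self θ]
  simp only [opp, dist_rot, opp_self]
  nth_rewrite 2 [← opp_self θ]
  simp [opp]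

lemma refl_add_apply_left (θ τ : Sph N) : refl ((θ : EE N) + (τ : EE N)) (θ : EE N) = τ := by
  rw [refl_apply]
  by_cases h : (θ : EE N) + (τ : EE N) = 0
  · simp only [h, smul_zero, zero_sub]
    exact neg_eq_of_add_eq_zero_right h
  · have h1 : ‖(θ : EE N) + (τ : EE N)‖ ^ 2 = 2 * inner ℝ ((θ : EE N) + (τ : EE N)) (θ : EE N) := by
      rw [norm_add_sq_real, inner_add_left, real_inner_self_eq_norm_sq]
      simp [real_inner_comm]; ring
    have h2 : ‖(θ : EE N) + (τ : EE N)‖ ^ 2 ≠ 0 := by simpa using h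
    rw [← mul_div_assoc, ← h1, div_self h2]
    simp

/-- Two points of the sphere are joined by a rotation that is close to the identity when the
points are close, and that also carries the symmetric point back. -/
lemma exists_rot (θ τ : Sph N) : ∃ R : EE N ≃ₗᵢ[ℝ] EE N,
    rot R θ = τ ∧ rot R (opp θ τ) = θ ∧ ∀ x : EE N, ‖x‖ = 1 → ‖R x - x‖ ≤ 8 * dist τ θ := by
  refine ⟨(refl (θ : EE N)).trans (refl ((θ : EE N) + (τ : EE N))), ?_, ?_, ?_⟩
  · ext1
    have : refl (θ : EE N) (θ : EE N) = θ := congrArg Subtype.val (opp_self θ)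
    simp only [coe_rot, LinearIsometryEquiv.trans_apply, this, refl_add_apply_left]
  · ext1
    simp only [coe_rot, LinearIsometryEquiv.trans_apply, opp, Submodule.reflection_reflection]
    rw [add_comm, refl_add_apply_left]
  · intro x hx
    simp only [LinearIsometryEquiv.trans_apply]
    set y := refl (θ : EE N) x with hy
    have hy1 : ‖y‖ = 1 := by rw [hy, LinearIsometryEquiv.norm_map, hx]
    have hxy : x = refl (θ : EE N) y := by simp [hy]
    rcases le_or_gt 1 (dist τ θ) with h1 | h1
    · calc ‖refl ((θ : EE N) + (τ : EE N)) y - x‖ ≤ ‖refl ((θ : EE N) + (τ : EE N)) y‖ + ‖x‖ := norm_sub_le _ _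
        _ = 2 := by rw [LinearIsometryEquiv.norm_map, hx, hy1]; norm_num1
        _ ≤ _ := by linarith
    rw [hxy, refl_apply, refl_apply, norm_coe]
    set d := dist τ θ with hd
    rw [dist_coe] at hd
    set L := ‖(θ : EE N) + (τ : EE N)‖ with hL
    have hL1 : 2 - d ≤ L := by
      have : (2:ℝ) = ‖((θ : EE N) + (τ : EE N)) - ((τ : EE N) - θ)‖ := by
        rw [show ((θ : EE N) + (τ : EE N)) - ((τ : EE N) - θ) = (2 : ℝ) • (θ : EE N) by module, norm_smul]
        simp
      linarith [norm_sub_le ((θ : EE N) + (τ : EE N)) ((τ : EE N) - θ)]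
    have hL2 : L ≤ 2 := by
      refine (norm_add_le _ _).trans ?_
      simp; norm_num
    have hL0 : 0 < L := by linarith
    set a := L⁻¹ • ((θ : EE N) + (τ : EE N)) with ha
    have ha1 : ‖a‖ = 1 := by
      rw [ha, norm_smul, ← hL, norm_inv, Real.norm_of_nonneg hL0.le, inv_mul_cancel₀ hL0.ne']
    have hva : (θ : EE N) + (τ : EE N) = L • a := by rw [ha, smul_inv_smul₀ hL0.ne']
    have haθ : ‖a - θ‖ ≤ 2 * d := by
      have e : a - θ = L⁻¹ • (((τ : EE N) - θ) + (2 - L) • (θ : EE N)) := by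
        rw [ha, sub_smul, show ((θ : EE N) + (τ : EE N)) = ((τ : EE N) - θ) + (2 : ℝ) • (θ : EE N) by module,
          smul_add, smul_add, smul_sub L⁻¹ ((2 : ℝ) • (θ : EE N)), inv_smul_smul₀ hL0.ne']
        abel
      rw [e, norm_smul, norm_inv, Real.norm_of_nonneg hL0.le, inv_mul_le_iff₀ hL0]
      refine (norm_add_le _ _).trans ?_
      rw [norm_smul, norm_coe, ← hd, Real.norm_of_nonneg (by linarith)]
      nlinarith [dist_nonneg (x := τ) (y := θ)]
    have e2 : (2 * (inner ℝ ((θ : EE N) + (τ : EE N)) y / L ^ 2)) • ((θ : EE N) + (τ : EE N)) - y -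
        ((2 * (inner ℝ (θ : EE N) y / 1 ^ 2)) • (θ : EE N) - y) =
        (2 : ℝ) • (inner ℝ (a - θ) y • a + inner ℝ (θ : EE N) y • (a - θ)) := by
      rw [hva, inner_smul_left, inner_sub_left, smul_smul]
      have : 2 * ((starRingEnd ℝ) L * inner ℝ a y / L ^ 2) * L = 2 * inner ℝ a y := by
        simp; field_simp
      rw [this]
      module
    rw [e2, norm_smul]
    have i1 := abs_real_inner_le_norm (a - θ) y
    have i2 := abs_real_inner_le_norm (θ : EE N) y
    rw [hy1, mul_one] at i1 i2
    rw [norm_coe] at i2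
    have := norm_add_le (inner ℝ (a - θ) y • a) (inner ℝ (θ : EE N) y • (a - θ))
    rw [norm_smul _ a, norm_smul _ (a - _), ha1, Real.norm_eq_abs, Real.norm_eq_abs] at this
    have i3 : |inner ℝ (θ : EE N) y| * ‖a - θ‖ ≤ 1 * ‖a - θ‖ := by gcongr
    rw [Real.norm_of_nonneg (by norm_num)]
    linarith

/-! ### Differences of smooth functions and of powers -/

lemma four_point {M M' : ℝ → ℝ} {I : Set ℝ} (hI : Convex ℝ I)
    (hM : ∀ x ∈ I, HasDerivAt M (M' x) x) {A B : ℝ} (hA : ∀ x ∈ I, |M' x| ≤ A)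
    (hB : ∀ x ∈ I, ∀ y ∈ I, |M' x - M' y| ≤ B * |x - y|) (hB0 : 0 ≤ B) {a₁ b₁ a₂ b₂ : ℝ}
    (ha₁ : a₁ ∈ I) (hb₁ : b₁ ∈ I) (ha₂ : a₂ ∈ I) (hb₂ : b₂ ∈ I) :
    |(M a₁ - M b₁) - (M a₂ - M b₂)| ≤
      A * |(a₁ - b₁) - (a₂ - b₂)| + B * |a₂ - b₂| * (|a₁ - a₂| + |b₁ - b₂|) := by
  set w₁ := a₁ - b₁ with hw₁
  set w₂ := a₂ - b₂ with hw₂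
  have hx : ∀ t ∈ Set.Icc (0:ℝ) 1, b₁ + t * w₁ ∈ I := fun t ht => by
    have := hI hb₁ ha₁ (sub_nonneg.2 ht.2) ht.1 (by ring)
    simp only [smul_eq_mul] at this
    convert this using 1; rw [hw₁]; ring
  have hy : ∀ t ∈ Set.Icc (0:ℝ) 1, b₂ + t * w₂ ∈ I := fun t ht => by
    have := hI hb₂ ha₂ (sub_nonneg.2 ht.2) ht.1 (by ring)
    simp only [smul_eq_mul] at this
    convert this using 1; rw [hw₂]; ring
  have hd : ∀ t ∈ Set.Icc (0:ℝ) 1, HasDerivWithinAt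
      (fun t => M (b₁ + t * w₁) - M (b₂ + t * w₂))
      (M' (b₁ + t * w₁) * w₁ - M' (b₂ + t * w₂) * w₂) (Set.Icc 0 1) t := fun t ht => by
    have h1 : HasDerivAt (fun t => b₁ + t * w₁) w₁ t := by
      simpa using ((hasDerivAt_id t).mul_const w₁).const_add b₁
    have h2 : HasDerivAt (fun t => b₂ + t * w₂) w₂ t := by
      simpa using ((hasDerivAt_id t).mul_const w₂).const_add b₂
    exact (((hM _ (hx t ht)).comp t h1).sub ((hM _ (hy t ht)).comp t h2)).hasDerivWithinAt
  have hbound : ∀ t ∈ Set.Icc (0:ℝ) 1, ‖M' (b₁ + t * w₁) * w₁ - M' (b₂ + t * w₂) * w₂‖ ≤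
      A * |w₁ - w₂| + B * |w₂| * (|a₁ - a₂| + |b₁ - b₂|) := fun t ht => by
    have e : M' (b₁ + t * w₁) * w₁ - M' (b₂ + t * w₂) * w₂ = M' (b₁ + t * w₁) * (w₁ - w₂) +
      (M' (b₁ + t * w₁) - M' (b₂ + t * w₂)) * w₂ := by ring
    rw [e]
    refine (norm_add_le _ _).trans ?_
    rw [norm_mul, norm_mul]
    simp only [Real.norm_eq_abs]
    have h1 : |b₁ + t * w₁ - (b₂ + t * w₂)| ≤ |a₁ - a₂| + |b₁ - b₂| := by
      have : b₁ + t * w₁ - (b₂ + t * w₂) = t * (a₁ - a₂) + (1 - t) * (b₁ - b₂) := by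
        rw [hw₁, hw₂]; ring
      rw [this]
      refine (abs_add_le _ _).trans ?_
      rw [abs_mul, abs_mul, abs_of_nonneg ht.1, abs_of_nonneg (sub_nonneg.2 ht.2)]
      nlinarith [abs_nonneg (a₁ - a₂), abs_nonneg (b₁ - b₂), ht.1, ht.2]
    have h2 := hA _ (hx t ht)
    have h3 := (hB _ (hx t ht) _ (hy t ht)).trans (mul_le_mul_of_nonneg_left h1 hB0)
    calc _ ≤ A * |w₁ - w₂| + (B * (|a₁ - a₂| + |b₁ - b₂|)) * |w₂| := by gcongr
      _ = _ := by ring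
  have := (convex_Icc (0:ℝ) 1).norm_image_sub_le_of_norm_hasDerivWithin_le hd hbound
    (Set.left_mem_Icc.2 zero_le_one) (Set.right_mem_Icc.2 zero_le_one)
  have e1 : b₁ + w₁ = a₁ := by rw [hw₁]; ring
  have e2 : b₂ + w₂ = a₂ := by rw [hw₂]; ring
  simp only [one_mul, zero_mul, add_zero, sub_zero, norm_one, mul_one, Real.norm_eq_abs, e1,
    e2] at this
  convert this using 2
  ring

lemma abs_rpow_sub_rpow_le {p a b : ℝ} (hp : p ≠ 0) (ha : 0 ≤ a) (hb : 0 ≤ b) :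
    |a ^ p - b ^ p| ≤ (|p| + 1) * |a - b| * (a ^ (p - 1) + b ^ (p - 1)) := by
  wlog hab : a ≤ b generalizing a b
  · have := this hb ha (le_of_not_ge hab)
    rwa [abs_sub_comm, abs_sub_comm b a, add_comm (b ^ _)] at this
  rcases ha.eq_or_lt with rfl | ha
  · rcases hb.eq_or_lt with rfl | hb
    · simp
    rw [Real.zero_rpow hp, zero_sub, zero_sub, abs_neg, abs_neg, abs_of_pos hb,
      abs_of_pos (Real.rpow_pos_of_pos hb p)]
    have h1 : b ^ p = b * b ^ (p - 1) := by
      rw [Real.rpow_sub_one hb.ne']; field_simp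
    have h2 : 0 ≤ (0:ℝ) ^ (p - 1) := Real.rpow_nonneg le_rfl _
    have h3 : 0 < b * b ^ (p - 1) := by positivity
    rw [h1]
    nlinarith [abs_nonneg p, mul_nonneg hb.le h2, mul_nonneg (abs_nonneg p) h3.le,
      mul_nonneg (abs_nonneg p) (mul_nonneg hb.le h2)]
  have hb : 0 < b := ha.trans_le hab
  have hd : ∀ t ∈ Set.Icc a b, HasDerivWithinAt (fun t : ℝ => t ^ p) (p * t ^ (p - 1))
      (Set.Icc a b) t := fun t ht =>
    (Real.hasDerivAt_rpow_const (Or.inl (ha.trans_le ht.1).ne')).hasDerivWithinAt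
  have hbd : ∀ t ∈ Set.Icc a b, ‖p * t ^ (p - 1)‖ ≤ |p| * (a ^ (p - 1) + b ^ (p - 1)) := by
    intro t ht
    have ht0 : 0 < t := ha.trans_le ht.1
    rw [norm_mul, Real.norm_eq_abs, Real.norm_of_nonneg (by positivity)]
    gcongr
    have p1 : 0 < a ^ (p - 1) := by positivity
    have p2 : 0 < b ^ (p - 1) := by positivity
    rcases le_total 0 (p - 1) with h | h
    · linarith [Real.rpow_le_rpow ht0.le ht.2 h]
    · linarith [Real.rpow_le_rpow_of_nonpos ha ht.1 h]
  have := (convex_Icc a b).norm_image_sub_le_of_norm_hasDerivWithin_le hd hbd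
    (Set.right_mem_Icc.2 hab) (Set.left_mem_Icc.2 hab)
  simp only [Real.norm_eq_abs] at this
  refine this.trans ?_
  have h1 : 0 ≤ |a - b| * (a ^ (p - 1) + b ^ (p - 1)) := by positivity
  linarith

/-- Mixed second differences of powers of the norm. -/
lemma exists_second_diff_bound {E : Type*} [NormedAddCommGroup E] [InnerProductSpace ℝ E] (p : ℝ) :
    ∃ C : ℝ, 0 ≤ C ∧ ∀ z u w : E, ‖u‖ ≤ ‖z‖ / 4 → ‖w‖ ≤ ‖z‖ / 4 →
    |(‖z + u + w‖ ^ p - ‖z + u‖ ^ p) - (‖z + w‖ ^ p - ‖z‖ ^ p)| ≤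
      C * ‖u‖ * ‖w‖ * ‖z‖ ^ (p - 2) := by
  set e := p / 2 with he
  set C₁ := |e| * 4 ^ |e - 1| with hC₁
  set C₂ := |e| * (|e - 1| * 4 ^ |e - 2|) with hC₂
  refine ⟨2 * C₁ + 18 * C₂, by positivity, fun z u w hu hw => ?_⟩
  rcases (norm_nonneg z).eq_or_lt with hz | hz
  · have hu0 : u = 0 := by rw [← norm_le_zero_iff]; linarith
    have hw0 : w = 0 := by rw [← norm_le_zero_iff]; linarith
    simp [hu0, hw0]
  set s := ‖z‖ ^ 2 with hs
  have hs0 : 0 < s := by positivity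
  have hI : ∀ x : E, ‖z‖ / 2 ≤ ‖x‖ → ‖x‖ ≤ 2 * ‖z‖ → ‖x‖ ^ 2 ∈ Set.Icc (s / 4) (4 * s) := by
    intro x h1 h2
    constructor <;> nlinarith [norm_nonneg x]
  have hpos : ∀ x ∈ Set.Icc (s / 4) (4 * s), 0 < x := fun x hx => by linarith [hx.1]
  have hpow : ∀ x ∈ Set.Icc (s / 4) (4 * s), ∀ q : ℝ, x ^ q ≤ 4 ^ |q| * s ^ q := fun x hx q =>
    rpow_le_rpow_abs_mul q (by norm_num) (hpos x hx) hs0 (by linarith [hx.1]) hx.2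
  have h4 := four_point (M := fun x => x ^ e) (M' := fun x => e * x ^ (e - 1))
    (convex_Icc (s / 4) (4 * s))
    (fun x hx => Real.hasDerivAt_rpow_const (Or.inl (hpos x hx).ne'))
    (A := C₁ * s ^ (e - 1)) (B := C₂ * s ^ (e - 2))
    (fun x hx => by
      rw [abs_mul, abs_of_pos (Real.rpow_pos_of_pos (hpos x hx) _), hC₁, mul_assoc]
      gcongr
      exact hpow x hx _)
    (fun x hx y hy => by
      have hd : ∀ t ∈ Set.Icc (s / 4) (4 * s), HasDerivWithinAt (fun t : ℝ => e * t ^ (e - 1))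
          (e * ((e - 1) * t ^ (e - 1 - 1))) (Set.Icc (s / 4) (4 * s)) t := fun t ht =>
        ((Real.hasDerivAt_rpow_const (Or.inl (hpos t ht).ne')).const_mul e).hasDerivWithinAt
      refine (convex_Icc (s / 4) (4 * s)).norm_image_sub_le_of_norm_hasDerivWithin_le hd
        (fun t ht => ?_) hy hx
      rw [norm_mul, norm_mul, Real.norm_eq_abs, Real.norm_eq_abs,
        Real.norm_of_nonneg (Real.rpow_nonneg (hpos t ht).le _), hC₂, mul_assoc, mul_assoc]
      gcongr
      rw [show e - 1 - 1 = e - 2 by ring]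
      exact hpow t ht _)
    (by positivity)
    (hI (z + u + w) (by
      have := norm_sub_norm_le z (-(u + w))
      rw [norm_neg, sub_neg_eq_add, ← add_assoc] at this
      linarith [norm_add_le u w]) (by linarith [norm_add_le (z + u) w, norm_add_le z u]))
    (hI (z + u) (by
      have := norm_sub_norm_le z (-u)
      rw [norm_neg, sub_neg_eq_add] at this
      linarith) (by linarith [norm_add_le z u]))
    (hI (z + w) (by
      have := norm_sub_norm_le z (-w)
      rw [norm_neg, sub_neg_eq_add] at this
      linarith) (by linarith [norm_add_le z w]))
    (hI z (by linarith) (by linarith))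
  have hrw : ∀ x : E, (‖x‖ ^ 2) ^ e = ‖x‖ ^ p := fun x => by
    rw [← Real.rpow_natCast, ← Real.rpow_mul (norm_nonneg _), he]; congr 1; push_cast; ring
  simp only [hrw, hs] at h4
  refine h4.trans ?_
  have n1 : ‖z + u + w‖ ^ 2 - ‖z + u‖ ^ 2 - (‖z + w‖ ^ 2 - ‖z‖ ^ 2) = 2 * inner ℝ u w := by
    rw [norm_add_sq_real, norm_add_sq_real z w, inner_add_left]; ring
  have n2 : |‖z + w‖ ^ 2 - ‖z‖ ^ 2| ≤ 3 * ‖z‖ * ‖w‖ := by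
    rw [norm_add_sq_real]
    have := abs_real_inner_le_norm z w
    rw [abs_le] at this ⊢
    constructor <;> nlinarith [norm_nonneg w]
  have n3 : |‖z + u‖ ^ 2 - ‖z‖ ^ 2| ≤ 3 * ‖z‖ * ‖u‖ := by
    rw [norm_add_sq_real]
    have := abs_real_inner_le_norm z u
    rw [abs_le] at this ⊢
    constructor <;> nlinarith [norm_nonneg u]
  have n4 : |‖z + u + w‖ ^ 2 - ‖z + w‖ ^ 2| ≤ 3 * ‖z‖ * ‖u‖ := by
    rw [show z + u + w = (z + w) + u by abel, norm_add_sq_real (z + w) u]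
    have i1 := abs_real_inner_le_norm (z + w) u
    have i2 := norm_add_le z w
    have i3 : ‖z + w‖ * ‖u‖ ≤ (‖z‖ + ‖z‖ / 4) * ‖u‖ := by gcongr; linarith
    rw [abs_le] at i1 ⊢
    constructor <;> nlinarith [norm_nonneg u]
  have n5 := abs_real_inner_le_norm u w
  have r1 : (‖z‖ ^ 2) ^ (e - 1) = ‖z‖ ^ (p - 2) := by
    rw [← Real.rpow_natCast, ← Real.rpow_mul (norm_nonneg _), he]; congr 1; push_cast; ring
  have r2 : (‖z‖ ^ 2) ^ (e - 2) * ‖z‖ ^ 2 = ‖z‖ ^ (p - 2) := by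
    rw [← r1, show e - 1 = e - 2 + 1 by ring, Real.rpow_add_one (by positivity)]
  rw [n1, r1, abs_mul, abs_two]
  calc _ ≤ C₁ * ‖z‖ ^ (p - 2) * (2 * (‖u‖ * ‖w‖)) + C₂ * (‖z‖ ^ 2) ^ (e - 2) * (3 * ‖z‖ * ‖w‖) *
        (3 * ‖z‖ * ‖u‖ + 3 * ‖z‖ * ‖u‖) := by gcongr
    _ = 2 * C₁ * ‖u‖ * ‖w‖ * ‖z‖ ^ (p - 2) +
        18 * C₂ * ‖u‖ * ‖w‖ * ((‖z‖ ^ 2) ^ (e - 2) * ‖z‖ ^ 2) := by ring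
    _ = _ := by rw [r2]; ring

/-! ### Potentials on the sphere -/

variable {N : ℕ}

lemma exists_sph_inner (hN : 2 ≤ N) {q : ℝ} (hq : q ≠ 0) (h : 0 < (N : ℝ) - 1 + q) :
    ∃ K : ℝ, 0 ≤ K ∧ ∀ (θ : Sph N) (t : ℝ), 0 < t →
      IntegrableOn (fun ω => dist ω θ ^ q) (Metric.ball θ t) (sm N) ∧
      ∫ ω in Metric.ball θ t, dist ω θ ^ q ∂(sm N) ≤ K * t ^ ((N : ℝ) - 1 + q) := by
  obtain ⟨C, hC, hC'⟩ := exists_cap_bound hN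
  obtain ⟨K, hK, hK'⟩ := exists_inner_bound (X := Sph N) C ((N : ℝ) - 1) q hC.le hq h
  exact ⟨K, hK, fun θ t ht => hK' (sm N) θ (hC' θ) t ht⟩

lemma exists_sph_outer (hN : 2 ≤ N) {q : ℝ} (h : (N : ℝ) - 1 + q < 0) :
    ∃ K : ℝ, 0 ≤ K ∧ ∀ (θ : Sph N) (t : ℝ), 0 < t →
      IntegrableOn (fun ω => dist ω θ ^ q) (Metric.ball θ t)ᶜ (sm N) ∧
      ∫ ω in (Metric.ball θ t)ᶜ, dist ω θ ^ q ∂(sm N) ≤ K * t ^ ((N : ℝ) - 1 + q) := by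
  obtain ⟨C, hC, hC'⟩ := exists_cap_bound hN
  obtain ⟨K, hK, hK'⟩ := exists_outer_bound (X := Sph N) C ((N : ℝ) - 1) q hC.le h
  exact ⟨K, hK, fun θ t ht => hK' (sm N) θ (hC' θ) t ht⟩

lemma ball_three (θ : Sph N) : Metric.ball θ 3 = Set.univ := by
  ext ω; simp; linarith [dist_le_two ω θ]

lemma exists_sph_full (hN : 2 ≤ N) {q : ℝ} (hq : q ≠ 0) (h : 0 < (N : ℝ) - 1 + q) :
    ∃ K : ℝ, 0 ≤ K ∧ ∀ θ : Sph N, Integrable (fun ω => dist ω θ ^ q) (sm N) ∧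
      ∫ ω, dist ω θ ^ q ∂(sm N) ≤ K := by
  obtain ⟨K, hK, hK'⟩ := exists_sph_inner hN hq h
  refine ⟨K * 3 ^ ((N : ℝ) - 1 + q), by positivity, fun θ => ?_⟩
  have := hK' θ 3 (by norm_num)
  rwa [ball_three, integrableOn_univ, setIntegral_univ] at this

lemma abs_integral_le_add {X : Type*} [MeasurableSpace X] {μ : Measure X} {g G₁ G₂ : X → ℝ}
    {s : Set X} (hs : MeasurableSet s) (h₁ : IntegrableOn G₁ s μ) (h₂ : IntegrableOn G₂ sᶜ μ)
    (hg₁ : ∀ x ∈ s, |g x| ≤ G₁ x) (hg₂ : ∀ x ∉ s, |g x| ≤ G₂ x) :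
    |∫ x, g x ∂μ| ≤ ∫ x in s, G₁ x ∂μ + ∫ x in sᶜ, G₂ x ∂μ := by
  classical
  rw [← integral_piecewise hs h₁ h₂]
  rw [← Real.norm_eq_abs]
  refine norm_integral_le_of_norm_le (Integrable.piecewise hs h₁ h₂) (Eventually.of_forall ?_)
  intro x
  by_cases hx : x ∈ s
  · simpa [hx] using hg₁ x hx
  · simpa [hx] using hg₂ x hx

/-- Bounded and Hölder continuous functions. -/
def Hol (γ A : ℝ) (f : Sph N → ℝ) : Prop :=
  (∀ θ, |f θ| ≤ A) ∧ ∀ θ τ, |f θ - f τ| ≤ A * dist θ τ ^ γ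

/-- Bounded Lipschitz functions whose rotation differences are Lipschitz with a Hölder gain. -/
structure XB (β U : ℝ) (u : Sph N → ℝ) : Prop where
  bd : ∀ θ, |u θ| ≤ U
  lip : ∀ σ θ, |u σ - u θ| ≤ U * dist σ θ
  rotd : ∀ (R : EE N ≃ₗᵢ[ℝ] EE N) (h : ℝ), (∀ x : EE N, ‖x‖ = 1 → ‖R x - x‖ ≤ h) →
    ∀ σ θ, |(u (rot R σ) - u σ) - (u (rot R θ) - u θ)| ≤ U * h ^ β * dist σ θ

lemma Hol.nonneg {γ A : ℝ} {f : Sph N → ℝ} (hf : Hol γ A f) (θ : Sph N) : 0 ≤ A :=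
  (abs_nonneg _).trans (hf.1 θ)

lemma XB.nonneg {β U : ℝ} {u : Sph N → ℝ} (hu : XB β U u) (θ : Sph N) : 0 ≤ U :=
  (abs_nonneg _).trans (hu.bd θ)

lemma Hol.mono {γ A B : ℝ} {f : Sph N → ℝ} (hf : Hol γ A f) (h : A ≤ B) : Hol γ B f :=
  ⟨fun θ => (hf.1 θ).trans h, fun θ τ => (hf.2 θ τ).trans (by gcongr)⟩

lemma Hol.continuous {γ A : ℝ} (hγ : 0 < γ) {f : Sph N → ℝ} (hf : Hol γ A f) : Continuous f := by
  rw [continuous_iff_continuousAt]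
  intro θ
  rw [ContinuousAt, tendsto_iff_dist_tendsto_zero]
  have h1 : Tendsto (fun τ => A * dist τ θ ^ γ) (nhds θ) (nhds 0) := by
    have : Tendsto (fun τ : Sph N => dist τ θ) (nhds θ) (nhds 0) := by
      have := (continuous_id.dist (continuous_const (y := θ))).tendsto θ
      simpa using this
    have := (this.rpow_const (Or.inr hγ.le)).const_mul A
    simpa [Real.zero_rpow hγ.ne'] using this
  exact squeeze_zero (fun _ => dist_nonneg) (fun τ => hf.2 τ θ) h1

lemma XB.continuous {β U : ℝ} {u : Sph N → ℝ} (hu : XB β U u) : Continuous u := by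
  rcases isEmpty_or_nonempty (Sph N) with h | ⟨⟨θ⟩⟩
  · exact continuous_of_discreteTopology
  · exact (LipschitzWith.of_dist_le_mul (K := ⟨U, hu.nonneg θ⟩)
      (fun σ τ => hu.lip σ τ)).continuous

lemma XB.symm_diff {β U : ℝ} (hβ0 : 0 ≤ β) (hβ : β ≤ 1) {u : Sph N → ℝ} (hu : XB β U u) (θ σ : Sph N) :
    |u σ + u (opp θ σ) - 2 * u θ| ≤ 8 * U * dist σ θ ^ (1 + β) := by
  obtain ⟨R, h1, h2, h3⟩ := exists_rot θ σ
  have := hu.rotd R _ h3 (opp θ σ) θ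
  rw [h1, h2, dist_opp, abs_sub_comm] at this
  rw [show u σ + u (opp θ σ) - 2 * u θ = u σ - u θ - (u θ - u (opp θ σ)) by ring]
  refine this.trans ?_
  rcases (dist_nonneg (x := σ) (y := θ)).eq_or_lt with h0 | h0
  · rw [← h0, Real.zero_rpow (by linarith)]; simp
  rw [Real.mul_rpow (by norm_num) h0.le, Real.rpow_add h0, Real.rpow_one]
  have : (8:ℝ) ^ β ≤ 8 := by
    have := Real.rpow_le_rpow_of_exponent_le (x := 8) (by norm_num) hβ
    simpa using this
  have hU := hu.nonneg θ
  have hp : 0 ≤ dist σ θ ^ β := by positivity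
  calc U * (8 ^ β * dist σ θ ^ β) * dist σ θ ≤ U * (8 * dist σ θ ^ β) * dist σ θ := by gcongr
    _ = _ := by ring

/-- The potential with kernel `|θ - ω| ^ p`. -/
noncomputable def pot (p : ℝ) (f : Sph N → ℝ) (θ : Sph N) : ℝ :=
  ∫ ω, dist ω θ ^ p * f ω ∂(sm N)

lemma bounded_of_continuous {f : Sph N → ℝ} (hf : Continuous f) : ∃ B, ∀ θ, |f θ| ≤ B := by
  obtain ⟨B, hB⟩ := isCompact_univ.exists_bound_of_continuousOn hf.continuousOn
  exact ⟨B, fun θ => hB θ trivial⟩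

lemma integrable_dist_mul {q : ℝ} {θ : Sph N} (hq : Integrable (fun ω => dist ω θ ^ q) (sm N))
    {f : Sph N → ℝ} (hf : Continuous f) :
    Integrable (fun ω => dist ω θ ^ q * f ω) (sm N) := by
  obtain ⟨B, hB⟩ := bounded_of_continuous hf
  exact hq.mul_bdd hf.measurable.aestronglyMeasurable (Eventually.of_forall hB)

lemma pot_rot (p : ℝ) (f : Sph N → ℝ) (R : EE N ≃ₗᵢ[ℝ] EE N) (θ : Sph N) :
    pot p f (rot R θ) = pot p (fun ω => f (rot R ω)) θ := by
  rw [pot, ← integral_rot R]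
  simp only [dist_rot, pot]

lemma exists_rot_eq (θ τ : Sph N) : ∃ R : EE N ≃ₗᵢ[ℝ] EE N, rot R θ = τ := by
  obtain ⟨R, h, -⟩ := exists_rot θ τ
  exact ⟨R, h⟩

lemma pot_const (p c : ℝ) (θ τ : Sph N) : pot p (fun _ => c) θ = pot p (fun _ => c) τ := by
  obtain ⟨R, rfl⟩ := exists_rot_eq θ τ
  rw [pot_rot]

section Riesz

variable {α γ p : ℝ}

lemma exists_pot_bound (hN : 2 ≤ N) (hp : p ≠ 0) (hp1 : 0 < (N : ℝ) - 1 + p) :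
    ∃ C : ℝ, 0 ≤ C ∧ ∀ (f : Sph N → ℝ) (A : ℝ), (∀ θ, |f θ| ≤ A) → ∀ θ, |pot p f θ| ≤ C * A := by
  obtain ⟨K, hK, hK'⟩ := exists_sph_full hN hp hp1
  refine ⟨K, hK, fun f A hf θ => ?_⟩
  have hA : 0 ≤ A := (abs_nonneg _).trans (hf θ)
  calc |pot p f θ| ≤ ∫ ω, dist ω θ ^ p * A ∂(sm N) := by
        rw [← Real.norm_eq_abs]
        refine norm_integral_le_of_norm_le ((hK' θ).1.mul_const A) (Eventually.of_forall ?_)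
        intro ω
        rw [norm_mul, Real.norm_of_nonneg (by positivity)]
        gcongr
        exact hf ω
    _ = (∫ ω, dist ω θ ^ p ∂(sm N)) * A := integral_mul_const _ _
    _ ≤ K * A := by gcongr; exact (hK' θ).2

lemma exists_pot_lip (hN : 2 ≤ N) (hp : p ≠ 0) (hp1 : p ≠ 1) (hp2 : 0 < (N : ℝ) - 2 + p) :
    ∃ C : ℝ, 0 ≤ C ∧ ∀ (f : Sph N → ℝ) (A : ℝ), Continuous f → (∀ θ, |f θ| ≤ A) →
      ∀ σ θ, |pot p f σ - pot p f θ| ≤ C * A * dist σ θ := by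
  obtain ⟨K, hK, hK'⟩ := exists_sph_full hN hp (by linarith)
  obtain ⟨L, hL, hL'⟩ := exists_sph_full (q := p - 1) hN (sub_ne_zero.2 hp1) (by linarith)
  refine ⟨(|p| + 1) * (2 * L), by positivity, fun f A hf hfA σ θ => ?_⟩
  have hA : 0 ≤ A := (abs_nonneg _).trans (hfA θ)
  rw [pot, pot, ← integral_sub (integrable_dist_mul (hK' σ).1 hf)
    (integrable_dist_mul (hK' θ).1 hf)]
  calc _ ≤ ∫ ω, ((|p| + 1) * dist σ θ * A) * (dist ω σ ^ (p - 1) + dist ω θ ^ (p - 1)) ∂(sm N) := by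
        rw [← Real.norm_eq_abs]
        refine norm_integral_le_of_norm_le (((hL' σ).1.add (hL' θ).1).const_mul _)
          (Eventually.of_forall ?_)
        intro ω
        rw [← sub_mul, norm_mul, Real.norm_eq_abs, Real.norm_eq_abs]
        have h1 := abs_rpow_sub_rpow_le hp (dist_nonneg (x := ω) (y := σ))
          (dist_nonneg (x := ω) (y := θ))
        have h2 : |dist ω σ - dist ω θ| ≤ dist σ θ := by
          rw [dist_comm ω σ, dist_comm ω θ]; exact abs_dist_sub_le _ _ _
        calc _ ≤ ((|p| + 1) * dist σ θ * (dist ω σ ^ (p - 1) + dist ω θ ^ (p - 1))) * A := by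
              gcongr
              · exact h1.trans (by gcongr)
              · exact hfA ω
          _ = _ := by ring
    _ = ((|p| + 1) * dist σ θ * A) * (∫ ω, dist ω σ ^ (p - 1) ∂(sm N) +
        ∫ ω, dist ω θ ^ (p - 1) ∂(sm N)) := by
        rw [integral_const_mul, integral_add (hL' σ).1 (hL' θ).1]
    _ ≤ ((|p| + 1) * dist σ θ * A) * (L + L) := by
        gcongr
        · exact (hL' σ).2
        · exact (hL' θ).2
    _ = _ := by ring

lemma exists_pot_rotd (hN : 2 ≤ N) (hα : α ∈ Set.Ioo (0 : ℝ) 1) (hγ : 0 < γ) (hαγ : α + γ < 1)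
    (hp : p = 2 + α - N) (hp0 : p ≠ 0) (hp1 : p ≠ 1) :
    ∃ C : ℝ, 0 ≤ C ∧ ∀ (f : Sph N → ℝ) (A : ℝ), Hol γ A f → ∀ (R : EE N ≃ₗᵢ[ℝ] EE N) (h : ℝ),
      (∀ x : EE N, ‖x‖ = 1 → ‖R x - x‖ ≤ h) → ∀ σ θ : Sph N,
      |(pot p f (rot R σ) - pot p f σ) - (pot p f (rot R θ) - pot p f θ)| ≤
        C * A * h ^ (α + γ) * dist σ θ := by
  obtain ⟨hα0, hα1⟩ := hα
  obtain ⟨K, hK, hK'⟩ := exists_sph_full (q := p) hN hp0 (by linarith)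
  obtain ⟨L, hL, hL'⟩ := exists_sph_inner (q := p - 1) hN (sub_ne_zero.2 hp1) (by linarith)
  obtain ⟨O, hO, hO'⟩ := exists_sph_outer (N := N) (q := p - 2 + γ) hN (by linarith)
  obtain ⟨D, hD, hD'⟩ := exists_second_diff_bound (E := EE N) p
  refine ⟨(|p| + 1) * 4 * (4 ^ γ * (L * 6 ^ α)) + D * O, by positivity,
    fun f A hf R h hR σ θ => ?_⟩
  have hA := hf.nonneg θ
  have hfc := hf.continuous hγ
  have hh : 0 ≤ h := (norm_nonneg _).trans (hR σ (norm_coe σ))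
  set d := dist σ θ with hd
  rcases (dist_nonneg (x := σ) (y := θ)).eq_or_lt with h0 | h0
  · have : σ = θ := dist_eq_zero.1 h0.symm
    subst this
    simp only [sub_self, abs_zero]; positivity
  rw [← hd] at h0
  set m := max h d with hm
  set l := min h d with hl
  have hm0 : 0 < m := lt_max_of_lt_right h0
  have hl0 : 0 ≤ l := le_min hh h0.le
  have hlm : h * d = l * m := by rw [hl, hm, min_mul_max]
  have hlβ : l * m ^ (α + γ) ≤ h ^ (α + γ) * d := by
    rcases le_total h d with h1 | h1
    · rw [hl, hm, min_eq_left h1, max_eq_right h1]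
      rcases hh.eq_or_lt with h2 | h2
      · rw [← h2, Real.zero_rpow (by linarith)]; simp
      have e1 : h = h ^ (α + γ) * h ^ (1 - (α + γ)) := by
        rw [← Real.rpow_add h2]; simp
      have e2 : d = d ^ (α + γ) * d ^ (1 - (α + γ)) := by
        rw [← Real.rpow_add h0]; simp
      calc h * d ^ (α + γ) = h ^ (α + γ) * h ^ (1 - (α + γ)) * d ^ (α + γ) := by rw [← e1]
        _ ≤ h ^ (α + γ) * d ^ (1 - (α + γ)) * d ^ (α + γ) := by gcongr
        _ = h ^ (α + γ) * (d ^ (α + γ) * d ^ (1 - (α + γ))) := by ring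
        _ = _ := by rw [← e2]
    · rw [hl, hm, min_eq_right h1, max_eq_left h1, mul_comm]
  -- subtract the value of `f` at `θ`
  set g : Sph N → ℝ := fun ω => f ω - f θ with hg
  have hgc : Continuous g := hfc.sub continuous_const
  have hgd : ∀ ω, |g ω| ≤ A * dist ω θ ^ γ := fun ω => hf.2 ω θ
  have hpot : ∀ τ, pot p f τ = pot p g τ + pot p (fun _ => f θ) θ := fun τ => by
    rw [← pot_const p (f θ) τ θ, pot, pot, pot, ← integral_add
      (integrable_dist_mul (hK' τ).1 hgc) (integrable_dist_mul (hK' τ).1 continuous_const)]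
    congr 1; ext ω; simp only [hg]; ring
  have hI : ∀ τ : Sph N, Integrable (fun ω => dist ω τ ^ p * g ω) (sm N) :=
    fun τ => integrable_dist_mul (hK' τ).1 hgc
  have hI2 : ∀ τ τ' : Sph N, Integrable
      (fun ω => dist ω τ ^ p * g ω - dist ω τ' ^ p * g ω) (sm N) := fun _ _ => (hI _).sub (hI _)
  rw [hpot, hpot σ, hpot (rot R θ), hpot θ, add_sub_add_right_eq_sub, add_sub_add_right_eq_sub]
  simp only [pot]
  rw [← integral_sub (hI _) (hI _), ← integral_sub (hI _) (hI _),
    ← integral_sub (hI2 _ _) (hI2 _ _)]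
  simp only [← sub_mul]
  have hRd : ∀ τ : Sph N, dist (rot R τ) τ ≤ h := fun τ => by
    rw [dist_coe]; exact hR τ (norm_coe τ)
  have hx : ∀ x : Sph N, dist x θ ≤ 2 * m → IntegrableOn (fun ω => dist ω x ^ (p - 1))
      (Metric.ball θ (4 * m)) (sm N) ∧
      ∫ ω in Metric.ball θ (4 * m), dist ω x ^ (p - 1) ∂(sm N) ≤ L * (6 * m) ^ α := fun x hx => by
    obtain ⟨i1, i2⟩ := hL' x (6 * m) (by positivity)
    have hs : Metric.ball θ (4 * m) ⊆ Metric.ball x (6 * m) :=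
      Metric.ball_subset_ball' (by rw [dist_comm]; linarith)
    refine ⟨i1.mono_set hs, ?_⟩
    rw [show (N : ℝ) - 1 + (p - 1) = α by rw [hp]; ring] at i2
    exact (setIntegral_mono_set i1 (Eventually.of_forall fun ω => by positivity)
      hs.eventuallyLE).trans i2
  have hhm : h ≤ m := le_max_left _ _
  have hdm : d ≤ m := le_max_right _ _
  obtain ⟨a1, b1⟩ := hx (rot R σ) (by linarith [dist_triangle (rot R σ) σ θ, hRd σ])
  obtain ⟨a2, b2⟩ := hx σ (by linarith)
  obtain ⟨a3, b3⟩ := hx (rot R θ) (by linarith [hRd θ])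
  obtain ⟨a4, b4⟩ := hx θ (by simp; positivity)
  obtain ⟨a5, b5⟩ := hO' θ (4 * m) (by positivity)
  refine (abs_integral_le_add (s := Metric.ball θ (4 * m)) Metric.isOpen_ball.measurableSet
    (G₁ := fun ω => ((|p| + 1) * l * (A * (4 * m) ^ γ)) * ((dist ω (rot R σ) ^ (p - 1) +
      dist ω σ ^ (p - 1)) + (dist ω (rot R θ) ^ (p - 1) + dist ω θ ^ (p - 1))))
    (G₂ := fun ω => (D * d * h * A) * dist ω θ ^ (p - 2 + γ)) ?_ ?_ ?_ ?_).trans ?_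
  · exact ((a1.add a2).add (a3.add a4)).const_mul _
  · exact a5.const_mul _
  · intro ω hω
    rw [abs_mul]
    have hlip : ∀ x y : Sph N, |dist ω x ^ p - dist ω y ^ p| ≤ (|p| + 1) * dist x y *
        (dist ω x ^ (p - 1) + dist ω y ^ (p - 1)) := fun x y => by
      refine (abs_rpow_sub_rpow_le hp0 dist_nonneg dist_nonneg).trans ?_
      gcongr
      rw [dist_comm ω x, dist_comm ω y]; exact abs_dist_sub_le _ _ _
    have hgω : |g ω| ≤ A * (4 * m) ^ γ := (hgd ω).trans (by
      gcongr; exact (Metric.mem_ball.1 hω).le)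
    rw [mul_right_comm ((|p| + 1) * l)]
    refine mul_le_mul ?_ hgω (abs_nonneg _) (by positivity)
    rcases le_total h d with h1 | h1
    · refine (abs_sub _ _).trans ?_
      rw [hl, min_eq_left h1, mul_add]
      gcongr
      · exact (hlip _ _).trans (by gcongr; exact hRd σ)
      · exact (hlip _ _).trans (by gcongr; exact hRd θ)
    · rw [sub_sub_sub_comm]
      refine (abs_sub _ _).trans ?_
      rw [hl, min_eq_right h1, add_add_add_comm, mul_add]
      gcongr
      · exact (hlip _ _).trans (by gcongr; rw [dist_rot])
      · exact hlip _ _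
  · intro ω hω
    rw [Metric.mem_ball, not_lt] at hω
    have hω0 : 0 < dist ω θ := lt_of_lt_of_le (by positivity) hω
    have e1 := hD' ((θ : EE N) - ω) ((σ : EE N) - θ) ((ω : EE N) - R.symm ω)
      (by rw [← dist_coe, ← dist_coe, dist_comm θ ω, ← hd]; linarith)
      (by
        have := hR (R.symm ω) (by simp)
        rw [LinearIsometryEquiv.apply_symm_apply] at this
        rw [← dist_coe, dist_comm θ ω]; linarith)
    have n1 : ∀ τ : Sph N, dist ω (rot R τ) = ‖(τ : EE N) - R.symm ω‖ := fun τ => by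
      rw [dist_comm, dist_coe, coe_rot, ← R.symm.norm_map]; simp
    rw [show (θ : EE N) - ω + (σ - θ) + (ω - R.symm ω) = σ - R.symm ω by abel,
      show (θ : EE N) - ω + (σ - θ) = σ - ω by abel,
      show (θ : EE N) - ω + (ω - R.symm ω) = θ - R.symm ω by abel, ← n1, ← n1, ← dist_coe,
      ← dist_coe, ← dist_coe, dist_comm σ ω, dist_comm θ ω, ← hd] at e1
    rw [abs_mul]
    have e2 := hR (R.symm ω) (by simp)
    rw [LinearIsometryEquiv.apply_symm_apply] at e2
    calc _ ≤ (D * d * h * dist ω θ ^ (p - 2)) * (A * dist ω θ ^ γ) := by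
          refine mul_le_mul (e1.trans ?_) (hgd ω) (abs_nonneg _) (by positivity)
          gcongr
      _ = _ := by rw [Real.rpow_add hω0]; ring
  · have a12 : IntegrableOn (fun ω => dist ω (rot R σ) ^ (p - 1) + dist ω σ ^ (p - 1))
        (Metric.ball θ (4 * m)) (sm N) := a1.add a2
    have a34 : IntegrableOn (fun ω => dist ω (rot R θ) ^ (p - 1) + dist ω θ ^ (p - 1))
        (Metric.ball θ (4 * m)) (sm N) := a3.add a4
    rw [integral_const_mul, integral_const_mul, integral_add a12 a34,
      integral_add a1 a2, integral_add a3 a4]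
    have s1 : (4 * m) ^ γ = 4 ^ γ * m ^ γ := Real.mul_rpow (by norm_num) hm0.le
    have s2 : (6 * m) ^ α = 6 ^ α * m ^ α := Real.mul_rpow (by norm_num) hm0.le
    have s3 : m ^ (α + γ) = m ^ α * m ^ γ := Real.rpow_add hm0 _ _
    have s4 : (4 * m) ^ ((N : ℝ) - 1 + (p - 2 + γ)) * m ≤ m ^ (α + γ) := by
      rw [show (N : ℝ) - 1 + (p - 2 + γ) = α + γ - 1 by rw [hp]; ring]
      calc (4 * m) ^ (α + γ - 1) * m ≤ m ^ (α + γ - 1) * m := by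
            gcongr ?_ * _
            exact Real.rpow_le_rpow_of_nonpos hm0 (by linarith) (by linarith)
        _ = m ^ (α + γ) := by rw [Real.rpow_sub_one hm0.ne']; field_simp
    calc _ ≤ (|p| + 1) * l * (A * (4 * m) ^ γ) * ((L * (6 * m) ^ α + L * (6 * m) ^ α) +
          (L * (6 * m) ^ α + L * (6 * m) ^ α)) +
          D * d * h * A * (O * (4 * m) ^ ((N : ℝ) - 1 + (p - 2 + γ))) := by gcongr
      _ = ((|p| + 1) * 4 * (4 ^ γ * (L * 6 ^ α))) * A * (l * m ^ (α + γ)) +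
          D * O * A * l * ((4 * m) ^ ((N : ℝ) - 1 + (p - 2 + γ)) * m) := by
        rw [s1, s2, s3, show D * d * h * A = D * A * (h * d) by ring, hlm]; ring
      _ ≤ ((|p| + 1) * 4 * (4 ^ γ * (L * 6 ^ α))) * A * (l * m ^ (α + γ)) +
          D * O * A * l * m ^ (α + γ) := by gcongr
      _ = ((|p| + 1) * 4 * (4 ^ γ * (L * 6 ^ α)) + D * O) * A * (l * m ^ (α + γ)) := by ring
      _ ≤ ((|p| + 1) * 4 * (4 ^ γ * (L * 6 ^ α)) + D * O) * A * (h ^ (α + γ) * d) := by gcongr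
      _ = _ := by ring

lemma exists_pot_XB (hN : 2 ≤ N) (hα : α ∈ Set.Ioo (0 : ℝ) 1) (hγ : 0 < γ) (hαγ : α + γ < 1)
    (hp : p = 2 + α - N) (hp0 : p ≠ 0) (hp1 : p ≠ 1) :
    ∃ C : ℝ, 0 ≤ C ∧ ∀ (f : Sph N → ℝ) (A : ℝ), Hol γ A f → XB (α + γ) (C * A) (pot p f) := by
  obtain ⟨C₁, h₁, H₁⟩ := exists_pot_bound (p := p) hN hp0 (by linarith [hα.1])
  obtain ⟨C₂, h₂, H₂⟩ := exists_pot_lip (p := p) hN hp0 hp1 (by linarith [hα.1])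
  obtain ⟨C₃, h₃, H₃⟩ := exists_pot_rotd hN hα hγ hαγ hp hp0 hp1
  refine ⟨C₁ + C₂ + C₃, by positivity, fun f A hf => ⟨fun θ => ?_, fun σ θ => ?_,
    fun R h hR σ θ => ?_⟩⟩
  · have hA := hf.nonneg θ
    exact (H₁ f A hf.1 θ).trans (by gcongr; linarith)
  · have hA := hf.nonneg θ
    exact (H₂ f A (hf.continuous hγ) hf.1 σ θ).trans (by gcongr; linarith)
  · have hA := hf.nonneg θ
    have hh : 0 ≤ h := (norm_nonneg _).trans (hR σ (norm_coe σ))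
    exact (H₃ f A hf R h hR σ θ).trans (by gcongr; linarith)

end Riesz

/-! ### Stereographic coordinates -/

section Stereo

variable {N : ℕ} (θ : Sph N)

/-- Projection onto the hyperplane orthogonal to `θ`. -/
noncomputable def prj : EE N →L[ℝ] EE N :=
  ContinuousLinearMap.id ℝ (EE N) - (innerSL ℝ (θ : EE N)).smulRight (θ : EE N)

lemma prj_apply (x : EE N) : prj θ x = x - inner ℝ (θ : EE N) x • (θ : EE N) := by
  simp [prj]

lemma inner_self_sph : inner ℝ (θ : EE N) (θ : EE N) = 1 := by
  rw [real_inner_self_eq_norm_sq]; simp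

@[simp] lemma inner_prj (x : EE N) : inner ℝ (θ : EE N) (prj θ x) = 0 := by
  rw [prj_apply, inner_sub_right, inner_smul_right, inner_self_sph]; ring

/-- The linear map scaling the hyperplane orthogonal to `θ` by `s` and fixing `θ`. -/
noncomputable def scl (s : ℝ) : EE N →L[ℝ] EE N :=
  (innerSL ℝ (θ : EE N)).smulRight (θ : EE N) + s • prj θ

lemma scl_apply (s : ℝ) (x : EE N) :
    scl θ s x = inner ℝ (θ : EE N) x • (θ : EE N) + s • prj θ x := by
  simp [scl]

lemma inner_scl (s : ℝ) (x : EE N) : inner ℝ (θ : EE N) (scl θ s x) = inner ℝ (θ : EE N) x := by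
  rw [scl_apply, inner_add_right, inner_smul_right, inner_smul_right, inner_self_sph]; simp

lemma prj_scl (s : ℝ) (x : EE N) : prj θ (scl θ s x) = s • prj θ x := by
  rw [prj_apply, inner_scl, scl_apply]; abel

lemma det_scl (hN : 2 ≤ N) {s : ℝ} (hs : s ≠ 0) :
    LinearMap.det (scl θ s : EE N →ₗ[ℝ] EE N) = s ^ (N - 1) := by
  have : (scl θ s : EE N →ₗ[ℝ] EE N) =
      s • LinearMap.transvection (innerSL ℝ (θ : EE N) : EE N →ₗ[ℝ] ℝ) ((s⁻¹ - 1) • (θ : EE N)) := by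
    ext1 x
    simp only [ContinuousLinearMap.coe_coe, scl_apply, prj_apply, LinearMap.smul_apply,
      LinearMap.transvection.apply, innerSL_apply_apply, smul_add, smul_sub, sub_smul, one_smul]
    rw [smul_comm s (inner ℝ (θ : EE N) x) (s⁻¹ • (θ : EE N)), smul_smul s s⁻¹, mul_inv_cancel₀ hs,
      one_smul]
    abel
  rw [this, LinearMap.det_smul, LinearMap.transvection.det]
  simp only [ContinuousLinearMap.coe_coe, innerSL_apply_apply, inner_smul_right, inner_self_sph,
    finrank_euclideanSpace, Fintype.card_fin]
  obtain ⟨k, rfl⟩ : ∃ k, N = k + 1 := ⟨N - 1, by omega⟩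
  simp only [add_tsub_cancel_right, pow_succ]
  field_simp
  ring

/-- The slab over the hyperplane orthogonal to `θ`. -/
def slab : Set (EE N) := {x | inner ℝ (θ : EE N) x ∈ Set.Ioo (0 : ℝ) 1}

lemma measurableSet_slab : MeasurableSet (slab θ) :=
  measurableSet_Ioo.preimage (by fun_prop)

/-- Lebesgue measure of the hyperplane orthogonal to `θ`. -/
noncomputable def ms : Measure (EE N) := (volume.restrict (slab θ)).map (prj θ)

lemma ms_apply {s : Set (EE N)} (hs : MeasurableSet s) :
    ms θ s = volume (prj θ ⁻¹' s ∩ slab θ) := by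
  rw [ms, Measure.map_apply (by fun_prop) hs, Measure.restrict_apply (hs.preimage (by fun_prop))]

lemma ae_ms : ∀ᵐ y ∂(ms θ), inner ℝ (θ : EE N) y = 0 := by
  rw [ms, ae_map_iff (by fun_prop) (measurableSet_eq_fun (by fun_prop) (by fun_prop))]
  exact Eventually.of_forall fun x => inner_prj θ x

lemma measurePreserving_add_ms {w : EE N} (hw : inner ℝ (θ : EE N) w = 0) :
    MeasurePreserving (fun y => y + w) (ms θ) (ms θ) := by
  refine ⟨by fun_prop, ?_⟩
  have h1 : (fun y => y + w) ∘ (prj θ) = prj θ ∘ fun x => x + w := by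
    ext1 x; simp [prj_apply, hw, inner_add_right]; abel
  have h2 : MeasurePreserving (fun x => x + w) (volume.restrict (slab θ))
      (volume.restrict (slab θ)) := by
    have := (measurePreserving_add_right (volume : Measure (EE N)) w).restrict_preimage
      (measurableSet_slab θ)
    convert this using 2
    ext x
    simp [slab, inner_add_right, hw]
  rw [ms, Measure.map_map (by fun_prop) (by fun_prop), h1, ← Measure.map_map (by fun_prop)
    (by fun_prop), h2.map_eq]

lemma ms_ball_zero (hN : 2 ≤ N) {t : ℝ} (ht : 0 < t) :
    ms θ (Metric.ball 0 t) = ENNReal.ofReal (t ^ ((N : ℝ) - 1)) * ms θ (Metric.ball 0 1) := by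
  have hd := det_scl θ hN ht.ne'
  have hd0 : LinearMap.det (scl θ t : EE N →ₗ[ℝ] EE N) ≠ 0 := by rw [hd]; positivity
  rw [ms_apply θ Metric.isOpen_ball.measurableSet, ms_apply θ Metric.isOpen_ball.measurableSet]
  have e1 := Measure.addHaar_preimage_linearMap (volume : Measure (EE N)) hd0
    (prj θ ⁻¹' Metric.ball 0 t ∩ slab θ)
  have e2 : (scl θ t : EE N →ₗ[ℝ] EE N) ⁻¹' (prj θ ⁻¹' Metric.ball 0 t ∩ slab θ) =
      prj θ ⁻¹' Metric.ball 0 1 ∩ slab θ := by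
    ext x
    simp only [slab, Set.mem_preimage, Set.mem_inter_iff, ContinuousLinearMap.coe_coe,
      mem_ball_zero_iff, prj_scl, Set.mem_ofPred_eq, inner_scl, norm_smul, Real.norm_of_nonneg ht.le]
    rw [← lt_div_iff₀' ht, div_self ht.ne']
  rw [e2] at e1
  rw [e1, hd, ← mul_assoc, ← ENNReal.ofReal_mul (by positivity), abs_of_pos (by positivity)]
  have : t ^ ((N : ℝ) - 1) = t ^ (N - 1) := by
    rw [← Real.rpow_natCast, Nat.cast_sub (by omega)]; simp
  rw [this, mul_inv_cancel₀ (by positivity)]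
  simp

lemma norm_sq_eq_prj (x : EE N) : ‖x‖ ^ 2 = inner ℝ (θ : EE N) x ^ 2 + ‖prj θ x‖ ^ 2 := by
  rw [prj_apply, norm_sub_sq_real, norm_smul, inner_smul_right,
    real_inner_comm (θ : EE N) x]
  simp; ring

lemma ms_ball_one_lt_top : ms θ (Metric.ball 0 1) < ⊤ := by
  rw [ms_apply θ Metric.isOpen_ball.measurableSet]
  refine lt_of_le_of_lt (measure_mono (t := Metric.ball 0 2) fun x hx => ?_)
    Metric.isBounded_ball.measure_lt_top
  obtain ⟨h1, h2, h3⟩ := hx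
  simp only [Set.mem_preimage, mem_ball_zero_iff] at h1 ⊢
  have := norm_sq_eq_prj θ x
  nlinarith [norm_nonneg x, norm_nonneg (prj θ x)]

lemma ms_ball (hN : 2 ≤ N) {w : EE N} (hw : inner ℝ (θ : EE N) w = 0) {t : ℝ} (ht : 0 < t) :
    ms θ (Metric.ball w t) = ENNReal.ofReal ((ms θ).real (Metric.ball 0 1) * t ^ ((N : ℝ) - 1)) := by
  have := (measurePreserving_add_ms θ hw).measure_preimage
    (Metric.isOpen_ball (x := w) (ε := t)).measurableSet.nullMeasurableSet
  rw [← this, show (fun y => y + w) ⁻¹' Metric.ball w t = Metric.ball 0 t by ext; simp,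
    ms_ball_zero θ hN ht, mul_comm, ENNReal.ofReal_mul measureReal_nonneg, ofReal_measureReal
    (ms_ball_one_lt_top θ).ne]

/-- The inverse stereographic projection with pole `θ`. -/
noncomputable def st (y : EE N) : Sph N := rot (ℝ ∙ (y - θ))ᗮ.reflection θ

lemma coe_st_eq (y : EE N) : (st θ y : EE N) =
    (θ : EE N) - (2 * (inner ℝ (y - θ) (θ : EE N) / ‖y - θ‖ ^ 2)) • (y - θ) := by
  rw [st, coe_rot, Submodule.reflection_orthogonal_apply]
  have := refl_apply (y - (θ : EE N)) (θ : EE N)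
  rw [refl] at this
  rw [this]; abel

lemma measurable_st : Measurable (st θ) := by
  refine Measurable.subtype_mk (h := fun y => (st θ y).2) (f := fun y => (st θ y : EE N)) ?_
  simp only [coe_st_eq]
  fun_prop

variable {θ}

lemma norm_sub_sq_of_inner {y : EE N} (hy : inner ℝ (θ : EE N) y = 0) :
    ‖y - (θ : EE N)‖ ^ 2 = 1 + ‖y‖ ^ 2 := by
  rw [norm_sub_sq_real, real_inner_comm, hy]; simp [add_comm]

lemma dist_pole_pos {y : EE N} (hy : inner ℝ (θ : EE N) y = 0) : 0 < dist y θ := by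
  rw [dist_eq_norm]
  have := norm_sub_sq_of_inner hy
  by_contra h
  have h0 : ‖y - (θ : EE N)‖ = 0 := le_antisymm (not_lt.1 h) (norm_nonneg _)
  rw [h0] at this
  nlinarith [norm_nonneg y]

lemma ne_pole {y : EE N} (hy : inner ℝ (θ : EE N) y = 0) : y ≠ θ := by
  intro h; have := dist_pole_pos hy; rw [h] at this; simp at this

lemma coe_st {y : EE N} (hy : inner ℝ (θ : EE N) y = 0) :
    (st θ y : EE N) = EuclideanGeometry.inversion (θ : EE N) (√2) y := by
  rw [coe_st_eq, EuclideanGeometry.inversion, inner_sub_left, real_inner_comm, hy, inner_self_sph,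
    dist_eq_norm, div_pow, Real.sq_sqrt (by norm_num)]
  simp only [vsub_eq_sub, vadd_eq_add]
  rw [zero_sub, neg_div, mul_neg, neg_smul, sub_neg_eq_add, mul_one_div, add_comm]

lemma dist_st_st {y w : EE N} (hy : inner ℝ (θ : EE N) y = 0) (hw : inner ℝ (θ : EE N) w = 0) :
    dist (st θ y) (st θ w) = 2 * dist y w / (dist y θ * dist w θ) := by
  rw [Subtype.dist_eq, coe_st hy, coe_st hw,
    EuclideanGeometry.dist_inversion_inversion (ne_pole hy) (ne_pole hw), Real.sq_sqrt (by norm_num)]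
  ring

lemma dist_st_pole {y : EE N} (hy : inner ℝ (θ : EE N) y = 0) :
    dist (st θ y) θ = 2 / dist y θ := by
  rw [Subtype.dist_eq, coe_st hy, EuclideanGeometry.dist_inversion_center,
    Real.sq_sqrt (by norm_num)]

lemma st_ne_pole {y : EE N} (hy : inner ℝ (θ : EE N) y = 0) : st θ y ≠ θ := by
  intro h
  have := dist_st_pole hy
  rw [h, dist_self] at this
  have h2 := dist_pole_pos hy
  exact (div_pos two_pos h2).ne this

lemma st_injOn : Set.InjOn (st θ) {y | inner ℝ (θ : EE N) y = 0} := by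
  intro y hy w hw h
  have := dist_st_st hy hw
  rw [h, dist_self] at this
  have h1 := dist_pole_pos hy
  have h2 := dist_pole_pos hw
  have h3 : dist y w = 0 := by
    rcases div_eq_zero_iff.1 this.symm with h | h
    · linarith
    · exact absurd h (mul_pos h1 h2).ne'
  exact dist_eq_zero.1 h3

lemma exists_st {ω : Sph N} (h : ω ≠ θ) : ∃ w, inner ℝ (θ : EE N) w = 0 ∧ st θ w = ω := by
  have hd : 0 < dist ω θ := dist_pos.2 h
  have hd2 := dist_sq ω θ
  rw [dist_coe] at hd hd2
  have hne : (2 / ‖(ω : EE N) - θ‖ ^ 2) ≠ 0 := by positivity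
  refine ⟨(θ : EE N) + (2 / ‖(ω : EE N) - θ‖ ^ 2) • ((ω : EE N) - θ), ?_, ?_⟩
  · rw [inner_add_right, inner_smul_right, inner_sub_right, inner_self_sph,
      real_inner_comm (ω : EE N), hd2]
    have : (1 - inner ℝ (ω : EE N) (θ : EE N)) ≠ 0 := by
      intro h
      have : 0 < ‖(ω : EE N) - θ‖ ^ 2 := by positivity
      linarith
    rw [show 2 - 2 * inner ℝ (ω : EE N) (θ : EE N) = 2 * (1 - inner ℝ (ω : EE N) (θ : EE N)) by ring]
    field_simp
    ring
  · ext1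
    have h3 : inner ℝ ((ω : EE N) - θ) (θ : EE N) = - (‖(ω : EE N) - θ‖ ^ 2 / 2) := by
      rw [inner_sub_left, inner_self_sph, hd2]; ring
    rw [coe_st_eq, add_sub_cancel_left, inner_smul_left, norm_smul, h3, smul_smul]
    have : 2 * ((starRingEnd ℝ) (2 / ‖(ω : EE N) - θ‖ ^ 2) * -(‖(ω : EE N) - θ‖ ^ 2 / 2) /
        (‖2 / ‖(ω : EE N) - θ‖ ^ 2‖ * ‖(ω : EE N) - θ‖) ^ 2) * (2 / ‖(ω : EE N) - θ‖ ^ 2) = -1 := by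
      rw [Real.norm_of_nonneg (by positivity)]
      simp only [conj_trivial]
      field_simp
    rw [this]
    simp

variable (θ)

/-- Stereographic coordinates on the sphere, extended radially. -/
noncomputable def stExt (x : EE N) : EE N :=
  Real.exp (inner ℝ (θ : EE N) x) • EuclideanGeometry.inversion (θ : EE N) (√2) (prj θ x)

lemma stExt_eq (x : EE N) :
    stExt θ x = Real.exp (inner ℝ (θ : EE N) x) • (st θ (prj θ x) : EE N) := by
  rw [stExt, coe_st (inner_prj θ x)]

lemma hasFDerivAt_stExt (x : EE N) :
    HasFDerivAt (stExt θ) (Real.exp (inner ℝ (θ : EE N) x) •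
      ((ℝ ∙ (prj θ x - θ))ᗮ.reflection : EE N →L[ℝ] EE N).comp
        (scl θ (2 / dist (prj θ x) θ ^ 2))) x := by
  have h1 : HasFDerivAt (fun x : EE N => Real.exp (inner ℝ (θ : EE N) x))
      (Real.exp (inner ℝ (θ : EE N) x) • innerSL ℝ (θ : EE N)) x :=
    (innerSL ℝ (θ : EE N)).hasFDerivAt.exp
  have h2 := (EuclideanGeometry.hasFDerivAt_inversion (R := √2)
    (ne_pole (inner_prj θ x))).comp x (prj θ).hasFDerivAt
  refine (h1.smul h2).congr_fderiv ?_
  ext1 k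
  have h3 := coe_st (inner_prj θ x)
  rw [st, coe_rot] at h3
  simp only [Function.comp_apply, ContinuousLinearMap.add_apply, ContinuousLinearMap.smul_apply,
    ContinuousLinearMap.comp_apply, ContinuousLinearMap.smulRight_apply, innerSL_apply_apply,
    scl_apply, map_add, map_smul, smul_add, ← h3, div_pow,
    Real.sq_sqrt (show (0:ℝ) ≤ 2 by norm_num)]
  rw [add_comm, smul_smul]
  congr 1
  simp [smul_smul]

lemma abs_det_stExt (hN : 2 ≤ N) (x : EE N) :
    |(Real.exp (inner ℝ (θ : EE N) x) •
      ((ℝ ∙ (prj θ x - θ))ᗮ.reflection : EE N →L[ℝ] EE N).comp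
        (scl θ (2 / dist (prj θ x) θ ^ 2))).det| =
      Real.exp (N * inner ℝ (θ : EE N) x) * (2 / dist (prj θ x) θ ^ 2) ^ (N - 1) := by
  have h0 := dist_pole_pos (inner_prj θ x)
  have hl : (2 / dist (prj θ x) θ ^ 2) ≠ 0 := by positivity
  have h1 : ∀ (c : ℝ) (A B : EE N →L[ℝ] EE N), (c • A.comp B).det =
      c ^ N * (A.det * B.det) := fun c A B => by
    rw [ContinuousLinearMap.det, ContinuousLinearMap.det, ContinuousLinearMap.det,
      ContinuousLinearMap.coe_smul, LinearMap.det_smul, ContinuousLinearMap.toLinearMap_comp,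
      LinearMap.det_comp]
    simp
  rw [h1, abs_mul, abs_mul, abs_of_pos (by positivity), ← Real.exp_nat_mul,
    ContinuousLinearMap.det, ContinuousLinearMap.det, det_scl θ hN hl]
  have h2 := Submodule.det_reflection (ℝ ∙ (prj θ x - θ))ᗮ
  have h3 : |LinearMap.det (((ℝ ∙ (prj θ x - θ))ᗮ.reflection : EE N →L[ℝ] EE N) :
      EE N →ₗ[ℝ] EE N)| = 1 := by
    have := congrArg abs h2
    rw [abs_neg_one_pow] at this
    exact this
  rw [h3, one_mul, abs_of_pos (by positivity)]

lemma stExt_injOn : Set.InjOn (stExt θ) (slab θ) := by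
  intro x hx y hy h
  rw [stExt_eq, stExt_eq] at h
  have h1 : Real.exp (inner ℝ (θ : EE N) x) = Real.exp (inner ℝ (θ : EE N) y) := by
    have := congrArg norm h
    simpa [norm_smul] using this
  have h4 := Real.exp_injective h1
  rw [h1] at h
  have h2 := smul_right_injective (EE N) (Real.exp_pos _).ne' h
  have h3 := st_injOn (inner_prj θ x) (inner_prj θ y) (Subtype.ext h2)
  rw [prj_apply, prj_apply, h4] at h3
  exact sub_left_injective h3

lemma mem_image_stExt (σ : Sph N) (s : ℝ) :
    Real.exp s • (σ : EE N) ∈ stExt θ '' slab θ ↔ σ ≠ θ ∧ s ∈ Set.Ioo (0 : ℝ) 1 := by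
  constructor
  · rintro ⟨x, hx, h⟩
    rw [stExt_eq] at h
    have h1 : Real.exp (inner ℝ (θ : EE N) x) = Real.exp s := by
      have := congrArg norm h
      simpa [norm_smul] using this
    have h4 := Real.exp_injective h1
    rw [h1] at h
    have h2 := smul_right_injective (EE N) (Real.exp_pos _).ne' h
    refine ⟨?_, h4 ▸ hx⟩
    rw [← show st θ (prj θ x) = σ from Subtype.ext h2]
    exact st_ne_pole (inner_prj θ x)
  · rintro ⟨h1, h2⟩
    obtain ⟨w, hw, rfl⟩ := exists_st h1
    have e1 : inner ℝ (θ : EE N) (w + s • (θ : EE N)) = s := by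
      rw [inner_add_right, inner_smul_right, hw, inner_self_sph]; ring
    refine ⟨w + s • (θ : EE N), by rw [slab, Set.mem_ofPred_eq, e1]; exact h2, ?_⟩
    rw [stExt_eq, e1, prj_apply, e1, add_sub_cancel_right]

lemma sm_singleton (hN : 2 ≤ N) : sm N {θ} = 0 := by
  obtain ⟨C, hC, H⟩ := exists_cap_bound hN
  have hn : (0 : ℝ) < (N : ℝ) - 1 := by
    have : (2:ℝ) ≤ N := by exact_mod_cast hN
    linarith
  have h1 : Tendsto (fun t : ℝ => ENNReal.ofReal (C * t ^ ((N : ℝ) - 1)))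
      (nhdsWithin 0 (Set.Ioi 0)) (nhds 0) := by
    have : Tendsto (fun t : ℝ => C * t ^ ((N : ℝ) - 1)) (nhdsWithin 0 (Set.Ioi 0)) (nhds 0) := by
      have h := (Real.continuousAt_rpow_const 0 ((N : ℝ) - 1) (Or.inr hn.le)).tendsto.const_mul C
      rw [Real.zero_rpow hn.ne', mul_zero] at h
      exact h.mono_left nhdsWithin_le_nhds
    simpa using ENNReal.tendsto_ofReal this
  refine le_antisymm (ge_of_tendsto h1 ?_) bot_le
  filter_upwards [self_mem_nhdsWithin] with t ht
  exact (measure_mono (by simpa using ht)).trans (H θ t ht)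

lemma lintegral_st (hN : 2 ≤ N) {F : Sph N → ENNReal} (hF : Measurable F) :
    ∫⁻ σ, F σ ∂(sm N) =
      ∫⁻ y, ENNReal.ofReal ((2 / dist y θ ^ 2) ^ (N - 1)) * F (st θ y) ∂(ms θ) := by
  set L := fun p : Sph N × ℝ => Real.exp p.2 • (p.1 : EE N) with hL
  set H : EE N → ENNReal := Function.extend L
    (fun p => F p.1 * ENNReal.ofReal (Real.exp (-(N * p.2)))) 0 with hH
  have hHm : Measurable H :=
    measurableEmbedding_logPolar.measurable_extend (by fun_prop) measurable_zero
  have hHL : ∀ (σ : Sph N) s, H (Real.exp s • (σ : EE N)) = F σ * ENNReal.ofReal (Real.exp (-(N * s))) :=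
    fun σ s => measurableEmbedding_logPolar.injective.extend_apply _ _ (σ, s)
  have hmul : ∀ s : ℝ, ENNReal.ofReal (Real.exp (N * s)) * ENNReal.ofReal (Real.exp (-(N * s))) = 1 :=
    fun s => by rw [← ENNReal.ofReal_mul (by positivity), ← Real.exp_add]; simp
  have himg : MeasurableSet (stExt θ '' slab θ) :=
    (measurableSet_slab θ).image_of_continuousOn_injOn
      (fun x _ => (hasFDerivAt_stExt θ x).continuousAt.continuousWithinAt) (stExt_injOn θ)
  have key := lintegral_image_eq_lintegral_abs_det_fderiv_mul volume (measurableSet_slab θ)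
    (fun x _ => (hasFDerivAt_stExt θ x).hasFDerivWithinAt) (stExt_injOn θ) H
  have hst := measurable_st θ
  have e1 : ∫⁻ y, ENNReal.ofReal ((2 / dist y θ ^ 2) ^ (N - 1)) * F (st θ y) ∂(ms θ) =
      ∫⁻ z in stExt θ '' slab θ, H z := by
    rw [key, ms, lintegral_map (by fun_prop) (by fun_prop)]
    refine lintegral_congr fun x => ?_
    rw [abs_det_stExt θ hN, stExt_eq, hHL, ENNReal.ofReal_mul (by positivity), mul_assoc,
      mul_comm (ENNReal.ofReal (Real.exp _)), mul_assoc, mul_assoc,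
      mul_comm (ENNReal.ofReal (Real.exp (-_))), hmul, mul_one]
  have e2 : ∀ (σ : Sph N) s, ENNReal.ofReal (Real.exp (N * s)) *
      (stExt θ '' slab θ).indicator H (Real.exp s • (σ : EE N)) =
      (Set.Ioo (0:ℝ) 1).indicator (fun _ => ({θ}ᶜ : Set (Sph N)).indicator F σ) s := fun σ s => by
    by_cases h1 : σ ≠ θ ∧ s ∈ Set.Ioo (0 : ℝ) 1
    · rw [Set.indicator_of_mem ((mem_image_stExt θ σ s).2 h1), Set.indicator_of_mem h1.2,
        Set.indicator_of_mem (by simpa using h1.1), hHL, mul_comm (F σ), ← mul_assoc, hmul, one_mul]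
    · rw [Set.indicator_of_notMem (mt (mem_image_stExt θ σ s).1 h1), mul_zero]
      by_cases h2 : s ∈ Set.Ioo (0 : ℝ) 1
      · rw [Set.indicator_of_mem h2, Set.indicator_of_notMem]
        simpa [h2] using h1
      · rw [Set.indicator_of_notMem h2]
  rw [e1, ← lintegral_indicator himg, lintegral_logPolar hN (hHm.indicator himg)]
  simp only [e2, lintegral_indicator measurableSet_Ioo, setLIntegral_const, Real.volume_Ioo,
    sub_zero, ENNReal.ofReal_one, mul_one]
  rw [lintegral_indicator (measurableSet_singleton θ).compl, Measure.restrict_eq_self_of_ae_mem]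
  rw [ae_iff]
  simpa using sm_singleton θ hN

lemma measurePreserving_st (hN : 2 ≤ N) : MeasurePreserving (st θ)
    ((ms θ).withDensity fun y => ENNReal.ofReal ((2 / dist y θ ^ 2) ^ (N - 1))) (sm N) := by
  refine ⟨measurable_st θ, ?_⟩
  ext s hs
  rw [Measure.map_apply (measurable_st θ) hs, withDensity_apply _ (measurable_st θ hs),
    ← lintegral_indicator (measurable_st θ hs), ← lintegral_indicator_one hs,
    lintegral_st θ hN (measurable_one.indicator hs)]
  refine lintegral_congr fun y => ?_
  simp only [Set.indicator, Pi.one_apply, mul_ite, mul_one, mul_zero]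
  rfl

lemma integral_st (hN : 2 ≤ N) {F : Sph N → ℝ} (hF : Measurable F) :
    ∫ σ, F σ ∂(sm N) =
      ∫ y, (2 / dist y θ ^ 2) ^ (N - 1) * F (st θ y) ∂(ms θ) := by
  rw [← (measurePreserving_st θ hN).map_eq, integral_map (measurable_st θ).aemeasurable
    hF.aestronglyMeasurable, integral_withDensity_eq_integral_toReal_smul (by fun_prop) (by simp)]
  refine integral_congr_ae (Eventually.of_forall fun y => ?_)
  simp only [smul_eq_mul]
  rw [ENNReal.toReal_ofReal (by positivity)]

end Stereo

section Shift

variable {N : ℕ} (θ : Sph N) {α p q : ℝ}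

lemma ms_real_ball (hN : 2 ≤ N) {w : EE N} (hw : inner ℝ (θ : EE N) w = 0) {t : ℝ} (ht : 0 < t) :
    (ms θ).real (Metric.ball w t) = (ms θ).real (Metric.ball 0 1) * t ^ ((N : ℝ) - 1) := by
  rw [measureReal_def, ms_ball θ hN hw ht, ENNReal.toReal_ofReal (by positivity)]

lemma ms_ball_lt_top (hN : 2 ≤ N) {w : EE N} (hw : inner ℝ (θ : EE N) w = 0) {t : ℝ} (ht : 0 < t) :
    ms θ (Metric.ball w t) < ⊤ := by
  rw [ms_ball θ hN hw ht]; exact ENNReal.ofReal_lt_top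

lemma exists_shell_bound (hN : 2 ≤ N) : ∃ C : ℝ, 0 ≤ C ∧ ∀ t r : ℝ, 0 < t → 0 ≤ r → r ≤ t / 2 →
    (ms θ).real (Metric.ball 0 (t + r) \ Metric.ball 0 (t - r)) ≤ C * r * t ^ ((N : ℝ) - 2) := by
  set V := (ms θ).real (Metric.ball 0 1)
  have hV : 0 ≤ V := measureReal_nonneg
  have hn : (0 : ℝ) < (N : ℝ) - 1 := by
    have : (2:ℝ) ≤ N := by exact_mod_cast hN
    linarith
  set n : ℝ := (N : ℝ) - 1 with hn'
  refine ⟨V * ((|n| + 1) * 2 * (2 ^ |n - 1| + 2 ^ |n - 1|)), by positivity, fun t r ht hr hrt => ?_⟩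
  rw [measureReal_sdiff (Metric.ball_subset_ball (by linarith)) Metric.isOpen_ball.measurableSet
    (ms_ball_lt_top θ hN (by simp) (by linarith)).ne,
    ms_real_ball θ hN (w := 0) (t := t + r) (by simp) (by linarith),
    ms_real_ball θ hN (w := 0) (t := t - r) (by simp) (by linarith), ← mul_sub,
    show (N : ℝ) - 2 = n - 1 by rw [hn']; ring]
  have h1 := abs_rpow_sub_rpow_le (p := n) hn.ne' (show 0 ≤ t + r by linarith)
    (show 0 ≤ t - r by linarith)
  rw [show t + r - (t - r) = 2 * r by ring, abs_of_nonneg (show 0 ≤ 2 * r by linarith)] at h1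
  have h2 : (t + r) ^ (n - 1) ≤ 2 ^ |n - 1| * t ^ (n - 1) :=
    rpow_le_rpow_abs_mul _ two_pos (by linarith) ht (by linarith) (by linarith)
  have h3 : (t - r) ^ (n - 1) ≤ 2 ^ |n - 1| * t ^ (n - 1) :=
    rpow_le_rpow_abs_mul _ two_pos (by linarith) ht (by linarith) (by linarith)
  calc V * ((t + r) ^ n - (t - r) ^ n)
      ≤ V * ((|n| + 1) * (2 * r) * (2 ^ |n - 1| * t ^ (n - 1) + 2 ^ |n - 1| * t ^ (n - 1))) := by
        gcongr
        exact (le_abs_self _).trans (h1.trans (by gcongr))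
    _ = _ := by ring

lemma setIntegral_shift {w : EE N} (hw : inner ℝ (θ : EE N) w = 0) (t : ℝ) :
    ∫ y in Metric.ball 0 t, ‖y - w‖ ^ p ∂(ms θ) = ∫ y in Metric.ball (-w) t, ‖y‖ ^ p ∂(ms θ) := by
  have := (measurePreserving_add_ms θ hw).setIntegral_preimage_emb
    (MeasurableEquiv.addRight w).measurableEmbedding (fun y => ‖y - w‖ ^ p) (Metric.ball 0 t)
  rw [← this]
  have h : (fun y => y + w) ⁻¹' Metric.ball 0 t = Metric.ball (-w) t := by
    ext y; simp [dist_eq_norm]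
  rw [h]
  simp

lemma exists_shift_bound (hN : 2 ≤ N) (hα : α ∈ Set.Ioo (0 : ℝ) 1)
    (hp : p = 2 + α - N) (hp0 : p ≠ 0) (hq1 : 1 + α < q) (hq2 : q ≤ 2) :
    (∀ w, inner ℝ (θ : EE N) w = 0 → ∀ t, 0 < t →
      IntegrableOn (fun y => ‖y - w‖ ^ p) (Metric.ball 0 t) (ms θ)) ∧
    ∃ C : ℝ, 0 ≤ C ∧ ∀ w, inner ℝ (θ : EE N) w = 0 → ∀ t, 0 < t →
      |∫ y in Metric.ball 0 t, ‖y‖ ^ p ∂(ms θ) - ∫ y in Metric.ball 0 t, ‖y - w‖ ^ p ∂(ms θ)| ≤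
        C * ‖w‖ ^ q * t ^ (1 + α - q) := by
  obtain ⟨hα0, hα1⟩ := hα
  obtain ⟨S, hS, HS⟩ := exists_shell_bound θ hN
  set V := (ms θ).real (Metric.ball 0 1)
  have hV : 0 ≤ V := measureReal_nonneg
  obtain ⟨K, hK, HK⟩ := exists_inner_bound (X := EE N) V ((N : ℝ) - 1) p hV hp0 (by linarith)
  have HK' : ∀ w, inner ℝ (θ : EE N) w = 0 → ∀ t : ℝ, 0 < t →
      IntegrableOn (fun y => dist y w ^ p) (Metric.ball w t) (ms θ) ∧
      ∫ y in Metric.ball w t, dist y w ^ p ∂(ms θ) ≤ K * t ^ ((N : ℝ) - 1 + p) := fun w hw =>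
    HK (ms θ) w fun t ht => (ms_ball θ hN hw ht).le
  have HI : ∀ t, 0 < t → IntegrableOn (fun y => ‖y‖ ^ p) (Metric.ball 0 t) (ms θ) ∧
      ∫ y in Metric.ball 0 t, ‖y‖ ^ p ∂(ms θ) ≤ K * t ^ (1 + α) := fun t ht => by
    have := HK' 0 (by simp) t ht
    simpa only [dist_zero_right, show (N : ℝ) - 1 + p = 1 + α by rw [hp]; ring] using this
  refine ⟨fun w hw t ht => ?_, ?_⟩
  · have := (HK' w hw (t + ‖w‖ + 1) (by positivity)).1
    simp only [dist_eq_norm] at this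
    refine this.mono_set (Metric.ball_subset_ball' ?_)
    rw [dist_zero_left]; linarith
  refine ⟨S * ((|p| + 1) * (2 ^ |p - 1| + 1)) + 2 * K * 3 ^ (1 + α) * 2 ^ (q - (1 + α)),
    by positivity, fun w hw t ht => ?_⟩
  rw [setIntegral_shift θ hw]
  have hw0 := norm_nonneg w
  have hBmem : ∀ y : EE N, y ∈ Metric.ball (-w) t ↔ ‖y + w‖ < t := fun y => by
    simp [dist_eq_norm]
  rcases le_or_gt ‖w‖ (t / 2) with h | h
  · set s := Metric.ball (0 : EE N) (t + ‖w‖) \ Metric.ball 0 (t - ‖w‖) with hs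
    have hsm : MeasurableSet s := Metric.isOpen_ball.measurableSet.diff
      Metric.isOpen_ball.measurableSet
    have hsf : ms θ s < ⊤ := (measure_mono Set.sdiff_subset).trans_lt
      (ms_ball_lt_top θ hN (by simp) (by linarith))
    have hw' : inner ℝ (θ : EE N) (-w) = 0 := by rw [inner_neg_right, hw, neg_zero]
    have c1 := (ms_ball_lt_top θ hN (w := 0) (by simp) ht).ne
    have c2 := (ms_ball_lt_top θ hN hw' ht).ne
    have hsub : Metric.ball (-w) t ⊆ Metric.ball 0 (t + ‖w‖) :=
      Metric.ball_subset_ball' (by rw [dist_zero_right, norm_neg])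
    have i1 := (HI t ht).1
    have i2 : IntegrableOn (fun y => ‖y‖ ^ p) (Metric.ball (-w) t) (ms θ) :=
      (HI (t + ‖w‖) (by linarith)).1.mono_set hsub
    have j1 : ∫ y in Metric.ball 0 t, ‖y‖ ^ p ∂(ms θ) =
        ∫ y in Metric.ball 0 t, (‖y‖ ^ p - t ^ p) ∂(ms θ) +
          (ms θ).real (Metric.ball 0 t) * t ^ p := by
      rw [integral_sub i1 (integrableOn_const c1), setIntegral_const, smul_eq_mul]; ring
    have j2 : ∫ y in Metric.ball (-w) t, ‖y‖ ^ p ∂(ms θ) =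
        ∫ y in Metric.ball (-w) t, (‖y‖ ^ p - t ^ p) ∂(ms θ) +
          (ms θ).real (Metric.ball 0 t) * t ^ p := by
      rw [ms_real_ball θ hN (by simp) ht, ← ms_real_ball θ hN hw' ht,
        integral_sub i2 (integrableOn_const c2), setIntegral_const, smul_eq_mul]; ring
    rw [j1, j2, add_sub_add_right_eq_sub, ← integral_indicator Metric.isOpen_ball.measurableSet,
      ← integral_indicator Metric.isOpen_ball.measurableSet, ← integral_sub]
    rotate_left
    · exact (i1.sub (integrableOn_const c1)).integrable_indicator Metric.isOpen_ball.measurableSet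
    · exact (i2.sub (integrableOn_const c2)).integrable_indicator Metric.isOpen_ball.measurableSet
    rw [← Real.norm_eq_abs]
    have hb : ∀ y, ‖(Metric.ball (0 : EE N) t).indicator (fun y => ‖y‖ ^ p - t ^ p) y -
        (Metric.ball (-w) t).indicator (fun y => ‖y‖ ^ p - t ^ p) y‖ ≤
        s.indicator (fun _ => (|p| + 1) * (2 ^ |p - 1| + 1) * ‖w‖ * t ^ (p - 1)) y := by
      intro y
      have k1 : ‖y + w‖ ≤ ‖y‖ + ‖w‖ := norm_add_le _ _
      have k2 : ‖y‖ ≤ ‖y + w‖ + ‖w‖ := by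
        have := norm_sub_le (y + w) w; rwa [add_sub_cancel_right] at this
      by_cases hys : y ∈ s
      · rw [Set.indicator_of_mem hys]
        obtain ⟨m1, m2⟩ := hys
        rw [mem_ball_zero_iff] at m1 m2
        rw [not_lt] at m2
        have l1 := abs_rpow_sub_rpow_le hp0 (norm_nonneg y) ht.le
        have l2 : |‖y‖ - t| ≤ ‖w‖ := abs_le.2 ⟨by linarith, by linarith⟩
        have l3 : ‖y‖ ^ (p - 1) ≤ 2 ^ |p - 1| * t ^ (p - 1) :=
          rpow_le_rpow_abs_mul _ two_pos (by linarith) ht (by linarith) (by linarith)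
        have l4 : |‖y‖ ^ p - t ^ p| ≤ (|p| + 1) * (2 ^ |p - 1| + 1) * ‖w‖ * t ^ (p - 1) :=
          calc _ ≤ (|p| + 1) * ‖w‖ * (2 ^ |p - 1| * t ^ (p - 1) + t ^ (p - 1)) :=
                l1.trans (by gcongr)
            _ = _ := by ring
        have l5 : 0 ≤ (|p| + 1) * (2 ^ |p - 1| + 1) * ‖w‖ * t ^ (p - 1) := by positivity
        by_cases b1 : y ∈ Metric.ball (0 : EE N) t <;> by_cases b2 : y ∈ Metric.ball (-w) t <;>
          simp only [b1, b2, Set.indicator_of_mem, Set.indicator_of_notMem, not_false_eq_true,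
            sub_self, sub_zero, zero_sub, norm_neg, norm_zero, Real.norm_eq_abs, l4, l5]
      · rw [Set.indicator_of_notMem hys]
        have hmem : y ∈ Metric.ball (0 : EE N) t ↔ y ∈ Metric.ball (-w) t := by
          rw [hBmem, mem_ball_zero_iff]
          rw [hs, Set.mem_sdiff, mem_ball_zero_iff, mem_ball_zero_iff] at hys
          by_contra hcon
          apply hys
          by_cases b : ‖y‖ < t
          · have : ¬ ‖y + w‖ < t := fun h => hcon (by simp [b, h])
            constructor <;> linarith
          · have : ‖y + w‖ < t := by by_contra h; exact hcon (by simp [b, h])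
            constructor <;> linarith
        by_cases b1 : y ∈ Metric.ball (0 : EE N) t
        · rw [Set.indicator_of_mem b1, Set.indicator_of_mem (hmem.1 b1)]; simp
        · rw [Set.indicator_of_notMem b1, Set.indicator_of_notMem (mt hmem.2 b1)]; simp
    refine (norm_integral_le_of_norm_le ((integrableOn_const hsf.ne).integrable_indicator hsm)
      (Eventually.of_forall hb)).trans ?_
    rw [integral_indicator hsm, setIntegral_const, smul_eq_mul]
    have hq' : ‖w‖ * ‖w‖ ≤ ‖w‖ ^ q * t ^ (2 - q) := by
      calc ‖w‖ * ‖w‖ = ‖w‖ ^ (q + (2 - q)) := by rw [show q + (2 - q) = 2 by ring]; simp [sq]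
        _ = ‖w‖ ^ q * ‖w‖ ^ (2 - q) :=
          Real.rpow_add_of_nonneg hw0 (by linarith) (by linarith)
        _ ≤ _ := by gcongr; linarith
    have e1 : t ^ (2 - q) * (t ^ ((N : ℝ) - 2) * t ^ (p - 1)) = t ^ (1 + α - q) := by
      rw [← Real.rpow_add ht, ← Real.rpow_add ht]; congr 1; rw [hp]; ring
    calc (ms θ).real s * ((|p| + 1) * (2 ^ |p - 1| + 1) * ‖w‖ * t ^ (p - 1))
        ≤ (S * ‖w‖ * t ^ ((N : ℝ) - 2)) * ((|p| + 1) * (2 ^ |p - 1| + 1) * ‖w‖ * t ^ (p - 1)) := by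
          gcongr; exact HS t ‖w‖ ht hw0 h
      _ = (S * ((|p| + 1) * (2 ^ |p - 1| + 1))) * (‖w‖ * ‖w‖) *
          (t ^ ((N : ℝ) - 2) * t ^ (p - 1)) := by ring
      _ ≤ (S * ((|p| + 1) * (2 ^ |p - 1| + 1))) * (‖w‖ ^ q * t ^ (2 - q)) *
          (t ^ ((N : ℝ) - 2) * t ^ (p - 1)) := by gcongr
      _ = (S * ((|p| + 1) * (2 ^ |p - 1| + 1))) * ‖w‖ ^ q * t ^ (1 + α - q) := by
          rw [← e1]; ring
      _ ≤ _ := by gcongr; exact le_add_of_nonneg_right (by positivity)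
  · have hwp : 0 < ‖w‖ := by linarith
    have a1 : |∫ y in Metric.ball 0 t, ‖y‖ ^ p ∂(ms θ)| ≤ K * (3 * ‖w‖) ^ (1 + α) := by
      rw [abs_of_nonneg (integral_nonneg fun y => by positivity)]
      exact (HI t ht).2.trans (by gcongr; linarith)
    have a2 : |∫ y in Metric.ball (-w) t, ‖y‖ ^ p ∂(ms θ)| ≤ K * (3 * ‖w‖) ^ (1 + α) := by
      rw [abs_of_nonneg (integral_nonneg fun y => by positivity)]
      refine le_trans ?_ (HI (3 * ‖w‖) (by linarith)).2
      exact setIntegral_mono_set (HI (3 * ‖w‖) (by linarith)).1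
        (Eventually.of_forall fun y => by positivity) (Metric.ball_subset_ball' (by
          rw [dist_zero_right, norm_neg]; linarith)).eventuallyLE
    have a3 : ‖w‖ ^ (1 + α - q) ≤ 2 ^ (q - (1 + α)) * t ^ (1 + α - q) := by
      calc ‖w‖ ^ (1 + α - q) ≤ (t / 2) ^ (1 + α - q) :=
            Real.rpow_le_rpow_of_nonpos (by linarith) h.le (by linarith)
        _ = _ := by
            rw [Real.div_rpow ht.le (by norm_num), div_eq_mul_inv, ← Real.rpow_neg (by norm_num),
              neg_sub]; ring
    calc _ ≤ K * (3 * ‖w‖) ^ (1 + α) + K * (3 * ‖w‖) ^ (1 + α) :=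
          (abs_sub _ _).trans (add_le_add a1 a2)
      _ = 2 * K * 3 ^ (1 + α) * (‖w‖ ^ q * ‖w‖ ^ (1 + α - q)) := by
          rw [Real.mul_rpow (by norm_num) hw0, ← Real.rpow_add hwp, add_sub_cancel]; ring
      _ ≤ 2 * K * 3 ^ (1 + α) * (‖w‖ ^ q * (2 ^ (q - (1 + α)) * t ^ (1 + α - q))) := by gcongr
      _ = (2 * K * 3 ^ (1 + α) * 2 ^ (q - (1 + α))) * ‖w‖ ^ q * t ^ (1 + α - q) := by ring
      _ ≤ _ := by gcongr; exact le_add_of_nonneg_left (by positivity)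

end Shift

section Truncation

variable {N : ℕ} {α β γ p q : ℝ}

/-- The region `dist σ θ > 2 / √(1 + t²)`, which corresponds to `‖y‖ < t` in stereographic
coordinates. -/
def far (θ : Sph N) (t : ℝ) : Set (Sph N) := {σ | 2 / √(1 + t ^ 2) < dist σ θ}

lemma measurableSet_far (θ : Sph N) (t : ℝ) : MeasurableSet (far θ t) :=
  measurableSet_lt measurable_const (by fun_prop)

lemma st_mem_far {θ : Sph N} {t : ℝ} (ht : 0 < t) {y : EE N} (hy : inner ℝ (θ : EE N) y = 0) :
    st θ y ∈ far θ t ↔ y ∈ Metric.ball (0 : EE N) t := by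
  have h1 := dist_pole_pos hy
  have h2 : dist y θ = √(1 + ‖y‖ ^ 2) := by
    rw [dist_eq_norm, ← norm_sub_sq_of_inner hy, Real.sqrt_sq (norm_nonneg _)]
  rw [far, Set.mem_ofPred_eq, dist_st_pole hy, mem_ball_zero_iff,
    div_lt_div_iff_of_pos_left two_pos (by positivity) h1, h2,
    Real.sqrt_lt_sqrt_iff (by positivity)]
  constructor
  · intro h; nlinarith [norm_nonneg y]
  · intro h; nlinarith [norm_nonneg y]

lemma opp_mem_far {θ σ : Sph N} {t : ℝ} : opp θ σ ∈ far θ t ↔ σ ∈ far θ t := by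
  rw [far, Set.mem_ofPred_eq, Set.mem_ofPred_eq, dist_opp]

lemma integral_opp (θ : Sph N) (f : Sph N → ℝ) :
    ∫ σ, f (opp θ σ) ∂(sm N) = ∫ σ, f σ ∂(sm N) := integral_rot _ f

lemma integrable_opp (θ : Sph N) {f : Sph N → ℝ} :
    Integrable (fun σ => f (opp θ σ)) (sm N) ↔ Integrable f (sm N) := integrable_rot _

lemma continuous_opp (θ : Sph N) : Continuous (opp θ) := continuous_rot _

/-- The truncated spherical fractional operator. -/
noncomputable def trunc (α : ℝ) (θ : Sph N) (t : ℝ) (u : Sph N → ℝ) : ℝ :=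
  ∫ σ in far θ t, (u θ - u σ) * dist σ θ ^ (-((N : ℝ) + α)) ∂(sm N)

/-- The spherical fractional operator, written with symmetrized second differences. -/
noncomputable def frac (α : ℝ) (u : Sph N → ℝ) (θ : Sph N) : ℝ :=
  (1 / 2) * ∫ σ, (2 * u θ - u σ - u (opp θ σ)) * dist σ θ ^ (-((N : ℝ) + α)) ∂(sm N)

lemma far_rpow_le (hα : 0 < α) {θ σ : Sph N} {t : ℝ} (h : σ ∈ far θ t) :
    dist σ θ ^ (-((N : ℝ) + α)) ≤ (2 / √(1 + t ^ 2)) ^ (-((N : ℝ) + α)) := by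
  refine Real.rpow_le_rpow_of_nonpos ?_ (le_of_lt h) (by linarith [Nat.cast_nonneg (α := ℝ) N])
  positivity

lemma integrableOn_far (hα : 0 < α) {θ : Sph N} {t : ℝ} {f : Sph N → ℝ}
    (hf : Integrable f (sm N)) :
    IntegrableOn (fun σ => f σ * dist σ θ ^ (-((N : ℝ) + α))) (far θ t) (sm N) := by
  refine Integrable.mul_bdd (c := (2 / √(1 + t ^ 2)) ^ (-((N : ℝ) + α))) hf.integrableOn
    (Measurable.aestronglyMeasurable (by fun_prop)) ?_
  refine (ae_restrict_iff' (measurableSet_far θ t)).2 (Eventually.of_forall fun σ hσ => ?_)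
  rw [Real.norm_of_nonneg (by positivity)]
  exact far_rpow_le hα hσ

lemma trunc_symm (hα : 0 < α) {θ : Sph N} {t : ℝ} {u : Sph N → ℝ} (hu : Continuous u) :
    trunc α θ t u = (1 / 2) * ∫ σ in far θ t,
      (2 * u θ - u σ - u (opp θ σ)) * dist σ θ ^ (-((N : ℝ) + α)) ∂(sm N) := by
  have i0 : ∀ f : Sph N → ℝ, Continuous f → Integrable f (sm N) := fun f hf => by
    obtain ⟨B, hB⟩ := bounded_of_continuous hf
    exact Integrable.of_bound hf.measurable.aestronglyMeasurable B (Eventually.of_forall hB)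
  have h1 : trunc α θ t u =
      ∫ σ in far θ t, (u θ - u (opp θ σ)) * dist σ θ ^ (-((N : ℝ) + α)) ∂(sm N) := by
    rw [trunc, ← integral_indicator (measurableSet_far θ t), ← integral_opp θ,
      ← integral_indicator (measurableSet_far θ t)]
    congr 1; ext σ
    by_cases h : σ ∈ far θ t
    · rw [Set.indicator_of_mem h, Set.indicator_of_mem (opp_mem_far.2 h), dist_opp]
    · rw [Set.indicator_of_notMem h, Set.indicator_of_notMem (mt opp_mem_far.1 h)]
  have e : ∀ σ, (2 * u θ - u σ - u (opp θ σ)) * dist σ θ ^ (-((N : ℝ) + α)) =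
      (u θ - u σ) * dist σ θ ^ (-((N : ℝ) + α)) +
        (u θ - u (opp θ σ)) * dist σ θ ^ (-((N : ℝ) + α)) := fun σ => by ring
  simp_rw [e]
  rw [integral_add (integrableOn_far hα (i0 (fun σ => u θ - u σ) (by fun_prop)))
    (integrableOn_far hα (i0 (fun σ => u θ - u (opp θ σ))
      (continuous_const.sub (hu.comp (continuous_opp θ)))))]
  rw [← h1]
  change _ = 1 / 2 * (trunc α θ t u + trunc α θ t u)
  ring

lemma frac_integrable (hN : 2 ≤ N) (hβ : α < β) (hα : 0 < α) (hβ1 : β ≤ 1) {U : ℝ} {u : Sph N → ℝ}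
    (hu : XB β U u) (θ : Sph N) :
    Integrable (fun σ => 8 * U * dist σ θ ^ (1 + β - (N + α))) (sm N) ∧
      ∀ σ, |(2 * u θ - u σ - u (opp θ σ)) * dist σ θ ^ (-((N : ℝ) + α))| ≤
        8 * U * dist σ θ ^ (1 + β - (N + α)) := by
  have h2 : (2:ℝ) ≤ N := by exact_mod_cast hN
  obtain ⟨K, -, hK⟩ := exists_sph_full hN (q := 1 + β - (N + α)) (by linarith) (by linarith)
  refine ⟨(hK θ).1.const_mul _, fun σ => ?_⟩
  have h := hu.symm_diff (by linarith) hβ1 θ σ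
  rcases (dist_nonneg (x := σ) (y := θ)).eq_or_lt with h0 | h0
  · have : σ = θ := dist_eq_zero.1 h0.symm
    subst this
    rw [opp_self]
    have := hu.nonneg σ
    simp only [show 2 * u σ - u σ - u σ = 0 by ring, zero_mul, abs_zero]
    positivity
  · rw [abs_mul, abs_of_nonneg (show 0 ≤ dist σ θ ^ (-((N : ℝ) + α)) by positivity),
      show 1 + β - ((N : ℝ) + α) = (1 + β) + -((N : ℝ) + α) by ring, Real.rpow_add h0, ← mul_assoc]
    gcongr
    rw [abs_sub_comm] at h
    rwa [show 2 * u θ - u σ - u (opp θ σ) = 2 * u θ - (u σ + u (opp θ σ)) by ring]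

lemma tendsto_trunc (hN : 2 ≤ N) (hβ : α < β) (hα : 0 < α) (hβ1 : β ≤ 1) {U : ℝ} {u : Sph N → ℝ}
    (hu : XB β U u) (θ : Sph N) :
    Tendsto (fun t => trunc α θ t u) atTop (nhds (frac α u θ)) := by
  have hc := hu.continuous
  obtain ⟨hi, hb⟩ := frac_integrable hN hβ hα hβ1 hu θ
  simp_rw [trunc_symm hα hc]
  refine Tendsto.const_mul _ ?_
  simp_rw [← integral_indicator (measurableSet_far θ _)]
  have hcm : Measurable fun σ => (2 * u θ - u σ - u (opp θ σ)) * dist σ θ ^ (-((N : ℝ) + α)) := by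
    have := (hc.comp (continuous_opp θ)).measurable
    have h2 := hc.measurable
    exact ((measurable_const.sub h2).sub this).mul (by fun_prop)
  refine tendsto_integral_filter_of_dominated_convergence _ (Eventually.of_forall fun t =>
    (hcm.indicator (measurableSet_far θ t)).aestronglyMeasurable)
    (Eventually.of_forall fun t => Eventually.of_forall fun σ => ?_) hi
    (Eventually.of_forall fun σ => ?_)
  · exact (norm_indicator_le_norm_self _ _).trans (hb σ)
  · rcases eq_or_ne σ θ with rfl | hne
    · have : ∀ t, (far σ t).indicator (fun τ => (2 * u σ - u τ - u (opp σ τ)) *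
          dist τ σ ^ (-((N : ℝ) + α))) σ = 0 := fun t => by
        refine Set.indicator_apply_eq_zero.2 fun _ => ?_
        rw [opp_self, show 2 * u σ - u σ - u σ = 0 by ring, zero_mul]
      simp_rw [this, opp_self]
      rw [show 2 * u σ - u σ - u σ = 0 by ring, zero_mul]
      exact tendsto_const_nhds
    · refine tendsto_const_nhds.congr' ?_
      have hd : 0 < dist σ θ := dist_pos.2 hne
      filter_upwards [eventually_gt_atTop (2 / dist σ θ)] with t ht
      rw [Set.indicator_of_mem]
      have ht0 : 0 < t := lt_of_le_of_lt (by positivity) ht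
      have : t < √(1 + t ^ 2) := Real.lt_sqrt_of_sq_lt (by linarith)
      rw [far, Set.mem_ofPred_eq, div_lt_comm₀ (by positivity) hd]
      exact ht.trans this

lemma measurable_dist_rpow (q : ℝ) : Measurable fun z : Sph N × Sph N => dist z.2 z.1 ^ q := by
  have : Measurable fun z : Sph N × Sph N => dist z.2 z.1 := measurable_snd.dist measurable_fst
  exact this.pow_const q

lemma integrable_dist_prod (hN : 2 ≤ N) (hq : q ≠ 0) (h : 0 < (N : ℝ) - 1 + q) :
    Integrable (fun z : Sph N × Sph N => dist z.2 z.1 ^ q) ((sm N).prod (sm N)) := by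
  obtain ⟨K, hK0, hK⟩ := exists_sph_full hN hq h
  rw [integrable_prod_iff (measurable_dist_rpow q).aestronglyMeasurable]
  refine ⟨Eventually.of_forall fun θ => (hK θ).1, ?_⟩
  refine Integrable.of_bound (C := K) ?_ (Eventually.of_forall fun θ => ?_)
  · exact ((measurable_dist_rpow q).norm.stronglyMeasurable.integral_prod_right').aestronglyMeasurable
  · rw [Real.norm_of_nonneg (integral_nonneg fun _ => norm_nonneg _)]
    simp_rw [Real.norm_of_nonneg (Real.rpow_nonneg dist_nonneg q)]
    exact (hK θ).2

/-- The kernel of the truncated operator composed with a Riesz potential. -/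
noncomputable def psi (α p : ℝ) (θ : Sph N) (t : ℝ) (ω : Sph N) : ℝ :=
  ∫ σ in far θ t, (dist ω θ ^ p - dist ω σ ^ p) * dist σ θ ^ (-((N : ℝ) + α)) ∂(sm N)

lemma trunc_pot (hN : 2 ≤ N) (hα : 0 < α) (hp0 : p ≠ 0) (hp : 0 < (N : ℝ) - 1 + p)
    (θ : Sph N) (t : ℝ) {f : Sph N → ℝ} (hf : Continuous f) :
    Integrable (fun ω => f ω * psi α p θ t ω) (sm N) ∧
    trunc α θ t (pot p f) = ∫ ω, f ω * psi α p θ t ω ∂(sm N) := by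
  obtain ⟨K, hK0, hK⟩ := exists_sph_full hN hp0 hp
  obtain ⟨B, hB⟩ := bounded_of_continuous hf
  set ν := (sm N).restrict (far θ t) with hν
  have i1 : Integrable (fun z : Sph N × Sph N => dist z.2 θ ^ p) ((sm N).prod (sm N)) :=
    (hK θ).1.comp_snd (sm N)
  have i2 : Integrable (fun z : Sph N × Sph N => dist z.2 z.1 ^ p) ((sm N).prod (sm N)) :=
    integrable_dist_prod hN hp0 hp
  have i3 : Integrable (fun z : Sph N × Sph N => (dist z.2 θ ^ p - dist z.2 z.1 ^ p))
      (ν.prod (sm N)) := by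
    have := i1.sub i2
    refine Integrable.mono_measure this ?_
    exact Measure.prod_mono Measure.restrict_le_self le_rfl
  have i4 : Integrable (fun z : Sph N × Sph N => (dist z.2 θ ^ p - dist z.2 z.1 ^ p) * f z.2)
      (ν.prod (sm N)) := i3.mul_bdd (c := B) (by
        have := hf.measurable; exact (this.comp measurable_snd).aestronglyMeasurable)
        (Eventually.of_forall fun z => hB z.2)
  have i5 : Integrable (fun z : Sph N × Sph N => (dist z.2 θ ^ p - dist z.2 z.1 ^ p) * f z.2 *
      dist z.1 θ ^ (-((N : ℝ) + α))) (ν.prod (sm N)) := by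
    refine i4.mul_bdd (c := (2 / √(1 + t ^ 2)) ^ (-((N : ℝ) + α)))
      (Measurable.aestronglyMeasurable (by fun_prop)) ?_
    have : ∀ᵐ σ ∂ν, σ ∈ far θ t := ae_restrict_mem (measurableSet_far θ t)
    filter_upwards [Measure.quasiMeasurePreserving_fst.ae this] with z hz
    rw [Real.norm_of_nonneg (by positivity)]
    exact far_rpow_le hα hz
  have e1 : ∀ ω, ∫ σ, (dist ω θ ^ p - dist ω σ ^ p) * f ω * dist σ θ ^ (-((N : ℝ) + α)) ∂ν =
      f ω * psi α p θ t ω := fun ω => by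
    rw [psi, ← integral_const_mul]; congr 1; ext σ; ring
  have e2 : ∀ σ, ∫ ω, (dist ω θ ^ p - dist ω σ ^ p) * f ω * dist σ θ ^ (-((N : ℝ) + α)) ∂(sm N) =
      (pot p f θ - pot p f σ) * dist σ θ ^ (-((N : ℝ) + α)) := fun σ => by
    rw [integral_mul_const, pot, pot, ← integral_sub (integrable_dist_mul (hK θ).1 hf)
      (integrable_dist_mul (hK σ).1 hf)]
    congr 2; ext ω; ring
  constructor
  · have := i5.integral_prod_right
    simpa only [e1] using this
  · have := integral_integral_swap (f := fun σ ω => (dist ω θ ^ p - dist ω σ ^ p) * f ω *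
      dist σ θ ^ (-((N : ℝ) + α))) i5
    simp only [e1, e2] at this
    exact this

end Truncation

section Inversion

variable {N : ℕ} {α β γ p q : ℝ}

lemma psi_st (hN : 2 ≤ N) (hp : p = 2 + α - N) {θ : Sph N} {t : ℝ} (ht : 0 < t) {w : EE N}
    (hw : inner ℝ (θ : EE N) w = 0) :
    psi α p θ t (st θ w) = dist (st θ w) θ ^ p * (2 ^ (-1 - α) *
      ∫ y in Metric.ball 0 t, (dist y θ ^ p - ‖y - w‖ ^ p) ∂(ms θ)) := by
  have hm : Measurable fun σ : Sph N =>
      (dist (st θ w) θ ^ p - dist (st θ w) σ ^ p) * dist σ θ ^ (-((N : ℝ) + α)) := by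
    have : Measurable fun σ : Sph N => dist (st θ w) σ := by fun_prop
    have := this.pow_const p
    exact (measurable_const.sub this).mul (by fun_prop)
  rw [psi, ← integral_indicator (measurableSet_far θ t),
    integral_st θ hN (hm.indicator (measurableSet_far θ t)), ← mul_assoc,
    ← integral_indicator Metric.isOpen_ball.measurableSet, ← integral_const_mul]
  refine integral_congr_ae ?_
  filter_upwards [ae_ms θ] with y hy
  by_cases h : y ∈ Metric.ball (0 : EE N) t
  · rw [Set.indicator_of_mem h, Set.indicator_of_mem ((st_mem_far ht hy).2 h)]
    have hD := dist_pole_pos hy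
    have hE := dist_pole_pos hw
    rw [dist_st_st hw hy, dist_st_pole hy, dist_st_pole hw, dist_comm w y, dist_eq_norm y w]
    have hx := norm_nonneg (y - w)
    set D := dist y (θ : EE N)
    set E := dist w (θ : EE N)
    set x := ‖y - w‖
    have e1 : (2 * x / (E * D)) ^ p = (2 / E) ^ p * (x ^ p * D ^ (-p)) := by
      rw [show 2 * x / (E * D) = (2 / E) * (x * D⁻¹) by field_simp,
        Real.mul_rpow (by positivity) (by positivity), Real.mul_rpow hx (by positivity),
        Real.inv_rpow hD.le, Real.rpow_neg hD.le]
    have e2 : (2 / D ^ 2) ^ (N - 1) * (2 / D) ^ (-((N : ℝ) + α)) = 2 ^ (-1 - α) * D ^ p := by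
      rw [← Real.rpow_natCast, ← Real.rpow_natCast, Nat.cast_sub (by omega),
        Real.div_rpow (by norm_num) (by positivity), Real.div_rpow (by norm_num) hD.le,
        ← Real.rpow_mul hD.le, div_mul_div_comm, ← Real.rpow_add two_pos, ← Real.rpow_add hD,
        div_eq_mul_inv, ← Real.rpow_neg hD.le]
      congr 2 <;> [skip; rw [hp]] <;> push_cast <;> ring
    have e3 : D ^ p * D ^ (-p) = 1 := by rw [← Real.rpow_add hD]; simp
    rw [e1]
    calc _ = ((2 / D ^ 2) ^ (N - 1) * (2 / D) ^ (-((N : ℝ) + α))) * (2 / E) ^ p *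
          (1 - x ^ p * D ^ (-p)) := by ring
      _ = 2 ^ (-1 - α) * (2 / E) ^ p * (D ^ p - x ^ p * (D ^ p * D ^ (-p))) := by
          rw [e2]; ring
      _ = _ := by rw [e3]; ring
  · rw [Set.indicator_of_notMem h, Set.indicator_of_notMem (mt (st_mem_far ht hy).1 h)]; simp

/-- The truncated constant in the inversion formula. -/
noncomputable def invConst (α p : ℝ) (θ : Sph N) (t : ℝ) : ℝ :=
  2 ^ (-1 - α) * ∫ y in Metric.ball 0 t, (dist y θ ^ p - ‖y‖ ^ p) ∂(ms θ)

lemma exists_psi_bound (θ : Sph N) (hN : 2 ≤ N) (hα : α ∈ Set.Ioo (0 : ℝ) 1)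
    (hp : p = 2 + α - N) (hp0 : p ≠ 0) (hq1 : 1 + α < q) (hq2 : q ≤ 2) :
    ∃ C : ℝ, 0 ≤ C ∧ ∀ t, 0 < t → ∀ ω, ω ≠ θ →
      |psi α p θ t ω - invConst α p θ t * dist ω θ ^ p| ≤
        C * dist ω θ ^ (p - q) * t ^ (1 + α - q) := by
  obtain ⟨hi, C, hC, HC⟩ := exists_shift_bound θ hN hα hp hp0 hq1 hq2
  refine ⟨2 ^ (-1 - α) * C * 2 ^ q, by positivity, fun t ht ω hω => ?_⟩
  obtain ⟨w, hw, rfl⟩ := exists_st hω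
  have hE := dist_pole_pos hw
  have hD : IntegrableOn (fun y : EE N => dist y (θ : EE N) ^ p) (Metric.ball 0 t) (ms θ) := by
    refine Measure.integrableOn_of_bounded (M := (1 + t) ^ |p|)
      (ms_ball_lt_top θ hN (by simp) ht).ne (Measurable.aestronglyMeasurable (by fun_prop)) ?_
    refine (ae_restrict_iff' Metric.isOpen_ball.measurableSet).2 ?_
    filter_upwards [ae_ms θ] with y hy hyt
    rw [mem_ball_zero_iff] at hyt
    rw [Real.norm_of_nonneg (by positivity)]
    have h1 : 1 ≤ dist y (θ : EE N) := by
      have := norm_sub_sq_of_inner hy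
      rw [dist_eq_norm]
      nlinarith [norm_nonneg (y - (θ : EE N)), norm_nonneg y]
    have h2 : dist y (θ : EE N) ≤ 1 + t := by
      rw [dist_eq_norm]
      refine (norm_sub_le _ _).trans ?_
      rw [norm_coe]; linarith
    have := rpow_le_rpow_abs_mul (c := 1 + t) p (by linarith) (dist_pole_pos hy) one_pos
      (show 1 ≤ (1 + t) * dist y (θ : EE N) by nlinarith) (by linarith)
    simpa using this
  have h0 := hi 0 (by simp) t ht
  simp only [sub_zero] at h0
  have key := HC w hw t ht
  rw [psi_st hN hp ht hw, invConst, integral_sub hD (hi w hw t ht), integral_sub hD h0]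
  rw [dist_st_pole hw]
  have hw1 : ‖w‖ ≤ dist w (θ : EE N) := by
    have := norm_sub_sq_of_inner hw
    rw [dist_eq_norm]
    nlinarith [norm_nonneg (w - (θ : EE N)), norm_nonneg w]
  set D := dist w (θ : EE N)
  have e1 : D ^ q = 2 ^ q * (2 / D) ^ (-q) := by
    rw [Real.div_rpow (by norm_num) hE.le, Real.rpow_neg hE.le, Real.rpow_neg (by norm_num)]
    field_simp
  have e2 : ‖w‖ ^ q ≤ 2 ^ q * (2 / D) ^ (-q) := by
    rw [← e1]; exact Real.rpow_le_rpow (norm_nonneg _) hw1 (by linarith [hα.1])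
  rw [show ∀ a b c d : ℝ, a * (b * (c - d)) = a * b * (c - d) from fun a b c d => by ring]
  set A := ∫ y in Metric.ball 0 t, ‖y‖ ^ p ∂(ms θ)
  set B := ∫ y in Metric.ball 0 t, ‖y - w‖ ^ p ∂(ms θ)
  rw [show ∀ a b c : ℝ, a * b * (c - B) - b * (c - A) * a = a * b * (A - B) from
    fun a b c => by ring, abs_mul, abs_of_nonneg (by positivity)]
  calc (2 / D) ^ p * 2 ^ (-1 - α) * |A - B|
      ≤ (2 / D) ^ p * 2 ^ (-1 - α) * (C * (2 ^ q * (2 / D) ^ (-q)) * t ^ (1 + α - q)) := by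
        gcongr
        exact key.trans (by gcongr)
    _ = 2 ^ (-1 - α) * C * 2 ^ q * ((2 / D) ^ p * (2 / D) ^ (-q)) * t ^ (1 + α - q) := by ring
    _ = _ := by rw [← Real.rpow_add (by positivity), ← sub_eq_add_neg]

lemma trunc_pot_tendsto (θ : Sph N) (hN : 2 ≤ N) (hα : α ∈ Set.Ioo (0 : ℝ) 1) (hγ : 0 < γ)
    (hαγ : α + γ < 1) (hp : p = 2 + α - N) (hp0 : p ≠ 0) {f : Sph N → ℝ} {A : ℝ}
    (hf : Hol γ A f) :
    Tendsto (fun t => trunc α θ t (pot p f) -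
      invConst α p θ t * (pot p f θ - pot p (fun _ => 1) θ * f θ)) atTop (nhds 0) := by
  have h2 : (2:ℝ) ≤ N := by exact_mod_cast hN
  have hα0 := hα.1
  have hα1 := hα.2
  have hA := hf.nonneg θ
  have hfc := hf.continuous hγ
  obtain ⟨C, hC, HC⟩ := exists_psi_bound (q := 1 + α + γ / 2) θ hN hα hp hp0 (by linarith)
    (by linarith)
  obtain ⟨K, hK0, HK⟩ := exists_sph_full hN (q := γ + (p - (1 + α + γ / 2))) (by linarith)
    (by linarith)
  obtain ⟨L, hL0, HL⟩ := exists_sph_full hN (q := p) hp0 (by linarith)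
  have hb : ∀ t, 0 < t → ‖trunc α θ t (pot p f) -
      invConst α p θ t * (pot p f θ - pot p (fun _ => 1) θ * f θ)‖ ≤
      A * C * K * t ^ (1 + α - (1 + α + γ / 2)) := fun t ht => by
    obtain ⟨i1, e1⟩ := trunc_pot hN hα0 hp0 (by linarith) θ t hfc
    obtain ⟨i2, e2⟩ := trunc_pot (p := p) hN hα0 hp0 (by linarith) θ t
      (continuous_const (y := (1:ℝ)) (X := Sph N))
    have e3 : trunc α θ t (pot p fun _ => (1:ℝ)) = 0 := by
      rw [show (pot p fun _ => (1:ℝ)) = fun _ : Sph N => pot p (fun _ => 1) θ from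
        funext fun σ => pot_const p 1 σ θ, trunc]
      simp
    rw [e3] at e2
    simp only [one_mul] at i2 e2
    have j1 := integrable_dist_mul (HL θ).1 hfc
    have j2 := (HL θ).1.mul_const (f θ)
    have e4 : trunc α θ t (pot p f) -
        invConst α p θ t * (pot p f θ - pot p (fun _ => 1) θ * f θ) =
        ∫ ω, (f ω - f θ) * (psi α p θ t ω - invConst α p θ t * dist ω θ ^ p) ∂(sm N) := by
      have : ∀ ω, (f ω - f θ) * (psi α p θ t ω - invConst α p θ t * dist ω θ ^ p) =
          (f ω * psi α p θ t ω - f θ * psi α p θ t ω) - invConst α p θ t *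
            (dist ω θ ^ p * f ω - dist ω θ ^ p * f θ) := fun ω => by ring
      simp_rw [this]
      have i12 : Integrable (fun ω => f ω * psi α p θ t ω - f θ * psi α p θ t ω) (sm N) :=
        i1.sub (i2.const_mul (f θ))
      have j12 : Integrable (fun ω => dist ω θ ^ p * f ω - dist ω θ ^ p * f θ) (sm N) := j1.sub j2
      rw [integral_sub i12 (j12.const_mul _),
        integral_sub i1 (i2.const_mul (f θ)), integral_const_mul, integral_const_mul,
        integral_sub j1 j2, integral_mul_const, ← e2, e1, pot, pot]
      simp
    rw [e4]
    have hbd : ∀ ω, ‖(f ω - f θ) * (psi α p θ t ω - invConst α p θ t * dist ω θ ^ p)‖ ≤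
        A * C * t ^ (1 + α - (1 + α + γ / 2)) *
          dist ω θ ^ (γ + (p - (1 + α + γ / 2))) := fun ω => by
      rcases eq_or_ne ω θ with rfl | hne
      · rw [sub_self, zero_mul, norm_zero]; positivity
      · rw [norm_mul, Real.norm_eq_abs, Real.norm_eq_abs, Real.rpow_add (dist_pos.2 hne)]
        calc _ ≤ (A * dist ω θ ^ γ) * (C * dist ω θ ^ (p - (1 + α + γ / 2)) *
              t ^ (1 + α - (1 + α + γ / 2))) :=
            mul_le_mul (hf.2 ω θ) (HC t ht ω hne) (abs_nonneg _) (by positivity)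
          _ = _ := by ring
    refine (norm_integral_le_of_norm_le ((HK θ).1.const_mul _) (Eventually.of_forall hbd)).trans ?_
    rw [integral_const_mul]
    have := (HK θ).2
    calc _ ≤ A * C * t ^ (1 + α - (1 + α + γ / 2)) * K := by gcongr
      _ = _ := by ring
  refine squeeze_zero_norm' ((eventually_gt_atTop 0).mono hb) ?_
  have : Tendsto (fun t : ℝ => t ^ (-(γ / 2))) atTop (nhds 0) :=
    tendsto_rpow_neg_atTop (by linarith)
  have := this.const_mul (A * C * K)
  rw [mul_zero] at this
  simpa only [show 1 + α - (1 + α + γ / 2) = -(γ / 2) by ring] using this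

end Inversion

section Spectrum

variable {N : ℕ} {α β γ p q : ℝ}

instance : (sm N).IsOpenPosMeasure := by unfold sm; infer_instance

lemma neg_eq_rot (σ : Sph N) : -σ = rot (LinearIsometryEquiv.neg ℝ) σ := by ext1; simp

lemma integral_neg_sph (f : Sph N → ℝ) : ∫ σ, f (-σ) ∂(sm N) = ∫ σ, f σ ∂(sm N) := by
  simp_rw [neg_eq_rot]; exact integral_rot _ f

lemma integrable_neg_sph {f : Sph N → ℝ} :
    Integrable (fun σ => f (-σ)) (sm N) ↔ Integrable f (sm N) := by
  simp_rw [neg_eq_rot]; exact integrable_rot _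

lemma dist_neg_neg_sph (σ τ : Sph N) : dist (-σ) (-τ) = dist σ τ := by
  rw [neg_eq_rot, neg_eq_rot, dist_rot]

lemma integral_zonal (F : ℝ → ℝ) (θ τ : Sph N) :
    ∫ ω, F (dist ω θ) ∂(sm N) = ∫ ω, F (dist ω τ) ∂(sm N) := by
  obtain ⟨R, rfl⟩ := exists_rot_eq θ τ
  rw [← integral_rot R (fun ω => F (dist ω (rot R θ)))]
  simp only [dist_rot]

lemma exists_sph (hN : 2 ≤ N) : Nonempty (Sph N) := by
  have : Nontrivial (EE N) := Module.nontrivial_of_finrank_pos (R := ℝ) (by simp; omega)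
  obtain ⟨x, hx⟩ := NormedSpace.sphere_nonempty (E := EE N) (x := 0) (r := 1) |>.2 zero_le_one
  exact ⟨⟨x, hx⟩⟩

lemma sm_ne_zero (hN : 2 ≤ N) : sm N ≠ 0 := by
  intro h
  obtain ⟨x⟩ := exists_sph hN
  have := isOpen_univ.measure_ne_zero (sm N) ⟨x, trivial⟩
  simp [h] at this

lemma integral_sph_pos (hN : 2 ≤ N) {g : Sph N → ℝ} (hg : Integrable g (sm N)) (θ : Sph N)
    (h : ∀ ω, ω ≠ θ → 0 < g ω) : 0 < ∫ ω, g ω ∂(sm N) := by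
  have hne : ∀ᵐ ω ∂(sm N), ω ≠ θ := by
    rw [ae_iff]; simpa using sm_singleton θ hN
  rw [integral_pos_iff_support_of_nonneg_ae (hne.mono fun ω hω => (h ω hω).le) hg]
  have : ({θ} : Set (Sph N))ᶜ ⊆ Function.support g := fun ω hω => (h ω hω).ne'
  refine lt_of_lt_of_le ?_ (measure_mono this)
  rw [measure_compl (measurableSet_singleton θ) (measure_ne_top _ _), sm_singleton θ hN, tsub_zero]
  exact pos_iff_ne_zero.2 (by simpa using sm_ne_zero hN)

lemma inner_eq_dist (θ ω : Sph N) : inner ℝ (θ : EE N) (ω : EE N) = 1 - dist ω θ ^ 2 / 2 := by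
  rw [dist_comm, dist_sq]; ring

lemma hol_lin (hγ : 0 < γ) (hγ1 : γ ≤ 1) (v : EE N) :
    Hol γ (2 * ‖v‖) (fun θ : Sph N => inner ℝ v (θ : EE N)) := by
  refine ⟨fun θ => ?_, fun θ τ => ?_⟩
  · refine (abs_real_inner_le_norm _ _).trans ?_
    rw [norm_coe]; linarith [norm_nonneg v]
  · rw [← inner_sub_right]
    refine (abs_real_inner_le_norm _ _).trans ?_
    rw [← dist_coe]
    rcases (dist_nonneg (x := θ) (y := τ)).eq_or_lt with h | h
    · rw [← h]; simp; positivity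
    · have : dist θ τ ≤ 2 * dist θ τ ^ γ := by
        calc dist θ τ = dist θ τ ^ (1 - γ) * dist θ τ ^ γ := by
              rw [← Real.rpow_add h]; simp
          _ ≤ 2 ^ (1 - γ) * dist θ τ ^ γ := by gcongr; exact dist_le_two _ _
          _ ≤ 2 ^ (1 : ℝ) * dist θ τ ^ γ := by gcongr <;> linarith
          _ = _ := by simp
      nlinarith [norm_nonneg v]

lemma inner_add_opp (v : EE N) (θ ω : Sph N) :
    inner ℝ v (ω : EE N) + inner ℝ v (opp θ ω : EE N) =
      2 * inner ℝ (θ : EE N) (ω : EE N) * inner ℝ v (θ : EE N) := by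
  rw [coe_opp, inner_sub_right, inner_smul_right]; ring

lemma pot_lin {θ : Sph N} (hi : Integrable (fun ω => dist ω θ ^ p) (sm N)) (v : EE N) :
    pot p (fun ω => inner ℝ v (ω : EE N)) θ =
      (∫ ω, dist ω θ ^ p * inner ℝ (θ : EE N) (ω : EE N) ∂(sm N)) * inner ℝ v (θ : EE N) := by
  have i1 := integrable_dist_mul hi (f := fun ω => inner ℝ v (ω : EE N)) (by fun_prop)
  have i2 := (integrable_opp θ).2 i1
  have h1 : pot p (fun ω => inner ℝ v (ω : EE N)) θ =
      ∫ ω, dist (opp θ ω) θ ^ p * inner ℝ v (opp θ ω : EE N) ∂(sm N) :=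
    (integral_opp θ (fun ω => dist ω θ ^ p * inner ℝ v (ω : EE N))).symm
  have h2 : 2 * pot p (fun ω => inner ℝ v (ω : EE N)) θ = 2 *
      ((∫ ω, dist ω θ ^ p * inner ℝ (θ : EE N) (ω : EE N) ∂(sm N)) * inner ℝ v (θ : EE N)) := by
    rw [two_mul]
    nth_rewrite 2 [h1]
    rw [pot, ← integral_add i1 i2, ← integral_mul_const, ← integral_const_mul]
    congr 1; ext ω
    rw [dist_opp, ← mul_add, inner_add_opp]; ring
  linarith

lemma frac_lin (α : ℝ) (θ : Sph N) (v : EE N) :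
    frac α (fun ω => inner ℝ v (ω : EE N)) θ =
      (∫ ω, (1 - inner ℝ (θ : EE N) (ω : EE N)) * dist ω θ ^ (-((N : ℝ) + α)) ∂(sm N)) *
        inner ℝ v (θ : EE N) := by
  rw [frac, ← integral_const_mul, ← integral_mul_const]
  congr 1; ext ω
  have := inner_add_opp v θ ω
  linear_combination (-1 / 2 * dist ω θ ^ (-((N : ℝ) + α))) * this

lemma one_sub_inner_pos {θ ω : Sph N} (h : ω ≠ θ) :
    0 < 1 - inner ℝ (θ : EE N) (ω : EE N) := by
  rw [inner_eq_dist]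
  have : 0 < dist ω θ := dist_pos.2 h
  have : 0 < dist ω θ ^ 2 := by positivity
  linarith

lemma dist_neg_sq (ω θ : Sph N) :
    dist (-ω) θ ^ 2 = 2 + 2 * inner ℝ (θ : EE N) (ω : EE N) := by
  rw [dist_sq, coe_neg_sphere, inner_neg_left, real_inner_comm]; ring

lemma integral_dist_inner_ne_zero (hN : 2 ≤ N) (hp0 : p ≠ 0) {θ : Sph N}
    (hi : Integrable (fun ω => dist ω θ ^ p) (sm N)) :
    ∫ ω, dist ω θ ^ p * inner ℝ (θ : EE N) (ω : EE N) ∂(sm N) ≠ 0 := by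
  have i1 := integrable_dist_mul hi (f := fun ω => inner ℝ (θ : EE N) (ω : EE N)) (by fun_prop)
  have i2 := integrable_neg_sph.2 i1
  intro h0
  have h1 : ∫ ω, (dist ω θ ^ p - dist (-ω) θ ^ p) * inner ℝ (θ : EE N) (ω : EE N) ∂(sm N) = 0 := by
    have : ∀ ω : Sph N, (dist ω θ ^ p - dist (-ω) θ ^ p) * inner ℝ (θ : EE N) (ω : EE N) =
        dist ω θ ^ p * inner ℝ (θ : EE N) (ω : EE N) +
          dist (-ω) θ ^ p * inner ℝ (θ : EE N) ((-ω : Sph N) : EE N) := fun ω => by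
      rw [coe_neg_sphere, inner_neg_right]; ring
    simp_rw [this]
    rw [integral_add i1 i2, integral_neg_sph (fun ω => dist ω θ ^ p * inner ℝ (θ : EE N) (ω : EE N)),
      h0, add_zero]
  have i3 : Integrable (fun ω => (dist ω θ ^ p - dist (-ω) θ ^ p) *
      inner ℝ (θ : EE N) (ω : EE N)) (sm N) := by
    have := i1.add i2
    refine this.congr (Eventually.of_forall fun ω => ?_)
    simp only [Pi.add_apply, coe_neg_sphere, inner_neg_right]; ring
  have ne1 : ∀ᵐ ω ∂(sm N), ω ≠ θ := by rw [ae_iff]; simpa using sm_singleton θ hN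
  have ne2 : ∀ᵐ ω : Sph N ∂(sm N), ω ≠ -θ := by
    rw [ae_iff]; simpa using sm_singleton (-θ) hN
  have lt_sq : ∀ {x y : ℝ}, 0 < y → x ^ 2 < y ^ 2 → x < y := fun hy h =>
    lt_of_pow_lt_pow_left₀ 2 hy.le h
  have key : ∀ᵐ ω : Sph N ∂(sm N), inner ℝ (θ : EE N) (ω : EE N) ≠ 0 →
      p * ((dist ω θ ^ p - dist (-ω) θ ^ p) * inner ℝ (θ : EE N) (ω : EE N)) < 0 := by
    filter_upwards [ne1, ne2] with ω h1 h2 hne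
    have d1 : 0 < dist ω θ := dist_pos.2 h1
    have d2 : 0 < dist (-ω) θ := dist_pos.2 fun h => h2 (by rw [← h, neg_neg])
    have s1 := dist_sq ω θ
    rw [real_inner_comm] at s1
    have s2 := dist_neg_sq ω θ
    rcases hne.lt_or_gt with hs | hs
    · have hlt : dist (-ω) θ < dist ω θ := lt_sq d1 (by linarith)
      rcases hp0.lt_or_gt with hp | hp
      · have := Real.rpow_lt_rpow_of_neg d2 hlt hp
        nlinarith [mul_pos (mul_pos (neg_pos.2 hp) (neg_pos.2 hs)) (sub_pos.2 this)]
      · have := Real.rpow_lt_rpow d2.le hlt hp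
        nlinarith [mul_pos (mul_pos hp (neg_pos.2 hs)) (sub_pos.2 this)]
    · have hlt : dist ω θ < dist (-ω) θ := lt_sq d2 (by linarith)
      rcases hp0.lt_or_gt with hp | hp
      · have := Real.rpow_lt_rpow_of_neg d1 hlt hp
        nlinarith [mul_pos (mul_pos (neg_pos.2 hp) hs) (sub_pos.2 this)]
      · have := Real.rpow_lt_rpow d1.le hlt hp
        nlinarith [mul_pos (mul_pos hp hs) (sub_pos.2 this)]
  have h2 : ∫ ω, -(p * ((dist ω θ ^ p - dist (-ω) θ ^ p) * inner ℝ (θ : EE N) (ω : EE N)))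
      ∂(sm N) = 0 := by
    rw [integral_neg, integral_const_mul, h1]; simp
  have h3 := (integral_eq_zero_iff_of_nonneg_ae ?_ (i3.const_mul p).neg).1 h2
  · have h4 : (fun ω : Sph N => (inner ℝ (θ : EE N) (ω : EE N) : ℝ)) =ᵐ[sm N] fun _ => 0 := by
      filter_upwards [h3, key] with ω k1 k2
      by_contra hne
      have := k2 hne
      simp only [Pi.neg_apply, Pi.zero_apply, neg_eq_zero] at k1
      linarith
    have h5 := (Continuous.ae_eq_iff_eq (sm N) (by fun_prop) continuous_const).1 h4
    have := congrFun h5 θ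
    simp at this
  · filter_upwards [key] with ω k
    by_cases h : inner ℝ (θ : EE N) (ω : EE N) = 0
    · simp [h]
    · have := k h
      simp only [Pi.zero_apply, Pi.neg_apply]
      linarith

/-- Spectral data of the Riesz potential and the fractional operator, and the inversion formula
relating them. -/
lemma exists_inversion (hN : 2 ≤ N) (hα : α ∈ Set.Ioo (0 : ℝ) 1) (hp : p = 2 + α - N)
    (hp0 : p ≠ 0) (hp1 : p ≠ 1) : ∃ k μ l s : ℝ, 0 < k ∧ μ < k ∧ μ ≠ 0 ∧ 0 < l ∧
      s * (μ - k) = μ * l ∧ (∀ θ, pot p (fun _ => 1) (θ : Sph N) = k) ∧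
      (∀ (v : EE N) (θ : Sph N), pot p (fun ω => inner ℝ v (ω : EE N)) θ = μ * inner ℝ v (θ : EE N)) ∧
      (∀ (v : EE N) (θ : Sph N), frac α (fun ω => inner ℝ v (ω : EE N)) θ = l * inner ℝ v (θ : EE N)) ∧
      ∀ γ : ℝ, 0 < γ → α + γ < 1 → ∀ (f : Sph N → ℝ) (A : ℝ), Hol γ A f → ∀ θ,
        frac α (pot p f) θ = s * (pot p f θ - k * f θ) := by
  have h2 : (2:ℝ) ≤ N := by exact_mod_cast hN
  obtain ⟨hα0, hα1⟩ := hα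
  obtain ⟨e⟩ := exists_sph hN
  obtain ⟨L, hL0, HL⟩ := exists_sph_full hN (q := p) hp0 (by linarith)
  obtain ⟨M, hM0, HM⟩ := exists_sph_full hN (q := 2 + -((N : ℝ) + α)) (by linarith) (by linarith)
  set k := pot p (fun _ => 1) e with hk
  set μ := ∫ ω, dist ω e ^ p * inner ℝ (e : EE N) (ω : EE N) ∂(sm N) with hμ
  set l := ∫ ω, (1 - inner ℝ (e : EE N) (ω : EE N)) * dist ω e ^ (-((N : ℝ) + α)) ∂(sm N) with hl
  have k0 : 0 < k := by
    have := integral_sph_pos hN (HL e).1 e fun ω hω => Real.rpow_pos_of_pos (dist_pos.2 hω) _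
    simpa [hk, pot] using this
  have hμk : μ < k := by
    have i1 := integrable_dist_mul (HL e).1 (f := fun ω => inner ℝ (e : EE N) (ω : EE N))
      (by fun_prop)
    have i2 := integrable_dist_mul (HL e).1 (f := fun _ => 1) (by fun_prop)
    have i3 : Integrable (fun ω => dist ω e ^ p * 1 -
      dist ω e ^ p * inner ℝ (e : EE N) (ω : EE N)) (sm N) := i2.sub i1
    have := integral_sph_pos hN i3 e fun ω hω => by
      rw [← mul_sub]
      exact mul_pos (Real.rpow_pos_of_pos (dist_pos.2 hω) _) (one_sub_inner_pos hω)
    rw [integral_sub i2 i1] at this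
    linarith [show k = ∫ ω, dist ω e ^ p * 1 ∂(sm N) from rfl]
  have l0 : 0 < l := by
    refine integral_sph_pos hN ?_ e fun ω hω =>
      mul_pos (one_sub_inner_pos hω) (Real.rpow_pos_of_pos (dist_pos.2 hω) _)
    refine ((HM e).1.const_mul (1 / 2)).congr (Eventually.of_forall fun ω => ?_)
    simp only [inner_eq_dist]
    rcases (dist_nonneg (x := ω) (y := e)).eq_or_lt with h | h
    · rw [← h, Real.zero_rpow (by linarith), Real.zero_rpow (by linarith)]; simp
    · rw [Real.rpow_add h]; norm_num; ring
  have hμθ : ∀ θ : Sph N, ∫ ω, dist ω θ ^ p * inner ℝ (θ : EE N) (ω : EE N) ∂(sm N) = μ := by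
    intro θ
    simp_rw [hμ, inner_eq_dist]
    exact integral_zonal (fun d => d ^ p * (1 - d ^ 2 / 2)) θ e
  have hlθ : ∀ θ : Sph N, ∫ ω, (1 - inner ℝ (θ : EE N) (ω : EE N)) *
      dist ω θ ^ (-((N : ℝ) + α)) ∂(sm N) = l := by
    intro θ
    simp_rw [hl, inner_eq_dist]
    exact integral_zonal (fun d => (1 - (1 - d ^ 2 / 2)) * d ^ (-((N : ℝ) + α))) θ e
  have Hk : ∀ θ : Sph N, pot p (fun _ => 1) θ = k := fun θ => pot_const p 1 θ e
  have Hμ : ∀ (v : EE N) (θ : Sph N), pot p (fun ω => inner ℝ v (ω : EE N)) θ = μ * inner ℝ v (θ : EE N) :=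
    fun v θ => by rw [pot_lin (HL θ).1, hμθ]
  have Hl : ∀ (v : EE N) (θ : Sph N), frac α (fun ω => inner ℝ v (ω : EE N)) θ = l * inner ℝ v (θ : EE N) :=
    fun v θ => by rw [frac_lin, hlθ]
  have hμk' : μ - k ≠ 0 := by linarith
  refine ⟨k, μ, l, μ * l / (μ - k), k0, hμk, integral_dist_inner_ne_zero hN hp0 (HL e).1, l0,
    by field_simp, Hk, Hμ, Hl, fun γ hγ hαγ f A hf θ => ?_⟩
  obtain ⟨C, hC, HC⟩ := exists_pot_XB hN ⟨hα0, hα1⟩ hγ hαγ hp hp0 hp1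
  have main : ∀ (f : Sph N → ℝ) (A : ℝ), Hol γ A f → Tendsto (fun t =>
      invConst α p θ t * (pot p f θ - k * f θ)) atTop (nhds (frac α (pot p f) θ)) := by
    intro f A hf
    have t1 := trunc_pot_tendsto θ hN ⟨hα0, hα1⟩ hγ hαγ hp hp0 hf
    have t2 := tendsto_trunc hN (by linarith) hα0 hαγ.le (HC f A hf) θ
    have := t2.sub t1
    simpa [Hk] using this
  have t1 := main _ _ (hol_lin hγ (by linarith) (θ : EE N))
  have hfr : frac α (pot p fun ω => inner ℝ (θ : EE N) (ω : EE N)) θ = μ * l := by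
    have : (pot p fun ω => inner ℝ (θ : EE N) (ω : EE N)) =
        fun ω : Sph N => inner ℝ (μ • (θ : EE N)) (ω : EE N) := by
      ext ω; rw [Hμ, inner_smul_left]; simp
    rw [this, Hl, inner_smul_left, real_inner_self_eq_norm_sq, norm_coe]; simp; ring
  rw [hfr, Hμ] at t1
  simp only [real_inner_self_eq_norm_sq, norm_coe, one_pow, mul_one] at t1
  have t2 : Tendsto (invConst α p θ) atTop (nhds (μ * l / (μ - k))) := by
    have := t1.div_const (μ - k)
    simpa [hμk'] using this
  exact tendsto_nhds_unique (main f A hf) (t2.mul_const _)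

end Spectrum

section Nondegenerate

variable {N : ℕ} {p : ℝ}

lemma continuous_comp_rot (R : EE N ≃ₗᵢ[ℝ] EE N) {f : Sph N → ℝ} (hf : Continuous f) :
    Continuous fun σ => f (rot R σ) := hf.comp (continuous_rot R)

lemma integral_dist_prod_mul (hN : 2 ≤ N) (hp0 : p ≠ 0) (hp : 0 < (N : ℝ) - 1 + p)
    {A B : Sph N → ℝ} {a b : ℝ} (hA : Measurable A) (hB : Measurable B) (ha : ∀ σ, |A σ| ≤ a)
    (hb : ∀ σ, |B σ| ≤ b) :
    Integrable (fun z : Sph N × Sph N => dist z.2 z.1 ^ p * (A z.1 * B z.2)) ((sm N).prod (sm N)) ∧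
    ∫ z, dist z.2 z.1 ^ p * (A z.1 * B z.2) ∂((sm N).prod (sm N)) =
      ∫ σ, A σ * pot p B σ ∂(sm N) := by
  have i1 : Integrable (fun z : Sph N × Sph N => dist z.2 z.1 ^ p * (A z.1 * B z.2))
      ((sm N).prod (sm N)) := by
    refine (integrable_dist_prod hN hp0 hp).mul_bdd (c := a * b)
      (Measurable.aestronglyMeasurable (by fun_prop)) (Eventually.of_forall fun z => ?_)
    rw [Real.norm_eq_abs, abs_mul]
    exact mul_le_mul (ha _) (hb _) (abs_nonneg _) ((abs_nonneg _).trans (ha z.1))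
  refine ⟨i1, ?_⟩
  rw [integral_prod _ i1]
  congr 1; ext σ
  rw [pot, ← integral_const_mul]
  congr 1; ext ω
  ring

lemma integral_dist_prod_mul' (hN : 2 ≤ N) (hp0 : p ≠ 0) (hp : 0 < (N : ℝ) - 1 + p)
    {A B : Sph N → ℝ} {a b : ℝ} (hA : Measurable A) (hB : Measurable B) (ha : ∀ σ, |A σ| ≤ a)
    (hb : ∀ σ, |B σ| ≤ b) :
    Integrable (fun z : Sph N × Sph N => dist z.2 z.1 ^ p * (B z.1 * A z.2)) ((sm N).prod (sm N)) ∧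
    ∫ z, dist z.2 z.1 ^ p * (B z.1 * A z.2) ∂((sm N).prod (sm N)) =
      ∫ σ, A σ * pot p B σ ∂(sm N) := by
  obtain ⟨h1, h2⟩ := integral_dist_prod_mul hN hp0 hp hA hB ha hb
  have e : ∀ z : Sph N × Sph N, dist z.2 z.1 ^ p * (B z.1 * A z.2) =
      (fun z : Sph N × Sph N => dist z.2 z.1 ^ p * (A z.1 * B z.2)) z.swap := fun z => by
    simp only [Prod.snd_swap, Prod.fst_swap, dist_comm z.1 z.2]; ring
  simp_rw [e]
  refine ⟨h1.swap, ?_⟩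
  rw [integral_prod_swap (fun z : Sph N × Sph N => dist z.2 z.1 ^ p * (A z.1 * B z.2)), h2]

/-- The reflection in the hyperplane orthogonal to `v`. -/
noncomputable abbrev hrefl (v : Sph N) : EE N ≃ₗᵢ[ℝ] EE N := (ℝ ∙ (v : EE N))ᗮ.reflection

lemma hrefl_apply (v : Sph N) (x : EE N) :
    hrefl v x = x - (2 * inner ℝ (v : EE N) x) • (v : EE N) := by
  rw [hrefl, Submodule.reflection_orthogonal_apply, Submodule.reflection_singleton_apply]
  simp only [norm_coe, one_pow, RCLike.ofReal_real_eq_id, id_eq, div_one]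
  module

lemma inner_hrefl (v : Sph N) (x : EE N) :
    inner ℝ (v : EE N) (hrefl v x) = - inner ℝ (v : EE N) x := by
  rw [hrefl_apply, inner_sub_right, inner_smul_right, real_inner_self_eq_norm_sq, norm_coe]; ring

lemma rot_hrefl_rot (v σ : Sph N) : rot (hrefl v) (rot (hrefl v) σ) = σ := by
  ext1; simp

lemma dist_rot_hrefl (v σ : Sph N) :
    dist σ (rot (hrefl v) σ) = 2 * |inner ℝ (v : EE N) (σ : EE N)| := by
  rw [dist_coe, coe_rot, hrefl_apply, sub_sub_cancel, norm_smul, norm_coe, mul_one,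
    Real.norm_eq_abs, abs_mul, abs_two]

lemma dist_rot_hrefl_sq (v σ ω : Sph N) : dist (rot (hrefl v) ω) σ ^ 2 = dist ω σ ^ 2 +
    4 * (inner ℝ (v : EE N) (σ : EE N) * inner ℝ (v : EE N) (ω : EE N)) := by
  rw [dist_sq, dist_sq, coe_rot, hrefl_apply, inner_sub_left, inner_smul_left]
  simp only [conj_trivial]; ring

/-- An eigenfunction of the Riesz potential that shares the eigenvalue of the linear functions is,
after antisymmetrization, a linear function. -/
lemma eigen_antisymm (hN : 2 ≤ N) (hp0 : p ≠ 0) (hp : 0 < (N : ℝ) - 1 + p) {μ L : ℝ} (v : Sph N)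
    {ψ : Sph N → ℝ} (hψ : Continuous ψ) (hL : ∀ σ, |ψ σ| ≤ L * |inner ℝ (v : EE N) (σ : EE N)|)
    (hodd : ∀ σ, ψ (rot (hrefl v) σ) = - ψ σ)
    (hKψ : ∀ σ, pot p ψ σ = μ * ψ σ)
    (hKh : ∀ σ : Sph N, pot p (fun ω => inner ℝ (v : EE N) (ω : EE N)) σ =
      μ * inner ℝ (v : EE N) (σ : EE N)) (σ : Sph N) :
    ψ σ = ψ v * inner ℝ (v : EE N) (σ : EE N) := by
  set h : Sph N → ℝ := fun σ => inner ℝ (v : EE N) (σ : EE N) with hh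
  have hhc : Continuous h := by fun_prop
  have hvn : ∀ σ, |h σ| ≤ 1 := fun σ => by
    have := abs_real_inner_le_norm (v : EE N) (σ : EE N); simpa using this
  have hvv : h v = 1 := by simp [hh]
  have hL0 : 0 ≤ L := by
    have := (abs_nonneg _).trans (hL v)
    change 0 ≤ L * |h v| at this
    rw [hvv] at this; simpa using this
  set w : Sph N → ℝ := fun σ => ψ σ / h σ with hw
  have hwh : ∀ σ, w σ * h σ = ψ σ := fun σ => by
    by_cases h0 : h σ = 0
    · have := hL σ
      change _ ≤ L * |h σ| at this
      rw [h0, abs_zero, mul_zero] at this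
      rw [h0, mul_zero]; exact (abs_eq_zero.1 (le_antisymm this (abs_nonneg _))).symm
    · simp [hw, h0]
  have hwb : ∀ σ, |w σ| ≤ L := fun σ => by
    by_cases h0 : h σ = 0
    · simp [hw, h0, hL0]
    · rw [hw]; simp only [abs_div]
      rw [div_le_iff₀ (abs_pos.2 h0)]; exact hL σ
  have hψb : ∀ σ, |ψ σ| ≤ L := fun σ => (hL σ).trans (by
    have := hvn σ; change L * |h σ| ≤ L; nlinarith)
  have hwm : Measurable w := hψ.measurable.div hhc.measurable
  have hRh : ∀ σ, h (rot (hrefl v) σ) = - h σ := fun σ => inner_hrefl v σ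
  have hRw : ∀ σ, w (rot (hrefl v) σ) = w σ := fun σ => by simp only [hw, hodd, hRh, neg_div_neg_eq]
  set P := (sm N).prod (sm N)
  set H : Sph N × Sph N → ℝ := fun z => h z.1 * h z.2 * (w z.1 - w z.2) ^ 2 with hH
  set k : Sph N × Sph N → ℝ := fun z => dist z.2 z.1 ^ p with hk
  set S : Sph N × Sph N → Sph N × Sph N := Prod.map id (rot (hrefl v)) with hS
  have hSP : MeasurePreserving S P P :=
    (MeasurePreserving.id _).prod (measurePreserving_rot (hrefl v))
  have hSe : MeasurableEmbedding S :=
    MeasurableEmbedding.id.prodMap (rotHomeo (hrefl v)).measurableEmbedding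
  have hHS : ∀ z, H (S z) = - H z := fun z => by
    simp only [hH, hS, Prod.map_fst, Prod.map_snd, id_eq, hRh, hRw]; ring
  have ψw : ∀ σ, |ψ σ * w σ| ≤ L * L := fun σ => by
    rw [abs_mul]; exact mul_le_mul (hψb _) (hwb _) (abs_nonneg _) hL0
  obtain ⟨a1, a2⟩ := integral_dist_prod_mul hN hp0 hp (A := fun σ => ψ σ * w σ) (hψ.measurable.mul hwm) hhc.measurable
    ψw hvn
  obtain ⟨b1, b2⟩ := integral_dist_prod_mul' hN hp0 hp (A := fun σ => ψ σ * w σ) (hψ.measurable.mul hwm) hhc.measurable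
    ψw hvn
  obtain ⟨c1, c2⟩ := integral_dist_prod_mul hN hp0 hp hψ.measurable hψ.measurable hψb hψb
  have e1 : ∀ z, k z * H z = k z * (ψ z.1 * w z.1 * h z.2) + k z * (h z.1 * (ψ z.2 * w z.2)) -
      2 * (k z * (ψ z.1 * ψ z.2)) := fun z => by
    simp only [hH]; rw [← hwh z.1, ← hwh z.2]; ring
  have ab : Integrable (fun z => k z * (ψ z.1 * w z.1 * h z.2) +
      k z * (h z.1 * (ψ z.2 * w z.2))) P := a1.add b1
  have ikH : Integrable (fun z => k z * H z) P := by
    simp_rw [e1]; exact ab.sub (c1.const_mul 2)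
  have I0 : ∫ z, k z * H z ∂P = 0 := by
    simp_rw [e1]
    rw [integral_sub ab (c1.const_mul 2), integral_const_mul,
      integral_add a1 b1]
    rw [a2, b2, c2]
    have k1 : ∀ σ, ψ σ * w σ * pot p h σ = μ * (ψ σ * ψ σ) := fun σ => by
      rw [hKh]; change ψ σ * w σ * (μ * h σ) = _; rw [← hwh σ]; ring
    have k2 : ∀ σ, ψ σ * pot p ψ σ = μ * (ψ σ * ψ σ) := fun σ => by rw [hKψ]; ring
    simp_rw [k1, k2]; ring
  have ikS : Integrable (fun z => k (S z) * H z) P := by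
    have := ((hSP.integrable_comp_emb hSe).2 ikH).neg
    refine this.congr (Eventually.of_forall fun z => ?_)
    simp only [Pi.neg_apply, Function.comp_apply, hHS]; ring
  have IS : ∫ z, k (S z) * H z ∂P = 0 := by
    have := hSP.integral_comp hSe (fun z => k z * H z)
    rw [I0] at this
    simp_rw [hHS, mul_neg, integral_neg] at this
    linarith
  have hdS : ∀ z : Sph N × Sph N, dist (S z).2 (S z).1 ^ 2 =
      dist z.2 z.1 ^ 2 + 4 * (h z.1 * h z.2) := fun z => dist_rot_hrefl_sq v z.1 z.2
  have lt_sq : ∀ {x y : ℝ}, 0 < y → x ^ 2 < y ^ 2 → x < y := fun hy h =>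
    lt_of_pow_lt_pow_left₀ 2 hy.le h
  have key : ∀ z : Sph N × Sph N, 0 < dist z.2 z.1 → 0 < dist (S z).2 (S z).1 →
      0 ≤ -p * ((k z - k (S z)) * H z) ∧ ((k z - k (S z)) * H z = 0 → H z = 0) := by
    intro z d1 d2
    have hz := hdS z
    have sq0 := sq_nonneg (w z.1 - w z.2)
    have hpk : h z.1 * h z.2 ≠ 0 → 0 < -p * (k z - k (S z)) * (h z.1 * h z.2) := by
      intro h0
      rcases h0.lt_or_gt with hs | hs
      · have hlt : dist (S z).2 (S z).1 < dist z.2 z.1 := lt_sq d1 (by linarith)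
        rcases hp0.lt_or_gt with hp' | hp'
        · have := Real.rpow_lt_rpow_of_neg d2 hlt hp'
          exact mul_pos_of_neg_of_neg (mul_neg_of_pos_of_neg (by linarith) (by
            simp only [hk]; linarith)) hs
        · have := Real.rpow_lt_rpow d2.le hlt hp'
          exact mul_pos_of_neg_of_neg (mul_neg_of_neg_of_pos (by linarith) (by
            simp only [hk]; linarith)) hs
      · have hlt : dist z.2 z.1 < dist (S z).2 (S z).1 := lt_sq d2 (by linarith)
        rcases hp0.lt_or_gt with hp' | hp'
        · have := Real.rpow_lt_rpow_of_neg d1 hlt hp'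
          exact mul_pos (mul_pos (by linarith) (by simp only [hk]; linarith)) hs
        · have := Real.rpow_lt_rpow d1.le hlt hp'
          exact mul_pos (mul_pos_of_neg_of_neg (by linarith) (by simp only [hk]; linarith)) hs
    by_cases h0 : h z.1 * h z.2 = 0
    · have : H z = 0 := by simp only [hH, h0, zero_mul]
      simp [this]
    · have hpos := hpk h0
      have e : -p * ((k z - k (S z)) * H z) =
          (-p * (k z - k (S z)) * (h z.1 * h z.2)) * (w z.1 - w z.2) ^ 2 := by
        simp only [hH]; ring
      refine ⟨by rw [e]; positivity, fun h1 => ?_⟩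
      rw [h1, mul_zero] at e
      have := (mul_eq_zero.1 e.symm).resolve_left hpos.ne'
      simp only [hH, this, mul_zero]
  have kS : Continuous S := continuous_id.prodMap (continuous_rot _)
  have ne1 : ∀ T : Sph N × Sph N → Sph N × Sph N, MeasurePreserving T P P →
      ∀ᵐ z ∂P, 0 < dist (T z).2 (T z).1 := by
    intro T hT
    have : ∀ᵐ z ∂P, 0 < dist z.2 z.1 := by
      refine (Measure.ae_prod_iff_ae_ae (measurableSet_lt measurable_const
        (measurable_snd.dist measurable_fst))).2 (Eventually.of_forall fun σ => ?_)
      have : ∀ᵐ ω ∂(sm N), ω ≠ σ := by rw [ae_iff]; simpa using sm_singleton σ hN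
      exact this.mono fun ω hω => dist_pos.2 hω
    exact hT.quasiMeasurePreserving.ae this
  have n1 := ne1 id (MeasurePreserving.id _)
  have n2 := ne1 S hSP
  have iD : Integrable (fun z => -p * ((k z - k (S z)) * H z)) P := by
    have := (ikH.sub ikS).const_mul (-p)
    refine this.congr (Eventually.of_forall fun z => ?_)
    simp only [Pi.sub_apply]; ring
  have ID : ∫ z, -p * ((k z - k (S z)) * H z) ∂P = 0 := by
    rw [integral_const_mul]
    simp_rw [sub_mul]
    rw [integral_sub ikH ikS, I0, IS]; simp
  have z1 := (integral_eq_zero_iff_of_nonneg_ae (by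
    filter_upwards [n1, n2] with z d1 d2 using (key z d1 d2).1) iD).1 ID
  have z2 : (fun z : Sph N × Sph N => dist z.2 z.1 * dist (S z).2 (S z).1 *
      (ψ z.1 * h z.2 - ψ z.2 * h z.1)) =ᵐ[P] fun _ => 0 := by
    filter_upwards [n1, n2, z1] with z d1 d2 hz
    have hH0 := (key z d1 d2).2 (by
      simp only [Pi.zero_apply, mul_eq_zero, neg_eq_zero, hp0, false_or] at hz
      simpa [mul_eq_zero] using hz)
    have : (ψ z.1 * h z.2 - ψ z.2 * h z.1) ^ 2 = 0 := by
      have e : (ψ z.1 * h z.2 - ψ z.2 * h z.1) ^ 2 = H z * (h z.1 * h z.2) := by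
        simp only [hH]; rw [← hwh z.1, ← hwh z.2]; ring
      rw [e, hH0, zero_mul]
    rw [pow_eq_zero_iff two_ne_zero] at this
    rw [this, mul_zero]
  have z3 := (Continuous.ae_eq_iff_eq P (by
    have := (continuous_snd.comp kS).dist (continuous_fst.comp kS)
    simp only [Function.comp_def] at this
    fun_prop) continuous_const).1 z2
  have z4 := congrFun z3 (σ, v)
  simp only [hvv, mul_one] at z4
  rcases mul_eq_zero.1 z4 with h0 | h0
  · rcases mul_eq_zero.1 h0 with h0 | h0
    · have : v = σ := dist_eq_zero.1 h0
      rw [← this]; change _ = _ * h v; rw [hvv, mul_one]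
    · have : rot (hrefl v) v = σ := dist_eq_zero.1 h0
      rw [← this, hodd]; change _ = ψ v * h (rot (hrefl v) v)
      rw [hRh, hvv]; ring
  · change _ = _ * h σ; linarith

end Nondegenerate

section Solver

variable {N : ℕ} {p : ℝ}

lemma rot_hrefl_self (v : Sph N) : rot (hrefl v) v = -v := by
  ext1
  rw [coe_rot, hrefl_apply, real_inner_self_eq_norm_sq, norm_coe]
  simp only [Metric.sphere, coe_neg_sphere]
  module

lemma exists_rot_hrefl_eq {σ τ : Sph N} (h : σ ≠ τ) : ∃ v : Sph N, rot (hrefl v) σ = τ := by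
  have h0 : (σ : EE N) - τ ≠ 0 := fun e => h (Subtype.ext (sub_eq_zero.1 e))
  refine ⟨⟨‖(σ : EE N) - τ‖⁻¹ • ((σ : EE N) - τ), by simp [norm_smul, h0]⟩, ?_⟩
  ext1
  rw [coe_rot, hrefl_apply]
  have hn : ‖(σ : EE N) - τ‖ ≠ 0 := norm_ne_zero_iff.2 h0
  have h1 : inner ℝ ((σ : EE N) - τ) (σ : EE N) = ‖(σ : EE N) - τ‖ ^ 2 / 2 := by
    rw [norm_sub_sq_real, inner_sub_left, real_inner_self_eq_norm_sq, norm_coe, norm_coe,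
      real_inner_comm]; ring
  simp only [inner_smul_left, h1, smul_smul, conj_trivial]
  have : 2 * (‖(σ : EE N) - τ‖⁻¹ * (‖(σ : EE N) - τ‖ ^ 2 / 2)) * ‖(σ : EE N) - τ‖⁻¹ = 1 := by
    field_simp
  rw [this, one_smul, sub_sub_cancel]

lemma continuous_pot (hN : 2 ≤ N) (hp : p ≠ 0) (hp1 : p ≠ 1) (hp2 : 0 < (N : ℝ) - 2 + p)
    {f : Sph N → ℝ} (hf : Continuous f) : Continuous (pot p f) := by
  obtain ⟨C, hC, H⟩ := exists_pot_lip hN hp hp1 hp2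
  obtain ⟨A, hA⟩ := bounded_of_continuous hf
  obtain ⟨e⟩ := exists_sph hN
  have hA0 : 0 ≤ A := (abs_nonneg _).trans (hA e)
  exact (LipschitzWith.of_dist_le_mul (K := ⟨C * A, by positivity⟩)
    (fun σ τ => H f A hf hA σ τ)).continuous

lemma pot_sub (hN : 2 ≤ N) (hp : p ≠ 0) (hp1 : 0 < (N : ℝ) - 1 + p) {f g : Sph N → ℝ}
    (hf : Continuous f) (hg : Continuous g) (θ : Sph N) :
    pot p (fun ω => f ω - g ω) θ = pot p f θ - pot p g θ := by
  obtain ⟨K, -, hK⟩ := exists_sph_full hN hp hp1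
  simp only [pot, mul_sub]
  exact integral_sub (integrable_dist_mul (hK θ).1 hf) (integrable_dist_mul (hK θ).1 hg)

lemma pot_add (hN : 2 ≤ N) (hp : p ≠ 0) (hp1 : 0 < (N : ℝ) - 1 + p) {f g : Sph N → ℝ}
    (hf : Continuous f) (hg : Continuous g) (θ : Sph N) :
    pot p (fun ω => f ω + g ω) θ = pot p f θ + pot p g θ := by
  obtain ⟨K, -, hK⟩ := exists_sph_full hN hp hp1
  simp only [pot, mul_add]
  exact integral_add (integrable_dist_mul (hK θ).1 hf) (integrable_dist_mul (hK θ).1 hg)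

lemma pot_const_mul (c : ℝ) (f : Sph N → ℝ) (θ : Sph N) :
    pot p (fun ω => c * f ω) θ = c * pot p f θ := by
  simp only [pot]
  rw [← integral_const_mul]
  congr 1; ext ω; ring

lemma pot_neg_sph (f : Sph N → ℝ) (θ : Sph N) : pot p f (-θ) = pot p (fun ω => f (-ω)) θ := by
  rw [neg_eq_rot, pot_rot]
  simp only [← neg_eq_rot]

/-- Even eigenfunctions of the Riesz potential for the eigenvalue of the linear functions vanish. -/
lemma even_eigen_eq_zero (hN : 2 ≤ N) (hp : p ≠ 0) (hp1 : p ≠ 1) (hp2 : 0 < (N : ℝ) - 2 + p)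
    {k μ : ℝ} (hμk : μ ≠ k) (hμ : μ ≠ 0) (hk : ∀ θ : Sph N, pot p (fun _ => 1) θ = k)
    (hl : ∀ (v : EE N) (θ : Sph N), pot p (fun ω => inner ℝ v (ω : EE N)) θ =
      μ * inner ℝ v (θ : EE N))
    {f : Sph N → ℝ} (hf : Continuous f) (hev : ∀ θ, f (-θ) = f θ)
    (hK : ∀ θ, pot p f θ = μ * f θ) (θ : Sph N) : f θ = 0 := by
  obtain ⟨C, hC, HC⟩ := exists_pot_lip hN hp hp1 hp2
  obtain ⟨A, hA⟩ := bounded_of_continuous hf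
  have hflip : ∀ σ τ, |f σ - f τ| ≤ C * A / |μ| * dist σ τ := fun σ τ => by
    have := HC f A hf hA σ τ
    rw [hK, hK, ← mul_sub, abs_mul] at this
    rw [div_mul_eq_mul_div, le_div_iff₀ (abs_pos.2 hμ)]
    linarith
  have hinv : ∀ v σ : Sph N, f (rot (hrefl v) σ) = f σ := fun v σ => by
    have hfR : Continuous fun σ => f (rot (hrefl v) σ) := continuous_comp_rot _ hf
    have := eigen_antisymm hN hp (by linarith) (μ := μ) (L := C * A / |μ| * 2) v
      (ψ := fun σ => f σ - f (rot (hrefl v) σ)) (hf.sub hfR)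
      (fun σ => by
        refine (hflip _ _).trans ?_
        rw [dist_rot_hrefl]; exact le_of_eq (by ring))
      (fun σ => by simp only [rot_hrefl_rot]; ring)
      (fun σ => by
        rw [pot_sub hN hp (by linarith) hf hfR, ← pot_rot, hK, hK]; ring)
      (hl v) σ
    simp only [rot_hrefl_self, hev, sub_self, zero_mul] at this
    linarith
  have hc : ∀ σ, f σ = f θ := fun σ => by
    by_cases h : σ = θ
    · rw [h]
    · obtain ⟨v, hv⟩ := exists_rot_hrefl_eq h
      rw [← hv, hinv]
  have e := hK θ
  rw [show f = fun _ => f θ * 1 from funext fun σ => by rw [hc σ, mul_one], pot_const_mul, hk] at e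
  simp only [mul_one] at e
  have : f θ * (k - μ) = 0 := by linarith
  exact (mul_eq_zero.1 this).resolve_right (sub_ne_zero.2 hμk.symm)

end Solver

section Fredholm

variable {N : ℕ} {p : ℝ}

open BoundedContinuousFunction in
/-- The Riesz potential of the even part, as an operator on continuous functions. -/
lemma exists_evenPot (hN : 2 ≤ N) (hp : p ≠ 0) (hp1 : p ≠ 1) (hp2 : 0 < (N : ℝ) - 2 + p) :
    ∃ T : (Sph N →ᵇ ℝ) →L[ℝ] (Sph N →ᵇ ℝ), IsCompactOperator T ∧
      ∀ f θ, T f θ = pot p (fun ω => (1 / 2) * (f ω + f (-ω))) θ := by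
  obtain ⟨C, hC, HC⟩ := exists_pot_lip hN hp hp1 hp2
  obtain ⟨D, hD, HD⟩ := exists_pot_bound hN hp (by linarith)
  have hcont : ∀ f : Sph N →ᵇ ℝ, Continuous fun ω => (1 / 2) * (f ω + f (-ω)) := fun f => by
    fun_prop
  have hbd : ∀ (f : Sph N →ᵇ ℝ) ω, |(1 / 2) * (f ω + f (-ω))| ≤ ‖f‖ := fun f ω => by
    have h1 := f.norm_coe_le_norm ω
    have h2 := f.norm_coe_le_norm (-ω)
    rw [Real.norm_eq_abs] at h1 h2
    rw [abs_mul, abs_of_pos (by norm_num : (0:ℝ) < 1 / 2)]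
    linarith [abs_add_le (f ω) (f (-ω))]
  let T₀ : (Sph N →ᵇ ℝ) →ₗ[ℝ] (Sph N →ᵇ ℝ) :=
    { toFun := fun f => ofNormedAddCommGroup (pot p fun ω => (1 / 2) * (f ω + f (-ω)))
        (continuous_pot hN hp hp1 hp2 (hcont f)) (D * ‖f‖) (fun θ => HD _ _ (hbd f) θ)
      map_add' := fun f g => by
        ext θ
        simp only [coe_ofNormedAddCommGroup, coe_add, Pi.add_apply]
        rw [← pot_add hN hp (by linarith) (hcont f) (hcont g)]
        congr 1; ext ω; ring
      map_smul' := fun c f => by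
        ext θ
        simp only [coe_ofNormedAddCommGroup, coe_smul, smul_eq_mul, RingHom.id_apply]
        rw [← pot_const_mul]
        congr 1; ext ω; ring }
  have hT : ∀ f θ, T₀ f θ = pot p (fun ω => (1 / 2) * (f ω + f (-ω))) θ := fun f θ => rfl
  refine ⟨T₀.mkContinuous D fun f => (norm_le (by positivity)).2 fun θ => ?_, ?_, fun f θ => hT f θ⟩
  · rw [hT, Real.norm_eq_abs]; exact HD _ _ (hbd f) θ
  · rw [← ContinuousLinearMap.coe_coe]
    refine (isCompactOperator_iff_isCompact_closure_image_closedBall _ one_pos).2 ?_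
    refine arzela_ascoli (Metric.closedBall (0:ℝ) D) (isCompact_closedBall _ _) _ ?_ ?_
    · rintro g θ ⟨f, hf, rfl⟩
      rw [mem_closedBall_zero_iff] at hf ⊢
      have := HD _ _ (hbd f) θ
      rw [Real.norm_eq_abs]
      refine this.trans ?_
      nlinarith
    · refine LipschitzWith.uniformEquicontinuous _ (⟨C, hC⟩ : NNReal) ?_ |>.equicontinuous
      rintro ⟨g, f, hf, rfl⟩
      refine LipschitzWith.of_dist_le_mul fun σ τ => ?_
      rw [mem_closedBall_zero_iff] at hf
      refine (HC _ _ (hcont f) (hbd f) σ τ).trans ?_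
      change _ ≤ C * _
      have := dist_nonneg (x := σ) (y := τ)
      gcongr
      nlinarith

lemma dist_le_two_mul_rpow {γ : ℝ} (hγ : 0 ≤ γ) (hγ1 : γ ≤ 1) (σ τ : Sph N) :
    dist σ τ ≤ 2 * dist σ τ ^ γ := by
  have h0 := dist_nonneg (x := σ) (y := τ)
  have h1 := dist_le_two σ τ
  rcases h0.eq_or_lt with h | h
  · rw [← h]; positivity
  calc dist σ τ = 2 * (dist σ τ / 2) ^ (1:ℝ) := by rw [Real.rpow_one]; ring
    _ ≤ 2 * (dist σ τ / 2) ^ γ := by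
        gcongr 2 * ?_
        exact Real.rpow_le_rpow_of_exponent_ge (by positivity) (by linarith) hγ1
    _ ≤ _ := by gcongr; linarith

open scoped BoundedContinuousFunction in
set_option maxHeartbeats 800000 in
/-- Solvability of the linearized equation on even functions. -/
lemma exists_solver (hN : 2 ≤ N) (hp : p ≠ 0) (hp1 : p ≠ 1) (hp2 : 0 < (N : ℝ) - 2 + p)
    {k μ l s : ℝ} (hk0 : 0 < k) (hμk : μ < k) (hμ : μ ≠ 0) (hl0 : 0 < l) (hs : s * (μ - k) = μ * l)
    (hk : ∀ θ : Sph N, pot p (fun _ => 1) θ = k)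
    (hl : ∀ (v : EE N) (θ : Sph N), pot p (fun ω => inner ℝ v (ω : EE N)) θ =
      μ * inner ℝ v (θ : EE N)) {γ : ℝ} (hγ : 0 < γ) (hγ1 : γ ≤ 1) :
    (∀ g : Sph N → ℝ, Continuous g → (∀ θ, g (-θ) = g θ) → ∃ f : Sph N → ℝ, Continuous f ∧
      (∀ θ, f (-θ) = f θ) ∧ ∀ θ, s * (pot p f θ - k * f θ) - l * pot p f θ = g θ) ∧
    ∃ C : ℝ, 0 ≤ C ∧ ∀ (f : Sph N → ℝ) (A : ℝ), Continuous f → (∀ θ, f (-θ) = f θ) →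
      Hol γ A (fun θ => s * (pot p f θ - k * f θ) - l * pot p f θ) → Hol γ (C * A) f := by
  obtain ⟨T, hT, HT⟩ := exists_evenPot hN hp hp1 hp2
  obtain ⟨D, hD, HD⟩ := exists_pot_lip hN hp hp1 hp2
  have hev : ∀ (f : Sph N → ℝ), (∀ θ, f (-θ) = f θ) →
      (fun ω => (1 / 2) * (f ω + f (-ω))) = f := fun f hf => by
    ext ω; rw [hf]; ring
  have hTev : ∀ f θ, T f (-θ) = T f θ := fun f θ => by
    rw [HT, HT, pot_neg_sph]
    congr 1; ext ω; rw [neg_neg]; ring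
  have hb : s - l ≠ 0 := fun h => by
    have h1 : s = l := by linarith
    rw [h1] at hs
    have : l * k = 0 := by linarith
    exact (mul_pos hl0 hk0).ne' this
  have hL : ∀ (f : Sph N → ℝ) θ, s * (pot p f θ - k * f θ) - l * pot p f θ =
      (s - l) * (pot p f θ - μ * f θ) := fun f θ => by
    linear_combination (f θ) * hs
  have hres : μ ∈ resolventSet ℝ T := by
    refine (hT.hasEigenvalue_or_mem_resolventSet hμ).resolve_left fun h => ?_
    obtain ⟨f, hf⟩ := h.exists_hasEigenvector
    have h1 : ∀ θ, T f θ = μ * f θ := fun θ => by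
      have := hf.apply_eq_smul
      rw [ContinuousLinearMap.coe_coe] at this
      rw [this]; rfl
    have h2 : ∀ θ, f (-θ) = f θ := fun θ => by
      have := hTev f θ
      rw [h1, h1] at this
      exact mul_left_cancel₀ hμ this
    refine hf.2 (BoundedContinuousFunction.ext fun θ => ?_)
    refine even_eigen_eq_zero hN hp hp1 hp2 hμk.ne hμ hk hl f.continuous h2 (fun θ => ?_) θ
    rw [← h1, HT, hev f h2]
  rw [spectrum.mem_resolventSet_iff] at hres
  obtain ⟨u, hu⟩ := hres
  have hu1 : ∀ f : Sph N →ᵇ ℝ, (u.inv : (Sph N →ᵇ ℝ) →L[ℝ] (Sph N →ᵇ ℝ)) (μ • f - T f) = f :=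
      fun f => by
    have : (u.inv * u.val : (Sph N →ᵇ ℝ) →L[ℝ] (Sph N →ᵇ ℝ)) f = f := by rw [u.inv_val]; rfl
    rw [ContinuousLinearMap.mul_apply, hu] at this
    exact this
  have hu2 : ∀ g : Sph N →ᵇ ℝ, μ • (u.inv : (Sph N →ᵇ ℝ) →L[ℝ] (Sph N →ᵇ ℝ)) g -
      T ((u.inv : (Sph N →ᵇ ℝ) →L[ℝ] (Sph N →ᵇ ℝ)) g) = g := fun g => by
    have : (u.val * u.inv : (Sph N →ᵇ ℝ) →L[ℝ] (Sph N →ᵇ ℝ)) g = g := by rw [u.val_inv]; rfl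
    rw [ContinuousLinearMap.mul_apply, hu] at this
    exact this
  set S := (u.inv : (Sph N →ᵇ ℝ) →L[ℝ] (Sph N →ᵇ ℝ))
  refine ⟨fun g hg hge => ?_, ?_⟩
  · set G : Sph N →ᵇ ℝ := BoundedContinuousFunction.mkOfCompact
      ⟨fun θ => -(s - l)⁻¹ * g θ, by fun_prop⟩ with hG
    have h1 : ∀ θ, μ * S G θ - T (S G) θ = -(s - l)⁻¹ * g θ := fun θ => by
      have := congrArg (fun f : Sph N →ᵇ ℝ => f θ) (hu2 G)
      exact this
    have h2 : ∀ θ, S G (-θ) = S G θ := fun θ => by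
      have a1 := h1 θ
      have a2 := h1 (-θ)
      rw [hTev, hge] at a2
      exact mul_left_cancel₀ hμ (by linarith)
    refine ⟨S G, (S G).continuous, h2, fun θ => ?_⟩
    rw [hL]
    have a1 := h1 θ
    rw [HT, hev _ h2] at a1
    rw [show pot p (S G) θ - μ * S G θ = (s - l)⁻¹ * g θ by linarith]
    field_simp
  · refine ⟨‖S‖ / |s - l| + (1 / |s - l| + D * (‖S‖ / |s - l|) * 2) / |μ|, by positivity,
      fun f A hf hfe hA => ?_⟩
    have hbp : 0 < |s - l| := abs_pos.2 hb
    obtain ⟨e⟩ := exists_sph hN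
    have hA0 := hA.nonneg e
    simp only [hL] at hA
    set F : Sph N →ᵇ ℝ := BoundedContinuousFunction.mkOfCompact ⟨f, hf⟩ with hF
    have hTF : ∀ θ, T F θ = pot p f θ := fun θ => by
      rw [HT]
      change pot p (fun ω => (1 / 2) * (f ω + f (-ω))) θ = _
      rw [hev f hfe]
    have hn : ‖μ • F - T F‖ ≤ A / |s - l| := by
      refine (BoundedContinuousFunction.norm_le (by positivity)).2 fun θ => ?_
      have : (μ • F - T F) θ = μ * f θ - pot p f θ := by rw [← hTF]; rfl
      rw [this, Real.norm_eq_abs, abs_sub_comm, le_div_iff₀ hbp, mul_comm, ← abs_mul]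
      exact hA.1 θ
    have hsup : ∀ θ, |f θ| ≤ ‖S‖ / |s - l| * A := fun θ => by
      have h1 : |f θ| ≤ ‖F‖ := F.norm_coe_le_norm θ
      have h2 : ‖F‖ ≤ ‖S‖ * ‖μ • F - T F‖ := by
        conv_lhs => rw [← hu1 F]
        exact S.le_opNorm _
      calc |f θ| ≤ ‖S‖ * ‖μ • F - T F‖ := h1.trans h2
        _ ≤ ‖S‖ * (A / |s - l|) := by gcongr
        _ = _ := by ring
    constructor
    · intro θ
      refine (hsup θ).trans ?_
      gcongr
      have : 0 ≤ (1 / |s - l| + D * (‖S‖ / |s - l|) * 2) / |μ| := by positivity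
      linarith
    · intro θ τ
      have e1 := hA.2 θ τ
      rw [← mul_sub, abs_mul] at e1
      have e2 := HD f _ hf hsup θ τ
      have e3 := dist_le_two_mul_rpow hγ.le hγ1 θ τ
      have hd : 0 ≤ dist θ τ ^ γ := by positivity
      have e4 : |μ| * |f θ - f τ| ≤ (1 / |s - l| + D * (‖S‖ / |s - l|) * 2) * A * dist θ τ ^ γ := by
        rw [← abs_mul]
        have : μ * (f θ - f τ) = (pot p f θ - pot p f τ) -
            (pot p f θ - μ * f θ - (pot p f τ - μ * f τ)) := by ring
        rw [this]
        refine (abs_sub _ _).trans ?_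
        have e5 : |pot p f θ - μ * f θ - (pot p f τ - μ * f τ)| ≤ 1 / |s - l| * A * dist θ τ ^ γ := by
          rw [div_mul_eq_mul_div, div_mul_eq_mul_div, le_div_iff₀ hbp]; linarith
        have e6 : D * (‖S‖ / |s - l| * A) * dist θ τ ≤
            D * (‖S‖ / |s - l| * A) * (2 * dist θ τ ^ γ) := by gcongr
        linarith
      have e7 : |f θ - f τ| ≤ (1 / |s - l| + D * (‖S‖ / |s - l|) * 2) / |μ| * A * dist θ τ ^ γ := by
        rw [div_mul_eq_mul_div, div_mul_eq_mul_div, le_div_iff₀ (abs_pos.2 hμ)]; linarith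
      refine e7.trans ?_
      gcongr
      have : 0 ≤ ‖S‖ / |s - l| := by positivity
      linarith

end Fredholm

section Kernel

variable {a b : ℝ}

/-- The kernel `|e ^ s σ - θ| ^ (-2b)` in logarithmic polar coordinates, with its weight. -/
noncomputable def gk (a b d s : ℝ) : ℝ :=
  Real.exp (a * s) * (4 * Real.sinh (s / 2) ^ 2 + d ^ 2) ^ (-b)

/-- The superlinear part of the primitive of `gk`. -/
noncomputable def Mk (a b d x : ℝ) : ℝ := ∫ s in (0:ℝ)..x, (gk a b d s - d ^ (-(2 * b)))

lemma gk_zero {d : ℝ} (hd : 0 < d) : gk a b d 0 = d ^ (-(2 * b)) := by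
  simp only [gk, mul_zero, Real.exp_zero, zero_div, Real.sinh_zero, one_mul]
  rw [show (4 * 0 ^ 2 + d ^ 2 : ℝ) = d ^ (2:ℝ) by norm_num, ← Real.rpow_mul hd.le]
  congr 1; ring

lemma gk_hasDerivAt {d : ℝ} (hd : 0 < d) (s : ℝ) : HasDerivAt (gk a b d)
    (Real.exp (a * s) * (a * (4 * Real.sinh (s / 2) ^ 2 + d ^ 2) ^ (-b) -
      b * (4 * Real.sinh (s / 2) * Real.cosh (s / 2)) *
        (4 * Real.sinh (s / 2) ^ 2 + d ^ 2) ^ (-b - 1))) s := by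
  have hq : 0 < 4 * Real.sinh (s / 2) ^ 2 + d ^ 2 := by positivity
  have h1 : HasDerivAt (fun s : ℝ => Real.exp (a * s)) (Real.exp (a * s) * (a * 1)) s :=
    ((hasDerivAt_id s).const_mul a).exp
  have h2 : HasDerivAt (fun s : ℝ => 4 * Real.sinh (s / 2) ^ 2 + d ^ 2)
      (4 * (2 * Real.sinh (s / 2) ^ 1 * (Real.cosh (s / 2) * (1 / 2)))) s := by
    have := ((((hasDerivAt_id s).div_const 2).sinh.pow 2).const_mul 4).add_const (d ^ 2)
    simpa using this
  have h3 := h1.mul (h2.rpow_const (p := -b) (Or.inl hq.ne'))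
  refine h3.congr_deriv ?_
  ring

lemma continuous_gk {d : ℝ} (hd : 0 < d) : Continuous (gk a b d) :=
  continuous_iff_continuousAt.2 fun s => (gk_hasDerivAt hd s).continuousAt

lemma gk_sub_neg (d x : ℝ) : gk a b d x - gk a b d (-x) =
    2 * Real.sinh (a * x) * (4 * Real.sinh (x / 2) ^ 2 + d ^ 2) ^ (-b) := by
  simp only [gk, neg_div, Real.sinh_neg, neg_sq, mul_neg, Real.sinh_eq (a * x)]
  ring

lemma rpow_gk_le (hb : 0 ≤ b) {d : ℝ} (hd : 0 < d) (s : ℝ) :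
    (4 * Real.sinh (s / 2) ^ 2 + d ^ 2) ^ (-b) ≤ d ^ (-(2 * b)) := by
  rw [show d ^ (-(2 * b)) = (d ^ 2) ^ (-b) by
    rw [show d ^ 2 = d ^ (2:ℝ) by norm_num, ← Real.rpow_mul hd.le]; congr 1; ring]
  exact Real.rpow_le_rpow_of_nonpos (by positivity) (by nlinarith [sq_nonneg (Real.sinh (s / 2))])
    (by linarith)

lemma exists_gk_lip (hb : 0 ≤ b) : ∃ C : ℝ, 0 ≤ C ∧ ∀ d : ℝ, 0 < d → d ≤ 2 → ∀ x y : ℝ,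
    |x| ≤ 2 → |y| ≤ 2 → |gk a b d x - gk a b d y| ≤ C * d ^ (-(2 * b) - 1) * |x - y| := by
  refine ⟨Real.exp (|a| * 2) * (|a| * 2 + b * 2 * Real.cosh 1), by positivity,
    fun d hd hd2 x y hx hy => ?_⟩
  have key := Convex.norm_image_sub_le_of_norm_hasDerivWithin_le (𝕜 := ℝ) (s := Set.Icc (-2) 2)
    (f := gk a b d)
    (f' := fun s => Real.exp (a * s) * (a * (4 * Real.sinh (s / 2) ^ 2 + d ^ 2) ^ (-b) -
      b * (4 * Real.sinh (s / 2) * Real.cosh (s / 2)) *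
        (4 * Real.sinh (s / 2) ^ 2 + d ^ 2) ^ (-b - 1))) (x := y) (y := x)
    (C := Real.exp (|a| * 2) * (|a| * 2 + b * 2 * Real.cosh 1) * d ^ (-(2 * b) - 1))
    (fun s _ => (gk_hasDerivAt hd s).hasDerivWithinAt) ?_ (convex_Icc _ _)
    (abs_le.1 hy) (abs_le.1 hx)
  · simpa only [Real.norm_eq_abs] using key
  intro s hs
  have hs2 : |s| ≤ 2 := abs_le.2 hs
  set S := Real.sinh (s / 2) with hS
  have hq : 0 < 4 * S ^ 2 + d ^ 2 := by positivity
  have e1 : (4 * S ^ 2 + d ^ 2) ^ (-b) ≤ 2 * d ^ (-(2 * b) - 1) := by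
    refine (rpow_gk_le hb hd s).trans ?_
    rw [show -(2 * b) = (-(2 * b) - 1) + 1 by ring, Real.rpow_add_one hd.ne',
      show -(2 * b) - 1 + 1 - 1 = -(2 * b) - 1 by ring]
    have : 0 ≤ d ^ (-(2 * b) - 1) := by positivity
    nlinarith
  have e2 : |4 * S * Real.cosh (s / 2)| * (4 * S ^ 2 + d ^ 2) ^ (-b - 1) ≤
      2 * Real.cosh 1 * d ^ (-(2 * b) - 1) := by
    have c1 : Real.cosh (s / 2) ≤ Real.cosh 1 := by
      rw [Real.cosh_le_cosh, abs_div, abs_one, abs_two]; linarith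
    have c2 : 2 * |S| ≤ (4 * S ^ 2 + d ^ 2) ^ (1 / 2 : ℝ) := by
      rw [← Real.sqrt_eq_rpow]
      refine Real.le_sqrt_of_sq_le ?_
      rw [mul_pow, sq_abs]; nlinarith [sq_nonneg d]
    have c3 : (4 * S ^ 2 + d ^ 2) ^ (1 / 2 : ℝ) * (4 * S ^ 2 + d ^ 2) ^ (-b - 1) ≤
        d ^ (-(2 * b) - 1) := by
      rw [← Real.rpow_add hq]
      have := rpow_gk_le (b := b + 1 / 2) (by linarith) hd s
      rw [show (1 / 2 : ℝ) + (-b - 1) = -(b + 1 / 2) by ring,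
        show -(2 * b) - 1 = -(2 * (b + 1 / 2)) by ring]
      exact this
    have c0 := Real.cosh_pos (s / 2)
    have c4 : 0 ≤ (4 * S ^ 2 + d ^ 2) ^ (-b - 1) := by positivity
    calc |4 * S * Real.cosh (s / 2)| * (4 * S ^ 2 + d ^ 2) ^ (-b - 1)
        = 2 * Real.cosh (s / 2) * ((2 * |S|) * (4 * S ^ 2 + d ^ 2) ^ (-b - 1)) := by
          rw [abs_mul, abs_mul, abs_of_pos c0, abs_of_pos (by norm_num : (0:ℝ) < 4)]; ring
      _ ≤ 2 * Real.cosh 1 * ((4 * S ^ 2 + d ^ 2) ^ (1 / 2 : ℝ) *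
            (4 * S ^ 2 + d ^ 2) ^ (-b - 1)) := by gcongr
      _ ≤ _ := by gcongr
  have e3 : Real.exp (a * s) ≤ Real.exp (|a| * 2) := by
    apply Real.exp_le_exp.2
    calc a * s ≤ |a * s| := le_abs_self _
      _ = |a| * |s| := abs_mul _ _
      _ ≤ _ := by gcongr
  rw [Real.norm_eq_abs, abs_mul, Real.abs_exp]
  have e4 : |a * (4 * S ^ 2 + d ^ 2) ^ (-b) -
      b * (4 * S * Real.cosh (s / 2)) * (4 * S ^ 2 + d ^ 2) ^ (-b - 1)| ≤
      (|a| * 2 + b * 2 * Real.cosh 1) * d ^ (-(2 * b) - 1) := by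
    refine (abs_sub _ _).trans ?_
    have p1 : 0 ≤ (4 * S ^ 2 + d ^ 2) ^ (-b) := by positivity
    have p2 : 0 ≤ (4 * S ^ 2 + d ^ 2) ^ (-b - 1) := by positivity
    rw [abs_mul, abs_of_nonneg p1, abs_mul, abs_mul, abs_of_nonneg hb, abs_of_nonneg p2]
    have := mul_le_mul_of_nonneg_left e1 (abs_nonneg a)
    have := mul_le_mul_of_nonneg_left e2 hb
    linarith
  calc _ ≤ Real.exp (|a| * 2) * ((|a| * 2 + b * 2 * Real.cosh 1) * d ^ (-(2 * b) - 1)) := by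
        gcongr
    _ = _ := by ring

lemma exists_gk_even (hb : 0 ≤ b) : ∃ C : ℝ, 0 ≤ C ∧ ∀ d : ℝ, 0 < d → ∀ x : ℝ,
    |x| ≤ 2 → |gk a b d x - gk a b d (-x)| ≤ C * d ^ (-(2 * b)) * |x| := by
  refine ⟨2 * Real.cosh (2 * |a|) * |a|, by positivity, fun d hd x hx => ?_⟩
  have key := Convex.norm_image_sub_le_of_norm_hasDerivWithin_le (𝕜 := ℝ)
    (s := Set.Icc (-(2 * |a|)) (2 * |a|)) (f := Real.sinh) (f' := Real.cosh) (x := 0) (y := a * x)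
    (C := Real.cosh (2 * |a|)) (fun s _ => (Real.hasDerivAt_sinh s).hasDerivWithinAt)
    (fun s hs => by
      rw [Real.norm_of_nonneg (Real.cosh_pos s).le, Real.cosh_le_cosh,
        abs_of_nonneg (by positivity : 0 ≤ 2 * |a|)]
      exact abs_le.2 hs) (convex_Icc _ _) (abs_le.1 (by simp))
    (abs_le.1 (by rw [abs_mul]; nlinarith [abs_nonneg a]))
  rw [Real.sinh_zero, sub_zero, sub_zero, Real.norm_eq_abs, Real.norm_eq_abs, abs_mul] at key
  rw [gk_sub_neg, abs_mul, abs_mul, abs_two, abs_of_nonneg (by positivity :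
    (0:ℝ) ≤ (4 * Real.sinh (x / 2) ^ 2 + d ^ 2) ^ (-b))]
  calc _ ≤ 2 * (Real.cosh (2 * |a|) * (|a| * |x|)) * d ^ (-(2 * b)) := by
        gcongr; exact rpow_gk_le hb hd x
    _ = _ := by ring

lemma Mk_hasDerivAt {d : ℝ} (hd : 0 < d) (x : ℝ) :
    HasDerivAt (Mk a b d) (gk a b d x - d ^ (-(2 * b))) x :=
  (((continuous_gk hd).sub continuous_const).integral_hasStrictDerivAt 0 x).hasDerivAt

lemma Mk_zero (d : ℝ) : Mk a b d 0 = 0 := by simp [Mk]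

lemma Mk_eq (d x : ℝ) :
    Mk a b d x = x * ∫ s in Set.Ioc (0:ℝ) 1, (gk a b d (x * s) - d ^ (-(2 * b))) := by
  have := intervalIntegral.mul_integral_comp_mul_left (a := 0) (b := 1)
    (f := fun s => gk a b d s - d ^ (-(2 * b))) x
  rw [mul_zero, mul_one] at this
  rw [Mk, ← this, intervalIntegral.integral_of_le zero_le_one]

lemma measurable_Mk : Measurable fun z : ℝ × ℝ => Mk a b z.1 z.2 := by
  simp only [Mk_eq]
  refine measurable_snd.mul ?_
  have : Measurable fun w : (ℝ × ℝ) × ℝ => gk a b w.1.1 (w.1.2 * w.2) - w.1.1 ^ (-(2 * b)) := by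
    unfold gk; fun_prop
  exact (this.stronglyMeasurable.integral_prod_right' (ν := volume.restrict (Set.Ioc 0 1))).measurable

/-- The four point estimate for the kernel primitive. -/
lemma exists_Mk_four (hb : 0 ≤ b) : ∃ C : ℝ, 0 ≤ C ∧ ∀ d ε : ℝ, 0 < d → d ≤ 2 → 0 ≤ ε → ε ≤ 1 →
    ∀ x₁ y₁ x₂ y₂ : ℝ, |x₁| ≤ ε * d → |y₁| ≤ ε * d → |x₂| ≤ ε * d → |y₂| ≤ ε * d →
    |(Mk a b d x₁ - Mk a b d y₁) - (Mk a b d x₂ - Mk a b d y₂)| ≤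
      C * ε * d ^ (-(2 * b)) * |(x₁ - y₁) - (x₂ - y₂)| +
      C * d ^ (-(2 * b) - 1) * |x₂ - y₂| * (|x₁ - x₂| + |y₁ - y₂|) := by
  obtain ⟨C, hC, H⟩ := exists_gk_lip (a := a) hb
  refine ⟨C, hC, fun d ε hd hd2 hε hε1 x₁ y₁ x₂ y₂ h1 h2 h3 h4 => ?_⟩
  have hI : ∀ x ∈ Set.Icc (-(ε * d)) (ε * d), |x| ≤ ε * d ∧ |x| ≤ 2 := fun x hx =>
    ⟨abs_le.2 hx, (abs_le.2 hx).trans (by nlinarith)⟩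
  refine four_point (convex_Icc (-(ε * d)) (ε * d)) (fun x _ => Mk_hasDerivAt hd x)
    (fun x hx => ?_) (fun x hx y hy => ?_) (by positivity) (abs_le.1 h1) (abs_le.1 h2) (abs_le.1 h3)
    (abs_le.1 h4)
  · rw [← gk_zero (a := a) hd]
    refine (H d hd hd2 x 0 (hI x hx).2 (by simp)).trans ?_
    rw [sub_zero]
    calc C * d ^ (-(2 * b) - 1) * |x| ≤ C * d ^ (-(2 * b) - 1) * (ε * d) := by
          gcongr; exact (hI x hx).1
      _ = C * ε * (d ^ (-(2 * b) - 1) * d) := by ring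
      _ = _ := by rw [← Real.rpow_add_one hd.ne', sub_add_cancel, gk_zero hd]
  · rw [sub_sub_sub_cancel_right]
    exact H d hd hd2 x y (hI x hx).2 (hI y hy).2

/-- The even part of the kernel primitive is quadratically small. -/
lemma exists_Mk_even (hb : 0 ≤ b) : ∃ C : ℝ, 0 ≤ C ∧ ∀ d ε : ℝ, 0 < d → d ≤ 2 → 0 ≤ ε → ε ≤ 1 →
    ∀ x y : ℝ, |x| ≤ ε * d → |y| ≤ ε * d →
    |(Mk a b d x + Mk a b d (-x)) - (Mk a b d y + Mk a b d (-y))| ≤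
      C * ε * d ^ (-(2 * b) + 1) * |x - y| := by
  obtain ⟨C, hC, H⟩ := exists_gk_even (a := a) hb
  refine ⟨C, hC, fun d ε hd hd2 hε hε1 x y h1 h2 => ?_⟩
  have key := Convex.norm_image_sub_le_of_norm_hasDerivWithin_le (𝕜 := ℝ)
    (s := Set.Icc (-(ε * d)) (ε * d)) (f := fun x => Mk a b d x + Mk a b d (-x))
    (f' := fun x => gk a b d x - gk a b d (-x)) (x := y) (y := x)
    (C := C * ε * d ^ (-(2 * b) + 1)) (fun s _ => by
      have := (Mk_hasDerivAt (a := a) (b := b) hd s).add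
        ((Mk_hasDerivAt (a := a) (b := b) hd (-s)).comp s (hasDerivAt_neg s))
      exact (this.congr_deriv (by ring)).hasDerivWithinAt)
    (fun s hs => ?_) (convex_Icc _ _) (abs_le.1 h2) (abs_le.1 h1)
  · simpa only [Real.norm_eq_abs] using key
  have hs1 : |s| ≤ ε * d := abs_le.2 hs
  refine (H d hd s (hs1.trans (by nlinarith))).trans ?_
  calc C * d ^ (-(2 * b)) * |s| ≤ C * d ^ (-(2 * b)) * (ε * d) := by gcongr
    _ = C * ε * (d ^ (-(2 * b)) * d) := by ring
    _ = _ := by rw [← Real.rpow_add_one hd.ne']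

end Kernel

section Quadratic

variable {N : ℕ} {α β : ℝ}

/-- The integrand of the superlinear part of the nonlocal mean curvature of a near-sphere. -/
noncomputable def Qm (α : ℝ) (u : Sph N → ℝ) (θ σ : Sph N) : ℝ :=
  (1 / 2) * (Mk (((N : ℝ) - α) / 2) (((N : ℝ) + α) / 2) (dist σ θ) (u σ - u θ) +
    Mk (((N : ℝ) - α) / 2) (((N : ℝ) + α) / 2) (dist σ θ) (u (opp θ σ) - u θ))

/-- The superlinear part of the nonlocal mean curvature of a near-sphere. -/
noncomputable def Qop (α : ℝ) (u : Sph N → ℝ) (θ : Sph N) : ℝ := ∫ σ, Qm α u θ σ ∂(sm N)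

lemma rot_opp (R : EE N ≃ₗᵢ[ℝ] EE N) (θ σ : Sph N) :
    opp (rot R θ) (rot R σ) = rot R (opp θ σ) := by
  ext1
  rw [coe_rot, coe_opp, coe_opp, coe_rot, coe_rot, R.inner_map_map, map_sub, map_smul]

lemma Qm_self (u : Sph N → ℝ) (θ : Sph N) : Qm α u θ θ = 0 := by
  simp [Qm, Mk_zero]

lemma Qm_zero (θ σ : Sph N) : Qm α (fun _ => (0:ℝ)) θ σ = 0 := by
  simp [Qm, Mk_zero]

lemma measurable_Qm {u : Sph N → ℝ} (hu : Continuous u) (θ : Sph N) : Measurable (Qm α u θ) := by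
  have h1 := (measurable_Mk (a := ((N : ℝ) - α) / 2) (b := ((N : ℝ) + α) / 2)).comp
    (((measurable_id.dist measurable_const).prodMk
      (hu.measurable.sub_const (u θ))) : Measurable fun σ : Sph N => (dist σ θ, u σ - u θ))
  have h2 := (measurable_Mk (a := ((N : ℝ) - α) / 2) (b := ((N : ℝ) + α) / 2)).comp
    (((measurable_id.dist measurable_const).prodMk
      ((hu.comp (continuous_opp θ)).measurable.sub_const (u θ))) :
      Measurable fun σ : Sph N => (dist σ θ, u (opp θ σ) - u θ))
  exact (h1.add h2).const_mul _

lemma two_half_add (x : ℝ) : -(2 * (x / 2)) = -x := by ring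

/-- The symmetrized pointwise estimate. -/
lemma exists_Qm_sub_le (hN : 2 ≤ N) (hα : 0 < α) (hβ0 : 0 ≤ β) (hβ : β ≤ 1) :
    ∃ C : ℝ, 0 ≤ C ∧ ∀ (u v : Sph N → ℝ) (ε W : ℝ), ε ≤ 1 → XB β ε u → XB β ε v →
      XB β W (fun σ => u σ - v σ) → ∀ θ σ, |Qm α u θ σ - Qm α v θ σ| ≤
        C * ε * W * dist σ θ ^ (1 + β - ((N : ℝ) + α)) := by
  have hb : 0 ≤ ((N : ℝ) + α) / 2 := by positivity
  obtain ⟨C₁, hC₁, H₁⟩ := exists_Mk_four (a := ((N : ℝ) - α) / 2) hb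
  obtain ⟨C₂, hC₂, H₂⟩ := exists_Mk_even (a := ((N : ℝ) - α) / 2) hb
  simp only [two_half_add] at H₁ H₂
  refine ⟨24 * C₁ + 2 * C₂, by positivity, fun u v ε W hε1 hu hv hw θ σ => ?_⟩
  have hε := hu.nonneg θ
  have hW := hw.nonneg θ
  by_cases hσ : σ = θ
  · subst hσ
    rw [Qm_self, Qm_self, sub_zero, abs_zero]; positivity
  have hd : 0 < dist σ θ := dist_pos.2 hσ
  have hd2 := dist_le_two σ θ
  set d := dist σ θ with hdd
  have hd' : dist (opp θ σ) θ = d := dist_opp θ σ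
  have x1 := hu.lip σ θ
  have x2 := hu.lip (opp θ σ) θ
  have y1 := hv.lip σ θ
  have y2 := hv.lip (opp θ σ) θ
  have w1 := hw.lip σ θ
  have w2 := hw.lip (opp θ σ) θ
  have s1 := hw.symm_diff hβ0 hβ θ σ
  have s2 := hv.symm_diff hβ0 hβ θ σ
  rw [hd'] at x2 y2 w2
  rw [← hdd] at x1 y1 w1 s1 s2
  set x := u σ - u θ
  set x' := u (opp θ σ) - u θ
  set y := v σ - v θ
  set y' := v (opp θ σ) - v θ
  have hw1 : |x - y| ≤ W * d := by
    convert w1 using 2; ring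
  have hw2 : |x' - y'| ≤ W * d := by
    convert w2 using 2; ring
  have hs1 : |(x - -x') - (y - -y')| ≤ 8 * W * d ^ (1 + β) := by
    convert s1 using 2; ring
  have hs2 : |y - -y'| ≤ 8 * ε * d ^ (1 + β) := by
    convert s2 using 2; ring
  have f1 := H₁ d ε hd hd2 hε hε1 x (-x') y (-y') x1 (by rwa [abs_neg]) y1 (by rwa [abs_neg])
  have f2 := H₂ d ε hd hd2 hε hε1 x' y' x2 y2
  have hw3 : |-x' - -y'| ≤ W * d := by rwa [← abs_neg, show -(-x' - -y') = x' - y' by ring]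
  set M := Mk (((N : ℝ) - α) / 2) (((N : ℝ) + α) / 2) d
  have e0 : Qm α u θ σ - Qm α v θ σ = (1 / 2) * (((M x - M (-x')) - (M y - M (-y'))) +
      ((M x' + M (-x')) - (M y' + M (-y')))) := by
    simp only [Qm]; ring
  have r1 : d ^ (-((N : ℝ) + α)) * d ^ (1 + β) = d ^ (1 + β - ((N : ℝ) + α)) := by
    rw [← Real.rpow_add hd]; congr 1; ring
  have r2 : d ^ (-((N : ℝ) + α) - 1) * d ^ (1 + β) * d = d ^ (1 + β - ((N : ℝ) + α)) := by
    rw [← Real.rpow_add hd, ← Real.rpow_add_one hd.ne']; congr 1; ring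
  have r3 : d ^ (-((N : ℝ) + α) + 1) * d ≤ 2 * d ^ (1 + β - ((N : ℝ) + α)) := by
    have := dist_le_two_mul_rpow hβ0 hβ σ θ
    rw [← hdd] at this
    calc d ^ (-((N : ℝ) + α) + 1) * d ≤ d ^ (-((N : ℝ) + α) + 1) * (2 * d ^ β) := by gcongr
      _ = 2 * (d ^ (-((N : ℝ) + α) + 1) * d ^ β) := by ring
      _ = _ := by rw [← Real.rpow_add hd]; congr 2; ring
  rw [e0, abs_mul, abs_of_pos (by norm_num : (0:ℝ) < 1 / 2)]
  have g1 : |(M x - M (-x')) - (M y - M (-y'))| ≤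
      24 * C₁ * ε * W * d ^ (1 + β - ((N : ℝ) + α)) := by
    refine f1.trans ?_
    calc _ ≤ C₁ * ε * d ^ (-((N : ℝ) + α)) * (8 * W * d ^ (1 + β)) +
          C₁ * d ^ (-((N : ℝ) + α) - 1) * (8 * ε * d ^ (1 + β)) * (W * d + W * d) := by gcongr
      _ = 8 * C₁ * ε * W * (d ^ (-((N : ℝ) + α)) * d ^ (1 + β)) +
          16 * C₁ * ε * W * (d ^ (-((N : ℝ) + α) - 1) * d ^ (1 + β) * d) := by ring
      _ = _ := by rw [r1, r2]; ring
  have g2 : |(M x' + M (-x')) - (M y' + M (-y'))| ≤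
      2 * C₂ * ε * W * d ^ (1 + β - ((N : ℝ) + α)) := by
    refine f2.trans ?_
    calc _ ≤ C₂ * ε * d ^ (-((N : ℝ) + α) + 1) * (W * d) := by gcongr
      _ = C₂ * ε * W * (d ^ (-((N : ℝ) + α) + 1) * d) := by ring
      _ ≤ C₂ * ε * W * (2 * d ^ (1 + β - ((N : ℝ) + α))) := by gcongr
      _ = _ := by ring
  have g3 := abs_add_le ((M x - M (-x')) - (M y - M (-y'))) ((M x' + M (-x')) - (M y' + M (-y')))
  have g4 : 0 ≤ (24 * C₁ + 2 * C₂) * ε * W * d ^ (1 + β - ((N : ℝ) + α)) := by positivity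
  nlinarith

/-- The pointwise estimate for differences under rotations. -/
lemma exists_Qm_rot_le (hN : 2 ≤ N) (hα : 0 < α) :
    ∃ C : ℝ, 0 ≤ C ∧ ∀ (u v : Sph N → ℝ) (ε W : ℝ), ε ≤ 1 → XB β ε u → XB β ε v →
      XB β W (fun σ => u σ - v σ) → ∀ (R : EE N ≃ₗᵢ[ℝ] EE N) (h : ℝ),
      (∀ x : EE N, ‖x‖ = 1 → ‖R x - x‖ ≤ h) → ∀ θ σ,
      |(Qm α u (rot R θ) (rot R σ) - Qm α v (rot R θ) (rot R σ)) - (Qm α u θ σ - Qm α v θ σ)| ≤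
        C * ε * W * h ^ β * dist σ θ ^ (1 - ((N : ℝ) + α)) := by
  have hb : 0 ≤ ((N : ℝ) + α) / 2 := by positivity
  obtain ⟨C₁, hC₁, H₁⟩ := exists_Mk_four (a := ((N : ℝ) - α) / 2) hb
  simp only [two_half_add] at H₁
  refine ⟨3 * C₁, by positivity, fun u v ε W hε1 hu hv hw R h hR θ σ => ?_⟩
  have hε := hu.nonneg θ
  have hW := hw.nonneg θ
  have hh : 0 ≤ h := (norm_nonneg _).trans (hR θ (norm_coe θ))
  by_cases hσ : σ = θ
  · subst hσ
    simp only [Qm_self, sub_zero, abs_zero]; positivity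
  have hd : 0 < dist σ θ := dist_pos.2 hσ
  have hd2 := dist_le_two σ θ
  have key : ∀ τ : Sph N, dist τ θ = dist σ θ →
      |(Mk (((N : ℝ) - α) / 2) (((N : ℝ) + α) / 2) (dist σ θ) (u (rot R τ) - u (rot R θ)) -
        Mk (((N : ℝ) - α) / 2) (((N : ℝ) + α) / 2) (dist σ θ) (v (rot R τ) - v (rot R θ))) -
       (Mk (((N : ℝ) - α) / 2) (((N : ℝ) + α) / 2) (dist σ θ) (u τ - u θ) -
        Mk (((N : ℝ) - α) / 2) (((N : ℝ) + α) / 2) (dist σ θ) (v τ - v θ))| ≤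
      3 * C₁ * ε * W * h ^ β * dist σ θ ^ (1 - ((N : ℝ) + α)) := fun τ hτ => by
    have x1 := hu.lip (rot R τ) (rot R θ)
    have y1 := hv.lip (rot R τ) (rot R θ)
    rw [dist_rot, hτ] at x1 y1
    have x2 := hu.lip τ θ
    have y2 := hv.lip τ θ
    have w2 := hw.lip τ θ
    have ru := hu.rotd R h hR τ θ
    have rv := hv.rotd R h hR τ θ
    have rw' := hw.rotd R h hR τ θ
    rw [hτ] at x2 y2 w2 ru rv rw'
    have f1 := H₁ (dist σ θ) ε hd hd2 hε hε1 _ _ _ _ x1 y1 x2 y2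
    set d := dist σ θ
    have r2 : d ^ (-((N : ℝ) + α)) * d = d ^ (1 - ((N : ℝ) + α)) := by
      rw [← Real.rpow_add_one hd.ne']; congr 1; ring
    have r3 : d ^ (-((N : ℝ) + α) - 1) * d * d = d ^ (1 - ((N : ℝ) + α)) := by
      rw [← Real.rpow_add_one hd.ne', ← Real.rpow_add_one hd.ne']; congr 1; ring
    have z1 : |u (rot R τ) - u (rot R θ) - (v (rot R τ) - v (rot R θ)) -
        (u τ - u θ - (v τ - v θ))| ≤ W * h ^ β * d := by convert rw' using 2; ring
    have z2 : |u τ - u θ - (v τ - v θ)| ≤ W * d := by convert w2 using 2; ring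
    have z3 : |u (rot R τ) - u (rot R θ) - (u τ - u θ)| ≤ ε * h ^ β * d := by
      convert ru using 2; ring
    have z4 : |v (rot R τ) - v (rot R θ) - (v τ - v θ)| ≤ ε * h ^ β * d := by
      convert rv using 2; ring
    refine f1.trans ?_
    calc _ ≤ C₁ * ε * d ^ (-((N : ℝ) + α)) * (W * h ^ β * d) +
          C₁ * d ^ (-((N : ℝ) + α) - 1) * (W * d) * (ε * h ^ β * d + ε * h ^ β * d) := by gcongr
      _ = C₁ * ε * W * h ^ β * (d ^ (-((N : ℝ) + α)) * d) +
          2 * C₁ * ε * W * h ^ β * (d ^ (-((N : ℝ) + α) - 1) * d * d) := by ring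
      _ = _ := by rw [r2, r3]; ring
  have k1 := key σ rfl
  have k2 := key (opp θ σ) (dist_opp θ σ)
  simp only [Qm, rot_opp, dist_rot]
  set M := Mk (((N : ℝ) - α) / 2) (((N : ℝ) + α) / 2) (dist σ θ)
  set B := 3 * C₁ * ε * W * h ^ β * dist σ θ ^ (1 - ((N : ℝ) + α))
  rw [abs_le] at *
  constructor <;> linarith

lemma integrable_Qm (hN : 2 ≤ N) (hα : 0 < α) (hαβ : α < β) (hβ : β ≤ 1) {ε : ℝ} (hε : ε ≤ 1)
    {u : Sph N → ℝ} (hu : XB β ε u) (θ : Sph N) : Integrable (Qm α u θ) (sm N) := by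
  have h2 : (2:ℝ) ≤ N := by exact_mod_cast hN
  obtain ⟨C, hC, H⟩ := exists_Qm_sub_le hN hα (by linarith) hβ
  obtain ⟨K, -, hK⟩ := exists_sph_full hN (q := 1 + β - (N + α)) (by linarith) (by linarith)
  have hε0 := hu.nonneg θ
  have h0 : XB β ε (fun _ : Sph N => (0:ℝ)) :=
    { bd := fun θ => by simpa using hε0
      lip := fun σ θ => by simp only [sub_self, abs_zero]; positivity
      rotd := fun R h hR σ θ => by
        have : 0 ≤ h := (norm_nonneg _).trans (hR σ (norm_coe σ))
        simp only [sub_self, abs_zero]; positivity }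
  refine ((hK θ).1.const_mul (C * ε * ε)).mono' (measurable_Qm hu.continuous θ).aestronglyMeasurable
    (Eventually.of_forall fun σ => ?_)
  have := H u _ ε ε hε hu h0 (by simpa using hu) θ σ
  rwa [Qm_zero, sub_zero] at this

lemma exists_Qop_Hol (hN : 2 ≤ N) (hα : 0 < α) {γ : ℝ} (hγ : 0 < γ) (hβ : α + γ < 1) :
    ∃ C : ℝ, 0 ≤ C ∧ ∀ (u v : Sph N → ℝ) (ε W : ℝ), ε ≤ 1 → XB (α + γ) ε u → XB (α + γ) ε v →
      XB (α + γ) W (fun σ => u σ - v σ) →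
      Hol γ (C * ε * W) (fun θ => Qop α u θ - Qop α v θ) := by
  have h2 : (2:ℝ) ≤ N := by exact_mod_cast hN
  obtain ⟨C₁, hC₁, H₁⟩ := exists_Qm_sub_le hN hα (β := α + γ) (by linarith) hβ.le
  obtain ⟨C₂, hC₂, H₂⟩ := exists_Qm_rot_le hN hα (β := α + γ)
  obtain ⟨K, hK0, hK⟩ := exists_sph_full hN (q := 1 + (α + γ) - (N + α)) (by linarith) (by linarith)
  obtain ⟨L, hL0, hL⟩ := exists_sph_inner hN (q := 1 + (α + γ) - (N + α)) (by linarith) (by linarith)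
  obtain ⟨P, hP0, hP⟩ := exists_sph_outer hN (q := 1 - (N + α)) (by linarith)
  refine ⟨C₁ * K + 2 * C₁ * L + C₂ * 8 ^ (α + γ) * P, by positivity,
    fun u v ε W hε hu hv hw => ?_⟩
  have iu := integrable_Qm hN hα (by linarith) hβ.le hε hu
  have iv := integrable_Qm hN hα (by linarith) hβ.le hε hv
  obtain ⟨e⟩ := exists_sph hN
  have hε0 := hu.nonneg e
  have hW := hw.nonneg e
  have hD : ∀ θ, Qop α u θ - Qop α v θ = ∫ σ, (Qm α u θ σ - Qm α v θ σ) ∂(sm N) := fun θ =>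
    (integral_sub (iu θ) (iv θ)).symm
  refine ⟨fun θ => ?_, fun θ τ => ?_⟩
  · beta_reduce
    rw [hD, ← Real.norm_eq_abs]
    refine (norm_integral_le_of_norm_le ((hK θ).1.const_mul (C₁ * ε * W))
      (Eventually.of_forall fun σ => H₁ u v ε W hε hu hv hw θ σ)).trans ?_
    rw [integral_const_mul]
    calc C₁ * ε * W * _ ≤ C₁ * ε * W * K := by gcongr; exact (hK θ).2
      _ = C₁ * K * (ε * W) := by ring
      _ ≤ _ := by
        rw [mul_assoc _ ε W]
        gcongr
        have : 0 ≤ 2 * C₁ * L + C₂ * 8 ^ (α + γ) * P := by positivity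
        linarith
  · by_cases hθ : θ = τ
    · subst hθ; simp only [sub_self, abs_zero]; positivity
    obtain ⟨R, rfl, -, hR⟩ := exists_rot θ τ
    set t := dist (rot R θ) θ with ht
    have ht0 : 0 < t := dist_pos.2 (Ne.symm hθ)
    have e1 : Qop α u (rot R θ) - Qop α v (rot R θ) =
        ∫ σ, (Qm α u (rot R θ) (rot R σ) - Qm α v (rot R θ) (rot R σ)) ∂(sm N) := by
      rw [hD, ← integral_rot R]
    have i1 : Integrable (fun σ => Qm α u (rot R θ) (rot R σ) - Qm α v (rot R θ) (rot R σ)) (sm N) :=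
      (integrable_rot R).2 ((iu (rot R θ)).sub (iv (rot R θ)))
    have i2 : Integrable (fun σ => Qm α u θ σ - Qm α v θ σ) (sm N) := (iu θ).sub (iv θ)
    beta_reduce
    rw [abs_sub_comm, e1, hD, ← integral_sub i1 i2, dist_comm, ← ht]
    refine (abs_integral_le_add (s := Metric.ball θ t) measurableSet_ball
      ((hL θ t ht0).1.const_mul (2 * C₁ * ε * W))
      ((hP θ t ht0).1.const_mul (C₂ * ε * W * (8 * t) ^ (α + γ))) (fun σ _ => ?_)
      (fun σ _ => H₂ u v ε W hε hu hv hw R _ hR θ σ)).trans ?_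
    · have a1 := H₁ u v ε W hε hu hv hw θ σ
      have a2 := H₁ u v ε W hε hu hv hw (rot R θ) (rot R σ)
      rw [dist_rot] at a2
      refine (abs_sub _ _).trans ?_
      linarith
    · rw [integral_const_mul, integral_const_mul]
      have r1 : t ^ ((N : ℝ) - 1 + (1 + (α + γ) - (N + α))) = t ^ γ := by congr 1; ring
      have r2 : (8 * t) ^ (α + γ) * t ^ ((N : ℝ) - 1 + (1 - (N + α))) = 8 ^ (α + γ) * t ^ γ := by
        rw [Real.mul_rpow (by norm_num) ht0.le, mul_assoc, ← Real.rpow_add ht0]; congr 2; ring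
      have q1 := (hL θ t ht0).2
      have q2 := (hP θ t ht0).2
      rw [r1] at q1
      calc _ ≤ 2 * C₁ * ε * W * (L * t ^ γ) +
            C₂ * ε * W * (8 * t) ^ (α + γ) * (P * t ^ ((N : ℝ) - 1 + (1 - (N + α)))) := by gcongr
        _ = 2 * C₁ * ε * W * (L * t ^ γ) +
            C₂ * ε * W * P * ((8 * t) ^ (α + γ) * t ^ ((N : ℝ) - 1 + (1 - (N + α)))) := by ring
        _ = (2 * C₁ * L + C₂ * 8 ^ (α + γ) * P) * ε * W * t ^ γ := by rw [r2]; ring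
        _ ≤ _ := by
          gcongr
          have : 0 ≤ C₁ * K := by positivity
          linarith

end Quadratic

section Lattice

variable {N M : ℕ} {α : ℝ}

/-- The lattice vector with integer coordinates `k`. -/
noncomputable def lat (a : Fin M → EE N) (k : Fin M → ℤ) : EE N := ∑ i, (k i : ℝ) • a i

lemma lat_sub (a : Fin M → EE N) (k l : Fin M → ℤ) : lat a (k - l) = lat a k - lat a l := by
  simp [lat, sub_smul, Finset.sum_sub_distrib]

lemma lat_neg (a : Fin M → EE N) (k : Fin M → ℤ) : lat a (-k) = -lat a k := by
  simp [lat]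

lemma lat_zero (a : Fin M → EE N) : lat a 0 = 0 := by simp [lat]

lemma exists_norm_le_lat {a : Fin M → EE N} (ha : LinearIndependent ℝ a) :
    ∃ c > 0, ∀ k : Fin M → ℤ, c * ‖fun i => (k i : ℝ)‖ ≤ ‖lat a k‖ := by
  obtain ⟨K, hK, h⟩ := LinearMap.exists_antilipschitzWith (Fintype.linearCombination ℝ a)
    (by rw [LinearMap.ker_eq_bot]
        exact ha.fintypeLinearCombination_injective)
  refine ⟨(K : ℝ)⁻¹, by positivity, fun k => ?_⟩
  have h1 := h.le_mul_dist (fun i => (k i : ℝ)) 0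
  rw [dist_zero_right, map_zero, dist_zero_right] at h1
  rw [inv_mul_le_iff₀ (by positivity)]
  exact h1

lemma one_le_norm_int {k : Fin M → ℤ} (hk : k ≠ 0) : 1 ≤ ‖fun i => (k i : ℝ)‖ := by
  obtain ⟨i, hi⟩ := Function.ne_iff.1 hk
  refine le_trans ?_ (norm_le_pi_norm (fun i => (k i : ℝ)) i)
  rw [Real.norm_eq_abs, ← Int.cast_abs]
  exact_mod_cast Int.one_le_abs hi

lemma summable_int_rpow {s : ℝ} (hs : (M : ℝ) < s) :
    Summable fun k : Fin M → ℤ => ‖fun i => (k i : ℝ)‖ ^ (-s) := by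
  let L := Submodule.span ℤ (Set.range (Pi.basisFun ℝ (Fin M)))
  have hL := ZLattice.summable_norm_rpow L (-s) (by
    rw [ZLattice.rank ℝ, Module.finrank_fintype_fun_eq_card, Fintype.card_fin]; linarith)
  have hmem : ∀ k : Fin M → ℤ, (fun i => (k i : ℝ)) ∈ L := fun k => by
    rw [(Pi.basisFun ℝ (Fin M)).mem_span_iff_repr_mem ℤ]
    intro i
    exact ⟨k i, by simp⟩
  exact hL.comp_injective (i := fun k : Fin M → ℤ => (⟨_, hmem k⟩ : L)) (fun k l h => by
    funext i
    have : ((k i : ℤ) : ℝ) = l i := congrFun (congrArg Subtype.val h) i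
    exact_mod_cast this)

/-- The sum of the kernel over the nonzero lattice points. -/
noncomputable def Phi (α : ℝ) (a : Fin M → EE N) (r : ℝ) (z : EE N) : ℝ :=
  ∑' k : {k : Fin M → ℤ // k ≠ 0}, ‖z + r • lat a k‖ ^ (-((N : ℝ) + α))

/-- Regularity and smallness of a kernel on a fixed ball. -/
structure Ker (κ : ℝ) (Ψ : EE N → ℝ) : Prop where
  bd : ∀ z, ‖z‖ ≤ 8 → |Ψ z| ≤ κ
  lip : ∀ z w, ‖z‖ ≤ 8 → ‖w‖ ≤ 8 → |Ψ z - Ψ w| ≤ κ * ‖z - w‖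
  four : ∀ z₁ z₂ z₃ z₄, ‖z₁‖ ≤ 8 → ‖z₂‖ ≤ 8 → ‖z₃‖ ≤ 8 → ‖z₄‖ ≤ 8 →
    |Ψ z₁ - Ψ z₂ - Ψ z₃ + Ψ z₄| ≤ κ * (‖z₁ - z₂ - z₃ + z₄‖ + ‖z₂ - z₄‖ * ‖z₃ - z₄‖)

lemma exists_Ker_term (s : ℝ) (hs : 0 < s) : ∃ C : ℝ, 0 ≤ C ∧ ∀ w : EE N, 128 ≤ ‖w‖ →
    Ker (C * ‖w‖ ^ (-s)) (fun z => ‖z + w‖ ^ (-s)) := by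
  obtain ⟨C₂, hC₂, h₂⟩ := exists_second_diff_bound (E := EE N) (-s)
  have key : ∀ w : EE N, 128 ≤ ‖w‖ → ∀ z, ‖z‖ ≤ 24 → ‖w‖ / 2 ≤ ‖z + w‖ := fun w hw z hz => by
    have := norm_sub_le (z + w) z
    rw [add_sub_cancel_left] at this
    linarith
  have hp : ∀ w : EE N, 128 ≤ ‖w‖ → ∀ z, ‖z‖ ≤ 24 → ∀ q, 0 ≤ q →
      ‖z + w‖ ^ (-s - q) ≤ 2 ^ s * ‖w‖ ^ (-s) := fun w hw z hz q hq => by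
    have h1 := key w hw z hz
    calc ‖z + w‖ ^ (-s - q) ≤ ‖z + w‖ ^ (-s) :=
          Real.rpow_le_rpow_of_exponent_le (by linarith) (by linarith)
      _ ≤ (‖w‖ / 2) ^ (-s) := Real.rpow_le_rpow_of_nonpos (by linarith) h1 (by linarith)
      _ = 2 ^ s * ‖w‖ ^ (-s) := by
          rw [Real.div_rpow (by linarith) (by norm_num), Real.rpow_neg (by norm_num : (0:ℝ) ≤ 2),
            div_inv_eq_mul, mul_comm]
  have hlip : ∀ w : EE N, 128 ≤ ‖w‖ → ∀ z z', ‖z‖ ≤ 24 → ‖z'‖ ≤ 24 →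
      |‖z + w‖ ^ (-s) - ‖z' + w‖ ^ (-s)| ≤ (2 * (s + 1) * 2 ^ s) * ‖w‖ ^ (-s) * ‖z - z'‖ := by
    intro w hw z z' hz hz'
    have h1 := abs_rpow_sub_rpow_le (p := -s) (by linarith) (norm_nonneg (z + w))
      (norm_nonneg (z' + w))
    have h3 : |‖z + w‖ - ‖z' + w‖| ≤ ‖z - z'‖ := by
      have := abs_norm_sub_norm_le (z + w) (z' + w)
      rwa [add_sub_add_right_eq_sub] at this
    have h4 := hp w hw z hz 1 zero_le_one
    have h5 := hp w hw z' hz' 1 zero_le_one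
    rw [abs_neg, abs_of_pos hs] at h1
    calc _ ≤ _ := h1
      _ ≤ (s + 1) * ‖z - z'‖ * (2 ^ s * ‖w‖ ^ (-s) + 2 ^ s * ‖w‖ ^ (-s)) := by gcongr
      _ = _ := by ring
  have e2 : 0 < (2:ℝ) ^ s := by positivity
  refine ⟨(2 * (s + 1) * 2 ^ s) + C₂ * 2 ^ s, by positivity, fun w hw => ⟨fun z hz => ?_,
    fun z z' hz hz' => ?_, fun z₁ z₂ z₃ z₄ h1 h2 h3 h4 => ?_⟩⟩
  · rw [abs_of_nonneg (by positivity)]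
    have h1 := hp w hw z (by linarith) 0 le_rfl
    rw [sub_zero] at h1
    refine h1.trans ?_
    gcongr
    nlinarith [mul_nonneg hC₂ e2.le]
  · refine (hlip w hw z z' (by linarith) (by linarith)).trans ?_
    gcongr
    linarith [mul_nonneg hC₂ e2.le]
  · have hn : ‖z₂ + z₃ - z₄‖ ≤ 24 := by
      have := norm_sub_le (z₂ + z₃) z₄
      have := norm_add_le z₂ z₃
      linarith
    have l1 := hlip w hw z₁ (z₂ + z₃ - z₄) (by linarith) hn
    have hk := key w hw z₄ (by linarith)
    have l2 := h₂ (z₄ + w) (z₂ - z₄) (z₃ - z₄)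
      (by have := norm_sub_le z₂ z₄; linarith) (by have := norm_sub_le z₃ z₄; linarith)
    have l3 := hp w hw z₄ (by linarith) 2 (by norm_num)
    rw [show z₄ + w + (z₂ - z₄) + (z₃ - z₄) = z₂ + z₃ - z₄ + w by abel,
      show z₄ + w + (z₂ - z₄) = z₂ + w by abel, show z₄ + w + (z₃ - z₄) = z₃ + w by abel] at l2
    rw [show z₁ - (z₂ + z₃ - z₄) = z₁ - z₂ - z₃ + z₄ by abel] at l1
    have l4 : C₂ * ‖z₂ - z₄‖ * ‖z₃ - z₄‖ * ‖z₄ + w‖ ^ (-s - 2) ≤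
        C₂ * ‖z₂ - z₄‖ * ‖z₃ - z₄‖ * (2 ^ s * ‖w‖ ^ (-s)) := by gcongr
    have l5 : 0 ≤ C₂ * 2 ^ s * ‖w‖ ^ (-s) * ‖z₁ - z₂ - z₃ + z₄‖ := by positivity
    have l6 : 0 ≤ (2 * (s + 1) * 2 ^ s) * ‖w‖ ^ (-s) * (‖z₂ - z₄‖ * ‖z₃ - z₄‖) := by positivity
    rw [show ‖z₁ + w‖ ^ (-s) - ‖z₂ + w‖ ^ (-s) - ‖z₃ + w‖ ^ (-s) + ‖z₄ + w‖ ^ (-s) =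
      (‖z₁ + w‖ ^ (-s) - ‖z₂ + z₃ - z₄ + w‖ ^ (-s)) +
      (‖z₂ + z₃ - z₄ + w‖ ^ (-s) - ‖z₂ + w‖ ^ (-s) - (‖z₃ + w‖ ^ (-s) - ‖z₄ + w‖ ^ (-s))) by ring]
    refine (abs_add_le _ _).trans ?_
    nlinarith

lemma Ker.tsum {ι : Type*} {c : ι → ℝ} {Ψ : ι → EE N → ℝ} (h : ∀ k, Ker (c k) (Ψ k))
    (hc : Summable c) : Ker (∑' k, c k) (fun z => ∑' k, Ψ k z) := by
  have hs : ∀ z, ‖z‖ ≤ 8 → Summable fun k => Ψ k z := fun z hz =>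
    Summable.of_norm_bounded hc fun k => (h k).bd z hz
  have hle : ∀ (f : ι → ℝ) (B : ℝ), (∀ k, |f k| ≤ c k * B) → |∑' k, f k| ≤ (∑' k, c k) * B :=
    fun f B hf => by
      rw [← tsum_mul_right]
      exact tsum_of_norm_bounded (f := f) (hc.mul_right B).hasSum hf
  refine ⟨fun z hz => ?_, fun z w hz hw => ?_, fun z₁ z₂ z₃ z₄ h1 h2 h3 h4 => ?_⟩
  · have := hle (fun k => Ψ k z) 1 fun k => by rw [mul_one]; exact (h k).bd z hz
    rwa [mul_one] at this
  · rw [← (hs z hz).tsum_sub (hs w hw)]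
    exact hle _ _ fun k => (h k).lip z w hz hw
  · rw [← (hs _ h1).tsum_sub (hs _ h2), ← ((hs _ h1).sub (hs _ h2)).tsum_sub (hs _ h3),
      ← (((hs _ h1).sub (hs _ h2)).sub (hs _ h3)).tsum_add (hs _ h4)]
    exact hle _ _ fun k => (h k).four z₁ z₂ z₃ z₄ h1 h2 h3 h4

lemma Phi_neg (a : Fin M → EE N) (r : ℝ) (z : EE N) : Phi α a r (-z) = Phi α a r z := by
  unfold Phi
  let e : {k : Fin M → ℤ // k ≠ 0} ≃ {k : Fin M → ℤ // k ≠ 0} :=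
    (Equiv.neg (Fin M → ℤ)).subtypeEquiv fun k => by simp
  rw [← e.tsum_eq]
  refine tsum_congr fun k => ?_
  have : ((e k : {k : Fin M → ℤ // k ≠ 0}) : Fin M → ℤ) = -(k : Fin M → ℤ) := rfl
  rw [this, lat_neg, smul_neg, ← neg_add, norm_neg]

lemma exists_Ker_Phi (hN : 2 ≤ N) (hMN : M ≤ N) (hα : 0 < α) {a : Fin M → EE N} (ha : LinearIndependent ℝ a) :
    ∃ C : ℝ, 0 ≤ C ∧ ∃ R : ℝ, 1 ≤ R ∧ ∀ r, R ≤ r →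
      (∀ k, k ≠ 0 → 128 ≤ ‖r • lat a k‖) ∧
      (∀ z, ‖z‖ ≤ 8 → Summable fun k : {k : Fin M → ℤ // k ≠ 0} =>
        ‖z + r • lat a k‖ ^ (-((N : ℝ) + α))) ∧
      Ker (C * r⁻¹) (Phi α a r) := by
  obtain ⟨c, hc, hlat⟩ := exists_norm_le_lat ha
  have hs : (M : ℝ) < (N : ℝ) + α := by
    have : (M : ℝ) ≤ N := by exact_mod_cast hMN
    linarith
  have hs0 : 0 < (N : ℝ) + α := by have := Nat.cast_nonneg (α := ℝ) N; linarith
  obtain ⟨C, hC, hK⟩ := exists_Ker_term (N := N) ((N : ℝ) + α) hs0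
  have hsum := summable_int_rpow hs
  set s : ℝ := (N : ℝ) + α with hsdef
  have h1s : 1 ≤ s := by
    have : (2:ℝ) ≤ N := by exact_mod_cast hN
    linarith
  have hsub : Summable fun k : {k : Fin M → ℤ // k ≠ 0} => ‖fun i => ((k : Fin M → ℤ) i : ℝ)‖ ^ (-s) :=
    hsum.comp_injective Subtype.val_injective
  set T : ℝ := ∑' k : {k : Fin M → ℤ // k ≠ 0}, ‖fun i => ((k : Fin M → ℤ) i : ℝ)‖ ^ (-s) with hT
  have hT0 : 0 ≤ T := tsum_nonneg fun k => by positivity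
  refine ⟨C * (c ^ (-s) * T), by positivity, max 1 (128 / c), le_max_left _ _, fun r hr => ?_⟩
  have hr1 : 1 ≤ r := (le_max_left _ _).trans hr
  have hr2 : 128 ≤ r * c := by
    have := (le_max_right _ _).trans hr
    rwa [div_le_iff₀ hc] at this
  have hnorm : ∀ k : Fin M → ℤ, (r * c) * ‖fun i => (k i : ℝ)‖ ≤ ‖r • lat a k‖ := fun k => by
    rw [norm_smul, Real.norm_eq_abs, abs_of_pos (by linarith), mul_assoc]
    exact mul_le_mul_of_nonneg_left (hlat k) (by linarith)
  have h128 : ∀ k : Fin M → ℤ, k ≠ 0 → 128 ≤ ‖r • lat a k‖ := fun k hk => by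
    have h1 := one_le_norm_int hk
    nlinarith [hnorm k]
  have hker : ∀ k : {k : Fin M → ℤ // k ≠ 0},
      Ker (C * (r⁻¹ * c ^ (-s) * ‖fun i => ((k : Fin M → ℤ) i : ℝ)‖ ^ (-s)))
        (fun z => ‖z + r • lat a k‖ ^ (-s)) := fun k => by
    have h0 := hK _ (h128 k k.2)
    have hle : ‖r • lat a k‖ ^ (-s) ≤ r⁻¹ * c ^ (-s) * ‖fun i => ((k : Fin M → ℤ) i : ℝ)‖ ^ (-s) := by
      have h1 := one_le_norm_int k.2
      calc ‖r • lat a k‖ ^ (-s) ≤ ((r * c) * ‖fun i => ((k : Fin M → ℤ) i : ℝ)‖) ^ (-s) :=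
            Real.rpow_le_rpow_of_nonpos (by nlinarith) (hnorm k) (by linarith)
        _ = r ^ (-s) * c ^ (-s) * ‖fun i => ((k : Fin M → ℤ) i : ℝ)‖ ^ (-s) := by
            rw [Real.mul_rpow (by nlinarith) (by positivity), Real.mul_rpow (by linarith) hc.le]
        _ ≤ r ^ (-1:ℝ) * c ^ (-s) * ‖fun i => ((k : Fin M → ℤ) i : ℝ)‖ ^ (-s) := by
            gcongr
        _ = _ := by rw [Real.rpow_neg_one]
    have hle' := mul_le_mul_of_nonneg_left hle hC
    exact ⟨fun z hz => (h0.bd z hz).trans hle',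
      fun z w hz hw => (h0.lip z w hz hw).trans (by gcongr),
      fun z₁ z₂ z₃ z₄ a1 a2 a3 a4 => (h0.four z₁ z₂ z₃ z₄ a1 a2 a3 a4).trans (by gcongr)⟩
  have hsum' : Summable fun k : {k : Fin M → ℤ // k ≠ 0} =>
      C * (r⁻¹ * c ^ (-s) * ‖fun i => ((k : Fin M → ℤ) i : ℝ)‖ ^ (-s)) :=
    (hsub.mul_left _).mul_left _
  refine ⟨h128, fun z hz => Summable.of_norm_bounded hsum' fun k => (hker k).bd z hz, ?_⟩
  have h := Ker.tsum hker hsum'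
  rw [tsum_mul_left, tsum_mul_left, ← hT] at h
  rw [show C * (c ^ (-s) * T) * r⁻¹ = C * (r⁻¹ * c ^ (-s) * T) by ring]
  exact h

end Lattice

section Body

variable {N : ℕ}

/-- The star-shaped body with logarithmic radial function `u`. -/
def body (u : Sph N → ℝ) : Set (EE N) := {x | ∀ (σ : Sph N) (s : ℝ), x = Real.exp s • (σ : EE N) → s < u σ}

lemma exp_smul_mem_body {u : Sph N → ℝ} {σ : Sph N} {s : ℝ} :
    Real.exp s • (σ : EE N) ∈ body u ↔ s < u σ := by
  refine ⟨fun h => h σ s rfl, fun h τ t e => ?_⟩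
  have := measurableEmbedding_logPolar.injective (a₁ := (σ, s)) (a₂ := (τ, t)) e
  obtain ⟨rfl, rfl⟩ := Prod.mk.inj this
  exact h

lemma zero_mem_body (u : Sph N → ℝ) : (0 : EE N) ∈ body u := fun σ s h => by
  have := congrArg norm h
  rw [norm_smul, norm_coe, norm_zero, Real.norm_eq_abs, Real.abs_exp] at this
  exact absurd this.symm (by positivity)

lemma exists_logPolar {x : EE N} (hx : x ≠ 0) :
    ∃ (σ : Sph N) (s : ℝ), x = Real.exp s • (σ : EE N) := by
  have h : 0 < ‖x‖ := norm_pos_iff.2 hx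
  refine ⟨⟨‖x‖⁻¹ • x, by simp [norm_smul, h.ne']⟩, Real.log ‖x‖, ?_⟩
  rw [Real.exp_log h, smul_smul, mul_inv_cancel₀ h.ne', one_smul]

lemma body_eq (u : Sph N → ℝ) : body u =
    insert 0 ((fun p : Sph N × ℝ => Real.exp p.2 • (p.1 : EE N)) '' {p | p.2 < u p.1}) := by
  ext x
  rcases eq_or_ne x 0 with rfl | hx
  · simp [zero_mem_body]
  · obtain ⟨σ, s, rfl⟩ := exists_logPolar hx
    rw [exp_smul_mem_body, Set.mem_insert_iff, or_iff_right hx]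
    exact ⟨fun h => ⟨(σ, s), h, rfl⟩, fun ⟨p, hp, e⟩ => by
      have := measurableEmbedding_logPolar.injective (a₁ := p) (a₂ := (σ, s)) e
      rw [this] at hp
      exact hp⟩

lemma measurableSet_body {u : Sph N → ℝ} (hu : Continuous u) : MeasurableSet (body u) := by
  rw [body_eq]
  refine MeasurableSet.insert (measurableEmbedding_logPolar.measurableSet_image.2 ?_) 0
  exact measurableSet_lt measurable_snd (hu.measurable.comp measurable_fst)

lemma norm_exp_smul (s : ℝ) (σ : Sph N) : ‖Real.exp s • (σ : EE N)‖ = Real.exp s := by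
  rw [norm_smul, norm_coe, Real.norm_eq_abs, Real.abs_exp, mul_one]

lemma exp_le_three {x : ℝ} (hx : x ≤ 1) : Real.exp x ≤ 3 := by
  have := Real.exp_one_lt_d9
  have := Real.exp_le_exp.2 hx
  linarith

lemma body_subset {u : Sph N → ℝ} (hu : ∀ σ, |u σ| ≤ 1) {x : EE N} (hx : x ∈ body u) : ‖x‖ ≤ 3 := by
  rcases eq_or_ne x 0 with rfl | h0
  · simp
  · obtain ⟨σ, s, rfl⟩ := exists_logPolar h0
    rw [exp_smul_mem_body] at hx
    rw [norm_exp_smul]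
    exact exp_le_three (by linarith [(abs_le.1 (hu σ)).2])

lemma volume_body_ne_top {u : Sph N → ℝ} (hu : ∀ σ, |u σ| ≤ 1) : volume (body u) ≠ ⊤ :=
  ((measure_mono (fun x hx => by simpa using body_subset hu hx)).trans_lt
    (measure_closedBall_lt_top (x := (0 : EE N)) (r := 3))).ne

open scoped symmDiff in
lemma exists_volume_symmDiff_le (hN : 2 ≤ N) : ∃ C : ℝ, 0 ≤ C ∧ ∀ (u v : Sph N → ℝ) (W : ℝ),
    Continuous u → Continuous v → (∀ σ, |u σ| ≤ 1) → (∀ σ, |v σ| ≤ 1) → 0 ≤ W →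
    (∀ σ, |u σ - v σ| ≤ W) → volume.real (body u ∆ body v) ≤ C * W := by
  refine ⟨(sm N).real Set.univ * (Real.exp N * 2), by positivity, fun u v W hu hv hu1 hv1 hW huv => ?_⟩
  have hms : MeasurableSet (body u ∆ body v) := (measurableSet_body hu).symmDiff (measurableSet_body hv)
  have key : volume (body u ∆ body v) ≤
      ENNReal.ofReal ((sm N).real Set.univ * (Real.exp N * 2) * W) := by
    rw [← (measurePreserving_logPolar hN).measure_preimage hms.nullMeasurableSet,
      Measure.prod_apply (measurable_logPolar hms)]
    have hslice : ∀ σ : Sph N, lw N (Prod.mk σ ⁻¹'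
        ((fun p : Sph N × ℝ => Real.exp p.2 • (p.1 : EE N)) ⁻¹' (body u ∆ body v))) ≤
        ENNReal.ofReal (Real.exp N * 2 * W) := fun σ => by
      have hsub : (Prod.mk σ ⁻¹'
          ((fun p : Sph N × ℝ => Real.exp p.2 • (p.1 : EE N)) ⁻¹' (body u ∆ body v))) ⊆
          Set.Icc (min (u σ) (v σ)) (max (u σ) (v σ)) := by
        intro s hs
        simp only [Set.mem_preimage, Set.mem_symmDiff, exp_smul_mem_body, not_lt] at hs
        rcases hs with ⟨h1, h2⟩ | ⟨h1, h2⟩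
        · exact ⟨(min_le_right _ _).trans h2, h1.le.trans (le_max_left _ _)⟩
        · exact ⟨(min_le_left _ _).trans h2, h1.le.trans (le_max_right _ _)⟩
      refine (measure_mono hsub).trans ?_
      rw [lw, withDensity_apply _ measurableSet_Icc]
      refine (setLIntegral_mono' (g := fun _ => ENNReal.ofReal (Real.exp N)) measurableSet_Icc
        fun s hs => ?_).trans ?_
      · refine ENNReal.ofReal_le_ofReal (Real.exp_le_exp.2 ?_)
        have h1 : s ≤ 1 := hs.2.trans (max_le (abs_le.1 (hu1 σ)).2 (abs_le.1 (hv1 σ)).2)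
        have := Nat.cast_nonneg (α := ℝ) N
        nlinarith
      · rw [setLIntegral_const, Real.volume_Icc, max_sub_min_eq_abs', ← ENNReal.ofReal_mul (by positivity)]
        refine ENNReal.ofReal_le_ofReal ?_
        nlinarith [huv σ, Real.exp_pos N]
    refine (lintegral_mono hslice).trans ?_
    rw [lintegral_const, mul_assoc ((sm N).real Set.univ), ENNReal.ofReal_mul measureReal_nonneg, mul_comm,
      ofReal_measureReal]
  exact (ENNReal.toReal_mono ENNReal.ofReal_ne_top key).trans_eq
    (ENNReal.toReal_ofReal (by positivity))

open scoped symmDiff in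
lemma abs_setIntegral_sub_le {X : Type*} [MeasurableSpace X] {μ : Measure X} {s t : Set X}
    (hs : MeasurableSet s) (ht : MeasurableSet t) (hst : μ (s ∆ t) ≠ ⊤) {f : X → ℝ} {c : ℝ}
    (hfs : IntegrableOn f s μ) (hft : IntegrableOn f t μ) (hc : ∀ x ∈ s ∪ t, |f x| ≤ c) :
    |∫ x in s, f x ∂μ - ∫ x in t, f x ∂μ| ≤ c * μ.real (s ∆ t) := by
  rw [← integral_indicator hs, ← integral_indicator ht,
    ← integral_sub (hfs.integrable_indicator hs) (hft.integrable_indicator ht)]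
  have hz : ∀ x, x ∉ s ∆ t → s.indicator f x - t.indicator f x = 0 := fun x hx => by
    rw [Set.mem_symmDiff] at hx
    by_cases h1 : x ∈ s <;> by_cases h2 : x ∈ t <;> simp_all
  rw [← setIntegral_eq_integral_of_forall_compl_eq_zero hz, ← Real.norm_eq_abs]
  refine norm_setIntegral_le_of_norm_le_const hst.lt_top fun x hx => ?_
  rw [Set.mem_symmDiff] at hx
  rcases hx with ⟨h1, h2⟩ | ⟨h1, h2⟩
  · simpa [h1, h2] using hc x (Or.inl h1)
  · simpa [h1, h2] using hc x (Or.inr h1)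

end Body

section Potential

variable {N : ℕ} {α κ : ℝ} {Ψ : EE N → ℝ}

/-- The kernel `Ψ` integrated over the body of `u`, at the point `x`. -/
noncomputable def vol (Ψ : EE N → ℝ) (u : Sph N → ℝ) (x : EE N) : ℝ := ∫ y in body u, Ψ (y - x)

lemma norm_sub_le_eight {x y : EE N} (hy : ‖y‖ ≤ 3) (hx : ‖x‖ ≤ 3) : ‖y - x‖ ≤ 8 :=
  (norm_sub_le _ _).trans (by linarith)

lemma integrableOn_vol (hΨ : Ker κ Ψ) {u : Sph N → ℝ} (hu : Continuous u) (hu1 : ∀ σ, |u σ| ≤ 1)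
    {x : EE N} (hx : ‖x‖ ≤ 3) : IntegrableOn (fun y => Ψ (y - x)) (body u) := by
  have hκ : 0 ≤ κ := (abs_nonneg _).trans (hΨ.bd 0 (by simp))
  have hc : ContinuousOn (fun y => Ψ (y - x)) (Metric.closedBall 0 3) := by
    have : LipschitzOnWith κ.toNNReal (fun y => Ψ (y - x)) (Metric.closedBall 0 3) :=
      LipschitzOnWith.of_dist_le_mul fun y hy z hz => by
        rw [Real.coe_toNNReal _ hκ, Real.dist_eq, dist_eq_norm]
        have := hΨ.lip (y - x) (z - x) (norm_sub_le_eight (by simpa using hy) hx)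
          (norm_sub_le_eight (by simpa using hz) hx)
        rwa [sub_sub_sub_cancel_right] at this
    exact this.continuousOn
  exact (hc.integrableOn_compact (isCompact_closedBall _ _)).mono_set
    fun y hy => by simpa using body_subset hu1 hy

lemma exists_vol_bounds (hN : 2 ≤ N) : ∃ C : ℝ, 0 ≤ C ∧ ∀ (κ : ℝ) (Ψ : EE N → ℝ), Ker κ Ψ →
    ∀ u : Sph N → ℝ, Continuous u → (∀ σ, |u σ| ≤ 1) →
    (∀ x, ‖x‖ ≤ 3 → |vol Ψ u x| ≤ C * κ) ∧
    (∀ x y, ‖x‖ ≤ 3 → ‖y‖ ≤ 3 → |vol Ψ u x - vol Ψ u y| ≤ C * κ * ‖x - y‖) ∧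
    (∀ x₁ x₂ x₃ x₄, ‖x₁‖ ≤ 3 → ‖x₂‖ ≤ 3 → ‖x₃‖ ≤ 3 → ‖x₄‖ ≤ 3 →
      |vol Ψ u x₁ - vol Ψ u x₂ - vol Ψ u x₃ + vol Ψ u x₄| ≤
        C * κ * (‖x₁ - x₂ - x₃ + x₄‖ + ‖x₂ - x₄‖ * ‖x₃ - x₄‖)) ∧
    ∀ (v : Sph N → ℝ) (W : ℝ), Continuous v → (∀ σ, |v σ| ≤ 1) → 0 ≤ W → (∀ σ, |u σ - v σ| ≤ W) →
      (∀ x, ‖x‖ ≤ 3 → |vol Ψ u x - vol Ψ v x| ≤ C * κ * W) ∧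
      ∀ x y, ‖x‖ ≤ 3 → ‖y‖ ≤ 3 →
        |(vol Ψ u x - vol Ψ v x) - (vol Ψ u y - vol Ψ v y)| ≤ C * κ * W * ‖x - y‖ := by
  obtain ⟨C, hC, hsd⟩ := exists_volume_symmDiff_le hN
  set D := (volume : Measure (EE N)).real (Metric.closedBall 0 3) with hD
  have hD0 : 0 ≤ D := measureReal_nonneg
  refine ⟨C + D, by positivity, fun κ Ψ hΨ u hu hu1 => ?_⟩
  have hκ : 0 ≤ κ := (abs_nonneg _).trans (hΨ.bd 0 (by simp))
  have hvol : volume.real (body u) ≤ D := measureReal_mono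
    (fun y hy => by simpa using body_subset hu1 hy)
    (measure_closedBall_lt_top (x := (0 : EE N)) (r := 3)).ne
  have hset : ∀ (f : EE N → ℝ) (c : ℝ), (∀ y, ‖y‖ ≤ 3 → |f y| ≤ κ * c) → 0 ≤ c →
      |∫ y in body u, f y| ≤ (C + D) * κ * c := fun f c hf hc => by
    rw [← Real.norm_eq_abs]
    refine (norm_setIntegral_le_of_norm_le_const (volume_body_ne_top hu1).lt_top
      fun y hy => hf y (body_subset hu1 hy)).trans ?_
    have : κ * c * volume.real (body u) ≤ κ * c * (C + D) := by gcongr; linarith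
    linarith
  refine ⟨fun x hx => ?_, fun x y hx hy => ?_, fun x₁ x₂ x₃ x₄ h1 h2 h3 h4 => ?_,
    fun v W hv hv1 hW huv => ⟨fun x hx => ?_, fun x y hx hy => ?_⟩⟩
  · have := hset (fun y => Ψ (y - x)) 1 (fun y hy => by
      rw [mul_one]; exact hΨ.bd _ (norm_sub_le_eight hy hx)) zero_le_one
    rwa [mul_one] at this
  · unfold vol
    rw [← integral_sub (integrableOn_vol hΨ hu hu1 hx) (integrableOn_vol hΨ hu hu1 hy)]
    refine hset _ _ (fun z hz => ?_) (norm_nonneg _)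
    have := hΨ.lip (z - x) (z - y) (norm_sub_le_eight hz hx) (norm_sub_le_eight hz hy)
    rwa [sub_sub_sub_cancel_left, norm_sub_rev] at this
  · unfold vol
    have i1 := integrableOn_vol hΨ hu hu1 h1
    have i2 := integrableOn_vol hΨ hu hu1 h2
    have i3 := integrableOn_vol hΨ hu hu1 h3
    have i12 : IntegrableOn (fun y => Ψ (y - x₁) - Ψ (y - x₂)) (body u) := i1.sub i2
    have i123 : IntegrableOn (fun y => Ψ (y - x₁) - Ψ (y - x₂) - Ψ (y - x₃)) (body u) := i12.sub i3
    rw [← integral_sub i1 i2, ← integral_sub i12 i3,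
      ← integral_add i123 (integrableOn_vol hΨ hu hu1 h4)]
    refine hset _ _ (fun z hz => ?_) (by positivity)
    have := hΨ.four (z - x₁) (z - x₂) (z - x₃) (z - x₄) (norm_sub_le_eight hz h1)
      (norm_sub_le_eight hz h2) (norm_sub_le_eight hz h3) (norm_sub_le_eight hz h4)
    rw [show z - x₁ - (z - x₂) - (z - x₃) + (z - x₄) = -(x₁ - x₂ - x₃ + x₄) by abel, norm_neg,
      sub_sub_sub_cancel_left, sub_sub_sub_cancel_left, norm_sub_rev x₄ x₂, norm_sub_rev x₄ x₃] at this
    exact this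
  · have h := abs_setIntegral_sub_le (measurableSet_body hu) (measurableSet_body hv)
      (measure_ne_top_of_subset Set.symmDiff_subset_union
        (measure_union_ne_top (volume_body_ne_top hu1) (volume_body_ne_top hv1)))
      (integrableOn_vol hΨ hu hu1 hx) (integrableOn_vol hΨ hv hv1 hx) (c := κ) (fun y hy => hΨ.bd _
        (norm_sub_le_eight (hy.elim (body_subset hu1) (body_subset hv1)) hx))
    have h2 := hsd u v W hu hv hu1 hv1 hW huv
    have h3 : κ * volume.real (symmDiff (body u) (body v)) ≤ κ * (C * W) := by gcongr
    have h4 : 0 ≤ D * κ * W := by positivity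
    refine h.trans (h3.trans ?_)
    linarith
  · have hi : ∀ w : Sph N → ℝ, Continuous w → (∀ σ, |w σ| ≤ 1) →
        IntegrableOn (fun z => Ψ (z - x) - Ψ (z - y)) (body w) := fun w hw hw1 =>
      (integrableOn_vol hΨ hw hw1 hx).sub (integrableOn_vol hΨ hw hw1 hy)
    have h := abs_setIntegral_sub_le (measurableSet_body hu) (measurableSet_body hv)
      (measure_ne_top_of_subset Set.symmDiff_subset_union
        (measure_union_ne_top (volume_body_ne_top hu1) (volume_body_ne_top hv1)))
      (hi u hu hu1) (hi v hv hv1) (c := κ * ‖x - y‖) (fun z hz => by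
        have hz3 : ‖z‖ ≤ 3 := hz.elim (body_subset hu1) (body_subset hv1)
        have := hΨ.lip (z - x) (z - y) (norm_sub_le_eight hz3 hx) (norm_sub_le_eight hz3 hy)
        rwa [sub_sub_sub_cancel_left, norm_sub_rev] at this)
    rw [integral_sub (integrableOn_vol hΨ hu hu1 hx) (integrableOn_vol hΨ hu hu1 hy),
      integral_sub (integrableOn_vol hΨ hv hv1 hx) (integrableOn_vol hΨ hv hv1 hy)] at h
    have h2 := hsd u v W hu hv hu1 hv1 hW huv
    have h3 : κ * ‖x - y‖ * volume.real (symmDiff (body u) (body v)) ≤ κ * ‖x - y‖ * (C * W) := by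
      gcongr
    have h4 : 0 ≤ D * κ * W * ‖x - y‖ := by positivity
    rw [sub_sub_sub_comm]
    refine h.trans (h3.trans ?_)
    linarith

end Potential

section HolCalculus

variable {N : ℕ} {γ A B : ℝ} {f g u v : Sph N → ℝ}

lemma Hol.add (hf : Hol γ A f) (hg : Hol γ B g) : Hol γ (A + B) (fun θ => f θ + g θ) := by
  refine ⟨fun θ => (abs_add_le _ _).trans (add_le_add (hf.1 θ) (hg.1 θ)), fun θ τ => ?_⟩
  rw [add_sub_add_comm, add_mul]
  exact (abs_add_le _ _).trans (add_le_add (hf.2 θ τ) (hg.2 θ τ))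

lemma Hol.mul (hf : Hol γ A f) (hg : Hol γ B g) : Hol γ (2 * A * B) (fun θ => f θ * g θ) := by
  refine ⟨fun θ => ?_, fun θ τ => ?_⟩
  · have hA := hf.nonneg θ
    have hB := hg.nonneg θ
    rw [abs_mul]
    have := mul_le_mul (hf.1 θ) (hg.1 θ) (abs_nonneg _) hA
    nlinarith
  · have hA := hf.nonneg θ
    have hB := hg.nonneg θ
    rw [show f θ * g θ - f τ * g τ = f θ * (g θ - g τ) + (f θ - f τ) * g τ by ring]
    refine (abs_add_le _ _).trans ?_
    rw [abs_mul, abs_mul]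
    have h1 := mul_le_mul (hf.1 θ) (hg.2 θ τ) (abs_nonneg _) hA
    have h2 := mul_le_mul (hf.2 θ τ) (hg.1 τ) (abs_nonneg _) (by positivity)
    linarith

lemma Hol.const (c : ℝ) (γ : ℝ) : Hol γ |c| (fun _ : Sph N => c) :=
  ⟨fun _ => le_rfl, fun _ _ => by rw [sub_self, abs_zero]; positivity⟩

lemma hol_one_iff : Hol 1 A f ↔ (∀ θ, |f θ| ≤ A) ∧ ∀ θ τ, |f θ - f τ| ≤ A * dist θ τ := by
  simp [Hol]

lemma Hol.of_one (hf : Hol 1 A f) (hγ0 : 0 ≤ γ) (hγ : γ ≤ 1) : Hol γ (2 * A) f := by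
  refine ⟨fun θ => (hf.1 θ).trans (by linarith [hf.nonneg θ]), fun θ τ => ?_⟩
  have hA := hf.nonneg θ
  have := (hol_one_iff.1 hf).2 θ τ
  have h2 := dist_le_two_mul_rpow hγ0 hγ θ τ
  nlinarith

lemma XB.hol_one {β U : ℝ} (hu : XB β U u) : Hol 1 U u := hol_one_iff.2 ⟨hu.bd, hu.lip⟩

lemma hol_comp_sub {M M' : ℝ → ℝ} {a b ε W : ℝ} (hε : 0 ≤ ε)
    (hM : ∀ x ∈ Set.Icc (-ε) ε, HasDerivAt M (M' x) x)
    (ha : ∀ x ∈ Set.Icc (-ε) ε, |M' x| ≤ a)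
    (hb : ∀ x ∈ Set.Icc (-ε) ε, ∀ y ∈ Set.Icc (-ε) ε, |M' x - M' y| ≤ b * |x - y|) (hb0 : 0 ≤ b)
    (hu : Hol 1 ε u) (hv : Hol 1 ε v) (hw : Hol 1 W (fun θ => u θ - v θ)) :
    Hol 1 ((a + 2 * b * ε) * W) (fun θ => M (u θ) - M (v θ)) := by
  have hmem : ∀ {w : Sph N → ℝ}, Hol 1 ε w → ∀ θ, w θ ∈ Set.Icc (-ε) ε := fun hw θ => abs_le.1 (hw.1 θ)
  have ha0 : 0 ≤ a := (abs_nonneg _).trans (ha 0 ⟨by linarith, hε⟩)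
  refine hol_one_iff.2 ⟨fun θ => ?_, fun θ τ => ?_⟩
  · have h := Convex.norm_image_sub_le_of_norm_hasDerivWithin_le (𝕜 := ℝ) (s := Set.Icc (-ε) ε) (f := M)
      (f' := M') (C := a) (fun x hx => (hM x hx).hasDerivWithinAt) ha (convex_Icc _ _)
      (hmem hv θ) (hmem hu θ)
    rw [Real.norm_eq_abs, Real.norm_eq_abs] at h
    have h1 := hw.1 θ
    have hW := hw.nonneg θ
    calc _ ≤ _ := h
      _ ≤ a * W := by gcongr
      _ ≤ _ := by have : 0 ≤ 2 * b * ε * W := by positivity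
                  linarith
  · have hW := hw.nonneg θ
    have h := four_point (convex_Icc (-ε) ε) hM ha hb hb0 (hmem hu θ) (hmem hv θ) (hmem hu τ) (hmem hv τ)
    have h1 := (hol_one_iff.1 hw).2 θ τ
    have h2 := hw.1 τ
    have h3 := (hol_one_iff.1 hu).2 θ τ
    have h4 := (hol_one_iff.1 hv).2 θ τ
    have h5 : a * |u θ - v θ - (u τ - v τ)| ≤ a * (W * dist θ τ) := by gcongr
    have h6 : b * |u τ - v τ| * (|u θ - u τ| + |v θ - v τ|) ≤ b * W * (ε * dist θ τ + ε * dist θ τ) := by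
      gcongr
    linarith

lemma hol_exp_sub {c ε W : ℝ} (hc : |c| ≤ 1) (hε : 0 ≤ ε) (hε1 : ε ≤ 1) (hW : 0 ≤ W) (hu : Hol 1 ε u) (hv : Hol 1 ε v)
    (hw : Hol 1 W (fun θ => u θ - v θ)) :
    Hol 1 (9 * W) (fun θ => Real.exp (c * u θ) - Real.exp (c * v θ)) := by
  have hcx : ∀ x ∈ Set.Icc (-ε) ε, c * x ≤ 1 := fun x hx => by
    have h1 : |x| ≤ 1 := (abs_le.2 hx).trans hε1
    calc c * x ≤ |c * x| := le_abs_self _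
      _ = |c| * |x| := abs_mul _ _
      _ ≤ 1 * 1 := by gcongr
      _ = 1 := one_mul 1
  have hd : ∀ x, HasDerivAt (fun x => Real.exp (c * x)) (Real.exp (c * x) * c) x := fun x => by
    simpa using ((hasDerivAt_id x).const_mul c).exp
  have hle : ∀ x ∈ Set.Icc (-ε) ε, |Real.exp (c * x) * c| ≤ 3 := fun x hx => by
    rw [abs_mul, Real.abs_exp]
    have h1 := exp_le_three (hcx x hx)
    calc Real.exp (c * x) * |c| ≤ 3 * 1 := by gcongr
      _ = 3 := mul_one 3
  have hlip : ∀ x ∈ Set.Icc (-ε) ε, ∀ y ∈ Set.Icc (-ε) ε,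
      |Real.exp (c * x) * c - Real.exp (c * y) * c| ≤ 3 * |x - y| := fun x hx y hy => by
    have h := Convex.norm_image_sub_le_of_norm_hasDerivWithin_le (𝕜 := ℝ) (s := Set.Icc (-ε) ε)
      (f := fun x => Real.exp (c * x)) (C := 3) (fun x _ => (hd x).hasDerivWithinAt) hle
      (convex_Icc _ _) hy hx
    rw [Real.norm_eq_abs, Real.norm_eq_abs] at h
    rw [← sub_mul, abs_mul]
    calc |Real.exp (c * x) - Real.exp (c * y)| * |c| ≤ 3 * |x - y| * 1 := by gcongr
      _ = _ := mul_one _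
  exact (hol_comp_sub hε (fun x _ => hd x) hle hlip (by norm_num) hu hv hw).mono (by nlinarith)

lemma hol_exp_sub_one_sub {c ε W : ℝ} (hc : |c| ≤ 1) (hε : 0 ≤ ε) (hε1 : ε ≤ 1) (hW : 0 ≤ W)
    (hu : Hol 1 ε u) (hv : Hol 1 ε v) (hw : Hol 1 W (fun θ => u θ - v θ)) :
    Hol 1 (9 * ε * W) (fun θ => (Real.exp (c * u θ) - 1 - c * u θ) - (Real.exp (c * v θ) - 1 - c * v θ)) := by
  have hcx : ∀ x ∈ Set.Icc (-ε) ε, c * x ≤ 1 := fun x hx => by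
    have h1 : |x| ≤ 1 := (abs_le.2 hx).trans hε1
    calc c * x ≤ |c * x| := le_abs_self _
      _ = |c| * |x| := abs_mul _ _
      _ ≤ 1 * 1 := by gcongr
      _ = 1 := one_mul 1
  have hd : ∀ x, HasDerivAt (fun x => Real.exp (c * x)) (Real.exp (c * x) * c) x := fun x => by
    simpa using ((hasDerivAt_id x).const_mul c).exp
  have hle : ∀ x ∈ Set.Icc (-ε) ε, |Real.exp (c * x) * c| ≤ 3 := fun x hx => by
    rw [abs_mul, Real.abs_exp]
    have h1 := exp_le_three (hcx x hx)
    calc Real.exp (c * x) * |c| ≤ 3 * 1 := by gcongr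
      _ = 3 := mul_one 3
  have hlip : ∀ x ∈ Set.Icc (-ε) ε, ∀ y ∈ Set.Icc (-ε) ε,
      |Real.exp (c * x) - Real.exp (c * y)| ≤ 3 * |x - y| := fun x hx y hy =>
    Convex.norm_image_sub_le_of_norm_hasDerivWithin_le (𝕜 := ℝ) (s := Set.Icc (-ε) ε)
      (f := fun x => Real.exp (c * x)) (C := 3) (fun x _ => (hd x).hasDerivWithinAt) hle
      (convex_Icc _ _) hy hx
  have hm : ∀ x, HasDerivAt (fun x => Real.exp (c * x) - 1 - c * x) ((Real.exp (c * x) - 1) * c) x :=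
    fun x => by
      convert! ((hd x).sub_const 1).sub ((hasDerivAt_id x).const_mul c) using 1
      ring
  refine (hol_comp_sub (a := 3 * ε) (b := 3) hε (fun x _ => hm x) (fun x hx => ?_) (fun x hx y hy => ?_)
    (by norm_num) hu hv hw).mono (by nlinarith [mul_nonneg hε hW])
  · have h := hlip x hx 0 ⟨by linarith, hε⟩
    rw [mul_zero, Real.exp_zero, sub_zero] at h
    rw [abs_mul]
    calc |Real.exp (c * x) - 1| * |c| ≤ 3 * |x| * 1 := by gcongr
      _ ≤ 3 * ε := by rw [mul_one]; gcongr; exact abs_le.2 hx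
  · rw [← sub_mul, sub_sub_sub_cancel_right, abs_mul]
    calc |Real.exp (c * x) - Real.exp (c * y)| * |c| ≤ 3 * |x - y| * 1 := by
          gcongr; exact hlip x hx y hy
      _ = _ := mul_one _

lemma hol_exp {c ε : ℝ} (hc : |c| ≤ 1) (hε : 0 ≤ ε) (hε1 : ε ≤ 1) (hu : Hol 1 ε u) :
    Hol 1 10 (fun θ => Real.exp (c * u θ)) := by
  have h0 : Hol 1 ε (fun _ : Sph N => (0:ℝ)) :=
    hol_one_iff.2 ⟨fun _ => by rwa [abs_zero], fun _ _ => by rw [sub_self, abs_zero]; positivity⟩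
  have h := (hol_exp_sub hc hε hε1 hε hu h0 (by simpa using hu)).add (Hol.const 1 1)
  simp only [mul_zero, Real.exp_zero, sub_add_cancel, abs_one] at h
  exact h.mono (by linarith)

end HolCalculus

section Potential

variable {N : ℕ}

/-- The potential `vol Ψ u` on the boundary of the body of `u`. -/
noncomputable def bpot (Ψ : EE N → ℝ) (u : Sph N → ℝ) (θ : Sph N) : ℝ :=
  vol Ψ u (Real.exp (u θ) • (θ : EE N))

lemma exists_bpot_bounds (hN : 2 ≤ N) : ∃ C : ℝ, 0 ≤ C ∧ ∀ (κ : ℝ) (Ψ : EE N → ℝ), Ker κ Ψ →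
    ∀ (u v : Sph N → ℝ) (ε W : ℝ), 0 ≤ ε → ε ≤ 1 → 0 ≤ W → Hol 1 ε u → Hol 1 ε v →
    Hol 1 W (fun θ => u θ - v θ) →
    Hol 1 (C * κ) (bpot Ψ u) ∧ Hol 1 (C * κ * W) (fun θ => bpot Ψ u θ - bpot Ψ v θ) := by
  obtain ⟨C, hC, hvol⟩ := exists_vol_bounds hN
  refine ⟨170 * C, by positivity, fun κ Ψ hΨ u v ε W hε hε1 hW hu hv hw => ?_⟩
  have hκ : 0 ≤ κ := (abs_nonneg _).trans (hΨ.bd 0 (by simp))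
  have hone : |(1:ℝ)| ≤ 1 := by simp
  have hcont : ∀ {w : Sph N → ℝ}, Hol 1 ε w → Continuous w := fun h => h.continuous one_pos
  have hbd : ∀ {w : Sph N → ℝ}, Hol 1 ε w → ∀ σ, |w σ| ≤ 1 := fun h σ => (h.1 σ).trans hε1
  obtain ⟨u1, u2, -, u4⟩ := hvol κ Ψ hΨ u (hcont hu) (hbd hu)
  obtain ⟨v1, v2, v3, -⟩ := hvol κ Ψ hΨ v (hcont hv) (hbd hv)
  obtain ⟨w1, w2⟩ := u4 v W (hcont hv) (hbd hv) hW hw.1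
  set X : (Sph N → ℝ) → Sph N → EE N := fun w θ => Real.exp (w θ) • (θ : EE N) with hX
  have hX3 : ∀ {w : Sph N → ℝ}, Hol 1 ε w → ∀ θ, ‖X w θ‖ ≤ 3 := fun h θ => by
    rw [hX]; simp only [norm_exp_smul]; exact exp_le_three ((abs_le.1 (hbd h θ)).2)
  have hXl : ∀ {w : Sph N → ℝ}, Hol 1 ε w → ∀ θ τ, ‖X w θ - X w τ‖ ≤ 13 * dist θ τ := fun {w} h θ τ => by
    have h1 := (hol_one_iff.1 (hol_exp hone hε hε1 h)).2 θ τ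
    simp only [one_mul] at h1
    have h2 := exp_le_three ((abs_le.1 (hbd h τ)).2)
    rw [show X w θ - X w τ = (Real.exp (w θ) - Real.exp (w τ)) • (θ : EE N) +
      Real.exp (w τ) • ((θ : EE N) - τ) by simp only [hX]; module]
    refine (norm_add_le _ _).trans ?_
    rw [norm_smul, norm_smul, norm_coe, ← dist_coe, Real.norm_eq_abs, Real.norm_eq_abs, Real.abs_exp]
    nlinarith [dist_nonneg (x := θ) (y := τ)]
  have hE := hol_exp_sub hone hε hε1 hW hu hv hw
  simp only [one_mul] at hE
  have hXW : ∀ θ, ‖X u θ - X v θ‖ ≤ 9 * W := fun θ => by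
    simp only [hX, ← sub_smul]
    rw [norm_smul, norm_coe, mul_one]
    exact hE.1 θ
  have hXd : ∀ θ τ, ‖X u θ - X v θ - X u τ + X v τ‖ ≤ 18 * W * dist θ τ := fun θ τ => by
    have h1 := (hol_one_iff.1 hE).2 θ τ
    have h2 := hE.1 τ
    rw [show X u θ - X v θ - X u τ + X v τ =
      ((Real.exp (u θ) - Real.exp (v θ)) - (Real.exp (u τ) - Real.exp (v τ))) • (θ : EE N) +
      (Real.exp (u τ) - Real.exp (v τ)) • ((θ : EE N) - τ) by simp only [hX]; module]
    refine (norm_add_le _ _).trans ?_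
    rw [norm_smul, norm_smul, norm_coe, ← dist_coe, Real.norm_eq_abs, Real.norm_eq_abs]
    nlinarith [dist_nonneg (x := θ) (y := τ)]
  have hCκ : 0 ≤ C * κ := by positivity
  have hCκW : 0 ≤ C * κ * W := by positivity
  refine ⟨hol_one_iff.2 ⟨fun θ => ?_, fun θ τ => ?_⟩, hol_one_iff.2 ⟨fun θ => ?_, fun θ τ => ?_⟩⟩
  · exact (u1 _ (hX3 hu θ)).trans (by linarith)
  · refine (u2 _ _ (hX3 hu θ) (hX3 hu τ)).trans ?_
    have := mul_le_mul_of_nonneg_left (hXl hu θ τ) hCκ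
    nlinarith [mul_nonneg hCκ (dist_nonneg (x := θ) (y := τ))]
  · have h1 := w1 _ (hX3 hu θ)
    have h2 := v2 _ _ (hX3 hu θ) (hX3 hv θ)
    have h3 := mul_le_mul_of_nonneg_left (hXW θ) hCκ
    rw [show bpot Ψ u θ - bpot Ψ v θ = (vol Ψ u (X u θ) - vol Ψ v (X u θ)) +
      (vol Ψ v (X u θ) - vol Ψ v (X v θ)) by simp only [bpot, hX]; ring]
    refine (abs_add_le _ _).trans ?_
    nlinarith
  · have h1 := w2 _ _ (hX3 hu θ) (hX3 hu τ)
    have h2 := v3 _ _ _ _ (hX3 hu θ) (hX3 hv θ) (hX3 hu τ) (hX3 hv τ)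
    have h3 := mul_le_mul_of_nonneg_left (hXl hu θ τ) hCκW
    have h4 : C * κ * (‖X u θ - X v θ - X u τ + X v τ‖ + ‖X v θ - X v τ‖ * ‖X u τ - X v τ‖) ≤
        C * κ * (18 * W * dist θ τ + (13 * dist θ τ) * (9 * W)) := by
      gcongr
      · exact hXd θ τ
      · exact hXl hv θ τ
      · exact hXW τ
    have h5 : 0 ≤ C * κ * W * dist θ τ := by positivity
    rw [show bpot Ψ u θ - bpot Ψ v θ - (bpot Ψ u τ - bpot Ψ v τ) =
      ((vol Ψ u (X u θ) - vol Ψ v (X u θ)) - (vol Ψ u (X u τ) - vol Ψ v (X u τ))) +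
      (vol Ψ v (X u θ) - vol Ψ v (X v θ) - vol Ψ v (X u τ) + vol Ψ v (X v τ)) by
        simp only [bpot, hX]; ring]
    refine (abs_add_le _ _).trans ?_
    nlinarith

end Potential

section Evenness

variable {N : ℕ} {α : ℝ}

lemma opp_neg_neg (θ σ : Sph N) : opp (-θ) (-σ) = -opp θ σ := by
  simp only [neg_eq_rot, rot_opp]

lemma Qop_neg {u : Sph N → ℝ} (hu : ∀ θ, u (-θ) = u θ) (θ : Sph N) : Qop α u (-θ) = Qop α u θ := by
  unfold Qop
  rw [← integral_neg_sph]
  refine integral_congr_ae (Eventually.of_forall fun σ => ?_)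
  simp only [Qm, opp_neg_neg, hu, dist_neg_neg_sph]

lemma neg_mem_body {u : Sph N → ℝ} (hu : ∀ θ, u (-θ) = u θ) {x : EE N} : -x ∈ body u ↔ x ∈ body u := by
  have key : ∀ {x : EE N}, x ∈ body u → -x ∈ body u := fun {x} hx σ s h => by
    rw [← hu]
    refine hx (-σ) s ?_
    rw [coe_neg_sphere, smul_neg, ← h, neg_neg]
  exact ⟨fun h => by simpa using key h, key⟩

lemma vol_neg {Ψ : EE N → ℝ} (hΨ : ∀ z, Ψ (-z) = Ψ z) {u : Sph N → ℝ} (hu : ∀ θ, u (-θ) = u θ)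
    (x : EE N) : vol Ψ u (-x) = vol Ψ u x := by
  have h := (Measure.measurePreserving_neg (volume : Measure (EE N))).setIntegral_preimage_emb
    (MeasurableEquiv.neg (EE N)).measurableEmbedding (fun y => Ψ (y - -x)) (body u)
  unfold vol
  rw [← h]
  have hs : Neg.neg ⁻¹' body u = body u := Set.ext fun y => neg_mem_body hu
  rw [hs]
  refine integral_congr_ae (Eventually.of_forall fun y => ?_)
  simp only
  rw [show -y - -x = -(y - x) by abel, hΨ]

lemma bpot_neg {Ψ : EE N → ℝ} (hΨ : ∀ z, Ψ (-z) = Ψ z) {u : Sph N → ℝ} (hu : ∀ θ, u (-θ) = u θ)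
    (θ : Sph N) : bpot Ψ u (-θ) = bpot Ψ u θ := by
  rw [bpot, bpot, hu, coe_neg_sphere, smul_neg, vol_neg hΨ hu]

end Evenness

section FixedPoint

variable {N : ℕ} {γ A : ℝ}

lemma Hol.of_tendsto {f : Sph N → ℝ} {F : ℕ → Sph N → ℝ} {B : ℝ}
    (hF : ∀ᶠ n in atTop, Hol γ B (F n)) (h : ∀ θ, Tendsto (fun n => F n θ) atTop (nhds (f θ))) :
    Hol γ B f :=
  ⟨fun θ => le_of_tendsto (h θ).abs (hF.mono fun _ h => h.1 θ),
    fun θ τ => le_of_tendsto ((h θ).sub (h τ)).abs (hF.mono fun _ h => h.2 θ τ)⟩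

/-- The contraction principle for maps of balls of Hölder functions. -/
lemma exists_Hol_fixed {T : (Sph N → ℝ) → Sph N → ℝ} {P : (Sph N → ℝ) → Prop} (hA : 0 ≤ A)
    (hP : ∀ f, P f ↔ Hol γ A f ∧ ∀ θ, f (-θ) = f θ) (hT : ∀ f, P f → P (T f))
    (hTT : ∀ f g D, P f → P g → 0 ≤ D → Hol γ D (fun θ => f θ - g θ) →
      Hol γ (D / 2) (fun θ => T f θ - T g θ)) : ∃ f, P f ∧ T f = f := by
  set F : ℕ → Sph N → ℝ := fun n => T^[n] (fun _ => 0) with hF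
  have hFs : ∀ n, F (n + 1) = T (F n) := fun n => Function.iterate_succ_apply' T n _
  have hPF : ∀ n, P (F n) := fun n => by
    induction n with
    | zero => exact (hP _).2 ⟨⟨fun _ => by simpa [hF], fun _ _ => by simp [hF]; positivity⟩, fun _ => rfl⟩
    | succ n ih => rw [hFs]; exact hT _ ih
  have hsub : ∀ {f g : Sph N → ℝ} {B D : ℝ}, Hol γ B f → Hol γ D g → Hol γ (B + D) (fun θ => f θ - g θ) :=
    fun {f g B D} hf hg => by
      refine ⟨fun θ => (abs_sub _ _).trans (add_le_add (hf.1 θ) (hg.1 θ)), fun θ τ => ?_⟩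
      rw [sub_sub_sub_comm, add_mul]
      exact (abs_sub _ _).trans (add_le_add (hf.2 θ τ) (hg.2 θ τ))
  have hstep : ∀ n, Hol γ (2 * A / 2 ^ n) (fun θ => F (n + 1) θ - F n θ) := fun n => by
    induction n with
    | zero => exact (hsub ((hP _).1 (hPF 1)).1 ((hP _).1 (hPF 0)).1).mono (by simp; linarith)
    | succ n ih =>
      have := hTT _ _ _ (hPF (n + 1)) (hPF n) (by positivity) ih
      rw [← hFs, ← hFs] at this
      exact this.mono (by rw [pow_succ, div_div])
  have hm : ∀ n m, Hol γ (4 * A / 2 ^ n - 4 * A / 2 ^ (n + m)) (fun θ => F (n + m) θ - F n θ) := fun n m => by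
    induction m with
    | zero => exact ⟨fun θ => by simp, fun θ τ => by simp⟩
    | succ m ih =>
      have := (hstep (n + m)).add ih
      simp only [sub_add_sub_cancel] at this
      rw [← add_assoc]
      refine this.mono (le_of_eq ?_)
      rw [pow_succ 2 (n + m)]
      field_simp
      ring
  have hm' : ∀ n m, Hol γ (4 * A / 2 ^ n) (fun θ => F (n + m) θ - F n θ) := fun n m =>
    (hm n m).mono (sub_le_self _ (by positivity))
  have hz : Tendsto (fun n : ℕ => 4 * A / 2 ^ n) atTop (nhds 0) := by
    have := (tendsto_pow_atTop_nhds_zero_of_lt_one (r := (1/2:ℝ)) (by norm_num) (by norm_num)).const_mul (4 * A)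
    simpa [div_eq_mul_inv] using this
  have hlim : ∀ θ, ∃ x, Tendsto (fun n => F n θ) atTop (nhds x) := fun θ =>
    cauchySeq_tendsto_of_complete (cauchySeq_of_le_tendsto_0' _ (fun n m hnm => by
      obtain ⟨j, rfl⟩ := Nat.exists_eq_add_of_le hnm
      rw [dist_comm, Real.dist_eq]
      exact (hm' n j).1 θ) hz)
  choose f hf using hlim
  have hfP : P f := (hP f).2 ⟨Hol.of_tendsto (Eventually.of_forall fun n => ((hP _).1 (hPF n)).1) hf,
    fun θ => tendsto_nhds_unique (hf (-θ)) ((hf θ).congr fun n => (((hP _).1 (hPF n)).2 θ).symm)⟩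
  have hfn : ∀ n, Hol γ (4 * A / 2 ^ n) (fun θ => f θ - F n θ) := fun n =>
    Hol.of_tendsto (F := fun m θ => F (n + m) θ - F n θ) (Eventually.of_forall (hm' n)) fun θ =>
      (((hf θ).comp (tendsto_add_atTop_nat n)).congr fun m => by
        simp [add_comm]).sub_const _
  refine ⟨f, hfP, funext fun θ => ?_⟩
  have h1 : Tendsto (fun n => T f θ - F (n + 1) θ) atTop (nhds 0) := by
    refine squeeze_zero_norm (fun n => ?_) (by simpa using hz.div_const 2)
    have := (hTT f (F n) _ hfP (hPF n) (by positivity) (hfn n)).1 θ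
    rwa [← hFs] at this
  have h2 := h1.add ((hf θ).comp (tendsto_add_atTop_nat 1))
  simp only [Function.comp_apply, sub_add_cancel, zero_add] at h2
  exact tendsto_nhds_unique tendsto_const_nhds h2

end FixedPoint

section Solution

variable {N : ℕ} {α γ : ℝ}

/-- The nonlinear part of the equation for the logarithmic radial function. -/
noncomputable def nonlin (α H : ℝ) (Ψ : EE N → ℝ) (u : Sph N → ℝ) (θ : Sph N) : ℝ :=
  Qop α u θ + H * (Real.exp (α * u θ) - 1 - α * u θ) + Real.exp (α * u θ) * bpot Ψ u θ

lemma exists_nonlin_bounds (hN : 2 ≤ N) (hα : α ∈ Set.Ioo (0 : ℝ) 1) (hγ : 0 < γ) (hαγ : α + γ < 1)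
    (H : ℝ) : ∃ C : ℝ, 0 ≤ C ∧ ∀ (κ : ℝ) (Ψ : EE N → ℝ), Ker κ Ψ →
    Hol γ (C * κ) (nonlin α H Ψ (fun _ => 0)) ∧ ∀ (u v : Sph N → ℝ) (ε W : ℝ), 0 ≤ ε → ε ≤ 1 → 0 ≤ W →
      XB (α + γ) ε u → XB (α + γ) ε v → XB (α + γ) W (fun θ => u θ - v θ) →
      Hol γ (C * (ε + κ) * W) (fun θ => nonlin α H Ψ u θ - nonlin α H Ψ v θ) := by
  obtain ⟨C₁, hC₁, h₁⟩ := exists_Qop_Hol hN hα.1 hγ hαγ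
  obtain ⟨C₂, hC₂, h₂⟩ := exists_bpot_bounds hN
  have hα1 : |α| ≤ 1 := abs_le.2 ⟨by linarith [hα.1], hα.2.le⟩
  have hγ1 : γ ≤ 1 := by linarith [hα.1]
  refine ⟨C₁ + 36 * |H| + 80 * C₂, by positivity, fun κ Ψ hΨ => ?_⟩
  have hκ : 0 ≤ κ := (abs_nonneg _).trans (hΨ.bd 0 (by simp))
  have h0 : Hol 1 0 (fun _ : Sph N => (0:ℝ)) :=
    hol_one_iff.2 ⟨fun _ => by simp, fun _ _ => by simp⟩
  refine ⟨?_, fun u v ε W hε hε1 hW hu hv hw => ?_⟩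
  · have hb := ((h₂ κ Ψ hΨ _ _ 0 0 le_rfl zero_le_one le_rfl h0 h0 (by simpa using h0)).1).of_one hγ.le hγ1
    have : nonlin α H Ψ (fun _ => 0) = bpot Ψ (fun _ => 0) := by
      funext θ
      simp [nonlin, Qop, Qm_zero]
    rw [this]
    refine hb.mono ?_
    have : 0 ≤ (C₁ + 36 * |H| + 78 * C₂) * κ := by positivity
    linarith
  · have q := h₁ u v ε W hε1 hu hv hw
    have e1 := (hol_exp_sub_one_sub hα1 hε hε1 hW hu.hol_one hv.hol_one hw.hol_one).of_one hγ.le hγ1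
    have e2 := (Hol.const H γ).mul e1
    have hb := h₂ κ Ψ hΨ _ _ ε W hε hε1 hW hu.hol_one hv.hol_one hw.hol_one
    have e3 := ((hol_exp_sub hα1 hε hε1 hW hu.hol_one hv.hol_one hw.hol_one).mul hb.1).of_one hγ.le hγ1
    have e4 := ((hol_exp hα1 hε hε1 hv.hol_one).mul hb.2).of_one hγ.le hγ1
    have e := ((q.add e2).add e3).add e4
    have hfun : (fun θ => nonlin α H Ψ u θ - nonlin α H Ψ v θ) = fun θ =>
        Qop α u θ - Qop α v θ + H * (Real.exp (α * u θ) - 1 - α * u θ - (Real.exp (α * v θ) - 1 - α * v θ)) +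
        (Real.exp (α * u θ) - Real.exp (α * v θ)) * bpot Ψ u θ +
        Real.exp (α * v θ) * (bpot Ψ u θ - bpot Ψ v θ) := by
      funext θ
      unfold nonlin
      ring
    rw [hfun]
    refine e.mono ?_
    have h1 : 0 ≤ C₂ * κ * W := by positivity
    have h2 : 0 ≤ C₁ * κ * W := by positivity
    have h3 : 0 ≤ |H| * κ * W := by positivity
    have h4 : 0 ≤ C₂ * ε * W := by positivity
    nlinarith

lemma nonlin_neg {H : ℝ} {Ψ : EE N → ℝ} (hΨ : ∀ z, Ψ (-z) = Ψ z) {u : Sph N → ℝ}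
    (hu : ∀ θ, u (-θ) = u θ) (θ : Sph N) : nonlin α H Ψ u (-θ) = nonlin α H Ψ u θ := by
  rw [nonlin, nonlin, Qop_neg hu, bpot_neg hΨ hu, hu]

lemma exists_small_solution (hN : 2 ≤ N) (hα : α ∈ Set.Ioo (0 : ℝ) 1) (hγ : 0 < γ) (hαγ : α + γ < 1)
    {p : ℝ} (hp : p = 2 + α - N) (hp0 : p ≠ 0) (hp1 : p ≠ 1) :
    ∃ l : ℝ, 0 < l ∧
      (∀ (v : EE N) (θ : Sph N), frac α (fun ω => inner ℝ v (ω : EE N)) θ = l * inner ℝ v (θ : EE N)) ∧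
      ∀ H : ℝ, ∃ C κ₀ : ℝ, 0 ≤ C ∧ 0 < κ₀ ∧ ∀ (κ : ℝ) (Ψ : EE N → ℝ), κ ≤ κ₀ → Ker κ Ψ →
        (∀ z, Ψ (-z) = Ψ z) → ∃ u : Sph N → ℝ, XB (α + γ) (C * κ) u ∧ (∀ θ, u (-θ) = u θ) ∧
          ∀ θ, frac α u θ - l * u θ = nonlin α H Ψ u θ := by
  have h2 : (2:ℝ) ≤ N := by exact_mod_cast hN
  have hγ1 : γ ≤ 1 := by linarith [hα.1]
  obtain ⟨k, μ, l, s, hk0, hμk, hμ, hl0, hs, hk, hl, hfl, hinv⟩ := exists_inversion hN hα hp hp0 hp1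
  have hq2 : 0 < (N : ℝ) - 2 + p := by rw [hp]; linarith [hα.1]
  have hq1 : 0 < (N : ℝ) - 1 + p := by linarith
  obtain ⟨hsolve, C₄, hC₄, h₄⟩ := exists_solver hN hp0 hp1 hq2 hk0 hμk hμ hl0 hs hk hl hγ hγ1
  obtain ⟨C₁, hC₁, h₁⟩ := exists_pot_XB hN hα hγ hαγ hp hp0 hp1
  refine ⟨l, hl0, hfl, fun H => ?_⟩
  obtain ⟨C₂, hC₂, h₂⟩ := exists_nonlin_bounds hN hα hγ hαγ H
  set E : ℝ := C₁ * (2 * C₄ * C₂) with hE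
  have hE0 : 0 ≤ E := by positivity
  set G : ℝ := C₄ * C₂ * C₁ * (E + 1) with hG
  have hG0 : 0 ≤ G := by positivity
  refine ⟨E, 1 / (2 * (E + G + 1)), hE0, by positivity, fun κ Ψ hκ₀ hΨ hev => ?_⟩
  have hκ : 0 ≤ κ := (abs_nonneg _).trans (hΨ.bd 0 (by simp))
  have hsm : κ * (2 * (E + G + 1)) ≤ 1 := by rwa [le_div_iff₀ (by positivity)] at hκ₀
  have hEκ : E * κ ≤ 1 := by nlinarith [mul_nonneg hG0 hκ, mul_nonneg hE0 hκ]
  have hGκ : G * κ ≤ 1 / 2 := by nlinarith [mul_nonneg hG0 hκ, mul_nonneg hE0 hκ]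
  obtain ⟨hn0, hn⟩ := h₂ κ Ψ hΨ
  set A : ℝ := 2 * C₄ * C₂ * κ with hA
  have hA0 : 0 ≤ A := by positivity
  have hEA : C₁ * A = E * κ := by rw [hA, hE]; ring
  have hpe : ∀ f : Sph N → ℝ, (∀ θ, f (-θ) = f θ) → ∀ θ, pot p f (-θ) = pot p f θ := fun f hf θ => by
    rw [pot_neg_sph, funext hf]
  -- the contraction estimate for the right-hand side
  have hcon : ∀ f g D, Hol γ A f → Hol γ A g → 0 ≤ D → Hol γ D (fun θ => f θ - g θ) →
      Hol γ (C₂ * (E * κ + κ) * (C₁ * D))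
        (fun θ => nonlin α H Ψ (pot p f) θ - nonlin α H Ψ (pot p g) θ) := fun f g D hf hg hD hfg => by
    have x1 := h₁ f A hf
    have x2 := h₁ g A hg
    have x3 := h₁ _ D hfg
    rw [hEA] at x1 x2
    refine hn _ _ (E * κ) (C₁ * D) (by positivity) hEκ (by positivity) x1 x2 ?_
    convert! x3 using 1
    funext θ
    exact (pot_sub hN hp0 hq1 (hf.continuous hγ) (hg.continuous hγ) θ).symm
  have hzero : Hol γ A (fun _ : Sph N => (0:ℝ)) :=
    ⟨fun _ => by simpa using hA0, fun _ _ => by rw [sub_self, abs_zero]; positivity⟩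
  have hpot0 : pot p (fun _ : Sph N => (0:ℝ)) = fun _ => 0 := by
    funext θ
    simp [pot]
  have hrhs : ∀ f, Hol γ A f → Hol γ (C₂ * (E * κ + κ) * (C₁ * A) + C₂ * κ) (nonlin α H Ψ (pot p f)) :=
    fun f hf => by
      have h := (hcon f _ A hf hzero hA0 (by simpa using hf)).add hn0
      rw [hpot0] at h
      simpa using h
  have hex : ∀ f, ∃ g, Hol γ A f → (∀ θ, f (-θ) = f θ) → Continuous g ∧ (∀ θ, g (-θ) = g θ) ∧
      ∀ θ, s * (pot p g θ - k * g θ) - l * pot p g θ = nonlin α H Ψ (pot p f) θ := fun f => by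
    by_cases hf : Hol γ A f ∧ ∀ θ, f (-θ) = f θ
    · obtain ⟨g, hg⟩ := hsolve _ ((hrhs f hf.1).continuous hγ) (nonlin_neg hev (hpe f hf.2))
      exact ⟨g, fun _ _ => hg⟩
    · exact ⟨0, fun h1 h2 => absurd ⟨h1, h2⟩ hf⟩
  choose T hT using hex
  have hsize : C₄ * (C₂ * (E * κ + κ) * C₁) ≤ 1 / 2 := by
    calc _ = G * κ := by rw [hG]; ring
      _ ≤ _ := hGκ
  obtain ⟨f, ⟨hf, hfe⟩, hTf⟩ := exists_Hol_fixed (T := T)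
    (P := fun f => Hol γ A f ∧ ∀ θ, f (-θ) = f θ) hA0 (fun f => Iff.rfl) (fun f hf => by
      obtain ⟨c, e, eq⟩ := hT f hf.1 hf.2
      refine ⟨(h₄ (T f) _ c e (by rw [funext eq]; exact hrhs f hf.1)).mono ?_, e⟩
      have : C₄ * (C₂ * (E * κ + κ) * (C₁ * A) + C₂ * κ) =
        C₄ * (C₂ * (E * κ + κ) * C₁) * A + A / 2 := by rw [hA]; ring
      rw [this]
      nlinarith) (fun f g D hf hg hD hfg => by
      obtain ⟨c, e, eq⟩ := hT f hf.1 hf.2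
      obtain ⟨c', e', eq'⟩ := hT g hg.1 hg.2
      refine (h₄ (fun θ => T f θ - T g θ) (C₂ * (E * κ + κ) * (C₁ * D)) (c.sub c')
        (fun θ => by rw [e, e']) ?_).mono (by nlinarith)
      have h := hcon f g D hf.1 hg.1 hD hfg
      convert! h using 1
      funext θ
      rw [pot_sub hN hp0 hq1 c c', ← eq, ← eq']
      ring)
  have hu := h₁ f A hf
  rw [hEA] at hu
  refine ⟨pot p f, hu, hpe f hfe, fun θ => ?_⟩
  rw [hinv γ hγ hαγ f A hf θ, ← (hT f hf hfe).2.2 θ, hTf]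

end Solution

section Topology

variable {N : ℕ} {u : Sph N → ℝ}

/-- The angular part of a nonzero vector. -/
noncomputable def ang (x : {x : EE N // x ≠ 0}) : Sph N :=
  ⟨‖x.1‖⁻¹ • x.1, by simp [norm_smul, norm_ne_zero_iff.2 x.2]⟩

lemma continuous_ang : Continuous (ang (N := N)) := by
  refine Continuous.subtype_mk ?_ _
  exact (continuous_subtype_val.norm.inv₀ fun x => norm_ne_zero_iff.2 x.2).smul continuous_subtype_val

lemma exp_log_smul_ang (x : {x : EE N // x ≠ 0}) : Real.exp (Real.log ‖x.1‖) • (ang x : EE N) = x.1 := by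
  have h := norm_pos_iff.2 x.2
  rw [Real.exp_log h, ang, smul_smul, mul_inv_cancel₀ h.ne', one_smul]

lemma continuous_log_norm_sub (hu : Continuous u) :
    Continuous fun x : {x : EE N // x ≠ 0} => Real.log ‖x.1‖ - u (ang x) :=
  (continuous_subtype_val.norm.log fun x => norm_ne_zero_iff.2 x.2).sub (hu.comp continuous_ang)

lemma exists_lower_bound (hu : Continuous u) : ∃ m : ℝ, ∀ σ, m < u σ := by
  obtain ⟨C, hC⟩ := (isCompact_range hu).isBounded.exists_norm_le
  exact ⟨-C - 1, fun σ => by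
    have := hC (u σ) ⟨σ, rfl⟩
    rw [Real.norm_eq_abs] at this
    linarith [(abs_le.1 this).1]⟩

lemma isOpen_body (hu : Continuous u) : IsOpen (body u) := by
  obtain ⟨m, hm⟩ := exists_lower_bound hu
  have hO : IsOpen {x : EE N | x ≠ 0} := isOpen_ne
  have h1 := hO.isOpenEmbedding_subtypeVal.isOpenMap _
    (isOpen_lt (continuous_log_norm_sub hu) continuous_const :
      IsOpen {x : {x : EE N // x ≠ 0} | Real.log ‖x.1‖ - u (ang x) < 0})
  convert! (Metric.isOpen_ball (x := (0 : EE N)) (ε := Real.exp m)).union h1 using 1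
  ext x
  rw [Set.mem_union, mem_ball_zero_iff]
  constructor
  · intro hx
    rcases eq_or_ne x 0 with rfl | h0
    · left; simpa using Real.exp_pos m
    · refine Or.inr ⟨⟨x, h0⟩, ?_, rfl⟩
      have := hx (ang ⟨x, h0⟩) _ (exp_log_smul_ang ⟨x, h0⟩).symm
      exact sub_neg.2 this
  · rintro (hx | ⟨y, hy, rfl⟩)
    · rintro σ s rfl
      rw [norm_exp_smul, Real.exp_lt_exp] at hx
      exact hx.trans (hm σ)
    · rw [← exp_log_smul_ang y, exp_smul_mem_body]
      exact sub_neg.1 hy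

lemma isOpen_exterior (hu : Continuous u) : IsOpen {x : EE N | ∃ (σ : Sph N) (s : ℝ),
    x = Real.exp s • (σ : EE N) ∧ u σ < s} := by
  have hO : IsOpen {x : EE N | x ≠ 0} := isOpen_ne
  have h1 := hO.isOpenEmbedding_subtypeVal.isOpenMap _
    (isOpen_lt continuous_const (continuous_log_norm_sub hu) :
      IsOpen {x : {x : EE N // x ≠ 0} | 0 < Real.log ‖x.1‖ - u (ang x)})
  convert! h1 using 1
  ext x
  constructor
  · rintro ⟨σ, s, rfl, h⟩
    have h0 : Real.exp s • (σ : EE N) ≠ 0 := by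
      rw [← norm_pos_iff, norm_exp_smul]; positivity
    refine ⟨⟨_, h0⟩, ?_, rfl⟩
    have := measurableEmbedding_logPolar.injective (a₁ := (_, _)) (a₂ := (σ, s)) (exp_log_smul_ang ⟨_, h0⟩)
    have h1 := (Prod.mk.inj this).1
    change 0 < Real.log ‖_‖ - u (ang ⟨_, h0⟩)
    have h1' : ang ⟨Real.exp s • (σ : EE N), h0⟩ = σ := h1
    rw [h1', norm_exp_smul, Real.log_exp]
    linarith
  · rintro ⟨y, hy, rfl⟩
    exact ⟨ang y, _, (exp_log_smul_ang y).symm, sub_pos.1 hy⟩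

lemma frontier_body_subset (hu : Continuous u) :
    frontier (body u) ⊆ Set.range fun σ : Sph N => Real.exp (u σ) • (σ : EE N) := by
  intro x hx
  rw [(isOpen_body hu).frontier_eq] at hx
  have h0 : x ≠ 0 := fun h => hx.2 (h ▸ zero_mem_body u)
  obtain ⟨σ, s, rfl⟩ := exists_logPolar h0
  have h1 := hx.2
  rw [exp_smul_mem_body, not_lt] at h1
  rcases h1.eq_or_lt with h | h
  · exact ⟨σ, by rw [← h]⟩
  · exfalso
    obtain ⟨y, ⟨τ, t, rfl, hy1⟩, hy2⟩ := mem_closure_iff.1 hx.1 _ (isOpen_exterior hu) ⟨σ, s, rfl, h⟩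
    rw [exp_smul_mem_body] at hy2
    linarith

lemma volume_frontier_body (hN : 2 ≤ N) (hu : Continuous u) : volume (frontier (body u)) = 0 := by
  rw [← (measurePreserving_logPolar hN).measure_preimage isClosed_frontier.measurableSet.nullMeasurableSet,
    Measure.prod_apply (measurable_logPolar isClosed_frontier.measurableSet)]
  refine (lintegral_congr fun σ => ?_).trans lintegral_zero
  refine measure_mono_null (t := {u σ}) (fun s hs => ?_) ?_
  · obtain ⟨τ, hτ⟩ := frontier_body_subset hu hs
    have := measurableEmbedding_logPolar.injective (a₁ := (τ, u τ)) (a₂ := (σ, s)) hτ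
    obtain ⟨rfl, rfl⟩ := Prod.mk.inj this
    rfl
  · exact withDensity_absolutelyContinuous _ _ Real.volume_singleton

end Topology

section PrincipalValue

variable {N : ℕ} {α : ℝ} {E : Set (EE N)}

/-- The truncated integral of the sign function of `E` against the fractional kernel. -/
noncomputable def pvo (N : ℕ) (α : ℝ) (E : Set (EE N)) (x : EE N) (ε : ℝ) : ℝ :=
  ∫ y in {y : EE N | ε < ‖y - x‖}, (1 - 2 * E.indicator (fun _ => (1:ℝ)) y) * ‖y - x‖ ^ (-((N : ℝ) + α))

lemma pvInt_eq (hE : IsOpen E) (h0 : volume (frontier E) = 0) (x : EE N) (ε : ℝ) :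
    pvInt N α E x ε = pvo N α E x ε := by
  refine integral_congr_ae (ae_restrict_of_ae ?_)
  filter_upwards [measure_eq_zero_iff_ae_notMem.1 h0] with y hy
  congr 1
  rw [hE.frontier_eq, Set.mem_sdiff, not_and_not_right] at hy
  by_cases h : y ∈ E
  · rw [Set.indicator_of_notMem (by simpa using subset_closure h), Set.indicator_of_mem h]; norm_num
  · rw [Set.indicator_of_mem (by simpa using fun h' => h (hy h')), Set.indicator_of_notMem h]; norm_num

lemma measurableSet_lt_norm_sub (x : EE N) (ε : ℝ) : MeasurableSet {y : EE N | ε < ‖y - x‖} :=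
  measurableSet_lt measurable_const (measurable_id.sub_const x).norm

lemma pvo_add (v x : EE N) (ε : ℝ) : pvo N α E (x + v) ε = pvo N α {y | y + v ∈ E} x ε := by
  rw [pvo, pvo, ← integral_indicator (measurableSet_lt_norm_sub _ _), ← integral_indicator (measurableSet_lt_norm_sub _ _),
    ← integral_add_right_eq_self _ v]
  congr 1
  ext y
  simp only [Set.indicator_apply, Set.mem_ofPred_eq, add_sub_add_right_eq_sub]
  rfl

lemma pvo_smul {R : ℝ} (hR : 0 < R) (x : EE N) (ε : ℝ) :
    pvo N α E (R • x) (R * ε) = R ^ (-α) * pvo N α {y | R • y ∈ E} x ε := by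
  rw [pvo, pvo, ← integral_indicator (measurableSet_lt_norm_sub _ _), ← integral_indicator (measurableSet_lt_norm_sub _ _)]
  have h := Measure.integral_comp_smul (volume : Measure (EE N))
    (fun y => Set.indicator {y : EE N | R * ε < ‖y - R • x‖} (fun y =>
      (1 - 2 * E.indicator (fun _ => (1:ℝ)) y) * ‖y - R • x‖ ^ (-((N : ℝ) + α))) y) R
  have hR' : 0 < R ^ N := pow_pos hR N
  rw [finrank_euclideanSpace_fin, abs_of_pos (inv_pos.2 hR'), smul_eq_mul, eq_comm,
    inv_mul_eq_iff_eq_mul₀ hR'.ne'] at h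
  rw [h, ← integral_const_mul, ← integral_const_mul]
  congr 1
  ext y
  simp only [Set.indicator_apply {y : EE N | _}]
  simp only [Set.mem_ofPred_eq, ← smul_sub, norm_smul, Real.norm_eq_abs, abs_of_pos hR,
    mul_lt_mul_iff_right₀ hR]
  have hi : {y : EE N | R • y ∈ E}.indicator (fun _ => (1:ℝ)) y = E.indicator (fun _ => (1:ℝ)) (R • y) := rfl
  rw [hi]
  by_cases hy : ε < ‖y - x‖
  · rw [if_pos hy, if_pos hy, Real.mul_rpow hR.le (norm_nonneg _), neg_add, Real.rpow_add hR, Real.rpow_neg hR.le,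
      Real.rpow_natCast]
    field_simp
  · simp [hy]

lemma smul_mem_body {u : Sph N → ℝ} (c : ℝ) :
    {y : EE N | Real.exp c • y ∈ body u} = body fun σ => u σ - c := by
  ext y
  rcases eq_or_ne y 0 with rfl | hy
  · simp [zero_mem_body]
  · obtain ⟨σ, s, rfl⟩ := exists_logPolar hy
    rw [Set.mem_ofPred_eq, smul_smul, ← Real.exp_add, exp_smul_mem_body, exp_smul_mem_body, lt_sub_iff_add_lt']

lemma pvo_body (u : Sph N → ℝ) (θ : Sph N) (ε : ℝ) :
    pvo N α (body u) (Real.exp (u θ) • (θ : EE N)) ε = Real.exp (-α * u θ) *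
      pvo N α (body fun σ => u σ - u θ) (θ : EE N) (Real.exp (-u θ) * ε) := by
  have := pvo_smul (α := α) (E := body u) (Real.exp_pos (u θ)) (θ : EE N) (Real.exp (-u θ) * ε)
  rw [smul_mem_body, ← mul_assoc, ← Real.exp_add, add_neg_cancel, Real.exp_zero, one_mul,
    ← Real.exp_mul, mul_comm (u θ)] at this
  exact this

end PrincipalValue

section LogPolarIntegral

variable {N : ℕ} {α : ℝ}

lemma prod_lw : (sm N).prod (lw N) =
    ((sm N).prod volume).withDensity fun p => ENNReal.ofReal (Real.exp (N * p.2)) := by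
  rw [lw, prod_withDensity_right (by fun_prop)]

lemma integral_logPolar (hN : 2 ≤ N) (F : EE N → ℝ) : ∫ y, F y =
    ∫ p : Sph N × ℝ, Real.exp (N * p.2) * F (Real.exp p.2 • (p.1 : EE N)) ∂(sm N).prod volume := by
  rw [← (measurePreserving_logPolar hN).integral_comp measurableEmbedding_logPolar, prod_lw,
    integral_withDensity_eq_integral_toReal_smul (by fun_prop) (by simp)]
  simp [ENNReal.toReal_ofReal (Real.exp_pos _).le]

lemma integrable_logPolar (hN : 2 ≤ N) {F : EE N → ℝ} : Integrable F ↔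
    Integrable (fun p : Sph N × ℝ => Real.exp (N * p.2) * F (Real.exp p.2 • (p.1 : EE N)))
      ((sm N).prod volume) := by
  rw [← (measurePreserving_logPolar hN).integrable_comp_emb measurableEmbedding_logPolar, prod_lw,
    integrable_withDensity_iff_integrable_smul' (by fun_prop) (by simp)]
  simp [ENNReal.toReal_ofReal (Real.exp_pos _).le]

/-- The logarithmic radial part of the kernel. -/
noncomputable def qq (d s : ℝ) : ℝ := 4 * Real.sinh (s / 2) ^ 2 + d ^ 2

lemma qq_nonneg (d s : ℝ) : 0 ≤ qq d s := by unfold qq; positivity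

lemma qq_neg (d s : ℝ) : qq d (-s) = qq d s := by
  rw [qq, qq, neg_div, Real.sinh_neg, neg_sq]

lemma sq_le_qq (d s : ℝ) : d ^ 2 ≤ qq d s := by unfold qq; nlinarith [sq_nonneg (Real.sinh (s / 2))]

lemma gk_eq_qq (a b d s : ℝ) : gk a b d s = Real.exp (a * s) * qq d s ^ (-b) := rfl

lemma norm_exp_smul_sub_sq (θ σ : Sph N) (s : ℝ) :
    ‖Real.exp s • (σ : EE N) - θ‖ ^ 2 = Real.exp s * qq (dist σ θ) s := by
  have h1 : Real.exp s = Real.exp (s / 2) ^ 2 := by rw [← Real.exp_nat_mul]; congr 1; push_cast; ring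
  have h2 : Real.exp (s / 2) * Real.exp (-(s / 2)) = 1 := by rw [← Real.exp_add]; simp
  rw [norm_sub_sq_real, norm_exp_smul, norm_coe, inner_smul_left, qq, dist_sq, Real.sinh_eq, h1]
  simp only [conj_trivial]
  linear_combination (-(Real.exp (s / 2) * Real.exp (-(s / 2))) - 1 + 2 * Real.exp (s / 2) ^ 2) * h2

lemma rpow_norm_exp_smul_sub (θ σ : Sph N) (s : ℝ) :
    ‖Real.exp s • (σ : EE N) - θ‖ ^ (-((N : ℝ) + α)) =
      Real.exp (-(((N : ℝ) + α) / 2) * s) * qq (dist σ θ) s ^ (-(((N : ℝ) + α) / 2)) := by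
  have : ‖Real.exp s • (σ : EE N) - θ‖ ^ (-((N : ℝ) + α)) =
      (‖Real.exp s • (σ : EE N) - θ‖ ^ 2) ^ (-(((N : ℝ) + α) / 2)) := by
    rw [← Real.rpow_natCast, ← Real.rpow_mul (norm_nonneg _)]; congr 1; push_cast; ring
  rw [this, norm_exp_smul_sub_sq, Real.mul_rpow (Real.exp_pos _).le (qq_nonneg _ _), ← Real.exp_mul,
    mul_comm s]

/-- The kernel at `θ` in logarithmic polar coordinates. -/
lemma exp_mul_rpow_norm (θ σ : Sph N) (s : ℝ) :
    Real.exp (N * s) * ‖Real.exp s • (σ : EE N) - θ‖ ^ (-((N : ℝ) + α)) =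
      gk (((N : ℝ) - α) / 2) (((N : ℝ) + α) / 2) (dist σ θ) s := by
  rw [rpow_norm_exp_smul_sub, gk_eq_qq, ← mul_assoc, ← Real.exp_add]
  congr 2; ring

end LogPolarIntegral

section Cutoff

variable {N : ℕ} {α : ℝ}

/-- The complement of a neighbourhood of `θ` that is adapted to logarithmic polar coordinates. -/
def cut (θ : Sph N) (ε : ℝ) : Set (EE N) := {y | ε ^ 2 * ‖y‖ < ‖y - θ‖ ^ 2}

lemma measurableSet_cut (θ : Sph N) (ε : ℝ) : MeasurableSet (cut θ ε) :=
  measurableSet_lt (by fun_prop) (by fun_prop)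

lemma exp_smul_mem_cut {θ σ : Sph N} {ε s : ℝ} :
    Real.exp s • (σ : EE N) ∈ cut θ ε ↔ ε ^ 2 < qq (dist σ θ) s := by
  rw [cut, Set.mem_ofPred_eq, norm_exp_smul_sub_sq, norm_exp_smul, mul_comm, mul_lt_mul_iff_right₀ (Real.exp_pos s)]

lemma sub_norm_le (θ : Sph N) (y : EE N) : 1 - ‖y - θ‖ ≤ ‖y‖ ∧ ‖y‖ ≤ 1 + ‖y - θ‖ := by
  have h1 := norm_sub_norm_le (θ : EE N) y
  have h2 := norm_sub_norm_le y (θ : EE N)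
  rw [norm_coe, norm_sub_rev] at h1
  rw [norm_coe] at h2
  constructor <;> linarith

lemma half_lt_of_mem_cut {θ : Sph N} {ε : ℝ} (hε : 0 < ε) (hε1 : ε ≤ 1) {y : EE N} (hy : y ∈ cut θ ε) :
    ε / 2 < ‖y - θ‖ := by
  by_contra! h
  have h1 := (sub_norm_le θ y).1
  have h2 : ε ^ 2 * ‖y‖ < ‖y - θ‖ ^ 2 := hy
  have h3 : ‖y - θ‖ ^ 2 ≤ (ε / 2) ^ 2 := pow_le_pow_left₀ (norm_nonneg _) h 2
  nlinarith [sq_nonneg ε, mul_le_mul_of_nonneg_left (show (1:ℝ) / 2 ≤ ‖y‖ by linarith) (sq_nonneg ε)]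

open scoped symmDiff in
lemma symmDiff_cut_subset {θ : Sph N} {ε : ℝ} (hε : 0 < ε) (hε1 : ε ≤ 1) :
    cut θ ε ∆ {y : EE N | ε < ‖y - θ‖} ⊆
      Metric.closedBall (θ : EE N) (ε * (1 + ε)) \ Metric.ball (θ : EE N) (ε * (1 - ε)) := by
  intro y hy
  have h0 := norm_nonneg (y - θ)
  obtain ⟨h1, h2⟩ := sub_norm_le θ y
  have hm : ∀ a : ℝ, ε ^ 2 * ‖y‖ < a ∨ a ≤ ε ^ 2 * ‖y‖ := fun a => lt_or_ge _ _
  rw [Set.mem_symmDiff, cut, Set.mem_ofPred_eq, Set.mem_ofPred_eq, not_lt, not_lt] at hy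
  rw [Set.mem_sdiff, Metric.mem_closedBall, Metric.mem_ball, dist_eq_norm, not_lt]
  rcases hy with ⟨h3, h4⟩ | ⟨h3, h4⟩
  · refine ⟨by nlinarith, ?_⟩
    by_contra! h5
    have h6 : ‖y - θ‖ ^ 2 ≤ (ε * (1 - ε)) ^ 2 := pow_le_pow_left₀ h0 h5.le 2
    have h7 : ε ^ 2 * (1 - ε) ≤ ε ^ 2 * ‖y‖ := mul_le_mul_of_nonneg_left (by linarith) (sq_nonneg ε)
    nlinarith [mul_nonneg (sq_nonneg ε) (mul_nonneg hε.le (sub_nonneg.2 hε1))]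
  · refine ⟨?_, by nlinarith⟩
    by_contra! h5
    have h6 : ε ^ 2 * ‖y‖ ≤ ε ^ 2 * (1 + ‖y - θ‖) := mul_le_mul_of_nonneg_left h2 (sq_nonneg ε)
    have h7 : ε * (1 + ε) * (ε * (1 + ε) - ε ^ 2) ≤ ‖y - θ‖ * (‖y - θ‖ - ε ^ 2) :=
      mul_le_mul h5.le (by linarith) (by nlinarith) h0
    nlinarith [pow_pos hε 3]

end Cutoff

section Cutoff

variable {N : ℕ} {α : ℝ}

lemma volume_ball_le (x : EE N) (t : ℝ) (ht : 0 < t) : (volume : Measure (EE N)) (Metric.ball x t) ≤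
    ENNReal.ofReal (volume.real (Metric.ball (0 : EE N) 1) * t ^ (N : ℝ)) := by
  rw [Measure.addHaar_ball_of_pos _ _ ht, finrank_euclideanSpace_fin, mul_comm, ENNReal.ofReal_mul measureReal_nonneg,
    ofReal_measureReal, Real.rpow_natCast]

lemma integrableOn_kernel (hα : 0 < α) (x : EE N) {c : ℝ} (hc : 0 < c) :
    IntegrableOn (fun y => ‖y - x‖ ^ (-((N : ℝ) + α))) {y : EE N | c < ‖y - x‖} := by
  obtain ⟨K, -, hK⟩ := exists_outer_bound (X := EE N) (volume.real (Metric.ball (0 : EE N) 1)) N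
    (-((N : ℝ) + α)) measureReal_nonneg (by linarith)
  refine ((hK volume x (volume_ball_le x) c hc).1.mono_set fun y hy => ?_).congr_fun (fun y _ => by
    simp only [dist_eq_norm]) (measurableSet_lt_norm_sub x c)
  simp only [Set.mem_compl_iff, Metric.mem_ball, dist_eq_norm, not_lt]
  exact le_of_lt hy

lemma integrableOn_mul_kernel (hα : 0 < α) {w : EE N → ℝ} (hw : Measurable w) (hw1 : ∀ y, |w y| ≤ 1)
    (x : EE N) {c : ℝ} (hc : 0 < c) :
    IntegrableOn (fun y => w y * ‖y - x‖ ^ (-((N : ℝ) + α))) {y : EE N | c < ‖y - x‖} :=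
  (integrableOn_kernel hα x hc).bdd_mul hw.aestronglyMeasurable (c := 1) (Eventually.of_forall hw1)

lemma volume_shell_le (x : EE N) {ε : ℝ} (hε : 0 < ε) (hε1 : ε < 1) :
    (volume : Measure (EE N)).real (Metric.closedBall x (ε * (1 + ε)) \ Metric.ball x (ε * (1 - ε))) ≤
      volume.real (Metric.ball (0 : EE N) 1) * (2 * N * 2 ^ (N - 1)) * ε ^ (N + 1) := by
  have h0 : 0 < ε * (1 - ε) := mul_pos hε (by linarith)
  rw [measureReal_sdiff (Metric.ball_subset_closedBall.trans
    (Metric.closedBall_subset_closedBall (by nlinarith))) Metric.isOpen_ball.measurableSet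
    measure_closedBall_lt_top.ne,
    Measure.addHaar_real_closedBall _ _ (by positivity), measureReal_def _ (Metric.ball x _), Measure.addHaar_ball_of_pos _ _ h0,
    ENNReal.toReal_mul, ← measureReal_def, ENNReal.toReal_ofReal (by positivity), finrank_euclideanSpace_fin, ← sub_mul, mul_pow, mul_pow, ← mul_sub]
  have h1 := abs_pow_sub_pow_le (1 + ε) (1 - ε) N
  have h2 : max |1 + ε| |1 - ε| ≤ 2 := max_le (by rw [abs_of_nonneg] <;> linarith) (by rw [abs_of_nonneg] <;> linarith)
  have h3 : max |1 + ε| |1 - ε| ^ (N - 1) ≤ 2 ^ (N - 1) :=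
    pow_le_pow_left₀ ((abs_nonneg _).trans (le_max_left _ _)) h2 _
  have h4 : (1 + ε) ^ N - (1 - ε) ^ N ≤ 2 * ε * N * 2 ^ (N - 1) := by
    refine (le_abs_self _).trans (h1.trans ?_)
    rw [show (1 + ε) - (1 - ε) = 2 * ε by ring, abs_of_pos (by linarith)]
    gcongr
  have hV : 0 ≤ volume.real (Metric.ball (0 : EE N) 1) := measureReal_nonneg
  calc _ ≤ ε ^ N * (2 * ε * N * 2 ^ (N - 1)) * volume.real (Metric.ball (0 : EE N) 1) := by gcongr
    _ = _ := by ring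

lemma tendsto_cut (hα : α ∈ Set.Ioo (0 : ℝ) 1) {w : EE N → ℝ} (hw : Measurable w) (hw1 : ∀ y, |w y| ≤ 1)
    (θ : Sph N) :
    Tendsto (fun ε => (∫ y in cut θ ε, w y * ‖y - θ‖ ^ (-((N : ℝ) + α))) -
      ∫ y in {y : EE N | ε < ‖y - θ‖}, w y * ‖y - θ‖ ^ (-((N : ℝ) + α)))
      (nhdsWithin 0 (Set.Ioi 0)) (nhds 0) := by
  set V := volume.real (Metric.ball (0 : EE N) 1) * (2 * N * 2 ^ (N - 1)) with hV
  set b := (N : ℝ) + α with hb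
  have hlim : Tendsto (fun ε : ℝ => (1 / 2 : ℝ) ^ (-b) * V * ε ^ (1 - α)) (nhdsWithin 0 (Set.Ioi 0)) (nhds 0) := by
    have h1 : ContinuousAt (fun ε : ℝ => ε ^ (1 - α)) 0 :=
      Real.continuousAt_rpow_const _ _ (Or.inr (by linarith [hα.2]))
    have h2 := (h1.tendsto.const_mul ((1 / 2 : ℝ) ^ (-b) * V)).mono_left
      (nhdsWithin_le_nhds (s := Set.Ioi 0))
    rwa [Real.zero_rpow (by linarith [hα.2]), mul_zero] at h2
  refine squeeze_zero_norm' ?_ hlim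
  filter_upwards [Ioo_mem_nhdsGT (show (0:ℝ) < 1 by norm_num)] with ε hε
  have hsub := symmDiff_cut_subset (θ := θ) hε.1 hε.2.le
  have hfin : (volume : Measure (EE N)) (Metric.closedBall (θ : EE N) (ε * (1 + ε)) \
      Metric.ball (θ : EE N) (ε * (1 - ε))) ≠ ⊤ :=
    ((measure_mono Set.sdiff_subset).trans_lt measure_closedBall_lt_top).ne
  have h2 : 0 < ε / 2 := half_pos hε.1
  have hI := integrableOn_mul_kernel (N := N) hα.1 hw hw1 (θ : EE N) h2
  have hs1 : cut θ ε ⊆ {y : EE N | ε / 2 < ‖y - θ‖} := fun y hy => half_lt_of_mem_cut hε.1 hε.2.le hy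
  have hs2 : {y : EE N | ε < ‖y - θ‖} ⊆ {y : EE N | ε / 2 < ‖y - θ‖} := fun y (hy : ε < _) =>
    (half_lt_self hε.1).trans hy
  rw [Real.norm_eq_abs]
  refine (abs_setIntegral_sub_le (c := (ε / 2) ^ (-b)) (measurableSet_cut θ ε) (measurableSet_lt_norm_sub _ _)
    (ne_top_of_le_ne_top hfin (measure_mono hsub)) (hI.mono_set hs1) (hI.mono_set hs2) fun y hy => ?_).trans ?_
  · have hy' : ε / 2 < ‖y - θ‖ := (Set.union_subset hs1 hs2) hy
    rw [abs_mul, abs_of_nonneg (Real.rpow_nonneg (norm_nonneg _) _)]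
    refine (mul_le_mul_of_nonneg_right (hw1 y) (Real.rpow_nonneg (norm_nonneg _) _)).trans ?_
    rw [one_mul]
    exact Real.rpow_le_rpow_of_nonpos h2 hy'.le (by linarith [hα.1, Nat.cast_nonneg (α := ℝ) N])
  · refine (mul_le_mul_of_nonneg_left ((measureReal_mono hsub hfin).trans
      (volume_shell_le (θ : EE N) hε.1 hε.2)) (by positivity)).trans_eq ?_
    rw [div_eq_mul_one_div, Real.mul_rpow hε.1.le (by norm_num), show (1 - α) = -b + ((N + 1 : ℕ) : ℝ) by
      rw [hb]; push_cast; ring, Real.rpow_add hε.1, Real.rpow_natCast]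
    ring

end Cutoff

section Primitive

variable {a b : ℝ}

/-- The primitive of the kernel in the logarithmic radial variable. -/
noncomputable def Gk (a b d x : ℝ) : ℝ := ∫ s in (0:ℝ)..x, gk a b d s

/-- The primitive of the truncated kernel. -/
noncomputable def Gc (a b ε d x : ℝ) : ℝ :=
  ∫ s in (0:ℝ)..x, if ε ^ 2 < qq d s then gk a b d s else 0

lemma Gk_eq_Mk {d : ℝ} (hd : 0 < d) (x : ℝ) : Gk a b d x = Mk a b d x + x * d ^ (-(2 * b)) := by
  rw [Gk, Mk, intervalIntegral.integral_sub ((continuous_gk hd).intervalIntegrable _ _)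
    (by simp), intervalIntegral.integral_const, smul_eq_mul]
  ring

lemma Gc_eq_Gk {ε d : ℝ} (hε : 0 ≤ ε) (h : ε < d) (x : ℝ) : Gc a b ε d x = Gk a b d x := by
  refine intervalIntegral.integral_congr fun s _ => if_pos ?_
  exact (pow_lt_pow_left₀ h hε two_ne_zero).trans_le (sq_le_qq d s)

lemma abs_gk_le (hb : 0 ≤ b) {d s : ℝ} (hd : 0 < d) (hs : |s| ≤ 2) :
    |gk a b d s| ≤ Real.exp (2 * |a|) * d ^ (-(2 * b)) := by
  rw [gk, abs_mul, Real.abs_exp, abs_of_nonneg (Real.rpow_nonneg (by positivity) _)]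
  refine mul_le_mul (Real.exp_le_exp.2 ?_) (rpow_gk_le hb hd s) (Real.rpow_nonneg (by positivity) _)
    (by positivity)
  refine (le_abs_self _).trans ?_
  rw [abs_mul, mul_comm]
  exact mul_le_mul_of_nonneg_right hs (abs_nonneg a)

lemma continuous_qq (d : ℝ) : Continuous (qq d) := by unfold qq; fun_prop

lemma exists_Gc_even (hb : 0 ≤ b) : ∃ C : ℝ, 0 ≤ C ∧ ∀ ε d x y : ℝ, 0 < d → |x| ≤ 2 → |y| ≤ 2 →
    |Gc a b ε d x + Gc a b ε d y| ≤ C * (|x| ^ 2 + |x + y|) * d ^ (-(2 * b)) := by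
  obtain ⟨C, hC, H⟩ := exists_gk_even (a := a) hb
  refine ⟨C + Real.exp (2 * |a|), by positivity, fun ε d x y hd hx hy => ?_⟩
  set f : ℝ → ℝ := fun s => if ε ^ 2 < qq d s then gk a b d s else 0 with hf
  have hfm : Measurable f := Measurable.ite (measurableSet_lt measurable_const (continuous_qq d).measurable)
    (continuous_gk hd).measurable measurable_const
  have hle : ∀ s, |f s| ≤ |gk a b d s| := fun s => by simp only [hf]; split_ifs <;> simp
  have hi : ∀ p q, IntervalIntegrable f volume p q := fun p q =>
    ((continuous_gk hd).intervalIntegrable p q).mono_fun hfm.aestronglyMeasurable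
      (Eventually.of_forall hle)
  have hd0 : 0 ≤ d ^ (-(2 * b)) := Real.rpow_nonneg hd.le _
  have e1 : ∫ s in (0:ℝ)..-x, f s = -∫ s in (0:ℝ)..x, f (-s) := by
    rw [intervalIntegral.integral_comp_neg, neg_zero, ← intervalIntegral.integral_symm]
  have hin : ∀ p q, IntervalIntegrable (fun s => f (-s)) volume p q := fun p q => by
    simpa using (hi (-p) (-q)).comp_sub_left 0
  have e2 : Gc a b ε d x + Gc a b ε d y = (∫ s in (0:ℝ)..x, (f s - f (-s))) + ∫ s in (-x)..y, f s := by
    rw [Gc, Gc, intervalIntegral.integral_sub (hi _ _) (hin _ _),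
      ← intervalIntegral.integral_add_adjacent_intervals (hi 0 (-x)) (hi (-x) y), e1]
    ring
  have h1 : |∫ s in (0:ℝ)..x, (f s - f (-s))| ≤ C * d ^ (-(2 * b)) * |x| * |x - 0| := by
    rw [← Real.norm_eq_abs (∫ _ in _.._, _)]
    refine intervalIntegral.norm_integral_le_of_norm_le_const fun s hs => ?_
    have hs1 : |s| ≤ |x| := by
      have := Set.uIoc_subset_uIcc hs
      simpa using Set.abs_sub_left_of_mem_uIcc this
    have h2 : |f s - f (-s)| ≤ |gk a b d s - gk a b d (-s)| := by
      simp only [hf, qq_neg]; split_ifs <;> simp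
    refine h2.trans ((H d hd s (hs1.trans hx)).trans ?_)
    gcongr
  have h3 : |∫ s in (-x)..y, f s| ≤ Real.exp (2 * |a|) * d ^ (-(2 * b)) * |y - -x| := by
    rw [← Real.norm_eq_abs]
    refine intervalIntegral.norm_integral_le_of_norm_le_const fun s hs => ?_
    refine (hle s).trans (abs_gk_le hb hd ?_)
    have h4 := Set.uIoc_subset_uIcc hs
    rw [Set.mem_uIcc] at h4
    rw [abs_le] at hx hy ⊢
    rcases h4 with h4 | h4 <;> constructor <;> linarith
  rw [e2]
  refine (abs_add_le _ _).trans ((add_le_add h1 h3).trans ?_)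
  rw [sub_zero, sub_neg_eq_add, add_comm y x]
  have := mul_nonneg (mul_nonneg (Real.exp_pos (2 * |a|)).le (sq_nonneg |x|)) hd0
  have := mul_nonneg (mul_nonneg hC (abs_nonneg (x + y))) hd0
  nlinarith

end Primitive

section UnitBall

variable {N : ℕ} {α : ℝ}

/-- The principal value integrand of the unit ball, in logarithmic polar coordinates and after
symmetrization. -/
noncomputable def Zk (α : ℝ) (θ : Sph N) (p : Sph N × ℝ) : ℝ :=
  |Real.sinh (((N : ℝ) - α) / 2 * p.2)| * qq (dist p.1 θ) p.2 ^ (-(((N : ℝ) + α) / 2))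

lemma measurable_qq (θ : Sph N) : Measurable fun p : Sph N × ℝ => qq (dist p.1 θ) p.2 := by
  unfold qq; fun_prop

lemma measurable_Zk (θ : Sph N) : Measurable (Zk α θ) := by
  refine Measurable.mul ?_ ((measurable_qq θ).pow_const _)
  exact Measurable.abs (Real.measurable_sinh.comp (measurable_snd.const_mul _))

lemma Zk_nonneg (θ : Sph N) (p : Sph N × ℝ) : 0 ≤ Zk α θ p :=
  mul_nonneg (abs_nonneg _) (Real.rpow_nonneg (qq_nonneg _ _) _)

lemma Zk_eq (hN : 2 ≤ N) (hα : α < 1) (θ σ : Sph N) {s : ℝ} (hs : 0 < s) : Zk α θ (σ, s) =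
    (gk (((N : ℝ) - α) / 2) (((N : ℝ) + α) / 2) (dist σ θ) s -
      gk (((N : ℝ) - α) / 2) (((N : ℝ) + α) / 2) (dist σ θ) (-s)) / 2 := by
  have h2 : (2:ℝ) ≤ N := by exact_mod_cast hN
  rw [gk_sub_neg, Zk, abs_of_nonneg (Real.sinh_nonneg_iff.2 (mul_nonneg (by linarith) hs.le)), qq]
  ring

lemma measurePreserving_neg_snd : MeasurePreserving (fun p : Sph N × ℝ => (p.1, -p.2))
    ((sm N).prod volume) ((sm N).prod volume) :=
  (MeasurePreserving.id (sm N)).prod (Measure.measurePreserving_neg volume)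

lemma measurableEmbedding_neg_snd : MeasurableEmbedding (fun p : Sph N × ℝ => (p.1, -p.2)) :=
  (MeasurableEquiv.prodCongr (MeasurableEquiv.refl _) (MeasurableEquiv.neg ℝ)).measurableEmbedding

lemma Zk_neg (θ : Sph N) (p : Sph N × ℝ) : Zk α θ (p.1, -p.2) = Zk α θ p := by
  simp only [Zk, mul_neg, Real.sinh_neg, abs_neg, qq_neg]

lemma integrable_exterior_kernel (hN : 2 ≤ N) (hα : α ∈ Set.Ioo (0 : ℝ) 1) (θ : Sph N) :
    Integrable (Set.indicator {y : EE N | 1 < ‖y‖} fun y =>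
      (1 - ‖y‖ ^ (-((N : ℝ) - α))) * ‖y - θ‖ ^ (-((N : ℝ) + α))) := by
  have h2 : (2:ℝ) ≤ N := by exact_mod_cast hN
  have ha : 0 < (N : ℝ) - α := by linarith [hα.2]
  set h : EE N → ℝ := fun y => (1 - ‖y‖ ^ (-((N : ℝ) - α))) * ‖y - θ‖ ^ (-((N : ℝ) + α))
  have hS : MeasurableSet {y : EE N | 1 < ‖y‖} := measurableSet_lt measurable_const measurable_norm
  have hm : Measurable (Set.indicator {y : EE N | 1 < ‖y‖} h) := by
    refine Measurable.indicator ?_ hS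
    exact (measurable_const.sub (measurable_norm.pow_const _)).mul
      ((measurable_id.sub_const _).norm.pow_const _)
  have hle0 : ∀ y : EE N, 1 < ‖y‖ → ‖y‖ ^ (-((N : ℝ) - α)) ≤ 1 := fun y hy =>
    Real.rpow_le_one_of_one_le_of_nonpos hy.le (by linarith)
  rw [← integrableOn_univ, ← Set.union_compl_self (Metric.ball (θ : EE N) 1), integrableOn_union]
  constructor
  · obtain ⟨K, -, hK⟩ := exists_inner_bound (X := EE N) (volume.real (Metric.ball (0 : EE N) 1)) N
      (1 - ((N : ℝ) + α)) measureReal_nonneg (by linarith [hα.1]) (by linarith [hα.2])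
    refine ((hK volume (θ : EE N) (volume_ball_le _) 1 one_pos).1.const_mul ((N : ℝ) - α)).mono'
      hm.aestronglyMeasurable (Eventually.of_forall fun y => ?_)
    by_cases hy : 1 < ‖y‖
    · have hρ : 0 < ‖y - θ‖ := by linarith [(sub_norm_le θ y).2]
      rw [Set.indicator_of_mem (show y ∈ {y : EE N | 1 < ‖y‖} from hy), Real.norm_eq_abs, abs_mul,
        abs_of_nonneg (Real.rpow_nonneg (norm_nonneg _) _), abs_of_nonneg (by linarith [hle0 y hy]),
        dist_eq_norm, sub_eq_add_neg 1 ((N : ℝ) + α), Real.rpow_add hρ, Real.rpow_one, ← mul_assoc]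
      refine mul_le_mul_of_nonneg_right ?_ (Real.rpow_nonneg (norm_nonneg _) _)
      have h3 : Real.log ‖y‖ ≤ ‖y‖ - 1 := Real.log_le_sub_one_of_pos (by linarith)
      have h4 := Real.add_one_le_exp (Real.log ‖y‖ * (-((N : ℝ) - α)))
      rw [← Real.rpow_def_of_pos (by linarith)] at h4
      have h5 := (sub_norm_le θ y).2
      have h6 : Real.log ‖y‖ * ((N : ℝ) - α) ≤ ‖y - θ‖ * ((N : ℝ) - α) :=
        mul_le_mul_of_nonneg_right (by linarith) ha.le
      linarith
    · rw [Set.indicator_of_notMem (show y ∉ {y : EE N | 1 < ‖y‖} from hy), norm_zero]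
      exact mul_nonneg ha.le (Real.rpow_nonneg dist_nonneg _)
  · have hsub : (Metric.ball (θ : EE N) 1)ᶜ ⊆ {y : EE N | 1 / 2 < ‖y - θ‖} := fun y hy => by
      rw [Set.mem_compl_iff, mem_ball_iff_norm, not_lt] at hy
      exact lt_of_lt_of_le (by norm_num) hy
    refine ((integrableOn_kernel hα.1 (θ : EE N) (by norm_num : (0:ℝ) < 1 / 2)).mono_set hsub).mono'
      hm.aestronglyMeasurable (Eventually.of_forall fun y => ?_)
    by_cases hy : 1 < ‖y‖
    · rw [Set.indicator_of_mem (show y ∈ {y : EE N | 1 < ‖y‖} from hy), Real.norm_eq_abs, abs_mul,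
        abs_of_nonneg (Real.rpow_nonneg (norm_nonneg _) _), abs_of_nonneg (by linarith [hle0 y hy])]
      refine mul_le_of_le_one_left (Real.rpow_nonneg (norm_nonneg _) _) ?_
      linarith [Real.rpow_nonneg (norm_nonneg y) (-((N : ℝ) - α))]
    · rw [Set.indicator_of_notMem (show y ∉ {y : EE N | 1 < ‖y‖} from hy), norm_zero]
      exact Real.rpow_nonneg (norm_nonneg _) _

lemma ae_snd_ne_zero : ∀ᵐ p : Sph N × ℝ ∂(sm N).prod volume, p.2 ≠ 0 := by
  rw [ae_iff]
  have : {p : Sph N × ℝ | ¬p.2 ≠ 0} = Set.univ ×ˢ {0} := by ext p; simp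
  rw [this, Measure.prod_prod, Real.volume_singleton, mul_zero]

lemma integrable_Zk (hN : 2 ≤ N) (hα : α ∈ Set.Ioo (0 : ℝ) 1) (θ : Sph N) :
    Integrable (Zk α θ) ((sm N).prod volume) := by
  have h2 : (2:ℝ) ≤ N := by exact_mod_cast hN
  have hS : MeasurableSet {p : Sph N × ℝ | 0 < p.2} := measurableSet_lt measurable_const measurable_snd
  have h1 : Integrable (Set.indicator {p : Sph N × ℝ | 0 < p.2} (Zk α θ)) ((sm N).prod volume) := by
    have := ((integrable_logPolar hN).1 (integrable_exterior_kernel hN hα θ)).mul_const (1 / 2)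
    refine this.congr (Eventually.of_forall fun ⟨σ, s⟩ => ?_)
    have hmem : Real.exp s • (σ : EE N) ∈ {y : EE N | 1 < ‖y‖} ↔ 0 < s := by
      rw [Set.mem_ofPred_eq, norm_exp_smul, Real.one_lt_exp_iff]
    by_cases hs : 0 < s
    · rw [Set.indicator_of_mem (show (σ, s) ∈ {p : Sph N × ℝ | 0 < p.2} from hs), Zk_eq hN hα.2 _ _ hs]
      simp only
      rw [Set.indicator_of_mem (hmem.2 hs), mul_left_comm, exp_mul_rpow_norm, norm_exp_smul, ← Real.exp_mul,
        gk_eq_qq, gk_eq_qq, qq_neg]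
      have : Real.exp (s * -((N : ℝ) - α)) * Real.exp (((N : ℝ) - α) / 2 * s) =
          Real.exp (((N : ℝ) - α) / 2 * -s) := by rw [← Real.exp_add]; congr 1; ring
      rw [← this]; ring
    · rw [Set.indicator_of_notMem (show (σ, s) ∉ {p : Sph N × ℝ | 0 < p.2} from hs)]
      simp only
      rw [Set.indicator_of_notMem (hmem.not.2 hs)]; ring
  have h3 := (measurePreserving_neg_snd.integrable_comp_emb measurableEmbedding_neg_snd).2 h1
  refine (h1.add h3).congr ?_
  filter_upwards [ae_snd_ne_zero] with p hp
  rw [Pi.add_apply, Function.comp_apply]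
  rcases lt_or_gt_of_ne hp with h | h
  · rw [Set.indicator_of_notMem (by simpa using h.le), Set.indicator_of_mem (by simpa using h), Zk_neg, zero_add]
  · rw [Set.indicator_of_mem (by simpa using h), Set.indicator_of_notMem (by simpa using h.le), add_zero]

/-- The nonlocal mean curvature of the unit sphere. -/
noncomputable def H0 (α : ℝ) (θ : Sph N) : ℝ := ∫ p, Zk α θ p ∂(sm N).prod volume

lemma H0_eq (hN : 2 ≤ N) (hα : α ∈ Set.Ioo (0 : ℝ) 1) (θ τ : Sph N) : H0 α θ = H0 α τ := by
  rw [H0, H0, integral_prod _ (integrable_Zk hN hα θ), integral_prod _ (integrable_Zk hN hα τ)]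
  exact integral_zonal (fun d => ∫ s, |Real.sinh (((N : ℝ) - α) / 2 * s)| * qq d s ^ (-(((N : ℝ) + α) / 2))) θ τ

end UnitBall

section Limit

variable {N : ℕ} {α β : ℝ}

/-- The sign function of `body u`. -/
noncomputable def sg (u : Sph N → ℝ) (y : EE N) : ℝ := 1 - 2 * (body u).indicator (fun _ => (1:ℝ)) y

lemma measurable_sg {u : Sph N → ℝ} (hu : Continuous u) : Measurable (sg u) :=
  measurable_const.sub ((measurable_const.indicator (measurableSet_body hu)).const_mul 2)

lemma abs_sg_le (u : Sph N → ℝ) (y : EE N) : |sg u y| ≤ 1 := by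
  by_cases h : y ∈ body u
  · rw [sg, Set.indicator_of_mem h]; norm_num
  · rw [sg, Set.indicator_of_notMem h]; norm_num

/-- The truncated kernel in logarithmic polar coordinates. -/
noncomputable def gt (α : ℝ) (θ : Sph N) (ε : ℝ) (p : Sph N × ℝ) : ℝ :=
  if ε ^ 2 < qq (dist p.1 θ) p.2 then
    gk (((N : ℝ) - α) / 2) (((N : ℝ) + α) / 2) (dist p.1 θ) p.2 else 0

/-- The truncated principal value integrand in logarithmic polar coordinates. -/
noncomputable def fi (α : ℝ) (u : Sph N → ℝ) (θ : Sph N) (ε : ℝ) (p : Sph N × ℝ) : ℝ :=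
  (1 - 2 * if p.2 < u p.1 then 1 else 0) * gt α θ ε p

lemma exp_mul_indicator_cut (u : Sph N → ℝ) (θ : Sph N) (ε : ℝ) (p : Sph N × ℝ) :
    Real.exp (N * p.2) * (cut θ ε).indicator (fun y => sg u y * ‖y - θ‖ ^ (-((N : ℝ) + α)))
      (Real.exp p.2 • (p.1 : EE N)) = fi α u θ ε p := by
  have h1 : sg u (Real.exp p.2 • (p.1 : EE N)) = 1 - 2 * if p.2 < u p.1 then 1 else 0 := by
    by_cases h : p.2 < u p.1
    · rw [sg, Set.indicator_of_mem (exp_smul_mem_body.2 h), if_pos h]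
    · rw [sg, Set.indicator_of_notMem (exp_smul_mem_body.not.2 h), if_neg h]
  rw [fi, gt]
  by_cases h : ε ^ 2 < qq (dist p.1 θ) p.2
  · rw [Set.indicator_of_mem (exp_smul_mem_cut.2 h), if_pos h, mul_left_comm, exp_mul_rpow_norm, h1]
  · rw [Set.indicator_of_notMem (exp_smul_mem_cut.not.2 h), if_neg h, mul_zero, mul_zero]

lemma integrable_fi (hN : 2 ≤ N) (hα : 0 < α) {u : Sph N → ℝ} (hu : Continuous u) (θ : Sph N) {ε : ℝ}
    (hε : 0 < ε) (hε1 : ε ≤ 1) : Integrable (fi α u θ ε) ((sm N).prod volume) := by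
  have h1 : IntegrableOn (fun y => sg u y * ‖y - θ‖ ^ (-((N : ℝ) + α))) (cut θ ε) :=
    (integrableOn_mul_kernel hα (measurable_sg hu) (abs_sg_le u) (θ : EE N) (half_pos hε)).mono_set
      fun y hy => half_lt_of_mem_cut hε hε1 hy
  have h2 := (integrable_logPolar hN).1 ((integrable_indicator_iff (measurableSet_cut θ ε)).2 h1)
  simpa only [exp_mul_indicator_cut] using h2

lemma integral_fi (hN : 2 ≤ N) (u : Sph N → ℝ) (θ : Sph N) (ε : ℝ) :
    ∫ y in cut θ ε, sg u y * ‖y - θ‖ ^ (-((N : ℝ) + α)) = ∫ p, fi α u θ ε p ∂(sm N).prod volume := by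
  rw [← integral_indicator (measurableSet_cut θ ε), integral_logPolar hN]
  simp only [exp_mul_indicator_cut]

lemma tendsto_fi_zero (hN : 2 ≤ N) (hα : α ∈ Set.Ioo (0 : ℝ) 1) (θ : Sph N) :
    Tendsto (fun ε => ∫ p, fi α (fun _ => 0) θ ε p ∂(sm N).prod volume) (nhdsWithin 0 (Set.Ioi 0))
      (nhds (H0 α θ)) := by
  set ν := (sm N).prod (volume : Measure ℝ) with hν
  have hZ := integrable_Zk hN hα θ
  set F : ℝ → Sph N × ℝ → ℝ := fun ε p => if ε ^ 2 < qq (dist p.1 θ) p.2 then Zk α θ p else 0 with hF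
  have hFle : ∀ ε p, ‖F ε p‖ ≤ Zk α θ p := fun ε p => by
    simp only [hF]
    split_ifs
    · rw [Real.norm_eq_abs, abs_of_nonneg (Zk_nonneg θ p)]
    · simpa using Zk_nonneg θ p
  have hFm : ∀ ε, Measurable (F ε) := fun ε =>
    Measurable.ite (measurableSet_lt measurable_const (measurable_qq θ)) (measurable_Zk θ) measurable_const
  have hlim : Tendsto (fun ε => ∫ p, F ε p ∂ν) (nhdsWithin 0 (Set.Ioi 0)) (nhds (H0 α θ)) := by
    refine tendsto_integral_filter_of_dominated_convergence (Zk α θ)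
      (Eventually.of_forall fun ε => (hFm ε).aestronglyMeasurable)
      (Eventually.of_forall fun ε => Eventually.of_forall (hFle ε)) hZ ?_
    filter_upwards [ae_snd_ne_zero] with p hp
    have hq : 0 < qq (dist p.1 θ) p.2 := by
      have : Real.sinh (p.2 / 2) ≠ 0 := fun h => hp (by simpa using Real.sinh_eq_zero.1 h)
      unfold qq; positivity
    refine tendsto_const_nhds.congr' ?_
    have h0 : Tendsto (fun ε : ℝ => ε ^ 2) (nhdsWithin 0 (Set.Ioi 0)) (nhds 0) := by
      have : ContinuousAt (fun ε : ℝ => ε ^ 2) 0 := by fun_prop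
      simpa using this.tendsto.mono_left (nhdsWithin_le_nhds (s := Set.Ioi 0))
    filter_upwards [h0.eventually_lt_const hq] with ε hε
    exact (if_pos hε).symm
  refine hlim.congr' ?_
  filter_upwards [Ioo_mem_nhdsGT (show (0:ℝ) < 1 by norm_num)] with ε hε
  have hi := integrable_fi hN hα.1 (continuous_const (y := (0:ℝ))) θ hε.1 hε.2.le
  have hi' : Integrable (fun p : Sph N × ℝ => fi α (fun _ => 0) θ ε (p.1, -p.2)) ν :=
    (measurePreserving_neg_snd.integrable_comp_emb measurableEmbedding_neg_snd).2 hi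
  have e1 : ∫ p, fi α (fun _ => 0) θ ε (p.1, -p.2) ∂ν = ∫ p, fi α (fun _ => 0) θ ε p ∂ν :=
    measurePreserving_neg_snd.integral_comp measurableEmbedding_neg_snd (fi α (fun _ => 0) θ ε)
  have e2 : ∫ p, (fi α (fun _ => 0) θ ε p + fi α (fun _ => 0) θ ε (p.1, -p.2)) ∂ν =
      ∫ p, 2 * F ε p ∂ν := by
    refine integral_congr_ae ?_
    filter_upwards [ae_snd_ne_zero] with ⟨σ, s⟩ hs
    simp only [fi, gt, hF, qq_neg]
    by_cases hq : ε ^ 2 < qq (dist σ θ) s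
    · rw [if_pos hq, if_pos hq, if_pos hq]
      rcases lt_or_gt_of_ne hs with h | h
      · simp only at h
        rw [if_pos h, if_neg (by linarith), ← Zk_neg, Zk_eq hN hα.2 _ _ (show 0 < -s by linarith), neg_neg]
        ring
      · simp only at h
        rw [if_neg (by linarith), if_pos (by linarith), Zk_eq hN hα.2 _ _ h]
        ring
    · rw [if_neg hq, if_neg hq, if_neg hq]; ring
  rw [integral_add hi hi', e1, integral_const_mul] at e2
  linarith

lemma integral_sub_ite (f : ℝ → ℝ) (x : ℝ) :
    ∫ s, ((if s < x then (1:ℝ) else 0) - if s < 0 then 1 else 0) * f s = ∫ s in (0:ℝ)..x, f s := by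
  rcases le_total 0 x with h | h
  · rw [intervalIntegral.integral_of_le h, ← integral_Ico_eq_integral_Ioc, ← integral_indicator measurableSet_Ico]
    congr 1; ext s
    by_cases h1 : s < x <;> by_cases h2 : s < 0 <;>
      simp only [Set.indicator_apply, Set.mem_Ico, h1, h2, if_true, if_false] <;> grind
  · rw [intervalIntegral.integral_of_ge h, ← integral_Ico_eq_integral_Ioc, ← integral_indicator measurableSet_Ico,
      ← integral_neg]
    congr 1; ext s
    by_cases h1 : s < x <;> by_cases h2 : s < 0 <;>
      simp only [Set.indicator_apply, Set.mem_Ico, h1, h2, if_true, if_false] <;> grind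

lemma fi_sub (hN : 2 ≤ N) (hα : 0 < α) {u : Sph N → ℝ} (hu : Continuous u) (θ : Sph N) {ε : ℝ}
    (hε : 0 < ε) (hε1 : ε ≤ 1) :
    Integrable (fun σ => Gc (((N : ℝ) - α) / 2) (((N : ℝ) + α) / 2) ε (dist σ θ) (u σ)) (sm N) ∧
    ∫ p, fi α u θ ε p ∂(sm N).prod volume = ∫ p, fi α (fun _ => 0) θ ε p ∂(sm N).prod volume -
      2 * ∫ σ, Gc (((N : ℝ) - α) / 2) (((N : ℝ) + α) / 2) ε (dist σ θ) (u σ) ∂(sm N) := by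
  have hi := integrable_fi hN hα hu θ hε hε1
  have hi0 := integrable_fi hN hα (continuous_const (y := (0:ℝ))) θ hε hε1
  set D : Sph N × ℝ → ℝ := fun p => (fi α (fun _ => 0) θ ε p - fi α u θ ε p) / 2 with hD
  have hDi : Integrable D ((sm N).prod volume) := (hi0.sub hi).div_const 2
  have hinner : ∀ σ, ∫ s, D (σ, s) = Gc (((N : ℝ) - α) / 2) (((N : ℝ) + α) / 2) ε (dist σ θ) (u σ) := fun σ => by
    rw [Gc, ← integral_sub_ite]
    congr 1; ext s
    simp only [hD, fi, gt]
    ring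
  have h1 := hDi.integral_prod_left
  simp only [hinner] at h1
  refine ⟨h1, ?_⟩
  have h2 := integral_prod _ hDi
  simp only [hinner] at h2
  rw [← h2]
  simp only [hD]
  rw [integral_div, integral_sub hi0 hi]
  ring

lemma tendsto_pvo_body (hN : 2 ≤ N) (hα : α ∈ Set.Ioo (0 : ℝ) 1) (hαβ : α < β) (hβ : β ≤ 1) {U : ℝ}
    {u : Sph N → ℝ} (hu : Continuous u) (θ : Sph N) (hu2 : ∀ σ, |u σ| ≤ 2)
    (hlip : ∀ σ, |u σ| ≤ U * dist σ θ) (hsym : ∀ σ, |u σ + u (opp θ σ)| ≤ U * dist σ θ ^ (1 + β)) :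
    Tendsto (pvo N α (body u) θ) (nhdsWithin 0 (Set.Ioi 0))
      (nhds (H0 α θ - ∫ σ, (Gk (((N : ℝ) - α) / 2) (((N : ℝ) + α) / 2) (dist σ θ) (u σ) +
        Gk (((N : ℝ) - α) / 2) (((N : ℝ) + α) / 2) (dist σ θ) (u (opp θ σ))) ∂(sm N))) := by
  have h2 : (2:ℝ) ≤ N := by exact_mod_cast hN
  set a := ((N : ℝ) - α) / 2
  set b := ((N : ℝ) + α) / 2 with hb
  obtain ⟨C, hC, H⟩ := exists_Gc_even (a := a) (b := b) (by rw [hb]; linarith [hα.1])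
  obtain ⟨K, -, hK⟩ := exists_sph_full hN (q := 1 + β - (N + α))
    (ne_of_lt (by linarith [hα.1])) (by linarith)
  have hne : ∀ᵐ σ ∂(sm N), σ ≠ θ := by rw [ae_iff]; simpa using sm_singleton θ hN
  have h2β : ∀ d : ℝ, 0 < d → d ≤ 2 → d ^ 2 ≤ 2 * d ^ (1 + β) := fun d hd hd2 => by
    have h3 : d ^ 2 = d ^ (1 + β) * d ^ (1 - β) := by
      rw [← Real.rpow_add hd, ← Real.rpow_natCast]; congr 1; push_cast; ring
    have h4 : d ^ (1 - β) ≤ 2 := by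
      refine (Real.rpow_le_rpow hd.le hd2 (by linarith)).trans ?_
      exact (Real.rpow_le_rpow_of_exponent_le (by norm_num) (by linarith [hα.1] : 1 - β ≤ 1)).trans (by norm_num)
    rw [h3, mul_comm 2]
    exact mul_le_mul_of_nonneg_left h4 (Real.rpow_nonneg hd.le _)
  have hbound : ∀ ε, ∀ σ, σ ≠ θ → ‖Gc a b ε (dist σ θ) (u σ) + Gc a b ε (dist σ θ) (u (opp θ σ))‖ ≤
      C * (2 * U ^ 2 + U) * dist σ θ ^ (1 + β - (N + α)) := fun ε σ hσ => by
    have hd : 0 < dist σ θ := dist_pos.2 hσ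
    refine (H ε _ _ _ hd (hu2 σ) (hu2 _)).trans ?_
    have h5 : |u σ| ^ 2 ≤ U ^ 2 * (2 * dist σ θ ^ (1 + β)) := by
      refine (pow_le_pow_left₀ (abs_nonneg _) (hlip σ) 2).trans ?_
      rw [mul_pow]
      exact mul_le_mul_of_nonneg_left (h2β _ hd (dist_le_two σ θ)) (sq_nonneg U)
    rw [show 1 + β - ((N : ℝ) + α) = (1 + β) + -(2 * b) by rw [hb]; ring, Real.rpow_add hd, ← mul_assoc]
    refine mul_le_mul_of_nonneg_right ?_ (Real.rpow_nonneg hd.le _)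
    rw [mul_assoc]
    refine mul_le_mul_of_nonneg_left ?_ hC
    linarith [hsym σ]
  have hG : Tendsto (fun ε => ∫ σ, (Gc a b ε (dist σ θ) (u σ) + Gc a b ε (dist σ θ) (u (opp θ σ))) ∂(sm N))
      (nhdsWithin 0 (Set.Ioi 0))
      (nhds (∫ σ, (Gk a b (dist σ θ) (u σ) + Gk a b (dist σ θ) (u (opp θ σ))) ∂(sm N))) := by
    refine tendsto_integral_filter_of_dominated_convergence
      (fun σ => C * (2 * U ^ 2 + U) * dist σ θ ^ (1 + β - (N + α))) ?_
      (Eventually.of_forall fun ε => hne.mono (hbound ε)) ((hK θ).1.const_mul _) ?_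
    · filter_upwards [Ioo_mem_nhdsGT (show (0:ℝ) < 1 by norm_num)] with ε hε
      have h3 := (fi_sub hN hα.1 hu θ hε.1 hε.2.le).1
      have h4 := (fi_sub hN hα.1 (hu.comp (continuous_opp θ)) θ hε.1 hε.2.le).1
      exact (h3.add h4).aestronglyMeasurable
    · filter_upwards [hne] with σ hσ
      refine tendsto_const_nhds.congr' ?_
      filter_upwards [Ioo_mem_nhdsGT (dist_pos.2 hσ)] with ε hε
      rw [Gc_eq_Gk hε.1.le hε.2, Gc_eq_Gk hε.1.le hε.2]
  have hP := ((tendsto_fi_zero hN hα θ).sub hG).sub (tendsto_cut hα (measurable_sg hu) (abs_sg_le u) θ)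
  rw [sub_zero] at hP
  refine hP.congr' ?_
  filter_upwards [Ioo_mem_nhdsGT (show (0:ℝ) < 1 by norm_num)] with ε hε
  obtain ⟨h3, h3'⟩ := fi_sub hN hα.1 hu θ hε.1 hε.2.le
  have h4 := (integrable_opp θ).2 h3
  have h5 := integral_opp θ (fun σ => Gc a b ε (dist σ θ) (u σ))
  simp only [dist_opp] at h4 h5
  rw [integral_add h3 h4, h5, integral_fi hN, h3']
  change _ = ∫ y in {y : EE N | ε < ‖y - θ‖}, sg u y * ‖y - θ‖ ^ (-((N : ℝ) + α))
  ring

end Limit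

section NearSphereCurvature

variable {N : ℕ} {α β : ℝ}

lemma tendsto_mul_nhdsGT {c : ℝ} (hc : 0 < c) :
    Tendsto (fun ε : ℝ => c * ε) (nhdsWithin 0 (Set.Ioi 0)) (nhdsWithin 0 (Set.Ioi 0)) := by
  refine tendsto_nhdsWithin_iff.2 ⟨?_, ?_⟩
  · have : ContinuousAt (fun ε : ℝ => c * ε) 0 := by fun_prop
    simpa using this.tendsto.mono_left (nhdsWithin_le_nhds (s := Set.Ioi 0))
  · filter_upwards [self_mem_nhdsWithin] with ε hε
    exact mul_pos hc hε

lemma tendsto_pvo_near_sphere (hN : 2 ≤ N) (hα : α ∈ Set.Ioo (0 : ℝ) 1) (hαβ : α < β) (hβ : β ≤ 1) {U : ℝ}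
    (hU : U ≤ 1) {u : Sph N → ℝ} (hu : XB β U u) (θ : Sph N) :
    Tendsto (pvo N α (body u) (Real.exp (u θ) • (θ : EE N))) (nhdsWithin 0 (Set.Ioi 0))
      (nhds (Real.exp (-α * u θ) * (H0 α θ + 2 * frac α u θ - 2 * Qop α u θ))) := by
  have hβ0 : 0 ≤ β := hα.1.le.trans hαβ.le
  have hU0 : 0 ≤ U := (abs_nonneg _).trans (hu.bd θ)
  have hd0 : ∀ σ, 0 ≤ U * dist σ θ := fun σ => mul_nonneg hU0 dist_nonneg
  have h1 := tendsto_pvo_body (u := fun σ => u σ - u θ) (U := 8 * U) hN hα hαβ hβ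
    (hu.continuous.sub continuous_const) θ
    (fun σ => (abs_sub _ _).trans (by linarith [hu.bd σ, hu.bd θ]))
    (fun σ => (hu.lip σ θ).trans (by linarith [hd0 σ]))
    (fun σ => by
      have := hu.symm_diff hβ0 hβ θ σ
      rwa [show u σ - u θ + (u (opp θ σ) - u θ) = u σ + u (opp θ σ) - 2 * u θ by ring])
  have h2 : ∫ σ, (Gk (((N : ℝ) - α) / 2) (((N : ℝ) + α) / 2) (dist σ θ) (u σ - u θ) +
        Gk (((N : ℝ) - α) / 2) (((N : ℝ) + α) / 2) (dist σ θ) (u (opp θ σ) - u θ)) ∂(sm N) =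
      2 * Qop α u θ - 2 * frac α u θ := by
    obtain ⟨hi, hle⟩ := frac_integrable hN hαβ hα.1 hβ hu θ
    have hi2 : Integrable (fun σ => (2 * u θ - u σ - u (opp θ σ)) * dist σ θ ^ (-((N : ℝ) + α))) (sm N) := by
      refine hi.mono' ?_ (Eventually.of_forall hle)
      refine (Measurable.mul ?_ ((measurable_id.dist measurable_const).pow_const _)).aestronglyMeasurable
      exact (measurable_const.sub hu.continuous.measurable).sub
        (hu.continuous.comp (continuous_opp θ)).measurable
    rw [Qop, frac, ← integral_const_mul, ← mul_assoc, show (2:ℝ) * (1 / 2) = 1 by norm_num, one_mul,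
      ← integral_sub ((integrable_Qm hN hα.1 hαβ hβ hU hu θ).const_mul 2) hi2]
    refine integral_congr_ae ?_
    have hne : ∀ᵐ σ ∂(sm N), σ ≠ θ := by rw [ae_iff]; simpa using sm_singleton θ hN
    filter_upwards [hne] with σ hσ
    rw [Gk_eq_Mk (dist_pos.2 hσ), Gk_eq_Mk (dist_pos.2 hσ), Qm, two_half_add]
    ring
  rw [h2] at h1
  have h3 := (h1.comp (tendsto_mul_nhdsGT (Real.exp_pos (-u θ)))).const_mul (Real.exp (-α * u θ))
  rw [show H0 α θ + 2 * frac α u θ - 2 * Qop α u θ = H0 α θ - (2 * Qop α u θ - 2 * frac α u θ) by ring]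
  refine h3.congr fun ε => ?_
  rw [pvo_body]
  rfl

lemma body_zero : body (fun _ : Sph N => (0:ℝ)) = Metric.ball (0 : EE N) 1 := by
  ext y
  rw [mem_ball_zero_iff]
  rcases eq_or_ne y 0 with rfl | hy
  · simp [zero_mem_body]
  · obtain ⟨σ, s, rfl⟩ := exists_logPolar hy
    rw [exp_smul_mem_body, norm_exp_smul, Real.exp_lt_one_iff]

lemma tendsto_pvo_ball (hN : 2 ≤ N) (hα : α ∈ Set.Ioo (0 : ℝ) 1) (θ : Sph N) :
    Tendsto (pvo N α (Metric.ball (0 : EE N) 1) θ) (nhdsWithin 0 (Set.Ioi 0)) (nhds (H0 α θ)) := by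
  have := tendsto_pvo_body (u := fun _ : Sph N => (0:ℝ)) (U := 0) hN hα hα.2 le_rfl continuous_const θ
    (fun _ => by simp) (fun _ => by simp) (fun _ => by simp)
  simpa [Gk, body_zero] using this

lemma tendsto_pvo_tangent_ball (hN : 2 ≤ N) (hα : α ∈ Set.Ioo (0 : ℝ) 1) (θ : Sph N) {t : ℝ} (ht : 0 < 1 + t) :
    Tendsto (pvo N α (Metric.ball (-t • (θ : EE N)) (1 + t)) θ) (nhdsWithin 0 (Set.Ioi 0))
      (nhds ((1 + t) ^ (-α) * H0 α θ)) := by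
  have h1 := ((tendsto_pvo_ball hN hα θ).comp (tendsto_mul_nhdsGT (inv_pos.2 ht))).const_mul ((1 + t) ^ (-α))
  refine h1.congr fun ε => ?_
  have h2 := pvo_add (N := N) (α := α) (E := Metric.ball (-t • (θ : EE N)) (1 + t)) (-t • (θ : EE N))
    ((1 + t) • (θ : EE N)) ε
  rw [← add_smul, add_neg_cancel_right, one_smul] at h2
  have h3 : {y : EE N | y + -t • (θ : EE N) ∈ Metric.ball (-t • (θ : EE N)) (1 + t)} =
      Metric.ball 0 (1 + t) := by
    ext y; simp
  have h4 := pvo_smul (N := N) (α := α) (E := Metric.ball 0 (1 + t)) ht (θ : EE N) ((1 + t)⁻¹ * ε)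
  have h5 : {y : EE N | (1 + t) • y ∈ Metric.ball (0 : EE N) (1 + t)} = Metric.ball 0 1 := by
    ext y
    rw [Set.mem_ofPred_eq, mem_ball_zero_iff, mem_ball_zero_iff, norm_smul, Real.norm_eq_abs, abs_of_pos ht]
    exact mul_lt_iff_lt_one_right ht
  rw [h2, h3, Function.comp_apply]
  rw [h5, mul_inv_cancel_left₀ ht.ne'] at h4
  exact h4.symm

end NearSphereCurvature

section TangentBall

variable {N : ℕ} {α : ℝ}

/-- The radial function of a ball of radius `1 + t` internally tangent to the unit sphere, as a function
of the distance to the contact point. -/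
noncomputable def rho (t d : ℝ) : ℝ :=
  -(t * (1 - d ^ 2 / 2)) + Real.sqrt (1 + 2 * t + (t * (1 - d ^ 2 / 2)) ^ 2)

lemma rho_spec {t d : ℝ} (ht : 0 ≤ t) : 0 < rho t d ∧
    rho t d ^ 2 + 2 * t * (1 - d ^ 2 / 2) * rho t d = 1 + 2 * t := by
  set z := t * (1 - d ^ 2 / 2) with hz
  have h0 : 0 ≤ 1 + 2 * t + z ^ 2 := by positivity
  have h1 := Real.sq_sqrt h0
  have h2 : |z| < Real.sqrt (1 + 2 * t + z ^ 2) := by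
    rw [← Real.sqrt_sq_eq_abs]; exact Real.sqrt_lt_sqrt (sq_nonneg z) (by linarith)
  have h3 : rho t d = -z + Real.sqrt (1 + 2 * t + z ^ 2) := rfl
  refine ⟨by rw [h3]; linarith [le_abs_self z], ?_⟩
  rw [mul_assoc 2 t, ← hz, h3]
  linear_combination h1

lemma log_rho_bounds {t d : ℝ} (ht : 0 < t) (ht1 : t ≤ 1 / 8) (hd : 0 ≤ d) (hd2 : d ≤ 2) :
    0 ≤ Real.log (rho t d) ∧ Real.log (rho t d) ≤ t * d ^ 2 ∧
      |Real.log (rho t d) - t * d ^ 2 / 2| ≤ 7 * t ^ 2 * d ^ 2 := by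
  obtain ⟨h0, h1⟩ := rho_spec (d := d) ht.le
  set X := rho t d
  have hd4 : d ^ 2 ≤ 4 := by nlinarith
  set c := 1 - d ^ 2 / 2 with hc
  have hc1 : c ≤ 1 := by rw [hc]; nlinarith [sq_nonneg d]
  have hc2 : -1 ≤ c := by rw [hc]; linarith
  have htc : |t * c| ≤ t := by
    rw [abs_mul, abs_of_pos ht]; exact mul_le_of_le_one_right ht.le (abs_le.2 ⟨hc2, hc1⟩)
  obtain ⟨htc1, htc2⟩ := abs_le.1 htc
  have key : (X - 1) * (X + 1 + 2 * (t * c)) = t * d ^ 2 := by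
    have : d ^ 2 = 2 - 2 * c := by rw [hc]; ring
    rw [this]; linear_combination h1
  have hD : 0 < X + 1 + 2 * (t * c) := by linarith
  have htd : 0 ≤ t * d ^ 2 := by positivity
  have hX : 0 ≤ X - 1 := by
    by_contra! h
    nlinarith [mul_neg_of_neg_of_pos h hD]
  have hX2 : X - 1 ≤ t * d ^ 2 := by nlinarith
  have hX3 : X - 1 ≤ 4 * t := by nlinarith
  have hl1 : Real.log X ≤ X - 1 := Real.log_le_sub_one_of_pos h0
  have hl2 : 1 - X⁻¹ ≤ Real.log X := Real.one_sub_inv_le_log_of_pos h0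
  have hl3 : (X - 1) - (X - 1) ^ 2 ≤ 1 - X⁻¹ := by
    have hinv : X * X⁻¹ = 1 := mul_inv_cancel₀ h0.ne'
    have hinv1 : X⁻¹ ≤ 1 := inv_le_one_of_one_le₀ (by linarith)
    have : 1 - X⁻¹ - ((X - 1) - (X - 1) ^ 2) = (X - 1) ^ 2 * (1 - X⁻¹) := by
      linear_combination (X - 2) * hinv
    nlinarith [mul_nonneg (sq_nonneg (X - 1)) (sub_nonneg.2 hinv1)]
  refine ⟨Real.log_nonneg (by linarith), hl1.trans hX2, ?_⟩
  have h5 : (X - 1) ^ 2 ≤ 4 * t * (t * d ^ 2) := by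
    rw [sq]; exact mul_le_mul hX3 hX2 hX (by positivity)
  have h6 : X - 1 - t * d ^ 2 / 2 = (X - 1) * (-(X - 1 + 2 * (t * c)) / 2) := by rw [← key]; ring
  have h7 : |X - 1 - t * d ^ 2 / 2| ≤ t * d ^ 2 * (3 * t) := by
    rw [h6, abs_mul, abs_of_nonneg hX]
    refine mul_le_mul hX2 ?_ (abs_nonneg _) htd
    rw [abs_le]; constructor <;> linarith
  rw [abs_le] at h7 ⊢
  constructor <;> nlinarith

lemma continuous_rho (t : ℝ) : Continuous (rho t) := by unfold rho; fun_prop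

lemma body_log_rho (θ : Sph N) {t : ℝ} (ht : 0 < t) :
    body (fun σ => Real.log (rho t (dist σ θ))) = Metric.ball (-t • (θ : EE N)) (1 + t) := by
  ext y
  rw [mem_ball_iff_norm]
  rcases eq_or_ne y 0 with rfl | hy
  · simp only [zero_mem_body, true_iff]
    rw [zero_sub, neg_smul, neg_neg, norm_smul, norm_coe, Real.norm_eq_abs, abs_of_pos ht]
    linarith
  · obtain ⟨σ, s, rfl⟩ := exists_logPolar hy
    obtain ⟨h0, h1⟩ := rho_spec (d := dist σ θ) ht.le
    rw [exp_smul_mem_body, Real.lt_log_iff_exp_lt h0, ← sq_lt_sq₀ (norm_nonneg _) (by linarith)]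
    have h2 : ‖Real.exp s • (σ : EE N) - -t • (θ : EE N)‖ ^ 2 - (1 + t) ^ 2 =
        (Real.exp s - rho t (dist σ θ)) * (Real.exp s + (rho t (dist σ θ) + 2 * t * (1 - dist σ θ ^ 2 / 2))) := by
      rw [neg_smul, sub_neg_eq_add, norm_add_sq_real, norm_exp_smul, norm_smul, norm_coe, Real.norm_eq_abs,
        abs_of_pos ht, inner_smul_left, inner_smul_right, real_inner_comm, inner_eq_dist]
      simp only [conj_trivial]
      linear_combination h1
    have h3 : 0 < rho t (dist σ θ) + 2 * t * (1 - dist σ θ ^ 2 / 2) := by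
      refine (mul_pos_iff_of_pos_left h0).1 ?_
      linarith
    have h4 := Real.exp_pos s
    rw [← sub_neg, ← sub_neg (b := (1 + t) ^ 2), h2]
    constructor
    · intro h; exact mul_neg_of_neg_of_pos h (by linarith)
    · intro h; by_contra! h'; nlinarith [mul_nonneg h' (by linarith : (0:ℝ) ≤ Real.exp s +
        (rho t (dist σ θ) + 2 * t * (1 - dist σ θ ^ 2 / 2)))]

end TangentBall

section TranslationEigenvalue

variable {N : ℕ} {α : ℝ}

lemma exists_Mk_sq_le {a b : ℝ} (hb : 0 ≤ b) : ∃ C : ℝ, 0 ≤ C ∧ ∀ d : ℝ, 0 < d → d ≤ 2 → ∀ x : ℝ,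
    |x| ≤ 2 → |Mk a b d x| ≤ C * d ^ (-(2 * b) - 1) * x ^ 2 := by
  obtain ⟨C, hC, H⟩ := exists_gk_lip (a := a) hb
  refine ⟨C, hC, fun d hd hd2 x hx => ?_⟩
  have h := intervalIntegral.norm_integral_le_of_norm_le_const (a := 0) (b := x)
    (f := fun s => gk a b d s - d ^ (-(2 * b))) (C := C * d ^ (-(2 * b) - 1) * |x|) fun s hs => by
      have hs1 : |s| ≤ |x| := by
        have := Set.abs_sub_left_of_mem_uIcc (Set.uIoc_subset_uIcc hs)
        simpa using this
      rw [← gk_zero (a := a) hd, Real.norm_eq_abs]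
      refine (H d hd hd2 s 0 (hs1.trans hx) (by simp)).trans ?_
      rw [sub_zero]
      gcongr
  rw [Real.norm_eq_abs, sub_zero, mul_assoc, abs_mul_abs_self, ← sq] at h
  exact h

lemma measurable_Gk_dist (hN : 2 ≤ N) {u : Sph N → ℝ} (hu : Continuous u) (θ : Sph N) :
    AEStronglyMeasurable (fun σ => Gk (((N : ℝ) - α) / 2) (((N : ℝ) + α) / 2) (dist σ θ) (u σ)) (sm N) := by
  have h3 := (measurable_Mk (a := ((N : ℝ) - α) / 2) (b := ((N : ℝ) + α) / 2)).comp
    (((measurable_id.dist measurable_const).prodMk hu.measurable :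
      Measurable fun σ : Sph N => (dist σ θ, u σ)))
  have h4 : Measurable fun σ => u σ * dist σ θ ^ (-(2 * (((N : ℝ) + α) / 2))) :=
    hu.measurable.mul ((measurable_id.dist measurable_const).pow_const _)
  refine (h3.add h4).aestronglyMeasurable.congr ?_
  have hne : ∀ᵐ σ ∂(sm N), σ ≠ θ := by rw [ae_iff]; simpa using sm_singleton θ hN
  filter_upwards [hne] with σ hσ
  exact (Gk_eq_Mk (dist_pos.2 hσ) _).symm

lemma exists_tangent_ball_expansion (hN : 2 ≤ N) (hα : α ∈ Set.Ioo (0 : ℝ) 1) (θ : Sph N) : ∃ C : ℝ,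
    ∀ t, 0 < t → t ≤ 1 / 8 → |(1 + t) ^ (-α) * H0 α θ - H0 α θ +
      2 * t * ∫ σ, dist σ θ ^ 2 / 2 * dist σ θ ^ (-((N : ℝ) + α)) ∂(sm N)| ≤ C * t ^ 2 := by
  have hN2 : (2 : ℝ) ≤ N := by exact_mod_cast hN
  obtain ⟨C, hC, hM⟩ := exists_Mk_sq_le (a := ((N : ℝ) - α) / 2) (b := ((N : ℝ) + α) / 2)
    (by linarith [hα.1])
  obtain ⟨K, hK0, hK⟩ := exists_sph_full hN (q := 2 - ((N : ℝ) + α))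
    (ne_of_lt (by linarith [hα.1])) (by linarith [hα.2])
  obtain ⟨hKi, hKb⟩ := hK θ
  refine ⟨2 * ((2 * C + 7) * K), fun t ht ht8 => ?_⟩
  set G := Gk (((N : ℝ) - α) / 2) (((N : ℝ) + α) / 2) with hG
  set u : Sph N → ℝ := fun σ => Real.log (rho t (dist σ θ)) with hu
  have hb : ∀ σ : Sph N, _ := fun σ => log_rho_bounds ht ht8 (dist_nonneg (x := σ) (y := θ)) (dist_le_two σ θ)
  have hu0 : ∀ σ, |u σ| ≤ t * dist σ θ ^ 2 := fun σ => by rw [abs_of_nonneg (hb σ).1]; exact (hb σ).2.1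
  have hd4 : ∀ σ : Sph N, dist σ θ ^ 2 ≤ 4 := fun σ => by
    nlinarith [dist_le_two σ θ, dist_nonneg (x := σ) (y := θ)]
  have hopp : ∀ σ, u (opp θ σ) = u σ := fun σ => by simp only [hu, dist_opp]
  have huc : Continuous u := by
    refine Continuous.log ((continuous_rho t).comp (continuous_id.dist continuous_const)) fun σ => ?_
    exact (rho_spec ht.le).1.ne'
  have hu2 : ∀ σ, |u σ| ≤ 2 := fun σ => (hu0 σ).trans (by nlinarith [hd4 σ])
  have h1 := tendsto_pvo_body (U := 2 * t) hN hα hα.2 le_rfl huc θ hu2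
    (fun σ => (hu0 σ).trans (by
      have := mul_nonneg (mul_nonneg ht.le (dist_nonneg (x := σ) (y := θ))) (sub_nonneg.2 (dist_le_two σ θ))
      nlinarith))
    (fun σ => by
      rw [hopp, ← two_mul, abs_mul, abs_two, show (1:ℝ) + 1 = (2:ℕ) by norm_num, Real.rpow_natCast,
        mul_assoc]
      exact mul_le_mul_of_nonneg_left (hu0 σ) zero_le_two)
  rw [body_log_rho θ ht] at h1
  have h2 := tendsto_nhds_unique (tendsto_pvo_tangent_ball hN hα θ (by linarith)) h1
  rw [h2]
  have hI : Integrable (fun σ => dist σ θ ^ 2 / 2 * dist σ θ ^ (-((N : ℝ) + α))) (sm N) := by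
    refine (hKi.div_const 2).congr ?_
    have hne : ∀ᵐ σ ∂(sm N), σ ≠ θ := by rw [ae_iff]; simpa using sm_singleton θ hN
    filter_upwards [hne] with σ hσ
    rw [sub_eq_add_neg, Real.rpow_add (dist_pos.2 hσ), Real.rpow_two]
    ring
  have hpt : ∀ᵐ σ ∂(sm N), ‖2 * t * (dist σ θ ^ 2 / 2 * dist σ θ ^ (-((N : ℝ) + α))) -
      (G (dist σ θ) (u σ) + G (dist σ θ) (u (opp θ σ)))‖ ≤
      2 * ((2 * C + 7) * t ^ 2) * dist σ θ ^ (2 - ((N : ℝ) + α)) := by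
    have hne : ∀ᵐ σ ∂(sm N), σ ≠ θ := by rw [ae_iff]; simpa using sm_singleton θ hN
    filter_upwards [hne] with σ hσ
    have hd := dist_pos.2 hσ
    have hM1 := hM _ hd (dist_le_two σ θ) (u σ) (hu2 σ)
    rw [hopp, hG, Gk_eq_Mk hd]
    have h3 := (hb σ).2.2
    have e : -(2 * (((N : ℝ) + α) / 2)) = -((N : ℝ) + α) := by ring
    rw [e] at hM1 ⊢
    set d := dist σ θ
    set m := Mk (((N : ℝ) - α) / 2) (((N : ℝ) + α) / 2) d (u σ)
    have e1 : d ^ (2 - ((N : ℝ) + α)) = d ^ 2 * d ^ (-((N : ℝ) + α)) := by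
      rw [sub_eq_add_neg, Real.rpow_add hd, Real.rpow_two]
    have e2 : d ^ (-((N : ℝ) + α) - 1) * d = d ^ (-((N : ℝ) + α)) := by
      rw [← Real.rpow_add_one hd.ne', sub_add_cancel]
    have hP : 0 ≤ d ^ (-((N : ℝ) + α)) := Real.rpow_nonneg hd.le _
    have hP1 : 0 ≤ d ^ (-((N : ℝ) + α) - 1) := Real.rpow_nonneg hd.le _
    have hm : |m| ≤ 2 * C * t ^ 2 * (d ^ 2 * d ^ (-((N : ℝ) + α))) := by
      refine hM1.trans ?_
      have h5 : u σ ^ 2 ≤ (t * d ^ 2) ^ 2 := sq_le_sq' (by linarith [neg_abs_le (u σ), hu0 σ])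
        ((le_abs_self _).trans (hu0 σ))
      calc C * d ^ (-((N : ℝ) + α) - 1) * u σ ^ 2
          ≤ C * d ^ (-((N : ℝ) + α) - 1) * (t * d ^ 2) ^ 2 := by gcongr
        _ = C * t ^ 2 * (d ^ 2 * (d ^ (-((N : ℝ) + α) - 1) * d)) * d := by ring
        _ ≤ C * t ^ 2 * (d ^ 2 * (d ^ (-((N : ℝ) + α) - 1) * d)) * 2 := by
            gcongr; exact dist_le_two σ θ
        _ = _ := by rw [e2]; ring
    have h6 : 2 * t * (d ^ 2 / 2 * d ^ (-((N : ℝ) + α))) - (m + u σ * d ^ (-((N : ℝ) + α)) +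
        (m + u σ * d ^ (-((N : ℝ) + α)))) =
        -(2 * (m + (u σ - t * d ^ 2 / 2) * d ^ (-((N : ℝ) + α)))) := by ring
    rw [Real.norm_eq_abs, h6, abs_neg, abs_mul, abs_two, mul_assoc 2]
    refine mul_le_mul_of_nonneg_left ?_ zero_le_two
    refine (abs_add_le _ _).trans ?_
    rw [abs_mul, abs_of_nonneg hP, e1]
    have h7 : |u σ - t * d ^ 2 / 2| * d ^ (-((N : ℝ) + α)) ≤ 7 * t ^ 2 * d ^ 2 * d ^ (-((N : ℝ) + α)) :=
      mul_le_mul_of_nonneg_right h3 hP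
    linarith
  have hm := measurable_Gk_dist (α := α) hN huc θ
  have hGi : Integrable (fun σ => G (dist σ θ) (u σ) + G (dist σ θ) (u (opp θ σ))) (sm N) := by
    have hm2 : AEStronglyMeasurable (fun σ => G (dist σ θ) (u σ) + G (dist σ θ) (u (opp θ σ))) (sm N) := by
      simp only [hopp]; exact hm.add hm
    have h5 : Integrable (fun σ => 2 * t * (dist σ θ ^ 2 / 2 * dist σ θ ^ (-((N : ℝ) + α))) -
        (2 * t * (dist σ θ ^ 2 / 2 * dist σ θ ^ (-((N : ℝ) + α))) -
      (G (dist σ θ) (u σ) + G (dist σ θ) (u (opp θ σ))))) (sm N) :=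
      (hI.const_mul (2 * t)).sub ((hKi.const_mul (2 * ((2 * C + 7) * t ^ 2))).mono'
        ((hI.const_mul (2 * t)).aestronglyMeasurable.sub hm2) hpt)
    simpa only [sub_sub_cancel] using h5
  rw [← integral_const_mul, show ∀ x y z : ℝ, x - y - x + z = z - y by intros; ring,
    ← integral_sub (hI.const_mul (2 * t)) hGi, ← Real.norm_eq_abs]
  refine (norm_integral_le_of_norm_le (hKi.const_mul _) hpt).trans ?_
  rw [integral_const_mul]
  have := mul_le_mul_of_nonneg_left hKb (by positivity : 0 ≤ 2 * ((2 * C + 7) * t ^ 2))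
  linarith

/-- Linear functions are generated by translations of the sphere, which identifies their eigenvalue. -/
lemma two_mul_translation_eigenvalue (hN : 2 ≤ N) (hα : α ∈ Set.Ioo (0 : ℝ) 1) (θ : Sph N) {l : ℝ}
    (hl : ∀ (v : EE N) (τ : Sph N), frac α (fun ω => inner ℝ v (ω : EE N)) τ = l * inner ℝ v (τ : EE N)) :
    2 * l = α * H0 α θ := by
  have h1 : ∫ σ, dist σ θ ^ 2 / 2 * dist σ θ ^ (-((N : ℝ) + α)) ∂(sm N) = l := by
    have := hl θ θ
    rw [frac_lin, real_inner_self_eq_norm_sq, norm_coe, one_pow, mul_one, mul_one] at this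
    rw [← this]
    refine integral_congr_ae (Eventually.of_forall fun σ => ?_)
    simp only [inner_eq_dist, sub_sub_cancel]
  obtain ⟨C, hC⟩ := exists_tangent_ball_expansion hN hα θ
  rw [h1] at hC
  have hder : HasDerivAt (fun t : ℝ => (1 + t) ^ (-α) * H0 α θ) (-α * H0 α θ) 0 := by
    have h2 : HasDerivAt (fun t : ℝ => 1 + t) 1 0 := (hasDerivAt_id 0).const_add 1
    have h3 := (h2.rpow_const (p := -α) (Or.inl (by norm_num))).mul_const (H0 α θ)
    simpa using h3
  have h4 := (hasDerivAt_iff_tendsto_slope_zero.1 hder).mono_left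
    (nhdsWithin_mono 0 (show Set.Ioi (0:ℝ) ⊆ {0}ᶜ from fun x hx => (ne_of_gt hx)))
  have h5 : Tendsto (fun t : ℝ => t⁻¹ • ((1 + (0 + t)) ^ (-α) * H0 α θ - (1 + 0) ^ (-α) * H0 α θ))
      (nhdsWithin 0 (Set.Ioi 0)) (nhds (-(2 * l))) := by
    rw [tendsto_iff_norm_sub_tendsto_zero]
    have h6 : Tendsto (fun t : ℝ => C * t) (nhdsWithin 0 (Set.Ioi 0)) (nhds 0) := by
      have : ContinuousAt (fun t : ℝ => C * t) 0 := by fun_prop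
      simpa using this.tendsto.mono_left (nhdsWithin_le_nhds (s := Set.Ioi 0))
    refine squeeze_zero' (Eventually.of_forall fun t => norm_nonneg _) ?_ h6
    filter_upwards [Ioo_mem_nhdsGT (show (0:ℝ) < 1 / 8 by norm_num)] with t ht
    have ht0 : 0 < t := ht.1
    have h7 := hC t ht0 ht.2.le
    rw [zero_add, add_zero, Real.one_rpow, one_mul, smul_eq_mul, Real.norm_eq_abs,
      show t⁻¹ * ((1 + t) ^ (-α) * H0 α θ - H0 α θ) - -(2 * l) =
        ((1 + t) ^ (-α) * H0 α θ - H0 α θ + 2 * t * l) / t by field_simp; ring,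
      abs_div, abs_of_pos ht0, div_le_iff₀ ht0]
    linarith
  have := tendsto_nhds_unique h4 h5
  linarith

end TranslationEigenvalue

section Packing

variable {N M : ℕ} {α : ℝ}

/-- The union of the translates of a body by the dilated lattice. -/
def pack (a : Fin M → EE N) (r : ℝ) (u : Sph N → ℝ) : Set (EE N) := ⋃ k, {y | y - r • lat a k ∈ body u}

lemma mem_pack {a : Fin M → EE N} {r : ℝ} {u : Sph N → ℝ} {y : EE N} :
    y ∈ pack a r u ↔ ∃ k, y - r • lat a k ∈ body u := Set.mem_iUnion

lemma isOpen_translate {u : Sph N → ℝ} (hu : Continuous u) (v : EE N) : IsOpen {y | y - v ∈ body u} :=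
  (isOpen_body hu).preimage (continuous_id.sub continuous_const)

lemma isOpen_pack (a : Fin M → EE N) (r : ℝ) {u : Sph N → ℝ} (hu : Continuous u) : IsOpen (pack a r u) :=
  isOpen_iUnion fun _ => isOpen_translate hu _

lemma add_lat_mem_pack (a : Fin M → EE N) (r : ℝ) (u : Sph N → ℝ) (k : Fin M → ℤ) :
    {y | y + r • lat a k ∈ pack a r u} = pack a r u := by
  ext y
  simp only [Set.mem_ofPred_eq, mem_pack]
  constructor
  · rintro ⟨m, hm⟩
    refine ⟨m - k, ?_⟩
    rwa [lat_sub, smul_sub, sub_sub_eq_add_sub]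
  · rintro ⟨m, hm⟩
    refine ⟨m + k, ?_⟩
    have : lat a m = lat a (m + k) - lat a k := by rw [← lat_sub, add_sub_cancel_right]
    rwa [this, smul_sub, sub_sub_eq_add_sub] at hm

lemma eq_of_norm_sub_lat_lt {a : Fin M → EE N} {r : ℝ} (hr : ∀ k, k ≠ 0 → 128 ≤ ‖r • lat a k‖)
    {x y : EE N} {k m : Fin M → ℤ} (hx : ‖x - r • lat a k‖ < 32) (hy : ‖y - r • lat a m‖ < 32)
    (hxy : ‖x - y‖ < 64) : k = m := by
  by_contra h
  have h1 := hr (k - m) (sub_ne_zero.2 h)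
  have h2 : r • lat a (k - m) = (x - y) - ((x - r • lat a k) - (y - r • lat a m)) := by
    rw [lat_sub, smul_sub]; abel
  have h3 := norm_sub_le (x - y) ((x - r • lat a k) - (y - r • lat a m))
  have h4 := norm_sub_le (x - r • lat a k) (y - r • lat a m)
  rw [h2] at h1
  linarith

lemma frontier_pack_subset {a : Fin M → EE N} {r : ℝ} (hr : ∀ k, k ≠ 0 → 128 ≤ ‖r • lat a k‖)
    {u : Sph N → ℝ} (hu : Continuous u) (hu1 : ∀ σ, |u σ| ≤ 1) :
    frontier (pack a r u) ⊆ ⋃ k, (fun y => y - r • lat a k) ⁻¹' frontier (body u) := by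
  intro x hx
  rw [(isOpen_pack a r hu).frontier_eq] at hx
  obtain ⟨y, hy, hyx⟩ := Metric.mem_closure_iff.1 hx.1 1 one_pos
  obtain ⟨k, hk⟩ := mem_pack.1 hy
  rw [dist_eq_norm] at hyx
  have hxk : ‖x - r • lat a k‖ < 32 := by
    have := norm_add_le (x - y) (y - r • lat a k)
    rw [sub_add_sub_cancel] at this
    linarith [body_subset hu1 hk]
  refine Set.mem_iUnion.2 ⟨k, ?_⟩
  rw [Set.mem_preimage, (isOpen_body hu).frontier_eq]
  refine ⟨Metric.mem_closure_iff.2 fun ε hε => ?_, fun h => hx.2 (mem_pack.2 ⟨k, h⟩)⟩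
  obtain ⟨z, hz, hzx⟩ := Metric.mem_closure_iff.1 hx.1 (min ε 1) (lt_min hε one_pos)
  obtain ⟨m, hm⟩ := mem_pack.1 hz
  have hzx1 := hzx.trans_le (min_le_right _ _)
  rw [dist_eq_norm] at hzx1
  obtain rfl := eq_of_norm_sub_lat_lt hr hxk ((body_subset hu1 hm).trans_lt (by norm_num)) (hzx1.trans (by norm_num))
  refine ⟨_, hm, ?_⟩
  rw [dist_sub_right]
  exact hzx.trans_le (min_le_left _ _)

lemma volume_frontier_pack (hN : 2 ≤ N) {a : Fin M → EE N} {r : ℝ}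
    (hr : ∀ k, k ≠ 0 → 128 ≤ ‖r • lat a k‖) {u : Sph N → ℝ} (hu : Continuous u) (hu1 : ∀ σ, |u σ| ≤ 1) :
    volume (frontier (pack a r u)) = 0 :=
  measure_mono_null (frontier_pack_subset hr hu hu1) (measure_iUnion_null fun k =>
    (measurePreserving_sub_right volume (r • lat a k)).quasiMeasurePreserving.preimage_null
      (volume_frontier_body hN hu))

lemma setIntegral_translate (f : EE N → ℝ) (s : Set (EE N)) (v : EE N) :
    ∫ y in {y | y - v ∈ s}, f y = ∫ y in s, f (y + v) := by
  have := (measurePreserving_sub_right (volume : Measure (EE N)) v).setIntegral_preimage_emb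
    (Homeomorph.subRight v).measurableEmbedding (fun y => f (y + v)) s
  simp only [sub_add_cancel] at this
  exact this

lemma pvo_pack (hα : 0 < α) {a : Fin M → EE N} {r : ℝ}
    (hr : ∀ k, k ≠ 0 → 128 ≤ ‖r • lat a k‖) {u : Sph N → ℝ} (hu : Continuous u) (hu1 : ∀ σ, |u σ| ≤ 1)
    {x : EE N} (hx : ‖x‖ ≤ 3) {ε : ℝ} (hε : 0 < ε) (hε1 : ε < 64) :
    pvo N α (pack a r u) x ε = pvo N α (body u) x ε - 2 * vol (Phi α a r) u x := by
  set K : EE N → ℝ := fun y => ‖y - x‖ ^ (-((N : ℝ) + α)) with hK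
  set T : {k : Fin M → ℤ // k ≠ 0} → Set (EE N) := fun k => {y | y - r • lat a k ∈ body u} with hT
  have hTm : ∀ k, MeasurableSet (T k) := fun k => (isOpen_translate hu _).measurableSet
  have hbT : ∀ {y : EE N} {k m : Fin M → ℤ}, y - r • lat a k ∈ body u → y - r • lat a m ∈ body u → k = m := by
    intro y k m h1 h2
    exact eq_of_norm_sub_lat_lt hr ((body_subset hu1 h1).trans_lt (by norm_num))
      ((body_subset hu1 h2).trans_lt (by norm_num)) (by simp)
  have hdis : Pairwise (Function.onFun Disjoint T) := fun k m hkm => by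
    refine Set.disjoint_left.2 fun y hy hy' => hkm (Subtype.ext (hbT hy hy'))
  have hfar : ∀ k, T k ⊆ {y | ε < ‖y - x‖} := fun k y hy => by
    by_contra h
    rw [Set.mem_ofPred_eq, not_lt] at h
    have h0 : ‖x - r • lat a 0‖ < 32 := by rw [lat_zero, smul_zero, sub_zero]; linarith
    exact k.2 (eq_of_norm_sub_lat_lt hr ((body_subset hu1 hy).trans_lt (by norm_num)) h0 (by linarith))
  have hTU : (⋃ k, T k) ⊆ {y | ε < ‖y - x‖} := Set.iUnion_subset hfar
  have hind : ∀ y, (pack a r u).indicator (fun _ => (1:ℝ)) y =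
      (body u).indicator (fun _ => (1:ℝ)) y + (⋃ k, T k).indicator (fun _ => (1:ℝ)) y := by
    intro y
    have hd : Disjoint (body u) (⋃ k, T k) := Set.disjoint_left.2 fun y hy hy' => by
      obtain ⟨k, hk⟩ := Set.mem_iUnion.1 hy'
      exact k.2 (hbT hk (show y - r • lat a 0 ∈ body u by rwa [lat_zero, smul_zero, sub_zero]))
    have he : pack a r u = body u ∪ ⋃ k, T k := by
      ext z
      rw [mem_pack, Set.mem_union, Set.mem_iUnion]
      constructor
      · rintro ⟨k, hk⟩
        rcases eq_or_ne k 0 with rfl | h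
        · left; rwa [lat_zero, smul_zero, sub_zero] at hk
        · exact Or.inr ⟨⟨k, h⟩, hk⟩
      · rintro (h | ⟨k, hk⟩)
        · exact ⟨0, by rwa [lat_zero, smul_zero, sub_zero]⟩
        · exact ⟨k, hk⟩
    rw [he, Set.indicator_union_of_disjoint hd]
  have hUm : MeasurableSet (⋃ k, T k) := MeasurableSet.iUnion hTm
  have hKi := integrableOn_kernel hα x hε
  have hHS := hasSum_integral_iUnion hTm hdis (hKi.mono_set hTU)
  have hterm : ∀ k, ∫ y in T k, K y = ∫ y in body u, ‖y - x + r • lat a k‖ ^ (-((N : ℝ) + α)) := by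
    intro k
    rw [hT, setIntegral_translate]
    simp only [hK, sub_add_eq_add_sub]
  have hint : ∀ k : {k : Fin M → ℤ // k ≠ 0},
      Integrable (fun y => ‖y - x + r • lat a k‖ ^ (-((N : ℝ) + α))) (volume.restrict (body u)) := by
    intro k
    have h1 : IntegrableOn K (T k) := hKi.mono_set (hfar k)
    have h2 := ((measurePreserving_add_right (volume : Measure (EE N)) (r • lat a k.1)).integrableOn_comp_preimage
      (Homeomorph.addRight (r • lat a k.1)).measurableEmbedding (f := K) (s := T k)).2 h1
    have h3 : (fun y => y + r • lat a k.1) ⁻¹' T k = body u := by ext y; simp [hT]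
    rw [h3] at h2
    refine h2.congr (Eventually.of_forall fun y => ?_)
    simp only [hK, Function.comp_apply, sub_add_eq_add_sub]
  have hvol : vol (Phi α a r) u x = ∫ y in ⋃ k, T k, K y := by
    rw [vol]
    simp only [Phi]
    rw [← integral_tsum_of_summable_integral_norm hint]
    · rw [← hHS.tsum_eq]
      exact tsum_congr fun k => (hterm k).symm
    · refine hHS.summable.congr fun k => ?_
      rw [hterm]
      refine integral_congr_ae (Eventually.of_forall fun y => ?_)
      exact (Real.norm_of_nonneg (Real.rpow_nonneg (norm_nonneg _) _)).symm
  have hind1 : ∀ s : Set (EE N), ∀ y, |s.indicator (fun _ => (1:ℝ)) y| ≤ 1 := fun s y => by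
    by_cases h : y ∈ s <;> simp [h]
  have hbm := measurableSet_body hu
  have hi1 : IntegrableOn (fun y => (1 - 2 * (body u).indicator (fun _ => (1:ℝ)) y) * K y)
      {y : EE N | ε < ‖y - x‖} := by
    refine integrableOn_mul_kernel hα ((measurable_const.sub
      ((measurable_const.indicator hbm).const_mul 2))) (fun y => ?_) x hε
    by_cases h : y ∈ body u <;> norm_num [h]
  have hi2 : IntegrableOn (fun y => (⋃ k, T k).indicator (fun _ => (1:ℝ)) y * K y)
      {y : EE N | ε < ‖y - x‖} :=
    integrableOn_mul_kernel hα (measurable_const.indicator hUm) (hind1 _) x hε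
  have hi3 : ∫ y in {y : EE N | ε < ‖y - x‖}, (⋃ k, T k).indicator (fun _ => (1:ℝ)) y * K y =
      ∫ y in ⋃ k, T k, K y := by
    have : ∀ y, (⋃ k, T k).indicator (fun _ => (1:ℝ)) y * K y = (⋃ k, T k).indicator K y := fun y => by
      by_cases h : y ∈ ⋃ k, T k <;> simp [h]
    simp only [this]
    rw [setIntegral_indicator hUm, Set.inter_eq_self_of_subset_right hTU]
  rw [hvol, ← hi3, pvo, pvo, ← integral_const_mul, ← integral_sub hi1 (hi2.const_mul 2)]
  refine integral_congr_ae (Eventually.of_forall fun y => ?_)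
  simp only [hind]
  ring

/-- The nonlocal mean curvature of a packing by a near-sphere that solves the reduced equation. -/
lemma tendsto_pvInt_pack (hN : 2 ≤ N) (hα : α ∈ Set.Ioo (0 : ℝ) 1) {β U l : ℝ} (hαβ : α < β) (hβ : β ≤ 1)
    (hU : U ≤ 1) {u : Sph N → ℝ} (hu : XB β U u) {a : Fin M → EE N} {r : ℝ}
    (hr : ∀ k, k ≠ 0 → 128 ≤ ‖r • lat a k‖) (τ : Sph N) (hl : 2 * l = α * H0 α τ)
    (hsol : ∀ θ, frac α u θ - l * u θ = nonlin α (H0 α τ / 2) (Phi α a r) u θ) {x : EE N}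
    (hx : x ∈ frontier (pack a r u)) :
    Tendsto (pvInt N α (pack a r u) x) (nhdsWithin 0 (Set.Ioi 0)) (nhds (H0 α τ)) := by
  have hu1 : ∀ σ, |u σ| ≤ 1 := fun σ => (hu.bd σ).trans hU
  have huc := hu.continuous
  obtain ⟨k, hk⟩ := Set.mem_iUnion.1 (frontier_pack_subset hr huc hu1 hx)
  obtain ⟨θ, hθ⟩ := frontier_body_subset huc hk
  have hx' : x = Real.exp (u θ) • (θ : EE N) + r • lat a k := by rw [← sub_eq_iff_eq_add]; exact hθ.symm
  have hx3 : ‖Real.exp (u θ) • (θ : EE N)‖ ≤ 3 := by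
    rw [norm_exp_smul]; exact exp_le_three ((le_abs_self _).trans (hu1 θ))
  have h1 := (tendsto_pvo_near_sphere hN hα hαβ hβ hU hu θ).sub_const
    (2 * vol (Phi α a r) u (Real.exp (u θ) • (θ : EE N)))
  have h2 : Real.exp (-α * u θ) * (H0 α θ + 2 * frac α u θ - 2 * Qop α u θ) -
      2 * vol (Phi α a r) u (Real.exp (u θ) • (θ : EE N)) = H0 α τ := by
    have h3 := hsol θ
    rw [nonlin, bpot] at h3
    have h4 : Real.exp (-α * u θ) * Real.exp (α * u θ) = 1 := by
      rw [← Real.exp_add, neg_mul, neg_add_cancel, Real.exp_zero]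
    rw [H0_eq hN hα θ τ]
    linear_combination 2 * Real.exp (-α * u θ) * h3 + Real.exp (-α * u θ) * u θ * hl +
      (H0 α τ + 2 * vol (Phi α a r) u (Real.exp (u θ) • (θ : EE N))) * h4
  rw [h2] at h1
  refine h1.congr' ?_
  filter_upwards [Ioo_mem_nhdsGT (show (0:ℝ) < 64 by norm_num)] with ε hε
  rw [pvInt_eq (isOpen_pack a r huc) (volume_frontier_pack hN hr huc hu1), hx', pvo_add, add_lat_mem_pack,
    pvo_pack hα.1 hr huc hu1 hx3 hε.1 hε.2]

end Packing

section Assembly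

variable {N M : ℕ} {α : ℝ}

open Classical in
/-- The radial perturbation, extended by zero off the sphere, whose star body is `body u`. -/
noncomputable def perturbation (u : Sph N → ℝ) (x : EE N) : ℝ :=
  if h : x ∈ Metric.sphere (0 : EE N) 1 then Real.exp (u ⟨x, h⟩) - 1 else 0

lemma perturbation_coe (u : Sph N → ℝ) (σ : Sph N) : perturbation u σ = Real.exp (u σ) - 1 := by
  rw [perturbation, dif_pos σ.2]

lemma continuousOn_perturbation {u : Sph N → ℝ} (hu : Continuous u) :
    ContinuousOn (perturbation u) (Metric.sphere (0 : EE N) 1) := by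
  rw [continuousOn_iff_continuous_domRestrict]
  exact ((Real.continuous_exp.comp hu).sub continuous_const).congr fun σ => (perturbation_coe u σ).symm

lemma perturbation_neg {u : Sph N → ℝ} (hu : ∀ σ, u (-σ) = u σ) (σ : Sph N) :
    perturbation u (-(σ : EE N)) = perturbation u σ := by
  rw [perturbation_coe u σ, ← hu σ]
  exact perturbation_coe u (-σ)

lemma starBody_perturbation (hN : 2 ≤ N) (u : Sph N → ℝ) : starBody (perturbation u) = body u := by
  ext x
  constructor
  · rintro ⟨σ, hσ, t, ht, rfl⟩
    rw [perturbation_coe u ⟨σ, hσ⟩, add_sub_cancel]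
    rcases ht.1.eq_or_lt with rfl | ht0
    · rw [zero_smul]; exact zero_mem_body u
    · have h := Real.exp_log ht0
      rw [smul_smul, ← h, ← Real.exp_add]
      refine (exp_smul_mem_body (σ := ⟨σ, hσ⟩)).2 ?_
      linarith [Real.log_neg ht0 ht.2]
  · intro hx
    rcases eq_or_ne x 0 with rfl | h0
    · obtain ⟨σ⟩ := exists_sph hN
      exact ⟨σ, σ.2, 0, ⟨le_rfl, one_pos⟩, by simp⟩
    · obtain ⟨σ, s, rfl⟩ := exists_logPolar h0
      rw [exp_smul_mem_body] at hx
      refine ⟨σ, σ.2, Real.exp (s - u σ), ⟨(Real.exp_pos _).le, Real.exp_lt_one_iff.2 (by linarith)⟩, ?_⟩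
      rw [perturbation_coe, add_sub_cancel, smul_smul, ← Real.exp_add, sub_add_cancel]

lemma translatedBodies_perturbation (hN : 2 ≤ N) (a : Fin M → EE N) (r : ℝ) (u : Sph N → ℝ) :
    translatedBodies a r (perturbation u) = pack a r u := by
  ext x
  simp only [translatedBodies, latticeSet, starBody_perturbation hN, mem_pack, Set.mem_iUnion, Set.mem_image,
    Set.mem_ofPred_eq]
  constructor
  · rintro ⟨p, ⟨k, rfl⟩, y, hy, rfl⟩
    refine ⟨k, ?_⟩
    rwa [lat, add_sub_cancel_right]
  · rintro ⟨k, hk⟩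
    exact ⟨_, ⟨k, rfl⟩, _, hk, sub_add_cancel _ _⟩

lemma abs_perturbation_le {u : Sph N → ℝ} {σ : Sph N} (h : |u σ| ≤ 1) : |perturbation u σ| ≤ 2 * |u σ| := by
  rw [perturbation_coe]
  exact Real.abs_exp_sub_one_le h

lemma tendsto_pvInt_ball (hN : 2 ≤ N) (hα : α ∈ Set.Ioo (0 : ℝ) 1) (τ θ : Sph N) :
    Tendsto (pvInt N α (Metric.ball (0 : EE N) 1) θ) (nhdsWithin 0 (Set.Ioi 0)) (nhds (H0 α τ)) := by
  have h0 : volume (frontier (Metric.ball (0 : EE N) 1)) = 0 := by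
    rw [← body_zero]; exact volume_frontier_body hN continuous_const
  rw [H0_eq hN hα τ θ]
  refine (tendsto_pvo_ball hN hα θ).congr fun ε => ?_
  rw [pvInt_eq Metric.isOpen_ball h0]

lemma exists_packing (hN : 2 ≤ N) (hMN : M ≤ N) (hα : α ∈ Set.Ioo (0 : ℝ) 1) {a : Fin M → EE N}
    (ha : LinearIndependent ℝ a) (τ : Sph N) : ∃ C r₀ : ℝ, 0 ≤ C ∧ 0 < r₀ ∧ ∀ r, r₀ < r →
      ∃ u : Sph N → ℝ, Continuous u ∧ (∀ θ, |u θ| ≤ C * r⁻¹) ∧ (∀ θ, |u θ| ≤ 1 / 4) ∧ (∀ θ, u (-θ) = u θ) ∧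
        ∀ x ∈ frontier (pack a r u),
          Tendsto (pvInt N α (pack a r u) x) (nhdsWithin 0 (Set.Ioi 0)) (nhds (H0 α τ)) := by
  have hN2 : (2 : ℝ) ≤ N := by exact_mod_cast hN
  have hp0 : 2 + α - N ≠ 0 := by
    intro h
    have h1 : ((N : ℤ) : ℝ) = 2 + α := by push_cast; linarith
    have h2 : (2 : ℤ) < N := by exact_mod_cast (show (2:ℝ) < ((N : ℤ) : ℝ) by linarith [hα.1])
    have h3 : (N : ℤ) < 3 := by exact_mod_cast (show ((N : ℤ) : ℝ) < 3 by linarith [hα.2])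
    omega
  obtain ⟨l, -, hl, hsolve⟩ := exists_small_solution (γ := (1 - α) / 2) hN hα (by linarith [hα.2])
    (by linarith [hα.2]) rfl hp0 (ne_of_lt (by linarith [hα.2]))
  obtain ⟨C₁, κ₀, hC₁, hκ₀, hsol⟩ := hsolve (H0 α τ / 2)
  obtain ⟨C₂, hC₂, R, hR, hker⟩ := exists_Ker_Phi hN hMN hα.1 ha
  refine ⟨C₁ * C₂, max R (max (C₂ / κ₀) (4 * (C₁ * C₂))), mul_nonneg hC₁ hC₂,
    lt_max_of_lt_left (by linarith), fun r hr => ?_⟩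
  obtain ⟨hr1, hr2⟩ := max_lt_iff.1 hr
  obtain ⟨hr2, hr3⟩ := max_lt_iff.1 hr2
  have hr0 : 0 < r := by linarith
  obtain ⟨hfar, -, hK⟩ := hker r hr1.le
  have hκ : C₂ * r⁻¹ ≤ κ₀ := by
    rw [← div_eq_mul_inv, div_le_iff₀ hr0]
    rw [div_lt_iff₀ hκ₀] at hr2
    linarith
  have hU : C₁ * (C₂ * r⁻¹) ≤ 1 / 4 := by
    rw [← mul_assoc, ← div_eq_mul_inv, div_le_iff₀ hr0]; linarith
  obtain ⟨u, hu, heven, heq⟩ := hsol _ _ hκ hK (Phi_neg a r)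
  refine ⟨u, hu.continuous, fun θ => (hu.bd θ).trans (mul_assoc _ _ _).ge, fun θ => (hu.bd θ).trans hU, heven,
    fun x hx => ?_⟩
  exact tendsto_pvInt_pack hN hα (by linarith [hα.2]) (by linarith [hα.2]) (hU.trans (by norm_num)) hu hfar τ
    (two_mul_translation_eigenvalue hN hα τ hl) heq hx

end Assembly

end NearSphere

theorem stmt0 (N M : ℕ) (hN : 2 ≤ N) (hM1 : 1 ≤ M) (hMN : M ≤ N)
    (α : ℝ) (hα : α ∈ Set.Ioo (0 : ℝ) 1)
    (a : Fin M → EuclideanSpace ℝ (Fin N)) (ha : LinearIndependent ℝ a) :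
    ∃ H₀ : ℝ,
      (∀ e ∈ Metric.sphere (0 : EuclideanSpace ℝ (Fin N)) 1,
        Tendsto (pvInt N α (Metric.ball (0 : EuclideanSpace ℝ (Fin N)) 1) e)
          (nhdsWithin 0 (Set.Ioi 0)) (nhds H₀)) ∧
      ∃ r₀ : ℝ, 0 < r₀ ∧ ∃ Φ : ℝ → EuclideanSpace ℝ (Fin N) → ℝ,
        (∀ r : ℝ, r₀ < r →
          ContinuousOn (Φ r) (Metric.sphere (0 : EuclideanSpace ℝ (Fin N)) 1) ∧
          (∀ θ ∈ Metric.sphere (0 : EuclideanSpace ℝ (Fin N)) 1, |Φ r θ| < 1) ∧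
          (∀ θ ∈ Metric.sphere (0 : EuclideanSpace ℝ (Fin N)) 1, Φ r (-θ) = Φ r θ) ∧
          (∀ x ∈ frontier (translatedBodies a r (Φ r)),
            Tendsto (pvInt N α (translatedBodies a r (Φ r)) x)
              (nhdsWithin 0 (Set.Ioi 0)) (nhds H₀))) ∧
        Tendsto (fun r : ℝ =>
            ⨆ θ : Metric.sphere (0 : EuclideanSpace ℝ (Fin N)) 1, |Φ r θ.1|)
          atTop (nhds 0) := by
  open NearSphere in
  obtain ⟨τ⟩ := exists_sph hN
  obtain ⟨C, r₀, hC, hr₀, h⟩ := exists_packing hN hMN hα ha τ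
  choose u huc hub hu4 hue hu using h
  classical
  set Φ : ℝ → EE N → ℝ := fun r => if hr : r₀ < r then perturbation (u r hr) else 0 with hΦ
  have hΦr : ∀ r (hr : r₀ < r), Φ r = perturbation (u r hr) := fun r hr => dif_pos hr
  refine ⟨H0 α τ, fun e he => tendsto_pvInt_ball hN hα τ ⟨e, he⟩, r₀, hr₀, Φ, fun r hr => ?_, ?_⟩
  · rw [hΦr r hr]
    refine ⟨continuousOn_perturbation (huc r hr), fun θ hθ => ?_, fun θ hθ => ?_, ?_⟩
    · have h4 := hu4 r hr ⟨θ, hθ⟩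
      exact (abs_perturbation_le (σ := ⟨θ, hθ⟩) (h4.trans (by norm_num))).trans_lt (by linarith)
    · exact perturbation_neg (hue r hr) ⟨θ, hθ⟩
    · rw [translatedBodies_perturbation hN]
      exact hu r hr
  · have hlim : Tendsto (fun r : ℝ => 2 * (C * r⁻¹)) atTop (nhds 0) := by
      simpa using (tendsto_inv_atTop_zero.const_mul C).const_mul 2
    refine squeeze_zero' (Eventually.of_forall fun r => Real.iSup_nonneg fun θ => abs_nonneg _) ?_ hlim
    filter_upwards [eventually_gt_atTop r₀] with r hr
    have : Nonempty (Metric.sphere (0 : EuclideanSpace ℝ (Fin N)) 1) := ⟨τ⟩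
    refine ciSup_le fun θ => ?_
    rw [hΦr r hr]
    exact (abs_perturbation_le ((hu4 r hr θ).trans (by norm_num))).trans
      (mul_le_mul_of_nonneg_left (hub r hr θ) zero_le_two)
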